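/- (Two-sided equivalence of even powers of the Gru\v{s}in operator with X-derivatives: Corollary 2.1 for the Gru\v{s}in operator, even order.) Fix integers n, m ≥ 1, N ≥ 1, let p ∈ (1,∞) and let s ≥ 1 be an integer. Then there exist constants c, c' > 0 such that for every φ ∈ C_c^∞(ℝ^(n+m)): c · max_{α} ‖X^α φ‖_p ≤ ‖H_N^s φ‖_p ≤ c' · max_{α} ‖X^α φ‖_p, where both maxima are over all words α of elements of 𝒳 with |α| = 2s and H_N^s denotes the s-fold composition of H_N. -/

import Mathlib

open MeasureTheory
open scoped ENNReal NNReal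

/-- Points of `ℝ^(n+m)`, written `(x, y)` with `x ∈ ℝⁿ`, `y ∈ ℝᵐ`. -/
abbrev Pt (n m : ℕ) := (Fin n → ℝ) × (Fin m → ℝ)

/-- The partial derivative operator `∂_{x_j}`. -/
noncomputable def Dx (n m : ℕ) (j : Fin n) (f : Pt n m → ℝ) : Pt n m → ℝ :=
  fun z => fderiv ℝ f z (Pi.single j 1, 0)

/-- The partial derivative operator `∂_{y_k}`. -/
noncomputable def Dy (n m : ℕ) (k : Fin m) (f : Pt n m → ℝ) : Pt n m → ℝ :=
  fun z => fderiv ℝ f z (0, Pi.single k 1)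

/-- Index set for the family `𝒳`: either `j ∈ {1,…,n}` (giving `X_j = ∂_{x_j}`) or a pair
of a multi-index `ν ∈ ℕⁿ` with `|ν| = N` and `k ∈ {1,…,m}` (giving
`X_{ν,k} = (N!/ν!)^(1/2) x^ν ∂_{y_k}`). -/
def XIdx (n m N : ℕ) := Fin n ⊕ ({ν : Fin n → ℕ // ∑ i, ν i = N} × Fin m)

/-- The family `𝒳` of first-order operators `X_j = ∂_{x_j}` and
`X_{ν,k} = (N!/ν!)^(1/2) x^ν ∂_{y_k}` for `|ν| = N`. -/
noncomputable def Xop (n m N : ℕ) : XIdx n m N → (Pt n m → ℝ) → (Pt n m → ℝ)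
  | Sum.inl j => Dx n m j
  | Sum.inr (ν, k) => fun f z =>
      Real.sqrt ((Nat.factorial N : ℝ) / ∏ i, (Nat.factorial (ν.1 i) : ℝ)) *
        (∏ i, z.1 i ^ ν.1 i) * Dy n m k f z

/-- Composition `Z_1 ∘ Z_2 ∘ ⋯ ∘ Z_s` of a word of operators. -/
def compOps {n m : ℕ} (l : List ((Pt n m → ℝ) → (Pt n m → ℝ))) :
    (Pt n m → ℝ) → (Pt n m → ℝ) :=
  l.foldr (· ∘ ·) id

/-- `X^α` for a word `α` of elements of `𝒳`. -/
noncomputable def Xw {n m N M : ℕ} (α : Fin M → XIdx n m N) :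
    (Pt n m → ℝ) → (Pt n m → ℝ) :=
  compOps (List.ofFn fun i => Xop n m N (α i))

/-- The Gru\v{s}in operator `H_N = −Δ_x − |x|^(2N) Δ_y`. -/
noncomputable def grusin (n m N : ℕ) (f : Pt n m → ℝ) : Pt n m → ℝ :=
  fun z => -(∑ j, Dx n m j (Dx n m j f) z) -
    (∑ i, z.1 i ^ 2) ^ N * ∑ k, Dy n m k (Dy n m k f) z

/-- The operators `Y_j = ∂_{x_j}` for `j ≤ n` and `Y_{n+l} = |x|^N ∂_{y_l}` for `l ≤ m`. -/
noncomputable def Yop (n m N : ℕ) : (Fin n ⊕ Fin m) → (Pt n m → ℝ) → (Pt n m → ℝ)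
  | Sum.inl j => Dx n m j
  | Sum.inr l => fun f z => Real.sqrt (∑ i, z.1 i ^ 2) ^ N * Dy n m l f z

/-- `Y^α` for a word `α ∈ {1,…,n+m}^M`. -/
noncomputable def Yw {n m N M : ℕ} (α : Fin M → (Fin n ⊕ Fin m)) :
    (Pt n m → ℝ) → (Pt n m → ℝ) :=
  compOps (List.ofFn fun i => Yop n m N (α i))

namespace Grusin
open scoped ContDiff InnerProductSpace

section TestFunctions
variable (V : Type*) [NormedAddCommGroup V] [NormedSpace ℝ V]

/-- The submodule of test functions. -/
def tfSubmodule : Submodule ℝ (V → ℝ) where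
  carrier := {f | ContDiff ℝ ∞ f ∧ HasCompactSupport f}
  add_mem' := fun h1 h2 => ⟨h1.1.add h2.1, h1.2.add h2.2⟩
  zero_mem' := ⟨contDiff_const, HasCompactSupport.zero⟩
  smul_mem' := fun c _ h => ⟨contDiff_const.smul h.1, h.2.smul_left (f := fun _ => c)⟩

/-- The space of real test functions on `V`. -/
def TF : Type _ := tfSubmodule V

/-- The algebra of smooth functions. -/
def smSubalgebra : Subalgebra ℝ (V → ℝ) where
  carrier := {f | ContDiff ℝ ∞ f}
  add_mem' {f g} (h1 : ContDiff ℝ ∞ f) (h2 : ContDiff ℝ ∞ g) := h1.add h2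
  mul_mem' {f g} (h1 : ContDiff ℝ ∞ f) (h2 : ContDiff ℝ ∞ g) := h1.mul h2
  algebraMap_mem' c := (contDiff_const : ContDiff ℝ ∞ fun _ : V => c)

/-- The algebra of real smooth functions on `V`. -/
def Sm : Type _ := smSubalgebra V

noncomputable instance : AddCommGroup (TF V) := inferInstanceAs (AddCommGroup (tfSubmodule V))
noncomputable instance : Module ℝ (TF V) := inferInstanceAs (Module ℝ (tfSubmodule V))
noncomputable instance : CommRing (Sm V) := inferInstanceAs (CommRing (smSubalgebra V))
noncomputable instance : Algebra ℝ (Sm V) := inferInstanceAs (Algebra ℝ (smSubalgebra V))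

variable {V}

instance : FunLike (TF V) V ℝ where
  coe f := f.1
  coe_injective _ _ h := Subtype.ext h

instance : FunLike (Sm V) V ℝ where
  coe f := f.1
  coe_injective _ _ h := Subtype.ext h

/-- Constructor for test functions. -/
def TF.mk (f : V → ℝ) (h : ContDiff ℝ ∞ f) (h' : HasCompactSupport f) : TF V := ⟨f, h, h'⟩
/-- Constructor for smooth functions. -/
def Sm.mk (f : V → ℝ) (h : ContDiff ℝ ∞ f) : Sm V := ⟨f, h⟩

@[simp] lemma TF.coe_mk (f : V → ℝ) (h h') : ⇑(TF.mk f h h') = f := rfl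
@[simp] lemma Sm.coe_mk (f : V → ℝ) (h) : ⇑(Sm.mk f h) = f := rfl

lemma TF.contDiff (f : TF V) : ContDiff ℝ ∞ f := f.2.1
lemma TF.hasCompactSupport (f : TF V) : HasCompactSupport f := f.2.2
lemma Sm.contDiff (f : Sm V) : ContDiff ℝ ∞ f := f.2
lemma TF.continuous (f : TF V) : Continuous f := f.contDiff.continuous
lemma Sm.continuous (f : Sm V) : Continuous f := f.contDiff.continuous
lemma TF.differentiable (f : TF V) : Differentiable ℝ f := f.contDiff.differentiable (by simp)
lemma Sm.differentiable (f : Sm V) : Differentiable ℝ f := f.contDiff.differentiable (by simp)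

@[ext] lemma TF.ext {f g : TF V} (h : ∀ x, f x = g x) : f = g := DFunLike.ext _ _ h
@[ext] lemma Sm.ext {f g : Sm V} (h : ∀ x, f x = g x) : f = g := DFunLike.ext _ _ h

@[simp] lemma TF.add_apply (f g : TF V) (x : V) : (f + g) x = f x + g x := rfl
@[simp] lemma TF.sub_apply (f g : TF V) (x : V) : (f - g) x = f x - g x := rfl
@[simp] lemma TF.neg_apply (f : TF V) (x : V) : (-f) x = -f x := rfl
@[simp] lemma TF.zero_apply (x : V) : (0 : TF V) x = 0 := rfl
@[simp] lemma TF.smul_apply (c : ℝ) (f : TF V) (x : V) : (c • f) x = c * f x := rfl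
@[simp] lemma Sm.add_apply (f g : Sm V) (x : V) : (f + g) x = f x + g x := rfl
@[simp] lemma Sm.sub_apply (f g : Sm V) (x : V) : (f - g) x = f x - g x := rfl
@[simp] lemma Sm.neg_apply (f : Sm V) (x : V) : (-f) x = -f x := rfl
@[simp] lemma Sm.mul_apply (f g : Sm V) (x : V) : (f * g) x = f x * g x := rfl
@[simp] lemma Sm.zero_apply (x : V) : (0 : Sm V) x = 0 := rfl
@[simp] lemma Sm.one_apply (x : V) : (1 : Sm V) x = 1 := rfl
@[simp] lemma Sm.smul_apply (c : ℝ) (f : Sm V) (x : V) : (c • f) x = c * f x := rfl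
@[simp] lemma Sm.pow_apply (f : Sm V) (k : ℕ) (x : V) : (f ^ k) x = f x ^ k := rfl

/-- Evaluation as an additive homomorphism. -/
def TF.eval (x : V) : TF V →ₗ[ℝ] ℝ where
  toFun f := f x
  map_add' _ _ := rfl
  map_smul' _ _ := rfl

/-- Evaluation of smooth functions as an algebra homomorphism. -/
def Sm.eval (x : V) : Sm V →ₐ[ℝ] ℝ where
  toFun f := f x
  map_one' := rfl
  map_mul' _ _ := rfl
  map_zero' := rfl
  map_add' _ _ := rfl
  commutes' _ := rfl

@[simp] lemma TF.sum_apply {ι : Type*} (s : Finset ι) (f : ι → TF V) (x : V) :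
    (∑ i ∈ s, f i) x = ∑ i ∈ s, f i x := map_sum (TF.eval x) f s
@[simp] lemma Sm.sum_apply {ι : Type*} (s : Finset ι) (f : ι → Sm V) (x : V) :
    (∑ i ∈ s, f i) x = ∑ i ∈ s, f i x := map_sum (Sm.eval x) f s
@[simp] lemma Sm.prod_apply {ι : Type*} (s : Finset ι) (f : ι → Sm V) (x : V) :
    (∏ i ∈ s, f i) x = ∏ i ∈ s, f i x := map_prod (Sm.eval x) f s

noncomputable instance : Module (Sm V) (TF V) where
  smul c f := TF.mk (fun x => c x * f x) (c.contDiff.mul f.contDiff) (f.hasCompactSupport.mul_left)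
  one_smul f := by ext x; exact one_mul _
  mul_smul a b f := by ext x; exact mul_assoc _ _ _
  smul_zero a := by ext x; exact mul_zero _
  smul_add a f g := by ext x; exact mul_add _ _ _
  add_smul a b f := by ext x; exact add_mul _ _ _
  zero_smul f := by ext x; exact zero_mul _

@[simp] lemma TF.sm_smul_apply (c : Sm V) (f : TF V) (x : V) : (c • f) x = c x * f x := rfl

instance : IsScalarTower ℝ (Sm V) (TF V) := ⟨fun a b f => by ext x; simp [mul_assoc]⟩
instance : SMulCommClass (Sm V) ℝ (TF V) := ⟨fun a b f => by ext x; simp [mul_left_comm]⟩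

/-- A test function viewed as a smooth function. -/
def TF.toSm : TF V →ₗ[ℝ] Sm V where
  toFun f := Sm.mk f f.contDiff
  map_add' _ _ := rfl
  map_smul' _ _ := rfl

@[simp] lemma TF.toSm_apply (f : TF V) (x : V) : f.toSm x = f x := rfl

/-- Multiplication by a smooth function. -/
noncomputable def Mul : Sm V →ₐ[ℝ] Module.End ℝ (TF V) := Algebra.lsmul ℝ ℝ (TF V)

@[simp] lemma Mul_apply (c : Sm V) (f : TF V) : Mul c f = c • f := rfl

lemma contDiff_dir {f : V → ℝ} (h : ContDiff ℝ ∞ f) (v : V) :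
    ContDiff ℝ ∞ fun x => fderiv ℝ f x v :=
  (h.fderiv_right (m := ∞) (by simp)).clm_apply contDiff_const

/-- Directional derivative on test functions. -/
noncomputable def Dv (v : V) : Module.End ℝ (TF V) where
  toFun f := TF.mk (fun x => fderiv ℝ f x v) (contDiff_dir f.contDiff v)
    (f.hasCompactSupport.fderiv_apply ℝ v)
  map_add' f g := by
    ext x
    have : (⇑(f + g) : V → ℝ) = ⇑f + ⇑g := rfl
    simp [this, fderiv_add f.differentiable.differentiableAt g.differentiable.differentiableAt]
  map_smul' c f := by
    ext x
    have : (⇑(c • f) : V → ℝ) = c • ⇑f := rfl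
    simp [this, fderiv_const_smul f.differentiable.differentiableAt]

/-- Directional derivative on smooth functions. -/
noncomputable def Ds (v : V) : Sm V →ₗ[ℝ] Sm V where
  toFun f := Sm.mk (fun x => fderiv ℝ f x v) (contDiff_dir f.contDiff v)
  map_add' f g := by
    ext x
    have : (⇑(f + g) : V → ℝ) = ⇑f + ⇑g := rfl
    simp [this, fderiv_add f.differentiable.differentiableAt g.differentiable.differentiableAt]
  map_smul' c f := by
    ext x
    have : (⇑(c • f) : V → ℝ) = c • ⇑f := rfl
    simp [this, fderiv_const_smul f.differentiable.differentiableAt]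

lemma Dv_apply (v : V) (f : TF V) (x : V) : Dv v f x = fderiv ℝ f x v := rfl
lemma Ds_apply (v : V) (f : Sm V) (x : V) : Ds v f x = fderiv ℝ f x v := rfl

lemma Dv_smul (v : V) (c : Sm V) (f : TF V) : Dv v (c • f) = c • Dv v f + Ds v c • f := by
  ext x
  have : (⇑(c • f) : V → ℝ) = ⇑c * ⇑f := rfl
  simp only [Dv_apply, this, TF.add_apply, TF.sm_smul_apply, Ds_apply]
  rw [fderiv_mul c.differentiable.differentiableAt f.differentiable.differentiableAt]
  simp [mul_comm]

lemma Ds_mul (v : V) (c f : Sm V) : Ds v (c * f) = c * Ds v f + Ds v c * f := by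
  ext x
  have : (⇑(c * f) : V → ℝ) = ⇑c * ⇑f := rfl
  simp only [Ds_apply, this, Sm.add_apply, Sm.mul_apply]
  rw [fderiv_mul c.differentiable.differentiableAt f.differentiable.differentiableAt]
  simp [mul_comm]

@[simp] lemma Ds_one (v : V) : Ds v (1 : Sm V) = 0 := by
  ext x
  have : (⇑(1 : Sm V) : V → ℝ) = fun _ => 1 := rfl
  simp [Ds_apply, this]

lemma fderiv_dir_comm {f : V → ℝ} (h : ContDiff ℝ ∞ f) (v w x : V) :
    fderiv ℝ (fun x => fderiv ℝ f x v) x w = fderiv ℝ (fun x => fderiv ℝ f x w) x v := by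
  have hd : DifferentiableAt ℝ (fderiv ℝ f) x :=
    (h.fderiv_right (m := ∞) (by simp)).differentiable (by simp) x
  rw [fderiv_clm_apply hd (differentiableAt_const _), fderiv_clm_apply hd (differentiableAt_const _)]
  have := (h.contDiffAt (x := x)).isSymmSndFDerivAt (n := ∞)
    (by simp only [minSmoothness_of_isRCLikeNormedField]; exact WithTop.coe_le_coe.2 (le_top : (2 : ℕ∞) ≤ ⊤))
  simpa using this w v

lemma Dv_comm (v w : V) (f : TF V) : Dv v (Dv w f) = Dv w (Dv v f) := by
  ext x; exact fderiv_dir_comm f.contDiff w v x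

end TestFunctions

section Inner
set_option linter.unusedSectionVars false
variable {V : Type*} [NormedAddCommGroup V] [NormedSpace ℝ V] [FiniteDimensional ℝ V]
  [MeasureSpace V] [BorelSpace V] [(volume : Measure V).IsAddHaarMeasure]

lemma TF.integrable_mul_cont (f : TF V) {g : V → ℝ} (hg : Continuous g) :
    Integrable (fun x => f x * g x) (volume : Measure V) :=
  (f.continuous.mul hg).integrable_of_hasCompactSupport f.hasCompactSupport.mul_right

lemma TF.integrable (f : TF V) : Integrable f (volume : Measure V) :=
  f.continuous.integrable_of_hasCompactSupport f.hasCompactSupport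

lemma TF.integrable_mul (f g : TF V) : Integrable (fun x => f x * g x) (volume : Measure V) :=
  f.integrable_mul_cont g.continuous

/-- The `L²` inner product. -/
@[reducible] noncomputable def tfCore : InnerProductSpace.Core ℝ (TF V) where
  inner f g := ∫ x, f x * g x
  conj_inner_symm f g := by simp [mul_comm]
  re_inner_nonneg f := integral_nonneg fun x => mul_self_nonneg _
  add_left f g h := by
    simp only [TF.add_apply, add_mul]
    exact integral_add (f.integrable_mul h) (g.integrable_mul h)
  smul_left f g c := by
    simp only [TF.smul_apply, mul_assoc]
    exact integral_const_mul _ _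
  definite f hf := by
    have h0 : (fun x => f x * f x) =ᵐ[volume] 0 :=
      (integral_eq_zero_iff_of_nonneg (fun x => mul_self_nonneg _) (f.integrable_mul f)).1 hf
    have := (Continuous.ae_eq_iff_eq volume (f.continuous.mul f.continuous) continuous_const).1 h0
    ext x
    exact mul_self_eq_zero.1 (congrFun this x)

noncomputable instance : NormedAddCommGroup (TF V) := tfCore.toNormedAddCommGroup
noncomputable instance : InnerProductSpace ℝ (TF V) := InnerProductSpace.ofCore tfCore.toCore

lemma inner_eq (f g : TF V) : ⟪f, g⟫_ℝ = ∫ x, f x * g x := rfl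

lemma norm_sq_eq (f : TF V) : ‖f‖ ^ 2 = ∫ x, f x ^ 2 := by
  rw [← real_inner_self_eq_norm_sq, inner_eq]; simp [sq]

lemma inner_smul_sm (c : Sm V) (f g : TF V) : ⟪c • f, g⟫_ℝ = ⟪f, c • g⟫_ℝ := by
  simp only [inner_eq, TF.sm_smul_apply]
  congr 1; ext x; ring

lemma inner_Dv (v : V) (f g : TF V) : ⟪Dv v f, g⟫_ℝ = -⟪f, Dv v g⟫_ℝ := by
  simp only [inner_eq, Dv_apply]
  have := integral_mul_fderiv_eq_neg_fderiv_mul_of_integrable (μ := (volume : Measure V))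
    (f := g) (g := f) (v := v)
    ((Dv v g).integrable_mul f) (g.integrable_mul (Dv v f)) (g.integrable_mul f)
    (fun x _ => g.differentiable x) (fun x _ => f.differentiable x)
  calc _ = ∫ x, g x * fderiv ℝ f x v := by congr 1; ext x; ring
    _ = _ := by rw [this]; congr 2; ext x; ring

end Inner

/-- A vector field of the form `c ∂_d`. -/
structure VF (V : Type*) [NormedAddCommGroup V] [NormedSpace ℝ V] where
  /-- the coefficient -/
  c : Sm V
  /-- the direction -/
  d : V

section Words
variable {V : Type*} [NormedAddCommGroup V] [NormedSpace ℝ V] {ι : Type*}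

/-- Action of a vector field on test functions. -/
noncomputable def VF.T (X : VF V) : Module.End ℝ (TF V) := Mul X.c * Dv X.d

/-- Action of a vector field on smooth functions. -/
noncomputable def VF.S (X : VF V) : Module.End ℝ (Sm V) :=
  (LinearMap.mulLeft ℝ X.c) ∘ₗ Ds X.d

lemma VF.T_apply (X : VF V) (f : TF V) : X.T f = X.c • Dv X.d f := rfl
lemma VF.S_apply (X : VF V) (f : Sm V) : X.S f = X.c * Ds X.d f := rfl

lemma VF.T_smul (X : VF V) (a : Sm V) (f : TF V) : X.T (a • f) = a • X.T f + X.S a • f := by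
  simp only [VF.T_apply, VF.S_apply, Dv_smul, smul_add, smul_smul, mul_comm a]

lemma VF.S_mul (X : VF V) (a f : Sm V) : X.S (a * f) = a * X.S f + X.S a * f := by
  simp only [VF.S_apply, Ds_mul]; ring

lemma VF.S_toSm (X : VF V) (f : TF V) : X.S f.toSm = (X.T f).toSm := rfl

lemma VF.S_pow (X : VF V) (a : Sm V) (k : ℕ) :
    X.S (a ^ (k + 1)) = ((k + 1 : ℕ) : Sm V) * a ^ k * X.S a := by
  induction k with
  | zero => simp
  | succ k ih => rw [pow_succ, VF.S_mul, ih]; push_cast; ring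

/-- The operator attached to a word, on test functions. -/
noncomputable def wT (X : ι → VF V) (β : List ι) : Module.End ℝ (TF V) :=
  (β.map fun i => (X i).T).prod

/-- The operator attached to a word, on smooth functions. -/
noncomputable def wS (X : ι → VF V) (β : List ι) : Module.End ℝ (Sm V) :=
  (β.map fun i => (X i).S).prod

@[simp] lemma wT_nil (X : ι → VF V) : wT X [] = 1 := rfl
@[simp] lemma wS_nil (X : ι → VF V) : wS X [] = 1 := rfl
@[simp] lemma wT_cons (X : ι → VF V) (i : ι) (β : List ι) : wT X (i :: β) = (X i).T * wT X β := by
  simp [wT]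
@[simp] lemma wS_cons (X : ι → VF V) (i : ι) (β : List ι) : wS X (i :: β) = (X i).S * wS X β := by
  simp [wS]
lemma wT_append (X : ι → VF V) (β γ : List ι) : wT X (β ++ γ) = wT X β * wT X γ := by
  simp [wT]
lemma wS_append (X : ι → VF V) (β γ : List ι) : wS X (β ++ γ) = wS X β * wS X γ := by
  simp [wS]

lemma wS_toSm (X : ι → VF V) (β : List ι) (f : TF V) : wS X β f.toSm = (wT X β f).toSm := by
  induction β with
  | nil => rfl
  | cons i β ih => simp [ih, VF.S_toSm]

/-- A vector field is divergence free. -/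
def VF.DivFree (X : VF V) : Prop := Ds X.d X.c = 0

end Words

section WordsInner
set_option linter.unusedSectionVars false
variable {V : Type*} [NormedAddCommGroup V] [NormedSpace ℝ V] [FiniteDimensional ℝ V]
  [MeasureSpace V] [BorelSpace V] [(volume : Measure V).IsAddHaarMeasure] {ι : Type*}

lemma VF.inner_T {X : VF V} (h : X.DivFree) (f g : TF V) : ⟪X.T f, g⟫_ℝ = -⟪f, X.T g⟫_ℝ := by
  rw [VF.T_apply, inner_smul_sm, inner_Dv, Dv_smul, h, VF.T_apply]; simp

lemma inner_wT {X : ι → VF V} (h : ∀ i, (X i).DivFree) (β : List ι) (f g : TF V) :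
    ⟪wT X β f, g⟫_ℝ = (-1) ^ β.length * ⟪f, wT X β.reverse g⟫_ℝ := by
  induction β generalizing f g with
  | nil => simp
  | cons i β ih =>
    rw [wT_cons, Module.End.mul_apply, VF.inner_T (h i), ih, List.reverse_cons, wT_append]
    simp [pow_succ]

end WordsInner

section Model
variable {n m N : ℕ}

instance : Finite {ν : Fin n → ℕ // ∑ i, ν i = N} := by
  refine Finite.of_injective (β := Fin n → Fin (N + 1))
    (fun ν i => ⟨ν.1 i, Nat.lt_succ_of_le ?_⟩) ?_
  · refine le_of_le_of_eq ?_ ν.2; exact Finset.single_le_sum (fun _ _ => Nat.zero_le _) (Finset.mem_univ i)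
  · intro ν μ h
    ext i
    simpa using congrFun h i

noncomputable instance : Fintype {ν : Fin n → ℕ // ∑ i, ν i = N} := Fintype.ofFinite _

noncomputable instance : Fintype (XIdx n m N) :=
  inferInstanceAs (Fintype (Fin n ⊕ ({ν : Fin n → ℕ // ∑ i, ν i = N} × Fin m)))

/-- The index of `∂_{x_j}`. -/
def iX (j : Fin n) : XIdx n m N := Sum.inl j
/-- The index of `X_{ν,k}`. -/
def iY (ν : {ν : Fin n → ℕ // ∑ i, ν i = N}) (k : Fin m) : XIdx n m N := Sum.inr (ν, k)

lemma XIdx.cases (i : XIdx n m N) : (∃ j, i = iX j) ∨ ∃ ν k, i = iY ν k := by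
  rcases i with j | ⟨ν, k⟩
  · exact Or.inl ⟨j, rfl⟩
  · exact Or.inr ⟨ν, k, rfl⟩

/-- The direction `∂_{x_j}`. -/
noncomputable def dx (n m : ℕ) (j : Fin n) : Pt n m := (Pi.single j 1, 0)
/-- The direction `∂_{y_k}`. -/
noncomputable def dy (n m : ℕ) (k : Fin m) : Pt n m := (0, Pi.single k 1)

/-- The coordinate function `x_i`. -/
noncomputable def xs (n m : ℕ) (i : Fin n) : Sm (Pt n m) := Sm.mk (fun z => z.1 i) (by fun_prop)
@[simp] lemma xs_apply (i : Fin n) (z : Pt n m) : xs n m i z = z.1 i := rfl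
lemma Ds_xs (v : Pt n m) (i : Fin n) : Ds v (xs n m i) = algebraMap ℝ _ (v.1 i) := by
  ext x
  have h : (⇑(xs n m i) : Pt n m → ℝ) =
      ((ContinuousLinearMap.proj i).comp (ContinuousLinearMap.fst ℝ (Fin n → ℝ) (Fin m → ℝ))) := rfl
  rw [Ds_apply, h, ContinuousLinearMap.fderiv]; rfl

/-- The coefficient `(N!/ν!)^{1/2}`. -/
noncomputable def cν (N : ℕ) (ν : Fin n → ℕ) : ℝ :=
  Real.sqrt ((Nat.factorial N : ℝ) / ∏ i, (Nat.factorial (ν i) : ℝ))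

/-- The monomial `x^ν`. -/
noncomputable def xpow (m : ℕ) (ν : Fin n → ℕ) : Sm (Pt n m) := ∏ i, xs n m i ^ ν i

/-- The family `𝒳` as vector fields. -/
noncomputable def XF (n m N : ℕ) : XIdx n m N → VF (Pt n m)
  | Sum.inl j => ⟨1, dx n m j⟩
  | Sum.inr (ν, k) => ⟨cν N ν.1 • xpow m ν.1, dy n m k⟩

@[simp] lemma XF_iX (j : Fin n) : XF n m N (iX j) = ⟨1, dx n m j⟩ := rfl
@[simp] lemma XF_iY (ν : {ν : Fin n → ℕ // ∑ i, ν i = N}) (k : Fin m) :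
    XF n m N (iY ν k) = ⟨cν N ν.1 • xpow m ν.1, dy n m k⟩ := rfl

lemma coe_XF (i : XIdx n m N) (f : TF (Pt n m)) : ⇑((XF n m N i).T f) = Xop n m N i f := by
  ext z
  rcases i with j | ⟨ν, k⟩
  · simp [XF, VF.T_apply, Xop, Dx, Dv_apply, dx]
  · simp [XF, VF.T_apply, Xop, Dy, Dv_apply, dy, cν, xpow, mul_assoc]

lemma Ds_pow (V : Type*) [NormedAddCommGroup V] [NormedSpace ℝ V] (v : V) (a : Sm V) (k : ℕ)
    (h : Ds v a = 0) : Ds v (a ^ k) = 0 := by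
  induction k with
  | zero => simp
  | succ k ih => rw [pow_succ, Ds_mul, ih, h]; simp

lemma Ds_prod {V : Type*} [NormedAddCommGroup V] [NormedSpace ℝ V] (v : V) {ι : Type*}
    (s : Finset ι) (a : ι → Sm V) (h : ∀ i ∈ s, Ds v (a i) = 0) : Ds v (∏ i ∈ s, a i) = 0 := by
  classical
  induction s using Finset.induction_on with
  | empty => simp
  | insert i s hi ih =>
    rw [Finset.prod_insert hi, Ds_mul, h i (by simp), ih fun j hj => h j (by simp [hj])]; simp

lemma Ds_dy_xpow (k : Fin m) (ν : Fin n → ℕ) : Ds (dy n m k) (xpow m ν) = 0 := by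
  refine Ds_prod _ _ _ fun i _ => Ds_pow _ _ _ _ ?_
  rw [Ds_xs]; simp [dy]

lemma XF_divFree (i : XIdx n m N) : (XF n m N i).DivFree := by
  rcases i with j | ⟨ν, k⟩
  · exact Ds_one _
  · simp [VF.DivFree, XF, Ds_dy_xpow]

/-- Word operators for the family `𝒳`. -/
noncomputable abbrev XT (n m N : ℕ) (β : List (XIdx n m N)) : Module.End ℝ (TF (Pt n m)) :=
  wT (XF n m N) β

lemma coe_XT (β : List (XIdx n m N)) (f : TF (Pt n m)) :
    ⇑(XT n m N β f) = compOps (β.map fun i => Xop n m N i) f := by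
  induction β with
  | nil => rfl
  | cons i β ih =>
    rw [XT, wT_cons, Module.End.mul_apply, coe_XF, ih]; rfl

lemma coe_Xw {M : ℕ} (α : Fin M → XIdx n m N) (f : TF (Pt n m)) :
    ⇑(XT n m N (List.ofFn α) f) = Xw α f := by
  rw [coe_XT, Xw, List.map_ofFn]; rfl

/-- The Grushin operator on test functions. -/
noncomputable def H (n m N : ℕ) : Module.End ℝ (TF (Pt n m)) := -∑ i, (XF n m N i).T ^ 2

lemma sum_cν_sq (x : Fin n → ℝ) :
    ∑ ν : {ν : Fin n → ℕ // ∑ i, ν i = N}, (cν N ν.1 * ∏ i, x i ^ ν.1 i) ^ 2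
      = (∑ i, x i ^ 2) ^ N := by
  rw [Finset.sum_pow_eq_sum_piAntidiag]
  symm
  refine Finset.sum_bij' (fun ν hν => ⟨ν, (by simpa using hν)⟩) (fun ν _ => ν.1)
    (fun _ _ => Finset.mem_univ _) (fun ν _ => by simpa using ν.2) (fun _ _ => rfl)
    (fun _ _ => rfl) ?_
  intro ν hν
  have hν' : ∑ i, ν i = N := by simpa using hν
  rw [mul_pow, cν, Real.sq_sqrt (by positivity), ← Finset.prod_pow]
  congr 1
  · have h := Nat.multinomial_spec Finset.univ ν
    rw [hν'] at h
    rw [eq_div_iff (by positivity), mul_comm]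
    exact_mod_cast h
  · refine Finset.prod_congr rfl fun i _ => ?_
    rw [← pow_mul, ← pow_mul, mul_comm]

lemma sum_XIdx {M : Type*} [AddCommMonoid M] (f : XIdx n m N → M) :
    ∑ i, f i = ∑ j, f (iX j) + ∑ k, ∑ ν, f (iY ν k) := by
  have h : ∑ i, f i = ∑ i : Fin n ⊕ ({ν : Fin n → ℕ // ∑ i, ν i = N} × Fin m),
    (fun i => f i : Fin n ⊕ ({ν : Fin n → ℕ // ∑ i, ν i = N} × Fin m) → M) i := rfl
  refine h.trans ?_
  rw [Fintype.sum_sum_type, Fintype.sum_prod_type_right]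
  rfl

lemma T_iX (j : Fin n) (f : TF (Pt n m)) : (XF n m N (iX j)).T f = Dv (dx n m j) f := by
  simp [VF.T_apply]

lemma T_iY_sq (ν : {ν : Fin n → ℕ // ∑ i, ν i = N}) (k : Fin m) (f : TF (Pt n m)) :
    ((XF n m N (iY ν k)).T ^ 2) f =
      (cν N ν.1 • xpow m ν.1) ^ 2 • Dv (dy n m k) (Dv (dy n m k) f) := by
  rw [pow_two, Module.End.mul_apply, VF.T_apply, VF.T_apply, Dv_smul, XF_iY, LinearMap.map_smul,
    Ds_dy_xpow, smul_zero, zero_smul, add_zero, smul_smul, ← pow_two]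

lemma H_apply (f : TF (Pt n m)) : H n m N f = -∑ j, Dv (dx n m j) (Dv (dx n m j) f) -
    ∑ k, (∑ i, xs n m i ^ 2) ^ N • Dv (dy n m k) (Dv (dy n m k) f) := by
  have h1 : ∀ k : Fin m, ∑ ν, ((XF n m N (iY ν k)).T ^ 2) f =
      (∑ i, xs n m i ^ 2) ^ N • Dv (dy n m k) (Dv (dy n m k) f) := by
    intro k
    simp only [T_iY_sq, ← Finset.sum_smul]
    congr 1
    ext z
    simp [xpow, ← sum_cν_sq]
  rw [H, LinearMap.neg_apply, LinearMap.sum_apply, sum_XIdx, neg_add, ← sub_eq_add_neg]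
  simp only [h1]
  congr 2
  refine Finset.sum_congr rfl fun j _ => ?_
  rw [pow_two, Module.End.mul_apply, T_iX, T_iX]

lemma coe_H (f : TF (Pt n m)) : ⇑(H n m N f) = grusin n m N f := by
  ext z
  rw [H_apply]
  simp only [TF.sub_apply, TF.neg_apply, TF.sum_apply, TF.sm_smul_apply, Sm.pow_apply,
    Sm.sum_apply, xs_apply, ← Finset.mul_sum]
  rfl

lemma coe_H_pow (s : ℕ) (f : TF (Pt n m)) : ⇑(((H n m N) ^ s) f) = (grusin n m N)^[s] f := by
  induction s with
  | zero => rfl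
  | succ s ih =>
    rw [pow_succ', Module.End.mul_apply, coe_H, ih, Function.iterate_succ_apply']

end Model

section Compare
set_option linter.unusedSectionVars false
variable {V : Type*} [NormedAddCommGroup V] [NormedSpace ℝ V] [FiniteDimensional ℝ V]
  [MeasureSpace V] [BorelSpace V] [(volume : Measure V).IsAddHaarMeasure]

lemma inner_mono {f g f' g' : TF V} (h : ∀ x, f x * g x ≤ f' x * g' x) :
    ⟪f, g⟫_ℝ ≤ ⟪f', g'⟫_ℝ :=
  integral_mono (f.integrable_mul g) (f'.integrable_mul g') h

lemma inner_mono_add {f g f₁ g₁ f₂ g₂ : TF V}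
    (h : ∀ x, f x * g x ≤ f₁ x * g₁ x + f₂ x * g₂ x) :
    ⟪f, g⟫_ℝ ≤ ⟪f₁, g₁⟫_ℝ + ⟪f₂, g₂⟫_ℝ := by
  rw [inner_eq f₁, inner_eq f₂, ← integral_add (f₁.integrable_mul g₁) (f₂.integrable_mul g₂)]
  exact integral_mono (f.integrable_mul g)
    ((f₁.integrable_mul g₁).add (f₂.integrable_mul g₂)) h

lemma norm_mono {f g : TF V} (h : ∀ x, |f x| ≤ |g x|) : ‖f‖ ≤ ‖g‖ := by
  refine le_of_sq_le_sq ?_ (norm_nonneg _)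
  rw [← real_inner_self_eq_norm_sq, ← real_inner_self_eq_norm_sq]
  refine inner_mono fun x => ?_
  rw [← sq, ← sq]
  exact sq_le_sq.2 (h x)

lemma inner_nonneg {f g : TF V} (h : ∀ x, 0 ≤ f x * g x) : 0 ≤ ⟪f, g⟫_ℝ :=
  integral_nonneg h

end Compare

section Rn
variable {n : ℕ}

/-- The coordinate functions on `ℝⁿ`. -/
noncomputable def rx (n : ℕ) (i : Fin n) : Sm (Fin n → ℝ) := Sm.mk (fun x => x i) (by fun_prop)

@[simp] lemma rx_apply (i : Fin n) (x : Fin n → ℝ) : rx n i x = x i := rfl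

/-- The partial derivatives on `ℝⁿ`. -/
noncomputable abbrev rD (i : Fin n) : Module.End ℝ (TF (Fin n → ℝ)) := Dv (Pi.single i 1)

lemma Ds_rx (v : Fin n → ℝ) (i : Fin n) : Ds v (rx n i) = algebraMap ℝ _ (v i) := by
  ext x
  have h : (⇑(rx n i) : (Fin n → ℝ) → ℝ) =
      (ContinuousLinearMap.proj i : (Fin n → ℝ) →L[ℝ] ℝ) := rfl
  rw [Ds_apply, h, ContinuousLinearMap.fderiv]; rfl

/-- Letters: derivatives and coordinates. -/
noncomputable def let1 (n : ℕ) : Fin n ⊕ Fin n → Module.End ℝ (TF (Fin n → ℝ))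
  | Sum.inl j => rD j
  | Sum.inr j => Mul (rx n j)

/-- Weights of letters. -/
def wt1 (n N : ℕ) : Fin n ⊕ Fin n → ℕ
  | Sum.inl _ => N
  | Sum.inr _ => 1

/-- Word operators on `ℝⁿ`. -/
noncomputable def wd (β : List (Fin n ⊕ Fin n)) : Module.End ℝ (TF (Fin n → ℝ)) :=
  (β.map (let1 n)).prod

/-- Weight of a word. -/
def wt (N : ℕ) (β : List (Fin n ⊕ Fin n)) : ℕ := (β.map (wt1 n N)).sum

@[simp] lemma wd_nil : wd ([] : List (Fin n ⊕ Fin n)) = 1 := rfl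
@[simp] lemma wd_cons (i) (β : List (Fin n ⊕ Fin n)) : wd (i :: β) = let1 n i * wd β := by
  simp [wd]
lemma wd_append (β γ : List (Fin n ⊕ Fin n)) : wd (β ++ γ) = wd β * wd γ := by simp [wd]
@[simp] lemma wt_nil (N : ℕ) : wt N ([] : List (Fin n ⊕ Fin n)) = 0 := rfl
@[simp] lemma wt_cons (N : ℕ) (i) (β : List (Fin n ⊕ Fin n)) :
    wt N (i :: β) = wt1 n N i + wt N β := by simp [wt]
lemma wt_append (N : ℕ) (β γ : List (Fin n ⊕ Fin n)) : wt N (β ++ γ) = wt N β + wt N γ := by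
  simp [wt]
lemma wt_perm {N : ℕ} {β γ : List (Fin n ⊕ Fin n)} (h : β.Perm γ) : wt N β = wt N γ :=
  (h.map _).sum_eq

/-- The weight filtration. -/
noncomputable def Fil (n N : ℕ) (w : ℤ) : Submodule ℝ (Module.End ℝ (TF (Fin n → ℝ))) :=
  Submodule.span ℝ {A | ∃ β : List (Fin n ⊕ Fin n), (wt N β : ℤ) ≤ w ∧ A = wd β}

lemma wd_mem {N : ℕ} {β : List (Fin n ⊕ Fin n)} {w : ℤ} (h : (wt N β : ℤ) ≤ w) :
    wd β ∈ Fil n N w := Submodule.subset_span ⟨β, h, rfl⟩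

lemma Fil_mono {N : ℕ} {w w' : ℤ} (h : w ≤ w') : Fil n N w ≤ Fil n N w' :=
  Submodule.span_mono fun _ ⟨β, hβ, e⟩ => ⟨β, hβ.trans h, e⟩

lemma Fil_mul {N : ℕ} {a b : ℤ} {A B} (hA : A ∈ Fil n N a) (hB : B ∈ Fil n N b) :
    A * B ∈ Fil n N (a + b) := by
  have h : Fil n N a * Fil n N b ≤ Fil n N (a + b) := by
    rw [Fil, Fil, Submodule.span_mul_span, Submodule.span_le]
    rintro _ ⟨_, ⟨β, hβ, rfl⟩, _, ⟨γ, hγ, rfl⟩, rfl⟩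
    refine Submodule.subset_span ⟨β ++ γ, ?_, (wd_append _ _).symm⟩
    rw [wt_append]; push_cast; omega
  exact h (Submodule.mul_mem_mul hA hB)

lemma one_mem_Fil (N : ℕ) : 1 ∈ Fil n N 0 := wd_mem (β := []) (by simp)

lemma Fil_pow {N : ℕ} {a : ℤ} {A} (hA : A ∈ Fil n N a) (k : ℕ) : A ^ k ∈ Fil n N (k * a) := by
  induction k with
  | zero => simpa using one_mem_Fil N
  | succ k ih =>
    rw [pow_succ]
    have := Fil_mul ih hA
    convert this using 1; push_cast; ring_nf

lemma let1_comm (N : ℕ) (i j : Fin n ⊕ Fin n) :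
    let1 n i * let1 n j - let1 n j * let1 n i ∈
      Fil n N ((wt1 n N i : ℤ) + wt1 n N j - N - 1) := by
  have key : ∀ i j : Fin n, rD i * Mul (rx n j) - Mul (rx n j) * rD i ∈ Fil n N 0 := by
    intro i j
    have : rD i * Mul (rx n j) - Mul (rx n j) * rD i
        = ((Pi.single i 1 : Fin n → ℝ) j) • (1 : Module.End ℝ (TF (Fin n → ℝ))) := by
      ext1 f
      simp only [LinearMap.sub_apply, Module.End.mul_apply, Mul_apply, Dv_smul, Ds_rx,
        add_sub_cancel_left, algebraMap_smul, LinearMap.smul_apply, Module.End.one_apply]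
    rw [this]
    exact Submodule.smul_mem _ _ (one_mem_Fil N)
  rcases i with i | i <;> rcases j with j | j
  · convert Submodule.zero_mem _
    ext1 f
    simp [let1, Dv_comm]
  · simpa [let1, wt1] using key i j
  · have := Submodule.neg_mem _ (key j i)
    rw [neg_sub] at this
    simpa [let1, wt1] using this
  · convert Submodule.zero_mem _
    ext1 f
    simp [let1, smul_smul, mul_comm]

lemma wd_perm {N : ℕ} {β γ : List (Fin n ⊕ Fin n)} (h : β.Perm γ) :
    wd β - wd γ ∈ Fil n N ((wt N β : ℤ) - N - 1) := by
  induction h with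
  | nil => simp
  | cons x h ih =>
    rw [wd_cons, wd_cons, ← mul_sub]
    have hx : let1 n x ∈ Fil n N (wt1 n N x) := by
      have := wd_mem (β := [x]) (N := N) (w := wt1 n N x) (by simp)
      simpa using this
    have := Fil_mul hx ih
    convert this using 1; rw [wt_cons]; push_cast; ring_nf
  | swap x y l =>
    have := Fil_mul (let1_comm N y x) (wd_mem (β := l) (le_refl (wt N l : ℤ)))
    rw [sub_mul] at this
    simp only [wd_cons, ← mul_assoc]
    convert this using 1; simp only [wt_cons]; push_cast; ring_nf
  | trans h1 h2 ih1 ih2 =>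
    rw [← wt_perm h1] at ih2
    simpa using Submodule.add_mem _ ih1 ih2

lemma Fil_comm {N : ℕ} {a b : ℤ} {A B} (hA : A ∈ Fil n N a) (hB : B ∈ Fil n N b) :
    A * B - B * A ∈ Fil n N (a + b - N - 1) := by
  induction hA using Submodule.span_induction with
  | mem A hA =>
    obtain ⟨β, hβ, rfl⟩ := hA
    induction hB using Submodule.span_induction with
    | mem B hB =>
      obtain ⟨γ, hγ, rfl⟩ := hB
      rw [← wd_append, ← wd_append]
      refine Fil_mono ?_ (wd_perm List.perm_append_comm)
      rw [wt_append]; push_cast; omega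
    | zero => simp
    | add x y _ _ hx hy =>
      have := Submodule.add_mem _ hx hy
      convert this using 1; simp only [mul_add, add_mul]; abel
    | smul c x _ hx =>
      have := Submodule.smul_mem _ c hx
      convert this using 1; simp [smul_sub]
  | zero => simp
  | add x y _ _ hx hy =>
    have := Submodule.add_mem _ hx hy
    convert this using 1; simp only [mul_add, add_mul]; abel
  | smul c x _ hx =>
    have := Submodule.smul_mem _ c hx
    convert this using 1; simp [smul_sub]

/-- The potential `|x|^{2N}`. -/
noncomputable def pot (n N : ℕ) : Sm (Fin n → ℝ) := (∑ i, rx n i ^ 2) ^ N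

/-- The anharmonic oscillator with spectral shift, `-Δ + |x|^{2N} + μ`. -/
noncomputable def osc (n N : ℕ) (μ : ℝ) : Module.End ℝ (TF (Fin n → ℝ)) :=
  -∑ j, rD j * rD j + Mul (pot n N) + μ • 1

lemma Mul_pot (N : ℕ) : Mul (pot n N) = (∑ i, Mul (rx n i) ^ 2) ^ N := by
  simp [pot, map_pow, map_sum]

lemma osc_mem (N : ℕ) (μ : ℝ) : osc n N μ ∈ Fil n N (2 * N) := by
  refine Submodule.add_mem _ (Submodule.add_mem _ (Submodule.neg_mem _
    (Submodule.sum_mem _ fun j _ => ?_)) ?_) (Submodule.smul_mem _ _ ?_)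
  · have := wd_mem (β := [Sum.inl j, Sum.inl j]) (N := N) (w := 2 * N) (by simp [wt1]; omega)
    simpa [let1] using this
  · rw [Mul_pot]
    have : ∑ i, Mul (rx n i) ^ 2 ∈ Fil n N 2 := by
      refine Submodule.sum_mem _ fun j _ => ?_
      have := wd_mem (β := [Sum.inr j, Sum.inr j]) (N := N) (w := 2) (by simp [wt1])
      simpa [let1, sq] using this
    have := Fil_pow this N
    rwa [mul_comm] at this
  · exact Fil_mono (by positivity) (one_mem_Fil N)

lemma osc_apply (N : ℕ) (μ : ℝ) (u : TF (Fin n → ℝ)) :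
    osc n N μ u = -∑ j, rD j (rD j u) + (pot n N + μ • 1) • u := by
  simp [osc, add_smul, add_assoc]

/-- Energy identity. -/
lemma osc_energy (N : ℕ) (μ : ℝ) (u : TF (Fin n → ℝ)) :
    ⟪osc n N μ u, u⟫_ℝ = ∑ j, ‖rD j u‖ ^ 2 + ⟪(pot n N + μ • 1) • u, u⟫_ℝ := by
  rw [osc_apply, inner_add_left, inner_neg_left, sum_inner, ← Finset.sum_neg_distrib]
  congr 1
  refine Finset.sum_congr rfl fun j _ => ?_
  rw [inner_Dv, neg_neg, real_inner_self_eq_norm_sq]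

lemma pot_apply (N : ℕ) (x : Fin n → ℝ) : pot n N x = (∑ i, x i ^ 2) ^ N := by simp [pot]

lemma Ds_Spow (V : Type*) [NormedAddCommGroup V] [NormedSpace ℝ V] (v : V) (a : Sm V) (k : ℕ) :
    Ds v (a ^ (k + 1)) = (k + 1 : ℝ) • (a ^ k * Ds v a) := by
  induction k with
  | zero => simp
  | succ k ih =>
    rw [pow_succ, Ds_mul, ih]
    ext x
    simp; ring

lemma Ds_pot (N : ℕ) (hN : 1 ≤ N) (j : Fin n) :
    Ds (Pi.single j 1) (pot n N) = (2 * N : ℝ) • ((∑ i, rx n i ^ 2) ^ (N - 1) * rx n j) := by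
  obtain ⟨M, rfl⟩ : ∃ M, N = M + 1 := ⟨N - 1, by omega⟩
  have h : Ds (Pi.single j 1 : Fin n → ℝ) (∑ i, rx n i ^ 2) = (2 : ℝ) • rx n j := by
    rw [map_sum, Finset.sum_eq_single j]
    · rw [show rx n j ^ 2 = rx n j ^ (1 + 1) from rfl, Ds_Spow, Ds_rx, Pi.single_eq_same,
        map_one, mul_one, pow_one]
      congr 1; norm_num
    · intro i _ hi
      rw [show rx n i ^ 2 = rx n i ^ (1 + 1) from rfl, Ds_Spow, Ds_rx]
      ext x; simp [hi]
    · simp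
  rw [pot, Ds_Spow, h, mul_smul_comm, smul_smul]
  congr 1
  push_cast; ring

lemma pow_le_aux {N : ℕ} (hN : 1 ≤ N) {r τ : ℝ} (hr : 0 ≤ r) (hτ : 0 ≤ τ) :
    r ^ (2 * N - 1) * τ ^ (2 * N + 2) ≤ (r ^ N + τ ^ (2 * N)) ^ 3 := by
  rcases le_total r (τ ^ 2) with h | h
  · calc r ^ (2 * N - 1) * τ ^ (2 * N + 2) ≤ (τ ^ 2) ^ (2 * N - 1) * τ ^ (2 * N + 2) := by gcongr
      _ = (0 + τ ^ (2 * N)) ^ 3 := by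
        rw [← pow_mul, ← pow_add, zero_add, ← pow_mul]; congr 1; omega
      _ ≤ _ := by gcongr; positivity
  · calc r ^ (2 * N - 1) * τ ^ (2 * N + 2) = r ^ (2 * N - 1) * (τ ^ 2) ^ (N + 1) := by
          rw [← pow_mul]; ring
      _ ≤ r ^ (2 * N - 1) * r ^ (N + 1) := by gcongr
      _ = (r ^ N + 0) ^ 3 := by rw [← pow_add, add_zero, ← pow_mul]; congr 1; omega
      _ ≤ _ := by gcongr; positivity

lemma norm_Dv_Dv_sq (i j : Fin n) (u : TF (Fin n → ℝ)) :
    ‖rD i (rD j u)‖ ^ 2 = ⟪rD i (rD i u), rD j (rD j u)⟫_ℝ := by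
  rw [← real_inner_self_eq_norm_sq]
  nth_rw 1 [Dv_comm]
  rw [inner_Dv, Dv_comm _ _ (rD j u), ← inner_Dv]

/-- The Laplacian on `ℝⁿ`. -/
noncomputable def rLap (n : ℕ) : Module.End ℝ (TF (Fin n → ℝ)) := ∑ j, rD j * rD j

lemma rLap_apply (u : TF (Fin n → ℝ)) : rLap n u = ∑ j, rD j (rD j u) := by simp [rLap]

lemma sum_norm_Dv_Dv_sq (u : TF (Fin n → ℝ)) :
    ∑ i, ∑ j, ‖rD i (rD j u)‖ ^ 2 = ‖rLap n u‖ ^ 2 := by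
  rw [← real_inner_self_eq_norm_sq, rLap_apply, sum_inner]
  simp only [inner_sum, norm_Dv_Dv_sq]

lemma norm_Dv_Dv_le (i j : Fin n) (u : TF (Fin n → ℝ)) : ‖rD i (rD j u)‖ ≤ ‖rLap n u‖ := by
  refine le_of_sq_le_sq ?_ (norm_nonneg _)
  rw [← sum_norm_Dv_Dv_sq]
  calc _ ≤ ∑ j, ‖rD i (rD j u)‖ ^ 2 :=
        Finset.single_le_sum (f := fun j => ‖rD i (rD j u)‖ ^ 2) (fun _ _ => sq_nonneg _)
          (Finset.mem_univ j)
    _ ≤ _ := Finset.single_le_sum (f := fun i => ∑ j, ‖rD i (rD j u)‖ ^ 2)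
          (fun _ _ => Finset.sum_nonneg fun _ _ => sq_nonneg _) (Finset.mem_univ i)

lemma osc_base_aux {U d v V k : ℝ} (hU : 0 < U) (hV : V ^ 2 ≤ k * U ^ 3) :
    -(2 * (d * (V * v))) ≤ U * d * d + k * (U * v * (U * v)) := by
  have h1 : V ^ 2 * v ^ 2 ≤ k * U ^ 3 * v ^ 2 := by gcongr
  have h2 : 0 ≤ (U * d + V * v) ^ 2 := sq_nonneg _
  have h3 : U * (-(2 * (d * (V * v)))) ≤ U * (U * d * d + k * (U * v * (U * v))) := by
    nlinarith
  exact le_of_mul_le_mul_left h3 hU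

lemma osc_base {N : ℕ} (hN : 1 ≤ N) : ∃ τ₀ : ℝ, 1 ≤ τ₀ ∧ ∀ τ ≥ τ₀, ∀ u : TF (Fin n → ℝ),
    ‖rLap n u‖ ^ 2 + 1 / 2 * ‖(pot n N + τ ^ (2 * N) • 1) • u‖ ^ 2 +
      ∑ j, ⟪(pot n N + τ ^ (2 * N) • 1) • rD j u, rD j u⟫_ℝ ≤ ‖osc n N (τ ^ (2 * N)) u‖ ^ 2 := by
  refine ⟨8 * n * N ^ 2 + 1, by nlinarith [(by positivity : (0:ℝ) ≤ 8 * n * N ^ 2)], ?_⟩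
  intro τ hτ u
  have hn0 : (0:ℝ) ≤ 8 * n * N ^ 2 := by positivity
  have hτ1 : 1 ≤ τ := by linarith
  set U : Sm (Fin n → ℝ) := pot n N + τ ^ (2 * N) • 1 with hU
  have hDU : ∀ j, Ds (Pi.single j 1) U = (2 * N : ℝ) • ((∑ i, rx n i ^ 2) ^ (N - 1) * rx n j) := by
    intro j; rw [hU, map_add, map_smul, Ds_one, Ds_pot N hN]; simp
  have hUpos : ∀ x, 0 < U x := by
    intro x
    have h1 : 0 ≤ (∑ i, x i ^ 2) ^ N := by positivity
    have h2 : 0 < τ ^ (2 * N) := by positivity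
    simp only [hU, Sm.add_apply, pot_apply, Sm.smul_apply, Sm.one_apply]; linarith
  have hpt : ∀ j x, (Ds (Pi.single j 1) U x) ^ 2 ≤ (1 / (2 * n)) * U x ^ 3 := by
    intro j x
    have hn : 0 < n := j.pos
    set r := ∑ i, x i ^ 2 with hr
    have hr0 : 0 ≤ r := by positivity
    have hxj : x j ^ 2 ≤ r := Finset.single_le_sum (f := fun i => x i ^ 2)
      (fun _ _ => sq_nonneg _) (Finset.mem_univ j)
    have e1 : Ds (Pi.single j 1) U x = 2 * N * (r ^ (N - 1) * x j) := by
      rw [hDU]; simp [hr]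
    have e2 : U x = r ^ N + τ ^ (2 * N) := by
      simp [hU, pot_apply, hr]
    have h1 := pow_le_aux hN hr0 (by linarith : 0 ≤ τ)
    have h2 : τ ≤ τ ^ (2 * N + 2) := le_self_pow₀ hτ1 (by omega)
    rw [e1, e2]
    have h3 : (2 * N * (r ^ (N - 1) * x j)) ^ 2 ≤ 4 * N ^ 2 * r ^ (2 * N - 1) := by
      calc (2 * N * (r ^ (N - 1) * x j)) ^ 2 = 4 * N ^ 2 * ((r ^ (N - 1)) ^ 2 * x j ^ 2) := by ring
        _ ≤ 4 * N ^ 2 * ((r ^ (N - 1)) ^ 2 * r) := by gcongr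
        _ = 4 * N ^ 2 * r ^ (2 * N - 1) := by
          rw [← pow_mul, ← pow_succ]; congr 2; omega
    refine h3.trans ?_
    rw [div_mul_eq_mul_div, one_mul, le_div_iff₀ (by positivity)]
    have h4 : r ^ (2 * N - 1) * (8 * n * N ^ 2) ≤ r ^ (2 * N - 1) * τ ^ (2 * N + 2) := by
      gcongr; linarith
    nlinarith
  have hA : osc n N (τ ^ (2 * N)) u = -rLap n u + U • u := by rw [osc_apply, rLap_apply]
  have hcross : ⟪-rLap n u, U • u⟫_ℝ = ∑ j, (⟪U • rD j u, rD j u⟫_ℝ +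
      ⟪rD j u, Ds (Pi.single j 1) U • u⟫_ℝ) := by
    rw [rLap_apply, inner_neg_left, sum_inner, ← Finset.sum_neg_distrib]
    refine Finset.sum_congr rfl fun j _ => ?_
    rw [inner_Dv, neg_neg, Dv_smul, inner_add_right, inner_smul_sm]
  have hj : ∀ j, -(2 * ⟪rD j u, Ds (Pi.single j 1) U • u⟫_ℝ) ≤
      ⟪U • rD j u, rD j u⟫_ℝ + 1 / (2 * n) * ‖U • u‖ ^ 2 := by
    intro j
    have := inner_mono_add (f := (-2 : ℝ) • rD j u) (g := Ds (Pi.single j 1) U • u)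
      (f₁ := U • rD j u) (g₁ := rD j u) (f₂ := (1 / (2 * n) : ℝ) • (U • u)) (g₂ := U • u)
      (fun x => by
        have := osc_base_aux (d := rD j u x) (v := u x) (hUpos x) (hpt j x)
        simp only [TF.smul_apply, TF.sm_smul_apply]
        linarith)
    rw [real_inner_smul_left, real_inner_smul_left, real_inner_self_eq_norm_sq] at this
    linarith
  have hsum : -(2 * ∑ j, ⟪rD j u, Ds (Pi.single j 1) U • u⟫_ℝ) ≤
      ∑ j, ⟪U • rD j u, rD j u⟫_ℝ + 1 / 2 * ‖U • u‖ ^ 2 := by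
    calc _ = ∑ j, -(2 * ⟪rD j u, Ds (Pi.single j 1) U • u⟫_ℝ) := by
          rw [Finset.mul_sum, Finset.sum_neg_distrib]
      _ ≤ ∑ j : Fin n, (⟪U • rD j u, rD j u⟫_ℝ + 1 / (2 * n) * ‖U • u‖ ^ 2) :=
          Finset.sum_le_sum fun j _ => hj j
      _ = ∑ j, ⟪U • rD j u, rD j u⟫_ℝ + n * (1 / (2 * n)) * ‖U • u‖ ^ 2 := by
          rw [Finset.sum_add_distrib]; simp [mul_assoc]
      _ ≤ _ := by
          gcongr
          rcases Nat.eq_zero_or_pos n with h | h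
          · simp [h]
          · rw [mul_one_div, div_le_div_iff₀ (by positivity) (by positivity)]; linarith
  rw [hA, norm_add_sq_real, norm_neg, hcross, Finset.sum_add_distrib]
  linarith

end Rn

section Rn2
variable {n : ℕ}

lemma length_le_wt {N : ℕ} (hN : 1 ≤ N) (β : List (Fin n ⊕ Fin n)) : β.length ≤ wt N β := by
  induction β with
  | nil => simp
  | cons i β ih =>
    rw [wt_cons, List.length_cons]
    have : 1 ≤ wt1 n N i := by rcases i with i | i <;> simp [wt1, hN]
    omega

lemma finite_wt_le {N : ℕ} (hN : 1 ≤ N) (w : ℕ) :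
    {β : List (Fin n ⊕ Fin n) | wt N β ≤ w}.Finite :=
  (List.finite_length_le (Fin n ⊕ Fin n) w).subset fun β hβ => (length_le_wt hN β).trans hβ

/-- The words of weight at most `w`. -/
noncomputable def wordsLE (n : ℕ) {N : ℕ} (hN : 1 ≤ N) (w : ℕ) : Finset (List (Fin n ⊕ Fin n)) :=
  (finite_wt_le hN w).toFinset

lemma mem_wordsLE {N : ℕ} (hN : 1 ≤ N) {w : ℕ} {β : List (Fin n ⊕ Fin n)} :
    β ∈ wordsLE n hN w ↔ wt N β ≤ w := by simp [wordsLE]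

/-- The weighted norm with parameter `τ`. -/
noncomputable def ES {N : ℕ} (hN : 1 ≤ N) (τ : ℝ) (w : ℕ) (u : TF (Fin n → ℝ)) : ℝ :=
  ∑ β ∈ wordsLE n hN w, τ ^ (w - wt N β) * ‖wd β u‖

lemma ES_nonneg {N : ℕ} (hN : 1 ≤ N) {τ : ℝ} (hτ : 0 ≤ τ) (w : ℕ) (u : TF (Fin n → ℝ)) :
    0 ≤ ES hN τ w u := Finset.sum_nonneg fun _ _ => by positivity

lemma wd_le_ES {N : ℕ} (hN : 1 ≤ N) {τ : ℝ} (hτ : 1 ≤ τ) {w d : ℕ} {β : List (Fin n ⊕ Fin n)}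
    (h : wt N β + d ≤ w) (u : TF (Fin n → ℝ)) : τ ^ d * ‖wd β u‖ ≤ ES hN τ w u := by
  calc τ ^ d * ‖wd β u‖ ≤ τ ^ (w - wt N β) * ‖wd β u‖ := by
        gcongr; omega
    _ ≤ _ := Finset.single_le_sum (f := fun β => τ ^ (w - wt N β) * ‖wd β u‖)
        (fun _ _ => by positivity) ((mem_wordsLE hN).2 (by omega))

lemma Fil_le_ES {N : ℕ} (hN : 1 ≤ N) {A} {a : ℤ} (hA : A ∈ Fil n N a) {w d : ℕ}
    (h : a + d ≤ w) : ∃ C : ℝ, 0 ≤ C ∧ ∀ τ : ℝ, 1 ≤ τ → ∀ u : TF (Fin n → ℝ),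
      τ ^ d * ‖A u‖ ≤ C * ES hN τ w u := by
  induction hA using Submodule.span_induction with
  | mem A hA =>
    obtain ⟨β, hβ, rfl⟩ := hA
    exact ⟨1, zero_le_one, fun τ hτ u => by
      rw [one_mul]; exact wd_le_ES hN hτ (by omega) u⟩
  | zero => exact ⟨0, le_rfl, fun τ hτ u => by simp⟩
  | add x y _ _ hx hy =>
    obtain ⟨C, hC, h1⟩ := hx
    obtain ⟨D, hD, h2⟩ := hy
    refine ⟨C + D, by positivity, fun τ hτ u => ?_⟩
    calc τ ^ d * ‖(x + y) u‖ ≤ τ ^ d * (‖x u‖ + ‖y u‖) := by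
          gcongr; exact norm_add_le _ _
      _ ≤ _ := by linarith [h1 τ hτ u, h2 τ hτ u]
  | smul c x _ hx =>
    obtain ⟨C, hC, h1⟩ := hx
    refine ⟨|c| * C, by positivity, fun τ hτ u => ?_⟩
    rw [LinearMap.smul_apply, norm_smul, Real.norm_eq_abs, mul_left_comm, mul_assoc]
    exact mul_le_mul_of_nonneg_left (h1 τ hτ u) (abs_nonneg c)

/-- The square of the Euclidean norm. -/
noncomputable def rsq (x : Fin n → ℝ) : ℝ := ∑ i, x i ^ 2

lemma rsq_nonneg (x : Fin n → ℝ) : 0 ≤ rsq x := Finset.sum_nonneg fun _ _ => sq_nonneg _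

/-- The word of coordinates. -/
def qword (l : List (Fin n)) : List (Fin n ⊕ Fin n) := l.map Sum.inr
/-- The word of derivatives. -/
def aword (l : List (Fin n)) : List (Fin n ⊕ Fin n) := l.map Sum.inl

@[simp] lemma wt_qword (N : ℕ) (l : List (Fin n)) : wt N (qword l) = l.length := by
  induction l with
  | nil => rfl
  | cons i l ih => simp_all [qword, wt1]; omega

@[simp] lemma wt_aword (N : ℕ) (l : List (Fin n)) : wt N (aword l) = l.length * N := by
  induction l with
  | nil => simp [aword]
  | cons i l ih => simp_all [aword, wt1]; ring

lemma abs_qword_le (l : List (Fin n)) (u : TF (Fin n → ℝ)) (x : Fin n → ℝ) :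
    |wd (qword l) u x| ≤ Real.sqrt (rsq x) ^ l.length * |u x| := by
  induction l with
  | nil => simp [qword]
  | cons i l ih =>
    simp only [qword, List.map_cons, wd_cons, Module.End.mul_apply] at ih ⊢
    rw [let1, Mul_apply, TF.sm_smul_apply, rx_apply, abs_mul, List.length_cons, pow_succ',
      mul_assoc]
    gcongr
    exact Real.abs_le_sqrt (Finset.single_le_sum (f := fun i => x i ^ 2)
      (fun _ _ => sq_nonneg _) (Finset.mem_univ i))

lemma perm_canonical (β : List (Fin n ⊕ Fin n)) : ∃ l l', β.Perm (qword l ++ aword l') := by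
  induction β with
  | nil => exact ⟨[], [], List.Perm.refl _⟩
  | cons i β ih =>
    obtain ⟨l, l', h⟩ := ih
    rcases i with i | i
    · exact ⟨l, i :: l', (h.cons _).trans List.perm_middle.symm⟩
    · exact ⟨i :: l, l', h.cons _⟩

lemma pow_mul_pow_le {s τ : ℝ} (hs : 0 ≤ s) (hτ : 0 ≤ τ) {i k : ℕ} (h : i ≤ k) :
    τ ^ (k - i) * s ^ i ≤ s ^ k + τ ^ k := by
  rcases le_total s τ with h1 | h1
  · calc τ ^ (k - i) * s ^ i ≤ τ ^ (k - i) * τ ^ i := by gcongr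
      _ = τ ^ k := by rw [← pow_add]; congr 1; omega
      _ ≤ _ := by linarith [pow_nonneg hs k]
  · calc τ ^ (k - i) * s ^ i ≤ s ^ (k - i) * s ^ i := by gcongr
      _ = s ^ k := by rw [← pow_add]; congr 1; omega
      _ ≤ _ := by linarith [pow_nonneg hτ k]

lemma pot_eq_sqrt (N : ℕ) (x : Fin n → ℝ) : pot n N x = Real.sqrt (rsq x) ^ (2 * N) := by
  rw [pot_apply, pow_mul, Real.sq_sqrt (rsq_nonneg x)]; rfl

/-- The base estimate for words of weight at most `2N`. -/
lemma words_base {N : ℕ} (hN : 1 ≤ N) : ∃ τ₀ : ℝ, 1 ≤ τ₀ ∧ ∀ β : List (Fin n ⊕ Fin n),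
    wt N β ≤ 2 * N → ∃ C : ℝ, 0 ≤ C ∧ ∀ τ ≥ τ₀, ∀ u : TF (Fin n → ℝ),
      τ ^ (2 * N - wt N β) * ‖wd β u‖ ≤ C * ‖osc n N (τ ^ (2 * N)) u‖ := by
  obtain ⟨τ₀, hτ₀, hbase⟩ := osc_base (n := n) hN
  refine ⟨τ₀, hτ₀, ?_⟩
  have hpos : ∀ τ ≥ τ₀, ∀ u : TF (Fin n → ℝ), ∀ j,
      0 ≤ ⟪(pot n N + τ ^ (2 * N) • 1) • rD j u, rD j u⟫_ℝ := by
    intro τ hτ u j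
    refine inner_nonneg fun x => ?_
    have : 0 ≤ τ := by linarith
    simp only [TF.sm_smul_apply, Sm.add_apply, Sm.smul_apply, Sm.one_apply, pot_apply, mul_assoc]
    exact mul_nonneg (by positivity) (mul_self_nonneg _)
  -- canonical words
  have hcan : ∀ l l', wt N (qword l ++ aword l' : List (Fin n ⊕ Fin n)) ≤ 2 * N →
      ∀ τ ≥ τ₀, ∀ u : TF (Fin n → ℝ),
      τ ^ (2 * N - wt N (qword l ++ aword l')) * ‖wd (qword l ++ aword l') u‖
        ≤ 2 * ‖osc n N (τ ^ (2 * N)) u‖ := by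
    intro l l' hw τ hτ u
    have hb := hbase τ hτ u
    have hτ0 : 0 ≤ τ := by linarith
    have hsum : 0 ≤ ∑ j, ⟪(pot n N + τ ^ (2 * N) • 1) • rD j u, rD j u⟫_ℝ :=
      Finset.sum_nonneg fun j _ => hpos τ hτ u j
    rw [wt_append, wt_qword, wt_aword] at hw ⊢
    match l' with
    | [] =>
      simp only [List.length_nil, zero_mul, add_zero] at hw ⊢
      have h1 : ‖τ ^ (2 * N - l.length) • wd (qword l ++ aword []) u‖ ≤
          ‖(pot n N + τ ^ (2 * N) • 1) • u‖ := by
        refine norm_mono fun x => ?_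
        rw [show (qword l ++ aword [] : List (Fin n ⊕ Fin n)) = qword l by simp [aword]]
        simp only [TF.smul_apply, TF.sm_smul_apply, Sm.add_apply, Sm.smul_apply, Sm.one_apply,
          abs_mul, pot_eq_sqrt]
        rw [abs_of_nonneg (by positivity : 0 ≤ τ ^ (2 * N - l.length)),
          abs_of_nonneg (by positivity : 0 ≤ Real.sqrt (rsq x) ^ (2 * N) + τ ^ (2 * N) * 1)]
        calc _ ≤ τ ^ (2 * N - l.length) * (Real.sqrt (rsq x) ^ l.length * |u x|) := by
              gcongr; exact abs_qword_le l u x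
          _ = (τ ^ (2 * N - l.length) * Real.sqrt (rsq x) ^ l.length) * |u x| := by ring
          _ ≤ _ := by
              gcongr
              rw [mul_one]
              exact pow_mul_pow_le (Real.sqrt_nonneg _) hτ0 hw
      rw [norm_smul, Real.norm_of_nonneg (by positivity)] at h1
      refine h1.trans (abs_le_of_sq_le_sq' ?_ (by positivity)).2
      nlinarith [sq_nonneg ‖rLap n u‖, sq_nonneg ‖osc n N (τ ^ (2 * N)) u‖]
    | [j] =>
      simp only [List.length_cons, List.length_nil, zero_add, one_mul] at hw ⊢
      have h1 : ‖τ ^ (N - l.length) • wd (qword l ++ aword [j]) u‖ ^ 2 ≤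
          2 * ⟪(pot n N + τ ^ (2 * N) • 1) • rD j u, rD j u⟫_ℝ := by
        rw [← real_inner_self_eq_norm_sq, ← real_inner_smul_left]
        refine inner_mono fun x => ?_
        rw [wd_append, show wd (aword [j]) = rD j by simp [aword, let1], Module.End.mul_apply]
        simp only [TF.smul_apply, TF.sm_smul_apply, Sm.add_apply, Sm.smul_apply, Sm.one_apply,
          pot_eq_sqrt]
        have h2 := abs_qword_le l (rD j u) x
        have h3 := pow_mul_pow_le (Real.sqrt_nonneg (rsq x)) hτ0 (by omega : l.length ≤ N)
        set a := wd (qword l) (rD j u) x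
        set b := rD j u x
        set S := Real.sqrt (rsq x)
        have hS : 0 ≤ S := Real.sqrt_nonneg _
        have h4 : |τ ^ (N - l.length) * a| ≤ (S ^ N + τ ^ N) * |b| := by
          rw [abs_mul, abs_of_nonneg (by positivity : 0 ≤ τ ^ (N - l.length))]
          calc _ ≤ τ ^ (N - l.length) * (S ^ l.length * |b|) := by gcongr
            _ = (τ ^ (N - l.length) * S ^ l.length) * |b| := by ring
            _ ≤ _ := by gcongr
        have h5 : (τ ^ (N - l.length) * a) ^ 2 ≤ (S ^ N + τ ^ N) ^ 2 * b ^ 2 := by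
          rw [← sq_abs, ← sq_abs b, ← mul_pow]
          exact pow_le_pow_left₀ (abs_nonneg _) h4 2
        have h6 : (S ^ N + τ ^ N) ^ 2 ≤ 2 * (S ^ (2 * N) + τ ^ (2 * N)) := by
          rw [pow_mul' S, pow_mul' τ]; nlinarith [sq_nonneg (S ^ N - τ ^ N)]
        nlinarith [mul_le_mul_of_nonneg_right h6 (sq_nonneg b)]
      rw [norm_smul, Real.norm_of_nonneg (by positivity)] at h1
      have h7 : ⟪(pot n N + τ ^ (2 * N) • 1) • rD j u, rD j u⟫_ℝ ≤
          ∑ j, ⟪(pot n N + τ ^ (2 * N) • 1) • rD j u, rD j u⟫_ℝ :=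
        Finset.single_le_sum (f := fun j => ⟪(pot n N + τ ^ (2 * N) • 1) • rD j u, rD j u⟫_ℝ)
          (fun j _ => hpos τ hτ u j) (Finset.mem_univ j)
      rw [show 2 * N - (l.length + N) = N - l.length by omega]
      refine (abs_le_of_sq_le_sq' ?_ (by positivity)).2
      nlinarith [sq_nonneg ‖rLap n u‖, sq_nonneg ‖osc n N (τ ^ (2 * N)) u‖,
        sq_nonneg ‖(pot n N + τ ^ (2 * N) • 1) • u‖]
    | i :: j :: l'' =>
      simp only [List.length_cons] at hw ⊢
      have h0 : l.length = 0 ∧ l''.length = 0 := by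
        constructor
        · nlinarith only [hw, hN]
        · by_contra h
          have : 1 ≤ l''.length := by omega
          nlinarith
      obtain ⟨rfl, rfl⟩ := And.imp List.length_eq_zero_iff.1 List.length_eq_zero_iff.1 h0
      rw [show 2 * N - (([] : List (Fin n)).length + (([] : List (Fin n)).length + 1 + 1) * N) = 0
        by simp]
      rw [pow_zero, one_mul]
      have h1 : ‖wd (qword [] ++ aword [i, j]) u‖ ≤ ‖rLap n u‖ := by
        simpa [qword, aword, let1] using norm_Dv_Dv_le i j u
      refine h1.trans (abs_le_of_sq_le_sq' ?_ (by positivity)).2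
      nlinarith [sq_nonneg ‖(pot n N + τ ^ (2 * N) • 1) • u‖,
        sq_nonneg ‖osc n N (τ ^ (2 * N)) u‖]
  -- general words, by induction on the weight
  have hind : ∀ k : ℕ, k ≤ 2 * N → ∀ β : List (Fin n ⊕ Fin n), wt N β ≤ k →
      ∃ C : ℝ, 0 ≤ C ∧ ∀ τ ≥ τ₀, ∀ u : TF (Fin n → ℝ),
      τ ^ (2 * N - wt N β) * ‖wd β u‖ ≤ C * ‖osc n N (τ ^ (2 * N)) u‖ := by
    intro k
    induction k with
    | zero =>
      intro _ β hβ
      have : β = [] := List.length_eq_zero_iff.1 (by have := length_le_wt hN β; omega)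
      subst this
      exact ⟨2, by norm_num, fun τ hτ u => by simpa [qword, aword] using hcan [] [] (by simp [qword, aword]) τ hτ u⟩
    | succ k ih =>
      intro hk β hβ
      obtain ⟨l, l', hp⟩ := perm_canonical β
      have herr := wd_perm (N := N) hp
      have hb : ∃ C : ℝ, 0 ≤ C ∧ ∀ τ : ℝ, τ₀ ≤ τ → ∀ u : TF (Fin n → ℝ),
          ES hN τ k u * τ ^ (2 * N - k) ≤ C * ‖osc n N (τ ^ (2 * N)) u‖ := by
        choose! C hC0 hC using ih (by omega)
        refine ⟨∑ β ∈ wordsLE n hN k, C β, Finset.sum_nonneg fun β hβ =>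
          hC0 β ((mem_wordsLE hN).1 hβ), fun τ hτ u => ?_⟩
        rw [ES, Finset.sum_mul, Finset.sum_mul]
        refine Finset.sum_le_sum fun β hβ => ?_
        have hβ' := (mem_wordsLE hN).1 hβ
        refine le_trans (le_of_eq ?_) (hC β hβ' τ hτ u)
        rw [mul_right_comm, ← pow_add]; congr 2; omega
      obtain ⟨C, hC0, hC⟩ := hb
      rcases Nat.lt_or_ge (wt N β) (k + 1) with h | h
      · exact ih (by omega) β (by omega)
      have hk' : wt N β = k + 1 := le_antisymm hβ h
      obtain ⟨D, hD0, hD⟩ := Fil_le_ES hN herr (w := k) (d := 0) (by omega)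
      refine ⟨2 + D * C, by positivity, fun τ hτ u => ?_⟩
      have hτ1 : 1 ≤ τ := hτ₀.trans hτ
      have h1 := hcan l l' (by rw [← wt_perm hp]; omega) τ hτ u
      rw [← wt_perm hp] at h1
      have h2 : ‖wd β u‖ ≤ ‖wd (qword l ++ aword l') u‖ + ‖(wd β - wd (qword l ++ aword l')) u‖ := by
        rw [LinearMap.sub_apply]; exact norm_le_norm_add_norm_sub' _ _
      have h3 := hD τ hτ1 u
      rw [pow_zero, one_mul] at h3
      have h4 : τ ^ (2 * N - wt N β) * ‖(wd β - wd (qword l ++ aword l')) u‖ ≤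
          D * (C * ‖osc n N (τ ^ (2 * N)) u‖) := by
        calc _ ≤ τ ^ (2 * N - k) * (D * ES hN τ k u) := by
              gcongr
              omega
          _ = D * (ES hN τ k u * τ ^ (2 * N - k)) := by ring
          _ ≤ _ := mul_le_mul_of_nonneg_left (hC τ hτ u) hD0
      calc _ ≤ τ ^ (2 * N - wt N β) * (‖wd (qword l ++ aword l') u‖ +
            ‖(wd β - wd (qword l ++ aword l')) u‖) := by gcongr
        _ ≤ _ := by rw [mul_add, add_mul, mul_assoc]; linarith
  exact fun β hβ => hind (2 * N) le_rfl β hβ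

lemma exists_split {N : ℕ} (β : List (Fin n ⊕ Fin n)) (h : 2 * N ≤ wt N β) :
    ∃ γ δ, β.Perm (γ ++ δ) ∧ wt N γ = 2 * N := by
  obtain ⟨l, l', hp⟩ := perm_canonical β
  rw [wt_perm hp, wt_append, wt_qword, wt_aword] at h
  match l' with
  | [] =>
    simp only [List.length_nil, zero_mul, add_zero] at h
    refine ⟨qword (l.take (2 * N)), qword (l.drop (2 * N)), ?_, ?_⟩
    · simpa [qword, aword, ← List.map_append] using hp
    · simpa using h
  | [j] =>
    simp only [List.length_cons, List.length_nil, zero_add, one_mul] at h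
    refine ⟨qword (l.take N) ++ aword [j], qword (l.drop N), ?_, ?_⟩
    · refine hp.trans ?_
      have e : qword l = qword (l.take N) ++ qword (l.drop N) := by
        simp [qword]
      rw [e, List.append_assoc, List.append_assoc]
      exact List.Perm.append_left _ List.perm_append_comm
    · rw [wt_append, wt_qword, wt_aword, List.length_take]; simp; omega
  | i :: j :: l'' =>
    refine ⟨aword [i, j], qword l ++ aword l'', ?_, ?_⟩
    · refine hp.trans ?_
      rw [← List.append_assoc]
      refine List.Perm.trans ?_ (List.Perm.append_right _ List.perm_append_comm)
      simp [aword]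
    · simp

lemma osc_comm (N : ℕ) (μ : ℝ) (A : Module.End ℝ (TF (Fin n → ℝ))) :
    osc n N μ * A - A * osc n N μ = osc n N 0 * A - A * osc n N 0 := by
  have : osc n N μ = osc n N 0 + μ • 1 := by simp [osc]
  rw [this]; simp only [add_mul, mul_add, smul_mul_assoc, mul_smul_comm, one_mul, mul_one]; abel

lemma ES_step {N : ℕ} (hN : 1 ≤ N) (w : ℕ) : ∃ τ₁ : ℝ, 1 ≤ τ₁ ∧ ∃ C : ℝ, 0 ≤ C ∧ ∀ τ ≥ τ₁,
    ∀ u : TF (Fin n → ℝ), ES hN τ (w + 2 * N) u ≤ C * ES hN τ w (osc n N (τ ^ (2 * N)) u) := by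
  obtain ⟨τ₀, hτ₀, hbase⟩ := words_base (n := n) hN
  have key : ∀ β : List (Fin n ⊕ Fin n), wt N β ≤ w + 2 * N → ∃ C D : ℝ, 0 ≤ C ∧ 0 ≤ D ∧
      ∀ τ ≥ τ₀, ∀ u : TF (Fin n → ℝ), τ * (τ ^ (w + 2 * N - wt N β) * ‖wd β u‖) ≤
        C * τ * ES hN τ w (osc n N (τ ^ (2 * N)) u) + D * ES hN τ (w + 2 * N) u := by
    intro β hβ
    rcases le_total (wt N β) (2 * N) with h | h
    · obtain ⟨C, hC0, hC⟩ := hbase β h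
      refine ⟨C, 0, hC0, le_rfl, fun τ hτ u => ?_⟩
      have hτ1 : 1 ≤ τ := hτ₀.trans hτ
      have h1 := hC τ hτ u
      have h2 := wd_le_ES hN hτ1 (β := []) (w := w) (d := w) (by simp) (osc n N (τ ^ (2 * N)) u)
      simp only [wd_nil, Module.End.one_apply] at h2
      calc _ = τ * τ ^ w * (τ ^ (2 * N - wt N β) * ‖wd β u‖) := by
            rw [show w + 2 * N - wt N β = w + (2 * N - wt N β) by omega, pow_add]; ring
        _ ≤ τ * τ ^ w * (C * ‖osc n N (τ ^ (2 * N)) u‖) := by gcongr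
        _ = C * τ * (τ ^ w * ‖osc n N (τ ^ (2 * N)) u‖) := by ring
        _ ≤ C * τ * ES hN τ w (osc n N (τ ^ (2 * N)) u) :=
            mul_le_mul_of_nonneg_left h2 (by positivity)
        _ = _ := by ring
    · obtain ⟨γ, δ, hp, hγ⟩ := exists_split β h
      have hwt : wt N β = 2 * N + wt N δ := by rw [wt_perm hp, wt_append, hγ]
      obtain ⟨C, hC0, hC⟩ := hbase γ hγ.le
      obtain ⟨D₁, hD₁, h1⟩ := Fil_le_ES hN (wd_perm (N := N) hp) (w := w + 2 * N)
        (d := w + 2 * N - wt N β + 1) (by omega)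
      obtain ⟨D₂, hD₂, h2⟩ := Fil_le_ES hN (Fil_comm (osc_mem (n := n) N 0)
        (wd_mem (N := N) (le_refl (wt N δ : ℤ)))) (w := w + 2 * N)
        (d := w + 2 * N - wt N β + 1) (by omega)
      refine ⟨C, D₁ + C * D₂, hC0, by positivity, fun τ hτ u => ?_⟩
      have hτ1 : 1 ≤ τ := hτ₀.trans hτ
      have e1 := h1 τ hτ1 u
      have e2 := h2 τ hτ1 u
      have e3 := hC τ hτ (wd δ u)
      rw [hγ, Nat.sub_self, pow_zero, one_mul] at e3
      have e4 : ‖wd β u‖ ≤ ‖wd γ (wd δ u)‖ + ‖(wd β - wd (γ ++ δ)) u‖ := by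
        rw [LinearMap.sub_apply, ← Module.End.mul_apply, ← wd_append]
        exact norm_le_norm_add_norm_sub' _ _
      have e5 : ‖osc n N (τ ^ (2 * N)) (wd δ u)‖ ≤ ‖wd δ (osc n N (τ ^ (2 * N)) u)‖ +
          ‖(osc n N 0 * wd δ - wd δ * osc n N 0) u‖ := by
        rw [← osc_comm N (τ ^ (2 * N)), LinearMap.sub_apply]
        exact norm_le_norm_add_norm_sub' _ _
      have e6 := wd_le_ES hN hτ1 (β := δ) (w := w) (d := w + 2 * N - wt N β) (by omega)
        (osc n N (τ ^ (2 * N)) u)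
      set d := w + 2 * N - wt N β
      rw [pow_succ'] at e1 e2
      set L := ‖wd δ (osc n N (τ ^ (2 * N)) u)‖
      set P := ‖(osc n N 0 * wd δ - wd δ * osc n N 0) u‖
      set Q := ‖(wd β - wd (γ ++ δ)) u‖
      have hT : 0 ≤ τ * τ ^ d := by positivity
      calc τ * (τ ^ d * ‖wd β u‖) = τ * τ ^ d * ‖wd β u‖ := by ring
        _ ≤ τ * τ ^ d * (C * (L + P) + Q) := by
            refine mul_le_mul_of_nonneg_left ?_ hT
            have := mul_le_mul_of_nonneg_left e5 hC0
            linarith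
        _ = C * τ * (τ ^ d * L) + C * (τ * τ ^ d * P) + τ * τ ^ d * Q := by ring
        _ ≤ C * τ * ES hN τ w (osc n N (τ ^ (2 * N)) u) +
            C * (D₂ * ES hN τ (w + 2 * N) u) + D₁ * ES hN τ (w + 2 * N) u := by
            refine add_le_add (add_le_add ?_ ?_) e1
            · exact mul_le_mul_of_nonneg_left e6 (by positivity)
            · exact mul_le_mul_of_nonneg_left e2 hC0
        _ = _ := by ring
  choose! C D hC hD hCD using key
  set C' := ∑ β ∈ wordsLE n hN (w + 2 * N), C β
  set D' := ∑ β ∈ wordsLE n hN (w + 2 * N), D β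
  have hC' : 0 ≤ C' := Finset.sum_nonneg fun β hβ => hC β ((mem_wordsLE hN).1 hβ)
  have hD' : 0 ≤ D' := Finset.sum_nonneg fun β hβ => hD β ((mem_wordsLE hN).1 hβ)
  refine ⟨max τ₀ (2 * D'), le_max_of_le_left hτ₀, 2 * C', by positivity, fun τ hτ u => ?_⟩
  have hτa : τ₀ ≤ τ := (le_max_left _ _).trans hτ
  have hτb : 2 * D' ≤ τ := (le_max_right _ _).trans hτ
  have hτ1 : 1 ≤ τ := hτ₀.trans hτa
  have hsum : τ * ES hN τ (w + 2 * N) u ≤ C' * τ * ES hN τ w (osc n N (τ ^ (2 * N)) u) +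
      D' * ES hN τ (w + 2 * N) u := by
    nth_rw 1 [ES]
    rw [Finset.mul_sum, Finset.sum_mul, Finset.sum_mul, Finset.sum_mul, ← Finset.sum_add_distrib]
    exact Finset.sum_le_sum fun β hβ => hCD β ((mem_wordsLE hN).1 hβ) τ hτa u
  have hE := ES_nonneg hN (by linarith : 0 ≤ τ) (w + 2 * N) u
  have h3 : τ * ES hN τ (w + 2 * N) u ≤ τ * (2 * C' * ES hN τ w (osc n N (τ ^ (2 * N)) u)) := by
    nlinarith
  exact le_of_mul_le_mul_left h3 (by linarith)

lemma ES_iter {N : ℕ} (hN : 1 ≤ N) (k : ℕ) : ∃ τ₁ : ℝ, 1 ≤ τ₁ ∧ ∃ C : ℝ, 0 ≤ C ∧ ∀ τ ≥ τ₁,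
    ∀ u : TF (Fin n → ℝ), ES hN τ (k * (2 * N)) u ≤ C * ‖(osc n N (τ ^ (2 * N)) ^ k) u‖ := by
  induction k with
  | zero =>
    refine ⟨1, le_rfl, 1, zero_le_one, fun τ hτ u => ?_⟩
    have : wordsLE n hN 0 = {[]} := by
      ext β
      rw [mem_wordsLE, Finset.mem_singleton]
      constructor
      · intro h
        exact List.length_eq_zero_iff.1 (by have := length_le_wt hN β; omega)
      · rintro rfl; simp
    simp [ES, this]
  | succ k ih =>
    obtain ⟨τ₁, h1, C, hC, h⟩ := ih
    obtain ⟨τ₂, h2, D, hD, h'⟩ := ES_step (n := n) hN (k * (2 * N))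
    refine ⟨max τ₁ τ₂, le_max_of_le_left h1, D * C, by positivity, fun τ hτ u => ?_⟩
    rw [Nat.succ_mul, pow_succ, Module.End.mul_apply]
    calc _ ≤ D * ES hN τ (k * (2 * N)) (osc n N (τ ^ (2 * N)) u) :=
          h' τ ((le_max_right _ _).trans hτ) u
      _ ≤ D * (C * _) := mul_le_mul_of_nonneg_left (h τ ((le_max_left _ _).trans hτ) _) hD
      _ = _ := by ring

/-- The spectral gap. -/
lemma osc_gap (hn : 1 ≤ n) {N : ℕ} (hN : 1 ≤ N) (u : TF (Fin n → ℝ)) :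
    ‖u‖ ≤ 2 ^ (N + 1) * ‖osc n N 0 u‖ := by
  let j : Fin n := ⟨0, hn⟩
  have h1 : ‖u‖ ^ 2 = -(2 * ⟪rx n j • u, rD j u⟫_ℝ) := by
    have e : rD j (rx n j • u) = rx n j • rD j u + u := by
      rw [Dv_smul, Ds_rx, Pi.single_eq_same, map_one, one_smul]
    have e2 := inner_Dv (Pi.single j 1) (rx n j • u) u
    rw [e, inner_add_left, real_inner_self_eq_norm_sq, inner_smul_sm, real_inner_comm] at e2
    linarith
  have h2 : -(2 * ⟪rx n j • u, rD j u⟫_ℝ) ≤ ‖rD j u‖ ^ 2 + ‖rx n j • u‖ ^ 2 := by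
    have := norm_add_sq_real (rx n j • u) (rD j u)
    nlinarith [sq_nonneg ‖rx n j • u + rD j u‖]
  have h3 : ‖rx n j • u‖ ^ 2 ≤ 1 / 2 * ‖u‖ ^ 2 + 2 ^ N * ⟪(pot n N + (0 : ℝ) • 1) • u, u⟫_ℝ := by
    rw [← real_inner_self_eq_norm_sq, ← real_inner_self_eq_norm_sq, ← real_inner_smul_left,
      ← real_inner_smul_left]
    refine inner_mono_add fun x => ?_
    simp only [TF.smul_apply, TF.sm_smul_apply, Sm.add_apply, Sm.smul_apply, Sm.one_apply,
      rx_apply, pot_apply]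
    have hx : x j ^ 2 ≤ 1 / 2 + 2 ^ N * (∑ i, x i ^ 2) ^ N := by
      set r := ∑ i, x i ^ 2
      have hr : x j ^ 2 ≤ r := Finset.single_le_sum (f := fun i => x i ^ 2)
        (fun _ _ => sq_nonneg _) (Finset.mem_univ j)
      rcases le_total (2 * r) 1 with h | h
      · have : 0 ≤ 2 ^ N * r ^ N := by
          have : 0 ≤ r := (sq_nonneg _).trans hr
          positivity
        linarith
      · have := le_self_pow₀ h (by omega : N ≠ 0)
        rw [mul_pow] at this
        nlinarith [sq_nonneg (x j)]
    nlinarith [mul_le_mul_of_nonneg_right hx (sq_nonneg (u x))]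
  have h4 := osc_energy N 0 u
  have h5 : ‖rD j u‖ ^ 2 ≤ ∑ j, ‖rD j u‖ ^ 2 :=
    Finset.single_le_sum (f := fun j => ‖rD j u‖ ^ 2) (fun _ _ => sq_nonneg _)
      (Finset.mem_univ j)
  have h6 := real_inner_le_norm (osc n N 0 u) u
  have h7 : (1 : ℝ) ≤ 2 ^ N := one_le_pow₀ (by norm_num)
  have h8 : ∑ j, ‖rD j u‖ ^ 2 ≤ 2 ^ N * ∑ j, ‖rD j u‖ ^ 2 :=
    le_mul_of_one_le_left (Finset.sum_nonneg fun _ _ => sq_nonneg _) h7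
  have h9 : ‖u‖ ^ 2 ≤ 2 ^ (N + 1) * (‖osc n N 0 u‖ * ‖u‖) := by
    have := mul_le_mul_of_nonneg_left h6 (by positivity : (0 : ℝ) ≤ 2 ^ N)
    rw [h4, mul_add] at this
    rw [pow_succ 2]
    linarith
  rcases (norm_nonneg u).eq_or_lt with h | h
  · rw [← h]; positivity
  · refine le_of_mul_le_mul_right ?_ h
    linarith

lemma osc_eq (N : ℕ) (μ : ℝ) : osc n N μ = osc n N 0 + μ • 1 := by simp [osc]

lemma osc_pow_le (hn : 1 ≤ n) {N : ℕ} (hN : 1 ≤ N) {μ : ℝ} (hμ : 0 ≤ μ) (k : ℕ)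
    (u : TF (Fin n → ℝ)) :
    ‖(osc n N μ ^ k) u‖ ≤ (1 + μ * 2 ^ (N + 1)) ^ k * ‖(osc n N 0 ^ k) u‖ := by
  have hc : Commute (osc n N μ) (osc n N 0) := by
    rw [osc_eq]; exact (Commute.refl _).add_left ((Commute.one_left _).smul_left μ)
  induction k generalizing u with
  | zero => simp
  | succ k ih =>
    rw [pow_succ, Module.End.mul_apply]
    refine (ih _).trans ?_
    rw [← Module.End.mul_apply, ← (hc.pow_right k).eq, Module.End.mul_apply, pow_succ (1 + _),
      pow_succ' (osc n N 0), mul_assoc, Module.End.mul_apply]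
    refine mul_le_mul_of_nonneg_left ?_ (by positivity)
    set v := (osc n N 0 ^ k) u
    rw [osc_eq, LinearMap.add_apply, LinearMap.smul_apply, Module.End.one_apply]
    refine (norm_add_le _ _).trans ?_
    rw [norm_smul, Real.norm_of_nonneg hμ, add_mul, one_mul, mul_assoc]
    gcongr
    exact osc_gap hn hN v

lemma Fil_le_osc (hn : 1 ≤ n) {N : ℕ} (hN : 1 ≤ N) (k : ℕ) {A}
    (hA : A ∈ Fil n N (k * (2 * N))) :
    ∃ C : ℝ, 0 ≤ C ∧ ∀ u : TF (Fin n → ℝ), ‖A u‖ ≤ C * ‖(osc n N 0 ^ k) u‖ := by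
  obtain ⟨D, hD, h⟩ := Fil_le_ES hN hA (w := k * (2 * N)) (d := 0) (by push_cast; simp)
  obtain ⟨τ, hτ, C, hC, h'⟩ := ES_iter (n := n) hN k
  refine ⟨D * (C * (1 + τ ^ (2 * N) * 2 ^ (N + 1)) ^ k), by positivity, fun u => ?_⟩
  have h1 := h τ hτ u
  rw [pow_zero, one_mul] at h1
  refine h1.trans ?_
  rw [mul_assoc, mul_assoc]
  refine mul_le_mul_of_nonneg_left ((h' τ le_rfl u).trans ?_) hD
  exact mul_le_mul_of_nonneg_left (osc_pow_le hn hN (by positivity) k u) hC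

/-- Dilations of test functions. -/
noncomputable def dil (t : ℝ) (ht : t ≠ 0) : Module.End ℝ (TF (Fin n → ℝ)) where
  toFun u := TF.mk (fun x => u (t • x)) (u.contDiff.comp (contDiff_const_smul t))
    (u.hasCompactSupport.comp_homeomorph (Homeomorph.smulOfNeZero t ht))
  map_add' _ _ := rfl
  map_smul' _ _ := rfl

@[simp] lemma dil_apply (t : ℝ) (ht : t ≠ 0) (u : TF (Fin n → ℝ)) (x : Fin n → ℝ) :
    dil t ht u x = u (t • x) := rfl

lemma norm_dil_sq (t : ℝ) (ht : t ≠ 0) (u : TF (Fin n → ℝ)) :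
    ‖dil t ht u‖ ^ 2 = |(t ^ n)⁻¹| * ‖u‖ ^ 2 := by
  rw [← real_inner_self_eq_norm_sq, ← real_inner_self_eq_norm_sq, inner_eq, inner_eq]
  have := Measure.integral_comp_smul (volume : Measure (Fin n → ℝ)) (fun x => u x * u x) t
  simpa using this

lemma Dv_dil (t : ℝ) (ht : t ≠ 0) (v : Fin n → ℝ) (u : TF (Fin n → ℝ)) :
    Dv v (dil t ht u) = t • dil t ht (Dv v u) := by
  ext x
  have h : HasFDerivAt (fun x => u (t • x)) ((fderiv ℝ u (t • x)).comp
      (t • ContinuousLinearMap.id ℝ (Fin n → ℝ))) x :=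
    (u.differentiable (t • x)).hasFDerivAt.comp x ((hasFDerivAt_id x).const_smul t)
  have h' : fderiv ℝ (dil t ht u) x = _ := h.fderiv
  rw [Dv_apply, h', TF.smul_apply, dil_apply, Dv_apply]
  simp

/-- The letters `∂_j` and `λ c_ν x^ν` on `ℝⁿ`. -/
noncomputable def Glet (n N : ℕ) (l : ℝ) :
    Fin n ⊕ {ν : Fin n → ℕ // ∑ i, ν i = N} → Module.End ℝ (TF (Fin n → ℝ))
  | Sum.inl j => rD j
  | Sum.inr ν => l • Mul (∏ i, rx n i ^ ν.1 i)

/-- Words in the letters `Glet`. -/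
noncomputable def Gw (n N : ℕ) (l : ℝ) (β : List (Fin n ⊕ {ν : Fin n → ℕ // ∑ i, ν i = N})) :
    Module.End ℝ (TF (Fin n → ℝ)) := (β.map (Glet n N l)).prod

/-- The oscillator `-Δ + l²|x|^{2N}`. -/
noncomputable def osL (n N : ℕ) (l : ℝ) : Module.End ℝ (TF (Fin n → ℝ)) :=
  -∑ j, rD j * rD j + l ^ 2 • Mul (pot n N)

lemma osL_one (N : ℕ) : osL n N 1 = osc n N 0 := by simp [osL, osc]

lemma Gw_mem (N : ℕ) (β) : Gw n N 1 β ∈ Fil n N (β.length * N) := by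
  induction β with
  | nil => simpa [Gw] using one_mem_Fil N
  | cons i β ih =>
    have hi : Glet n N 1 i ∈ Fil n N N := by
      rcases i with j | ν
      · have := wd_mem (β := [Sum.inl j]) (N := N) (w := N) (by simp [wt1])
        simpa [let1, Glet] using this
      · rw [Glet, one_smul]
        obtain ⟨ν, hν⟩ := ν
        have : ∀ s : Finset (Fin n), Mul (∏ i ∈ s, rx n i ^ ν i) ∈
            Fil n N ((∑ i ∈ s, ν i : ℕ) : ℤ) := by
          intro s
          induction s using Finset.cons_induction with
          | empty => simpa using one_mem_Fil N
          | cons a s ha ih =>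
            rw [Finset.prod_cons, Finset.sum_cons, map_mul, map_pow]
            have h1 := wd_mem (β := [Sum.inr a]) (N := N) (w := 1) (by simp [wt1])
            have h2 := Fil_mul (Fil_pow h1 (ν a)) ih
            simpa [let1] using h2
        simpa [hν] using this Finset.univ
    have := Fil_mul hi ih
    convert this using 1
    · rw [List.length_cons]; push_cast; ring_nf
    · simp [Gw]

lemma rx_dil (t : ℝ) (ht : t ≠ 0) (ν : Fin n → ℕ) (u : TF (Fin n → ℝ)) :
    (∏ i, rx n i ^ ν i) • dil t ht u =
      (t ^ (∑ i, ν i))⁻¹ • dil t ht ((∏ i, rx n i ^ ν i) • u) := by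
  ext x
  simp only [TF.sm_smul_apply, Sm.prod_apply, Sm.pow_apply, rx_apply, dil_apply, TF.smul_apply,
    Pi.smul_apply, smul_eq_mul, mul_pow, Finset.prod_mul_distrib, Finset.prod_pow_eq_pow_sum]
  field_simp

lemma Gw_dil {N : ℕ} (t : ℝ) (ht : t ≠ 0) (β) (u : TF (Fin n → ℝ)) :
    Gw n N (t ^ (N + 1)) β (dil t ht u) = t ^ β.length • dil t ht (Gw n N 1 β u) := by
  induction β with
  | nil => simp [Gw]
  | cons i β ih =>
    simp only [Gw, List.map_cons, List.prod_cons, Module.End.mul_apply] at ih ⊢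
    rw [ih, map_smul]
    set v := (List.map (Glet n N 1) β).prod u
    have : Glet n N (t ^ (N + 1)) i (dil t ht v) = t • dil t ht (Glet n N 1 i v) := by
      rcases i with j | ⟨ν, hν⟩
      · exact Dv_dil t ht _ v
      · simp only [Glet, LinearMap.smul_apply, Mul_apply, one_smul, rx_dil, hν, smul_smul]
        congr 1
        field_simp
        ring
    rw [this, smul_smul, List.length_cons, pow_succ]

lemma osL_dil {N : ℕ} (t : ℝ) (ht : t ≠ 0) (u : TF (Fin n → ℝ)) :
    osL n N (t ^ (N + 1)) (dil t ht u) = t ^ 2 • dil t ht (osL n N 1 u) := by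
  have h : pot n N • dil t ht u = (t ^ (2 * N))⁻¹ • dil t ht (pot n N • u) := by
    ext x
    simp only [TF.sm_smul_apply, pot_apply, dil_apply, TF.smul_apply, Pi.smul_apply, smul_eq_mul,
      mul_pow, ← Finset.mul_sum, ← pow_mul]
    field_simp
  simp only [osL, LinearMap.add_apply, LinearMap.neg_apply, LinearMap.sum_apply,
    Module.End.mul_apply, Dv_dil, map_smul, LinearMap.smul_apply, Mul_apply, h, map_add, map_neg,
    map_sum, one_pow, one_smul, smul_add, smul_neg, Finset.smul_sum, smul_smul]
  congr 2
  · refine Finset.sum_congr rfl fun j _ => ?_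
    rw [sq]
  · field_simp
    ring

lemma osL_pow_dil {N : ℕ} (t : ℝ) (ht : t ≠ 0) (k : ℕ) (u : TF (Fin n → ℝ)) :
    (osL n N (t ^ (N + 1)) ^ k) (dil t ht u) = t ^ (2 * k) • dil t ht ((osL n N 1 ^ k) u) := by
  induction k with
  | zero => simp
  | succ k ih =>
    rw [pow_succ', Module.End.mul_apply, ih, map_smul, osL_dil, smul_smul, pow_succ' (osL n N 1),
      Module.End.mul_apply]
    congr 1; ring

/-- The uniform estimate for the oscillators `-Δ + l²|x|^{2N}`. -/
theorem Gw_le_osL (hn : 1 ≤ n) {N : ℕ} (hN : 1 ≤ N) (k : ℕ)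
    (β : List (Fin n ⊕ {ν : Fin n → ℕ // ∑ i, ν i = N})) (hβ : β.length = 2 * k) :
    ∃ C : ℝ, 0 ≤ C ∧ ∀ l : ℝ, 0 < l → ∀ u : TF (Fin n → ℝ),
      ‖Gw n N l β u‖ ≤ C * ‖(osL n N l ^ k) u‖ := by
  obtain ⟨C, hC, h⟩ := Fil_le_osc hn hN k (A := Gw n N 1 β)
    (by have := Gw_mem N β; rw [hβ] at this; convert this using 1; push_cast; ring_nf)
  refine ⟨C, hC, fun l hl u => ?_⟩
  obtain ⟨t, ht, rfl⟩ : ∃ t : ℝ, 0 < t ∧ l = t ^ (N + 1) :=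
    ⟨l ^ ((N + 1 : ℕ) : ℝ)⁻¹, by positivity, (Real.rpow_inv_natCast_pow hl.le (by omega)).symm⟩
  obtain ⟨v, rfl⟩ : ∃ v, u = dil t ht.ne' v := by
    refine ⟨dil t⁻¹ (inv_ne_zero ht.ne') u, ?_⟩
    ext x
    simp [smul_smul, ht.ne']
  rw [Gw_dil, osL_pow_dil, hβ, norm_smul, norm_smul, mul_left_comm]
  refine mul_le_mul_of_nonneg_left ?_ (norm_nonneg _)
  have h1 : ∀ w : TF (Fin n → ℝ), ‖dil t ht.ne' w‖ = Real.sqrt |(t ^ n)⁻¹| * ‖w‖ := fun w => by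
    rw [← Real.sqrt_sq (norm_nonneg (dil t ht.ne' w)), norm_dil_sq,
      Real.sqrt_mul (abs_nonneg _), Real.sqrt_sq (norm_nonneg _)]
  rw [h1, h1, mul_left_comm, osL_one]
  exact mul_le_mul_of_nonneg_left (h v) (Real.sqrt_nonneg _)

end Rn2

section Parts
set_option linter.unusedSectionVars false
variable {V : Type*} [NormedAddCommGroup V] [NormedSpace ℝ V] [FiniteDimensional ℝ V]
  [MeasureSpace V] [BorelSpace V] [(volume : Measure V).IsAddHaarMeasure]

lemma TF.integral_Dv_mul (v : V) (g : TF V) (κ : Sm V) :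
    ∫ x, κ x * Dv v g x = -∫ x, Ds v κ x * g x := by
  have h : ∀ (f : TF V) {g : V → ℝ}, Continuous g → Integrable (fun x => g x * f x) volume := by
    intro f g hg
    simpa only [mul_comm] using f.integrable_mul_cont hg
  exact integral_mul_fderiv_eq_neg_fderiv_mul_of_integrable (μ := (volume : Measure V))
    (f := κ) (g := g) (v := v) (h g (Ds v κ).continuous) (h (Dv v g) κ.continuous)
    (h g κ.continuous)
    (fun x _ => κ.differentiable x) (fun x _ => g.differentiable x)

end Parts

instance {n m : ℕ} : (volume : Measure (Pt n m)).IsAddHaarMeasure :=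
  Measure.prod.instIsAddHaarMeasure _ _

section PartialTransform
variable {n m N : ℕ}

/-- The slice `y ↦ F(x,y)`. -/
noncomputable def slice (x : Fin n → ℝ) : TF (Pt n m) →ₗ[ℝ] TF (Fin m → ℝ) where
  toFun F := TF.mk (fun y => F (x, y)) (F.contDiff.comp (contDiff_prodMk_right x))
    (HasCompactSupport.intro (F.hasCompactSupport.isCompact.image continuous_snd) fun y hy => by
      by_contra h
      exact hy ⟨(x, y), subset_tsupport _ h, rfl⟩)
  map_add' _ _ := rfl
  map_smul' _ _ := rfl

@[simp] lemma slice_apply (x : Fin n → ℝ) (F : TF (Pt n m)) (y : Fin m → ℝ) :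
    slice x F y = F (x, y) := rfl

lemma Dv_slice (x : Fin n → ℝ) (F : TF (Pt n m)) (v : Fin m → ℝ) :
    Dv v (slice x F) = slice x (Dv (0, v) F) := by
  ext y
  have h : HasFDerivAt (fun y => F (x, y)) ((fderiv ℝ F (x, y)).comp
      (ContinuousLinearMap.inr ℝ (Fin n → ℝ) (Fin m → ℝ))) y :=
    (F.differentiable (x, y)).hasFDerivAt.comp y (hasFDerivAt_prodMk_right x y)
  have h' : fderiv ℝ (slice x F) y = _ := h.fderiv
  rw [Dv_apply, h', slice_apply, Dv_apply]
  simp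

/-- The partial integral as a convolution with parameter. -/
lemma partial_conv (κ : Sm (Fin m → ℝ)) (F : TF (Pt n m)) :
    ∃ K : Set (Fin m → ℝ), IsCompact K ∧
      (∀ (x : Fin n → ℝ) y, x ∈ Set.univ → y ∉ K → F (x, -y) = 0) ∧
      LocallyIntegrable κ volume ∧ ContDiff ℝ ∞ (fun q : Pt n m => F (q.1, -q.2)) := by
  refine ⟨-(Prod.snd '' tsupport F), (F.hasCompactSupport.isCompact.image continuous_snd).neg,
    fun x y _ hy => ?_, κ.continuous.locallyIntegrable, F.contDiff.comp
      (contDiff_fst.prodMk contDiff_snd.neg)⟩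
  by_contra h
  exact hy (Set.mem_neg.2 ⟨(x, -y), subset_tsupport _ h, rfl⟩)

lemma partial_conv_eq (κ : Sm (Fin m → ℝ)) (F : TF (Pt n m)) (x : Fin n → ℝ) :
    ∫ y, κ y * F (x, y) = convolution κ (fun y => F (x, -y)) (ContinuousLinearMap.mul ℝ ℝ) volume
      0 := by
  simp [convolution_def]

lemma contDiff_partial (κ : Sm (Fin m → ℝ)) (F : TF (Pt n m)) :
    ContDiff ℝ ∞ (fun x => ∫ y, κ y * F (x, y)) := by
  obtain ⟨K, hK, h1, h2, h3⟩ := partial_conv κ F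
  have := contDiffOn_convolution_right_with_param (n := ⊤) (ContinuousLinearMap.mul ℝ ℝ)
    (g := fun (x : Fin n → ℝ) y => F (x, -y)) isOpen_univ hK h1 h2 h3.contDiffOn
  rw [Set.univ_prod_univ, contDiffOn_univ] at this
  simp only [partial_conv_eq]
  exact this.comp (contDiff_prodMk_left (0 : Fin m → ℝ))

/-- The partial transform `x ↦ ∫ κ(y) F(x,y) dy`. -/
noncomputable def PT (κ : Sm (Fin m → ℝ)) : TF (Pt n m) →ₗ[ℝ] TF (Fin n → ℝ) where
  toFun F := TF.mk (fun x => ∫ y, κ y * F (x, y)) (contDiff_partial κ F)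
    (HasCompactSupport.intro (F.hasCompactSupport.isCompact.image continuous_fst) fun x hx => by
      have : ∀ y, F (x, y) = 0 := fun y => by
        by_contra h
        exact hx ⟨(x, y), subset_tsupport _ h, rfl⟩
      simp [this])
  map_add' F G := by
    ext x
    simp only [TF.coe_mk, TF.add_apply, mul_add]
    simp only [mul_comm (κ _)]
    exact integral_add ((slice x F).integrable_mul_cont κ.continuous)
      ((slice x G).integrable_mul_cont κ.continuous)
  map_smul' c F := by
    ext x
    simp only [TF.coe_mk, TF.smul_apply, mul_left_comm (κ _), integral_const_mul, RingHom.id_apply]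

lemma PT_apply (κ : Sm (Fin m → ℝ)) (F : TF (Pt n m)) (x : Fin n → ℝ) :
    PT κ F x = ∫ y, κ y * F (x, y) := rfl

lemma Dv_PT (κ : Sm (Fin m → ℝ)) (F : TF (Pt n m)) (v : Fin n → ℝ) :
    Dv v (PT κ F) = PT κ (Dv (v, 0) F) := by
  ext x
  obtain ⟨K, hK, h1, h2, h3⟩ := partial_conv κ F
  have h := hasFDerivAt_convolution_right_with_param (ContinuousLinearMap.mul ℝ ℝ)
    (g := fun (x : Fin n → ℝ) y => F (x, -y)) isOpen_univ hK h1 h2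
    (h3.of_le (by exact_mod_cast le_top)).contDiffOn (x, 0) trivial
  have h4 := HasFDerivAt.comp (f := fun e : Fin n → ℝ => (e, (0 : Fin m → ℝ))) x h
    (hasFDerivAt_prodMk_left x (0 : Fin m → ℝ))
  have h5 : fderiv ℝ (PT κ F) x = _ := (h4.congr_of_eventuallyEq
    (Filter.Eventually.of_forall fun x => partial_conv_eq κ F x)).fderiv
  set g' : Pt n m → ℝ := fun q => F (q.1, -q.2) with hg'
  have hd : ∀ y, fderiv ℝ g' (x, y) (v, 0) = Dv (v, 0) F (x, -y) := by
    intro y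
    let A : Pt n m →L[ℝ] Pt n m := (ContinuousLinearMap.fst ℝ _ _).prod
      (-ContinuousLinearMap.snd ℝ _ _)
    have h : HasFDerivAt g' ((fderiv ℝ F (A (x, y))).comp A) (x, y) :=
      (F.differentiable (A (x, y))).hasFDerivAt.comp (x, y) A.hasFDerivAt
    rw [h.fderiv, Dv_apply]
    simp [A]
  rw [Dv_apply, h5, ContinuousLinearMap.comp_apply]
  have h6 : HasCompactSupport fun y => fderiv ℝ g' (x, y) := by
    refine HasCompactSupport.intro hK fun y hy => ?_
    refine (hasFDerivAt_zero_of_eventually_const 0 ?_).fderiv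
    have : ∀ᶠ q : Pt n m in nhds (x, y), q.2 ∉ K :=
      continuous_snd.continuousAt.eventually (hK.isClosed.isOpen_compl.mem_nhds (by exact hy))
    filter_upwards [this] with q hq using h1 q.1 q.2 trivial hq
  have h7 : Continuous fun y => fderiv ℝ g' (x, y) :=
    (h3.continuous_fderiv (by simp)).comp (Continuous.prodMk_right x)
  have h8 := convolution_precompR_apply (ContinuousLinearMap.mul ℝ ℝ) h2 h6 h7 0 ((v, 0) : Pt n m)
  simp only [ContinuousLinearMap.inl_apply]
  refine h8.trans ?_
  rw [PT_apply, convolution_def]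
  simp [hd]

lemma PT_Dv_right (κ : Sm (Fin m → ℝ)) (F : TF (Pt n m)) (v : Fin m → ℝ) :
    PT κ (Dv (0, v) F) = -PT (Ds v κ) F := by
  ext x
  rw [TF.neg_apply, PT_apply, PT_apply]
  have := TF.integral_Dv_mul v (slice x F) κ
  rw [Dv_slice] at this
  simpa using this

/-- A smooth function of `x`, viewed as a function on the product. -/
noncomputable def liftS : Sm (Fin n → ℝ) →ₐ[ℝ] Sm (Pt n m) where
  toFun a := Sm.mk (fun z => a z.1) (a.contDiff.comp contDiff_fst)
  map_one' := rfl
  map_zero' := rfl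
  map_add' _ _ := rfl
  map_mul' _ _ := rfl
  commutes' _ := rfl

@[simp] lemma liftS_apply (a : Sm (Fin n → ℝ)) (z : Pt n m) : liftS a z = a z.1 := rfl

lemma PT_lift_smul (κ : Sm (Fin m → ℝ)) (a : Sm (Fin n → ℝ)) (F : TF (Pt n m)) :
    PT κ ((liftS (m := m) a : Sm (Pt n m)) • F) = a • PT κ F := by
  ext x
  simp only [PT_apply, TF.sm_smul_apply, liftS_apply, mul_left_comm (κ _), integral_const_mul]

lemma liftS_rx (i : Fin n) : liftS (m := m) (rx n i) = xs n m i := rfl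

lemma liftS_pow (ν : Fin n → ℕ) : liftS (m := m) (∏ i, rx n i ^ ν i) = xpow m ν := by
  simp [xpow, map_prod, liftS_rx]

/-- The phase `2π η·y`. -/
noncomputable def phase (η y : Fin m → ℝ) : ℝ := 2 * Real.pi * ∑ k, η k * y k

lemma contDiff_phase (η : Fin m → ℝ) : ContDiff ℝ ∞ (phase η) := by
  unfold phase; fun_prop

/-- The cosine kernel. -/
noncomputable def kc (η : Fin m → ℝ) : Sm (Fin m → ℝ) :=
  Sm.mk (fun y => Real.cos (phase η y)) (Real.contDiff_cos.comp (contDiff_phase η))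
/-- The sine kernel. -/
noncomputable def ks (η : Fin m → ℝ) : Sm (Fin m → ℝ) :=
  Sm.mk (fun y => Real.sin (phase η y)) (Real.contDiff_sin.comp (contDiff_phase η))

lemma hasFDerivAt_phase (η y : Fin m → ℝ) (k : Fin m) :
    ∃ L : (Fin m → ℝ) →L[ℝ] ℝ, HasFDerivAt (phase η) L y ∧
      L (Pi.single k 1) = 2 * Real.pi * η k := by
  refine ⟨(2 * Real.pi) • ∑ k, η k • ContinuousLinearMap.proj k, ?_, ?_⟩
  · have : phase η = ⇑((2 * Real.pi) • ∑ k, η k • (ContinuousLinearMap.proj k :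
        (Fin m → ℝ) →L[ℝ] ℝ)) := by
      ext y; simp [phase]
    rw [this]
    exact ContinuousLinearMap.hasFDerivAt _
  · simp [Pi.single_apply]

lemma Ds_kc (η : Fin m → ℝ) (k : Fin m) :
    Ds (Pi.single k 1) (kc η) = -((2 * Real.pi * η k) • ks η) := by
  ext y
  obtain ⟨L, hL, h⟩ := hasFDerivAt_phase η y k
  have h' : fderiv ℝ (kc η) y = _ := hL.cos.fderiv
  rw [Ds_apply, h']
  simp [h, ks]; ring

lemma Ds_ks (η : Fin m → ℝ) (k : Fin m) :
    Ds (Pi.single k 1) (ks η) = (2 * Real.pi * η k) • kc η := by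
  ext y
  obtain ⟨L, hL, h⟩ := hasFDerivAt_phase η y k
  have h' : fderiv ℝ (ks η) y = _ := hL.sin.fderiv
  rw [Ds_apply, h']
  simp [h, kc]; ring

lemma PT_smul_left (c : ℝ) (κ : Sm (Fin m → ℝ)) (F : TF (Pt n m)) :
    PT (c • κ) F = c • PT κ F := by
  ext x
  simp only [PT_apply, Sm.smul_apply, TF.smul_apply, mul_assoc, integral_const_mul]

lemma PT_neg_left (κ : Sm (Fin m → ℝ)) (F : TF (Pt n m)) : PT (-κ) F = -PT κ F := by
  simpa using PT_smul_left (-1) κ F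

lemma kc_dy (η : Fin m → ℝ) (k : Fin m) (F : TF (Pt n m)) :
    PT (kc η) (Dv (dy n m k) F) = (2 * Real.pi * η k) • PT (ks η) F := by
  rw [dy, PT_Dv_right, Ds_kc, PT_neg_left, PT_smul_left, neg_neg]

lemma ks_dy (η : Fin m → ℝ) (k : Fin m) (F : TF (Pt n m)) :
    PT (ks η) (Dv (dy n m k) F) = -((2 * Real.pi * η k) • PT (kc η) F) := by
  rw [dy, PT_Dv_right, Ds_ks, PT_smul_left]

/-- The frequency modulus. -/
noncomputable def freq (η : Fin m → ℝ) : ℝ := Real.sqrt (∑ k, (2 * Real.pi * η k) ^ 2)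

lemma abs_le_freq (η : Fin m → ℝ) (k : Fin m) : |2 * Real.pi * η k| ≤ freq η :=
  Real.abs_le_sqrt (Finset.single_le_sum (f := fun k => (2 * Real.pi * η k) ^ 2)
    (fun _ _ => sq_nonneg _) (Finset.mem_univ k))

lemma freq_sq (η : Fin m → ℝ) : freq η ^ 2 = ∑ k, (2 * Real.pi * η k) ^ 2 :=
  Real.sq_sqrt (Finset.sum_nonneg fun _ _ => sq_nonneg _)

lemma PT_H_aux (η : Fin m → ℝ) (κ : Sm (Fin m → ℝ)) (F : TF (Pt n m))
    (h : ∀ k, PT κ (Dv (dy n m k) (Dv (dy n m k) F)) = -((2 * Real.pi * η k) ^ 2 • PT κ F)) :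
    PT κ (H n m N F) = osL n N (freq η) (PT κ F) := by
  have e : (∑ i, xs n m i ^ 2) ^ N = liftS (pot n N) := by
    simp [pot, map_sum, liftS_rx]
  rw [H_apply, e, map_sub, map_neg, map_sum, map_sum]
  simp only [PT_lift_smul, h, smul_neg, Finset.sum_neg_distrib, sub_neg_eq_add, osL,
    LinearMap.add_apply, LinearMap.neg_apply, LinearMap.sum_apply, LinearMap.smul_apply, Mul_apply,
    Module.End.mul_apply, freq_sq]
  congr 1
  · congr 1
    refine Finset.sum_congr rfl fun j _ => ?_
    rw [Dv_PT, Dv_PT]; rfl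
  · rw [Finset.sum_smul]
    refine Finset.sum_congr rfl fun k _ => ?_
    rw [smul_comm]

lemma PT_H_kc (η : Fin m → ℝ) (F : TF (Pt n m)) :
    PT (kc η) (H n m N F) = osL n N (freq η) (PT (kc η) F) := by
  refine PT_H_aux η _ F fun k => ?_
  rw [kc_dy, ks_dy, smul_neg, smul_smul, sq]

lemma PT_H_ks (η : Fin m → ℝ) (F : TF (Pt n m)) :
    PT (ks η) (H n m N F) = osL n N (freq η) (PT (ks η) F) := by
  refine PT_H_aux η _ F fun k => ?_
  rw [ks_dy, kc_dy, smul_smul, sq]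

lemma PT_H_pow (κ : Sm (Fin m → ℝ)) (l : ℝ)
    (h : ∀ F : TF (Pt n m), PT κ (H n m N F) = osL n N l (PT κ F)) (K : ℕ) (F : TF (Pt n m)) :
    PT κ ((H n m N ^ K) F) = (osL n N l ^ K) (PT κ F) := by
  induction K generalizing F with
  | zero => simp
  | succ K ih => rw [pow_succ, pow_succ, Module.End.mul_apply, Module.End.mul_apply, ih, h]

/-- Squared norm at a given frequency of the partial Fourier transform. -/
noncomputable def EF (A : Module.End ℝ (TF (Fin n → ℝ))) (η : Fin m → ℝ) (F : TF (Pt n m)) : ℝ :=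
  ‖A (PT (kc η) F)‖ ^ 2 + ‖A (PT (ks η) F)‖ ^ 2

/-- The projection of letters on `ℝⁿ⁺ᵐ` to letters on `ℝⁿ`. -/
def proj1 : XIdx n m N → Fin n ⊕ {ν : Fin n → ℕ // ∑ i, ν i = N}
  | Sum.inl j => Sum.inl j
  | Sum.inr (ν, _) => Sum.inr ν

lemma cν_sq_le (ν : Fin n → ℕ) : cν N ν ^ 2 ≤ N.factorial := by
  rw [cν, Real.sq_sqrt (by positivity)]
  refine div_le_self (by positivity) ?_
  exact_mod_cast Nat.one_le_iff_ne_zero.2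
    (Finset.prod_ne_zero_iff.2 fun i _ => Nat.factorial_ne_zero _)

lemma EF_letter (A : Module.End ℝ (TF (Fin n → ℝ))) {η : Fin m → ℝ} (hη : 0 < freq η)
    (i : XIdx n m N) (F : TF (Pt n m)) :
    EF A η ((XF n m N i).T F) ≤ N.factorial * EF (A * Glet n N (freq η) (proj1 i)) η F := by
  have hN1 : (1 : ℝ) ≤ N.factorial := by
    exact_mod_cast Nat.factorial_pos N
  rcases XIdx.cases i with ⟨j, rfl⟩ | ⟨ν, k, rfl⟩
  · rw [T_iX]
    have : EF A η (Dv (dx n m j) F) = EF (A * Glet n N (freq η) (proj1 (iX j : XIdx n m N))) η F := by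
      simp only [EF, dx, ← Dv_PT]; rfl
    rw [this]
    exact le_mul_of_one_le_left (by unfold EF; positivity) hN1
  · set t := 2 * Real.pi * η k
    have e1 : A (PT (kc η) ((XF n m N (iY ν k)).T F)) = (cν N ν.1 * t / freq η) •
        (A * Glet n N (freq η) (Sum.inr ν)) (PT (ks η) F) := by
      rw [VF.T_apply, XF_iY]
      simp only [← liftS_pow, smul_assoc, map_smul, PT_lift_smul, kc_dy, Glet,
        Module.End.mul_apply, LinearMap.smul_apply, Mul_apply, smul_smul]
      rw [smul_comm, map_smul, smul_smul]
      congr 1; field_simp; ring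
    have e2 : A (PT (ks η) ((XF n m N (iY ν k)).T F)) = -(cν N ν.1 * t / freq η) •
        (A * Glet n N (freq η) (Sum.inr ν)) (PT (kc η) F) := by
      rw [VF.T_apply, XF_iY]
      simp only [← liftS_pow, smul_assoc, map_smul, PT_lift_smul, ks_dy, Glet,
        Module.End.mul_apply, LinearMap.smul_apply, Mul_apply, smul_smul, smul_neg, map_neg]
      rw [smul_comm, map_smul, smul_smul]
      rw [neg_mul, neg_smul]
      congr 2; field_simp; ring
    have hb : (cν N ν.1 * t / freq η) ^ 2 ≤ N.factorial := by
      rw [div_pow, mul_pow, mul_div_assoc]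
      have : t ^ 2 / freq η ^ 2 ≤ 1 := by
        rw [div_le_one (by positivity), ← sq_abs]
        exact pow_le_pow_left₀ (abs_nonneg _) (abs_le_freq η k) 2
      calc _ ≤ cν N ν.1 ^ 2 * 1 := by gcongr
        _ ≤ _ := by rw [mul_one]; exact cν_sq_le ν.1
    simp only [EF, e1, e2, norm_smul, mul_pow, norm_neg, Real.norm_eq_abs, sq_abs]
    rw [← mul_add, add_comm]
    exact mul_le_mul_of_nonneg_right hb (by positivity)

lemma EF_word (A : Module.End ℝ (TF (Fin n → ℝ))) {η : Fin m → ℝ} (hη : 0 < freq η)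
    (β : List (XIdx n m N)) (F : TF (Pt n m)) :
    EF A η (XT n m N β F) ≤
      N.factorial ^ β.length * EF (A * Gw n N (freq η) (β.map proj1)) η F := by
  induction β generalizing A with
  | nil => simp [Gw]
  | cons i β ih =>
    rw [XT, wT_cons, Module.End.mul_apply, List.length_cons, pow_succ', mul_assoc]
    refine (EF_letter A hη i _).trans (mul_le_mul_of_nonneg_left ?_ (by positivity))
    refine (ih _).trans (le_of_eq ?_)
    simp [Gw, mul_assoc]

end PartialTransform

section Plancherel
variable {n m N : ℕ}

lemma plancherel (g : TF (Fin m → ℝ)) :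
    ∫⁻ η, ENNReal.ofReal ((∫ y, kc η y * g y) ^ 2 + (∫ y, ks η y * g y) ^ 2) =
      ENNReal.ofReal (∫ y, g y ^ 2) := by
  let E := EuclideanSpace ℝ (Fin m)
  let L : E ≃L[ℝ] (Fin m → ℝ) := EuclideanSpace.equiv (Fin m) ℝ
  let G : E → ℂ := fun v => (g (L v) : ℂ)
  have hG : HasCompactSupport G :=
    (g.hasCompactSupport.comp_homeomorph L.toHomeomorph).comp_left
      (g := fun r : ℝ => (r : ℂ)) (by simp)
  have hG' : ContDiff ℝ ∞ G :=
    Complex.ofRealCLM.contDiff.comp (g.contDiff.comp L.contDiff)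
  let f : SchwartzMap E ℂ := hG.toSchwartzMap hG'
  have hf : ⇑f = G := rfl
  have key := SchwartzMap.integral_norm_sq_fourier f
  have hint : Integrable fun ξ => ‖(FourierTransform.fourier f) ξ‖ ^ 2 := by
    have := ((FourierTransform.fourier f).memLp 2 volume).integrable_norm_pow (by norm_num)
    simpa using this
  have h1 : ∀ ξ : E, ‖(FourierTransform.fourier f) ξ‖ ^ 2 =
      (∫ y, kc (L ξ) y * g y) ^ 2 + (∫ y, ks (L ξ) y * g y) ^ 2 := by
    intro ξ
    have e : (FourierTransform.fourier f) ξ =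
        ((∫ y, kc (L ξ) y * g y : ℝ) : ℂ) + ((-∫ y, ks (L ξ) y * g y : ℝ) : ℂ) * Complex.I := by
      rw [SchwartzMap.fourier_coe, Real.fourier_eq', hf]
      have e0 : ∀ y : Fin m → ℝ, Complex.exp (((-2 * Real.pi * inner ℝ (L.symm y) ξ : ℝ) : ℂ) *
          Complex.I) • G (L.symm y) =
          ((kc (L ξ) y * g y : ℝ) : ℂ) + ((-(ks (L ξ) y * g y) : ℝ) : ℂ) * Complex.I := by
        intro y
        have : -2 * Real.pi * inner ℝ (L.symm y) ξ = -(phase (L ξ) y) := by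
          have : inner ℝ (L.symm y) ξ = ∑ k, L ξ k * y k := by
            rw [PiLp.inner_apply]; rfl
          rw [this, phase]; ring
        rw [this, Complex.exp_mul_I]
        simp [kc, ks, G]
        ring
      have e1 : ∫ v : E, Complex.exp (((-2 * Real.pi * inner ℝ v ξ : ℝ) : ℂ) *
          Complex.I) • G v = ∫ y, Complex.exp (((-2 * Real.pi * inner ℝ (L.symm y) ξ : ℝ) : ℂ) *
          Complex.I) • G (L.symm y) :=
        ((EuclideanSpace.volume_preserving_symm_measurableEquiv_toLp (Fin m)).symm.integral_comp'
          (f := (MeasurableEquiv.toLp 2 (Fin m → ℝ))) (fun v : E =>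
            Complex.exp (((-2 * Real.pi * inner ℝ v ξ : ℝ) : ℂ) * Complex.I) • G v)).symm
      rw [e1]
      simp only [e0]
      have i1 : Integrable fun y => ((kc (L ξ) y * g y : ℝ) : ℂ) := by
        refine Integrable.ofReal (𝕜 := ℂ) (f := fun y => kc (L ξ) y * g y) ?_
        simpa only [mul_comm] using g.integrable_mul_cont (kc (L ξ)).continuous
      have i2 : Integrable fun y => ((-(ks (L ξ) y * g y) : ℝ) : ℂ) * Complex.I := by
        refine Integrable.mul_const (Integrable.ofReal (𝕜 := ℂ)
          (Integrable.neg (f := fun y => ks (L ξ) y * g y) ?_)) _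
        simpa only [mul_comm] using g.integrable_mul_cont (ks (L ξ)).continuous
      rw [integral_add i1 i2, integral_mul_const, integral_complex_ofReal, integral_complex_ofReal,
        integral_neg]
    rw [e, ← Complex.normSq_eq_norm_sq, Complex.normSq_add_mul_I]
    ring
  have mp := EuclideanSpace.volume_preserving_symm_measurableEquiv_toLp (Fin m)
  simp only [h1] at key hint
  have k1 : ∫⁻ η, ENNReal.ofReal ((∫ y, kc η y * g y) ^ 2 + (∫ y, ks η y * g y) ^ 2) =
      ∫⁻ ξ : E, ENNReal.ofReal ((∫ y, kc (L ξ) y * g y) ^ 2 + (∫ y, ks (L ξ) y * g y) ^ 2) :=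
    (mp.lintegral_comp_emb (MeasurableEquiv.measurableEmbedding _) _).symm
  rw [k1, ← ofReal_integral_eq_lintegral_ofReal hint (Filter.Eventually.of_forall fun _ => by
    positivity), key]
  congr 1
  have k2 : ∫ x : E, ‖f x‖ ^ 2 = ∫ x : E, g (L x) ^ 2 := by simp [hf, G]
  rw [k2]
  exact mp.integral_comp' (g := fun y => g y ^ 2)

lemma measurable_PT (κ : (Fin m → ℝ) → Sm (Fin m → ℝ))
    (hκ : Continuous fun q : (Fin m → ℝ) × (Fin m → ℝ) => κ q.1 q.2) (F : TF (Pt n m)) :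
    Measurable fun q : (Fin m → ℝ) × (Fin n → ℝ) => PT (κ q.1) F q.2 := by
  have hc : Continuous fun r : ((Fin m → ℝ) × (Fin n → ℝ)) × (Fin m → ℝ) =>
      κ r.1.1 r.2 * F (r.1.2, r.2) :=
    (hκ.comp (by fun_prop : Continuous fun r : ((Fin m → ℝ) × (Fin n → ℝ)) × (Fin m → ℝ) =>
      (r.1.1, r.2))).mul (F.continuous.comp (by fun_prop))
  exact (hc.stronglyMeasurable.integral_prod_right (ν := volume)).measurable

lemma continuous_phase : Continuous fun q : (Fin m → ℝ) × (Fin m → ℝ) => phase q.1 q.2 := by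
  unfold phase; fun_prop

lemma lintegral_EF (F : TF (Pt n m)) :
    ∫⁻ η, ENNReal.ofReal (EF 1 η F) = ENNReal.ofReal (‖F‖ ^ 2) := by
  have mc := measurable_PT (n := n) kc (Real.continuous_cos.comp continuous_phase) F
  have ms := measurable_PT (n := n) ks (Real.continuous_sin.comp continuous_phase) F
  have e1 : ∀ η, ENNReal.ofReal (EF 1 η F) =
      ∫⁻ x, ENNReal.ofReal (PT (kc η) F x ^ 2 + PT (ks η) F x ^ 2) := by
    intro η
    rw [EF, Module.End.one_apply, Module.End.one_apply, norm_sq_eq, norm_sq_eq]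
    have i : ∀ f : TF (Fin n → ℝ), Integrable fun x => f x ^ 2 := fun f => by
      simpa only [sq] using f.integrable_mul f
    rw [← integral_add (i _) (i _)]
    exact ofReal_integral_eq_lintegral_ofReal ((i _).add (i _))
      (Filter.Eventually.of_forall fun _ => add_nonneg (sq_nonneg _) (sq_nonneg _))
  simp only [e1]
  rw [lintegral_lintegral_swap
    (((mc.pow_const 2).add (ms.pow_const 2)).ennreal_ofReal.aemeasurable)]
  have e2 : ∀ x, ∫⁻ η, ENNReal.ofReal (PT (kc η) F x ^ 2 + PT (ks η) F x ^ 2) =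
      ∫⁻ y, ENNReal.ofReal (F (x, y) ^ 2) := by
    intro x
    refine (plancherel (slice x F)).trans ?_
    rw [ofReal_integral_eq_lintegral_ofReal]
    · rfl
    · simpa only [sq] using (slice x F).integrable_mul (slice x F)
    · exact Filter.Eventually.of_forall fun _ => by positivity
  simp only [e2]
  have i : Integrable fun x => F x ^ 2 := by simpa only [sq] using F.integrable_mul F
  rw [norm_sq_eq, ofReal_integral_eq_lintegral_ofReal i
    (Filter.Eventually.of_forall fun _ => by positivity), Measure.volume_eq_prod, lintegral_prod]
  exact (F.continuous.pow 2).measurable.ennreal_ofReal.aemeasurable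

/-- The `L₂` estimate for words of even length. -/
theorem norm_XT_le (hn : 1 ≤ n) (hm : 1 ≤ m) (hN : 1 ≤ N) (K : ℕ) (β : List (XIdx n m N))
    (hβ : β.length = 2 * K) :
    ∃ C, 0 ≤ C ∧ ∀ φ, ‖XT n m N β φ‖ ≤ C * ‖(H n m N ^ K) φ‖ := by
  obtain ⟨C, hC, h⟩ := Gw_le_osL hn hN K (β.map proj1) (by simpa using hβ)
  set D : ℝ := N.factorial ^ β.length * C ^ 2 with hD
  have hD0 : 0 ≤ D := by positivity
  refine ⟨Real.sqrt D, by positivity, fun φ => ?_⟩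
  have hfreq : ∀ᵐ η : Fin m → ℝ, 0 < freq η := by
    have : Nonempty (Fin m) := ⟨⟨0, hm⟩⟩
    have h0 : ∀ᵐ η : Fin m → ℝ, η ≠ 0 := by
      rw [ae_iff]; simp
    filter_upwards [h0] with η hη
    obtain ⟨k, hk⟩ := Function.ne_iff.1 hη
    refine lt_of_lt_of_le ?_ (abs_le_freq η k)
    have : η k ≠ 0 := hk
    positivity
  have key : ENNReal.ofReal (‖XT n m N β φ‖ ^ 2) ≤
      ENNReal.ofReal (D * ‖(H n m N ^ K) φ‖ ^ 2) := by
    rw [ENNReal.ofReal_mul hD0, ← lintegral_EF, ← lintegral_EF,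
      ← lintegral_const_mul' _ _ ENNReal.ofReal_ne_top]
    refine lintegral_mono_ae ?_
    filter_upwards [hfreq] with η hη
    rw [← ENNReal.ofReal_mul hD0]
    refine ENNReal.ofReal_le_ofReal ((EF_word 1 hη β φ).trans ?_)
    rw [hD, mul_assoc]
    refine mul_le_mul_of_nonneg_left ?_ (by positivity)
    simp only [EF, one_mul, Module.End.one_apply]
    rw [PT_H_pow _ _ (PT_H_kc η), PT_H_pow _ _ (PT_H_ks η), mul_add]
    have := fun u => pow_le_pow_left₀ (norm_nonneg _) (h (freq η) hη u) 2
    simp only [mul_pow] at this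
    exact add_le_add (this _) (this _)
  have key' := (ENNReal.ofReal_le_ofReal_iff (by positivity)).1 key
  refine (abs_le_of_sq_le_sq' (a := ‖XT n m N β φ‖) ?_ (by positivity)).2
  rw [mul_pow, Real.sq_sqrt hD0]
  exact key'

end Plancherel

lemma Sm.natCast_apply {V : Type*} [NormedAddCommGroup V] [NormedSpace ℝ V] (k : ℕ) (x : V) :
    (k : Sm V) x = k := map_natCast (Sm.eval x) k

section Families
variable {n m : ℕ} (N : ℕ) {P : Type*}

/-- Families of smooth functions whose rescaled `X`-derivatives are uniformly bounded. -/
def UB (r : P → ℝ) (a : P → Sm (Pt n m)) : Prop :=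
  ∀ β : List (XIdx n m N), ∃ C, ∀ p x, |r p ^ β.length * wS (XF n m N) β (a p) x| ≤ C

variable {N} {r : P → ℝ} {a b χ : P → Sm (Pt n m)}

lemma UB.bound (h : UB N r a) : ∃ C, 0 ≤ C ∧ ∀ p x, |a p x| ≤ C := by
  obtain ⟨C, hC⟩ := h []
  exact ⟨|C|, abs_nonneg _, fun p x => (by simpa using hC p x : |a p x| ≤ C).trans (le_abs_self C)⟩

lemma UB.deriv (h : UB N r a) (i : XIdx n m N) :
    UB N r fun p => r p • (XF n m N i).S (a p) := by
  intro β
  obtain ⟨C, hC⟩ := h (β ++ [i])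
  refine ⟨C, fun p x => le_trans (le_of_eq ?_) (hC p x)⟩
  rw [wS_append, map_smul, List.length_append, pow_add]
  simp [wS, mul_assoc]

lemma UB.add (ha : UB N r a) (hb : UB N r b) : UB N r fun p => a p + b p := by
  intro β
  obtain ⟨A, hA⟩ := ha β
  obtain ⟨B, hB⟩ := hb β
  refine ⟨A + B, fun p x => ?_⟩
  rw [map_add, Sm.add_apply, mul_add]
  exact (abs_add_le _ _).trans (add_le_add (hA p x) (hB p x))

lemma UB.const_smul (c : ℝ) (ha : UB N r a) : UB N r fun p => c • a p := by
  intro β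
  obtain ⟨A, hA⟩ := ha β
  refine ⟨|c| * A, fun p x => ?_⟩
  rw [map_smul, Sm.smul_apply, mul_left_comm, abs_mul]
  exact mul_le_mul_of_nonneg_left (hA p x) (abs_nonneg _)

lemma UB.one : UB N r fun _ => (1 : Sm (Pt n m)) := by
  intro β
  rcases List.eq_nil_or_concat' β with rfl | ⟨β, i, rfl⟩
  · exact ⟨1, fun p x => by simp [wS]⟩
  · refine ⟨0, fun p x => ?_⟩
    rw [wS_append]
    simp [wS, VF.S_apply]

lemma UB.mul_aux (k : ℕ) : ∀ {a b : P → Sm (Pt n m)}, UB N r a → UB N r b →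
    ∀ β : List (XIdx n m N), β.length = k →
      ∃ C, ∀ p x, |r p ^ β.length * wS (XF n m N) β (a p * b p) x| ≤ C := by
  induction k with
  | zero =>
    intro a b ha hb β hβ
    obtain ⟨A, hA0, hA⟩ := ha.bound
    obtain ⟨B, hB0, hB⟩ := hb.bound
    obtain rfl := List.length_eq_zero_iff.1 hβ
    refine ⟨A * B, fun p x => ?_⟩
    simp only [List.length_nil, pow_zero, one_mul, wS_nil, Module.End.one_apply, Sm.mul_apply,
      abs_mul]
    exact mul_le_mul (hA p x) (hB p x) (abs_nonneg _) hA0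
  | succ k ih =>
    intro a b ha hb β hβ
    rcases List.eq_nil_or_concat' β with rfl | ⟨β, i, rfl⟩
    · simp at hβ
    · have hl : β.length = k := by simpa using hβ
      obtain ⟨A, hA⟩ := ih ha (hb.deriv i) β hl
      obtain ⟨B, hB⟩ := ih (ha.deriv i) hb β hl
      refine ⟨A + B, fun p x => ?_⟩
      have e : r p ^ (β ++ [i]).length * wS (XF n m N) (β ++ [i]) (a p * b p) x =
          r p ^ β.length * wS (XF n m N) β (a p * (r p • (XF n m N i).S (b p))) x +
          r p ^ β.length * wS (XF n m N) β ((r p • (XF n m N i).S (a p)) * b p) x := by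
        rw [wS_append, List.length_append, pow_add]
        simp [wS, VF.S_mul, mul_add, mul_assoc]
      rw [e]
      exact (abs_add_le _ _).trans (add_le_add (hA p x) (hB p x))

lemma UB.mul (ha : UB N r a) (hb : UB N r b) : UB N r fun p => a p * b p :=
  fun β => UB.mul_aux β.length ha hb β rfl

lemma UB.pow (ha : UB N r a) (k : ℕ) : UB N r fun p => a p ^ k := by
  induction k with
  | zero => simpa using UB.one
  | succ k ih => simpa only [pow_succ] using ih.mul ha

variable (N r χ) in
/-- Families of operators of `X`-order less than `k`, weighted by powers of the cutoff. -/
noncomputable def Low (k s : ℕ) : Submodule ℝ (P → Module.End ℝ (TF (Pt n m))) :=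
  Submodule.span ℝ {A | ∃ (d : P → Sm (Pt n m)) (γ : List (XIdx n m N)) (j : ℕ), UB N r d ∧
    γ.length < k ∧ γ.length + s ≤ j ∧
    A = fun p => r p ^ γ.length • (Mul (d p * χ p ^ j) * XT n m N γ)}

lemma Low.gen {k s : ℕ} {d : P → Sm (Pt n m)} (hd : UB N r d) {γ : List (XIdx n m N)} {j : ℕ}
    (h1 : γ.length < k) (h2 : γ.length + s ≤ j) :
    (fun p => r p ^ γ.length • (Mul (d p * χ p ^ j) * XT n m N γ)) ∈ Low N r χ k s :=
  Submodule.subset_span ⟨d, γ, j, hd, h1, h2, rfl⟩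

lemma Low.step (hχ : UB N r χ) (i : XIdx n m N) {k s : ℕ}
    {A : P → Module.End ℝ (TF (Pt n m))} (hA : A ∈ Low N r χ k (s + 1)) :
    (fun p => r p • ((XF n m N i).T * A p)) ∈ Low N r χ (k + 1) s := by
  induction hA using Submodule.span_induction with
  | mem A h =>
    obtain ⟨d, γ, j, hd, h1, h2, rfl⟩ := h
    obtain ⟨j, rfl⟩ : ∃ j', j = j' + 1 := ⟨j - 1, by omega⟩
    have g1 := Low.gen (χ := χ) (k := k + 1) (s := s) (hd.deriv i) (γ := γ) (j := j + 1)
      (by omega) (by omega)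
    have g2 := Low.gen (χ := χ) (k := k + 1) (s := s)
      ((hd.mul (hχ.deriv i)).const_smul (j + 1)) (γ := γ) (j := j)
      (by omega) (by omega)
    have g3 := Low.gen (χ := χ) (k := k + 1) (s := s) hd (γ := i :: γ) (j := j + 1)
      (by simpa using h1) (by simp; omega)
    convert (Low N r χ (k + 1) s).add_mem ((Low N r χ (k + 1) s).add_mem g1 g2) g3 using 1
    funext p
    ext1 u
    simp only [Pi.add_apply, LinearMap.add_apply, LinearMap.smul_apply, Module.End.mul_apply,
      Mul_apply, map_smul, VF.T_smul, VF.S_mul, VF.S_pow, XT, wT_cons, List.length_cons]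
    simp only [pow_succ]
    ext x
    simp only [TF.add_apply, TF.smul_apply, TF.sm_smul_apply, Sm.mul_apply, Sm.add_apply,
      Sm.smul_apply, Sm.pow_apply, Sm.natCast_apply]
    push_cast
    ring
  | zero => simp only [Pi.zero_apply, mul_zero, smul_zero]; exact Submodule.zero_mem _
  | add A B _ _ hA hB =>
    simp only [Pi.add_apply, mul_add, smul_add]; exact Submodule.add_mem _ hA hB
  | smul c A _ hA =>
    have := Submodule.smul_mem _ c hA
    convert this using 1
    funext p
    simp only [Pi.smul_apply, mul_smul_comm]
    rw [smul_comm]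

lemma Low.comm (hχ : UB N r χ) (β : List (XIdx n m N)) {M : ℕ} (hM : β.length ≤ M) :
    (fun p => r p ^ β.length • (XT n m N β * Mul (χ p ^ M) - Mul (χ p ^ M) * XT n m N β)) ∈
      Low N r χ β.length (M - β.length) := by
  induction β with
  | nil =>
    simp only [XT, wT_nil, one_mul, mul_one, sub_self, smul_zero]
    exact Submodule.zero_mem _
  | cons i β ih =>
    rw [List.length_cons] at hM
    have ih := ih (by omega)
    obtain ⟨s, rfl⟩ : ∃ s, M = β.length + s + 1 := ⟨M - β.length - 1, by omega⟩
    rw [show β.length + s + 1 - β.length = s + 1 by omega] at ih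
    rw [List.length_cons, show β.length + s + 1 - (β.length + 1) = s by omega]
    have h1 := Low.step hχ i ih
    have h2 := Low.gen (χ := χ) (k := β.length + 1) (s := s)
      ((hχ.deriv i).const_smul (β.length + s + 1)) (γ := β) (j := β.length + s)
      (by omega) le_rfl
    convert Submodule.add_mem _ h1 h2 using 1
    funext p
    ext1 u
    simp only [Pi.add_apply, LinearMap.add_apply, LinearMap.sub_apply, LinearMap.smul_apply,
      Module.End.mul_apply, smul_sub, map_sub,
      Mul_apply, map_smul, VF.T_smul, VF.S_pow, XT, wT_cons]
    simp only [pow_succ]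
    ext x
    simp only [TF.add_apply, TF.sub_apply, TF.smul_apply, TF.sm_smul_apply, Sm.mul_apply,
      Sm.smul_apply, Sm.pow_apply, Sm.natCast_apply]
    push_cast
    ring

variable (N r χ) in
/-- The local seminorms `∑_{|γ| = k} r^k ‖χ^k X^γ u‖`. -/
noncomputable def cac (k : ℕ) (p : P) (u : TF (Pt n m)) : ℝ :=
  ∑ γ : Fin k → XIdx n m N, |r p| ^ k * ‖χ p ^ k • XT n m N (List.ofFn γ) u‖

lemma cac_nonneg (k : ℕ) (p : P) (u : TF (Pt n m)) : 0 ≤ cac N r χ k p u :=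
  Finset.sum_nonneg fun _ _ => by positivity

lemma le_cac (β : List (XIdx n m N)) (p : P) (u : TF (Pt n m)) :
    |r p| ^ β.length * ‖χ p ^ β.length • XT n m N β u‖ ≤ cac N r χ β.length p u := by
  have := Finset.single_le_sum (f := fun γ : Fin β.length → XIdx n m N =>
    |r p| ^ β.length * ‖χ p ^ β.length • XT n m N (List.ofFn γ) u‖)
    (fun _ _ => by positivity) (Finset.mem_univ β.get)
  simp only [List.ofFn_get] at this
  exact this

lemma cac_zero (p : P) (u : TF (Pt n m)) : cac N r χ 0 p u = ‖u‖ := by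
  simp [cac, XT]

lemma norm_sm_smul_le {V : Type*} [NormedAddCommGroup V] [NormedSpace ℝ V]
    [FiniteDimensional ℝ V] [MeasureSpace V] [BorelSpace V]
    [(volume : Measure V).IsAddHaarMeasure] {c : Sm V} {C : ℝ} (hC : 0 ≤ C)
    (u : TF V) (h : ∀ x, u x ≠ 0 → |c x| ≤ C) : ‖c • u‖ ≤ C * ‖u‖ := by
  have : ‖c • u‖ ≤ ‖C • u‖ := by
    refine norm_mono fun x => ?_
    rw [TF.sm_smul_apply, TF.smul_apply, abs_mul, abs_mul, abs_of_nonneg hC]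
    by_cases hx : u x = 0
    · simp [hx]
    · exact mul_le_mul_of_nonneg_right (h x hx) (abs_nonneg _)
  have e : ‖C • u‖ = C * ‖u‖ := by rw [norm_smul, Real.norm_eq_abs, abs_of_nonneg hC]
  rwa [e] at this

lemma Low.bound (hχ : UB N r χ) {k s : ℕ} {A : P → Module.End ℝ (TF (Pt n m))}
    (hA : A ∈ Low N r χ k s) :
    ∃ C, 0 ≤ C ∧ ∀ p u, ‖A p u‖ ≤ C * ∑ j ∈ Finset.range k, cac N r χ j p u := by
  have hS : ∀ p u, 0 ≤ ∑ j ∈ Finset.range k, cac N r χ j p u := fun p u =>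
    Finset.sum_nonneg fun _ _ => cac_nonneg _ _ _
  induction hA using Submodule.span_induction with
  | mem A h =>
    obtain ⟨d, γ, j, hd, h1, h2, rfl⟩ := h
    obtain ⟨C, hC, hb⟩ := (hd.mul (hχ.pow (j - γ.length))).bound
    refine ⟨C, hC, fun p u => ?_⟩
    have e : Mul (d p * χ p ^ j) (XT n m N γ u) =
        (d p * χ p ^ (j - γ.length)) • (χ p ^ γ.length • XT n m N γ u) := by
      rw [Mul_apply, smul_smul, mul_assoc, ← pow_add, Nat.sub_add_cancel (by omega)]
    rw [LinearMap.smul_apply, norm_smul, Module.End.mul_apply, e, norm_pow, Real.norm_eq_abs]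
    calc _ ≤ |r p| ^ γ.length * (C * ‖χ p ^ γ.length • XT n m N γ u‖) := by
          gcongr; exact norm_sm_smul_le hC _ fun x _ => hb p x
      _ = C * (|r p| ^ γ.length * ‖χ p ^ γ.length • XT n m N γ u‖) := by ring
      _ ≤ C * cac N r χ γ.length p u := mul_le_mul_of_nonneg_left (le_cac γ p u) hC
      _ ≤ _ := mul_le_mul_of_nonneg_left (Finset.single_le_sum
          (f := fun j => cac N r χ j p u) (fun _ _ => cac_nonneg _ _ _)
          (Finset.mem_range.2 h1)) hC
  | zero => exact ⟨0, le_rfl, fun p u => by simp⟩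
  | add A B _ _ hA hB =>
    obtain ⟨C, hC, hA⟩ := hA
    obtain ⟨D, hD, hB⟩ := hB
    refine ⟨C + D, by positivity, fun p u => ?_⟩
    rw [add_mul]
    exact (norm_add_le _ _).trans (add_le_add (hA p u) (hB p u))
  | smul c A _ hA =>
    obtain ⟨C, hC, hA⟩ := hA
    refine ⟨|c| * C, by positivity, fun p u => ?_⟩
    rw [Pi.smul_apply, LinearMap.smul_apply, norm_smul, mul_assoc]
    exact mul_le_mul_of_nonneg_left (hA p u) (abs_nonneg _)

variable (n m N) in
/-- The span of the words of length `k`. -/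
noncomputable def Wd (k : ℕ) : Submodule ℝ (Module.End ℝ (TF (Pt n m))) :=
  Submodule.span ℝ {A | ∃ β : List (XIdx n m N), β.length = k ∧ A = XT n m N β}

lemma XT_mem_Wd (β : List (XIdx n m N)) : XT n m N β ∈ Wd n m N β.length :=
  Submodule.subset_span ⟨β, rfl, rfl⟩

lemma XT_append (β γ : List (XIdx n m N)) : XT n m N (β ++ γ) = XT n m N β * XT n m N γ :=
  wT_append _ _ _

lemma Wd_mul {k l : ℕ} {A B : Module.End ℝ (TF (Pt n m))} (hA : A ∈ Wd n m N k)
    (hB : B ∈ Wd n m N l) : A * B ∈ Wd n m N (k + l) := by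
  have := Submodule.mul_mem_mul hA hB
  rw [Wd, Wd, Submodule.span_mul_span] at this
  refine Submodule.span_mono ?_ this
  rintro _ ⟨_, ⟨β, rfl, rfl⟩, _, ⟨γ, rfl, rfl⟩, rfl⟩
  exact ⟨β ++ γ, by simp, (XT_append β γ).symm⟩

lemma H_mem_Wd : H n m N ∈ Wd n m N 2 := by
  refine Submodule.neg_mem _ (Submodule.sum_mem _ fun i _ => Submodule.subset_span ⟨[i, i], rfl, ?_⟩)
  simp [XT, sq]

lemma H_pow_mem_Wd (K : ℕ) : H n m N ^ K ∈ Wd n m N (2 * K) := by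
  induction K with
  | zero => exact XT_mem_Wd []
  | succ K ih => rw [pow_succ, mul_add, mul_one]; exact Wd_mul ih H_mem_Wd

lemma Low.comm' (hχ : UB N r χ) {k : ℕ} {A : Module.End ℝ (TF (Pt n m))} (hA : A ∈ Wd n m N k)
    {M : ℕ} (hM : k ≤ M) :
    (fun p => r p ^ k • (A * Mul (χ p ^ M) - Mul (χ p ^ M) * A)) ∈ Low N r χ k (M - k) := by
  induction hA using Submodule.span_induction with
  | mem A h => obtain ⟨β, rfl, rfl⟩ := h; exact Low.comm hχ β hM
  | zero => simp only [zero_mul, mul_zero, sub_self, smul_zero]; exact Submodule.zero_mem _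
  | add A B _ _ hA hB =>
    convert Submodule.add_mem _ hA hB using 1
    funext p
    simp only [Pi.add_apply, ← smul_add, add_mul, mul_add]
    congr 1
    abel
  | smul c A _ hA =>
    convert Submodule.smul_mem _ c hA using 1
    funext p
    simp only [Pi.smul_apply, smul_mul_assoc, mul_smul_comm, ← smul_sub]
    rw [smul_comm]

lemma cac_interp (hχ : UB N r χ) (q : ℕ) : ∃ C, 0 ≤ C ∧ ∀ p u,
    cac N r χ (q + 1) p u ^ 2 ≤
      C * cac N r χ q p u * (cac N r χ (q + 2) p u + cac N r χ (q + 1) p u) := by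
  choose D hD0 hD using fun i => ((hχ.deriv i).const_smul (2 * q + 2 : ℝ)).bound
  set E := 1 + ∑ i, D i with hE
  have hDE : ∀ i, D i ≤ E := fun i =>
    (Finset.single_le_sum (fun i _ => hD0 i) (Finset.mem_univ i)).trans (by linarith)
  have hE1 : 1 ≤ E := by
    have : 0 ≤ ∑ i, D i := Finset.sum_nonneg fun i _ => hD0 i
    linarith
  set L : ℝ := (Fintype.card (Fin (q + 1) → XIdx n m N) : ℝ) with hL
  refine ⟨L * (L * E), by positivity, fun p u => ?_⟩
  set a := cac N r χ q p u with ha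
  set b := cac N r χ (q + 1) p u with hb
  set c := cac N r χ (q + 2) p u with hc
  have ha0 : 0 ≤ a := cac_nonneg _ _ _
  have hb0 : 0 ≤ b := cac_nonneg _ _ _
  have hc0 : 0 ≤ c := cac_nonneg _ _ _
  have key : ∀ β : List (XIdx n m N), β.length = q + 1 →
      (|r p| ^ (q + 1) * ‖χ p ^ (q + 1) • XT n m N β u‖) ^ 2 ≤ E * a * (c + b) := by
    intro β hβ
    obtain ⟨i, γ, rfl⟩ := List.exists_cons_of_length_eq_add_one hβ
    obtain rfl : γ.length = q := by simpa using hβ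
    set q := γ.length with hq
    set v := XT n m N γ u with hv
    set X := (XF n m N i).T with hX
    have h1 := le_cac (r := r) (χ := χ) (i :: i :: γ) p u
    have h2 := le_cac (r := r) (χ := χ) (i :: γ) p u
    have h3 := le_cac (r := r) (χ := χ) γ p u
    simp only [List.length_cons, ← hq, XT, wT_cons, Module.End.mul_apply] at h1 h2 h3
    change |r p| ^ (q + 2) * ‖χ p ^ (q + 2) • X (X v)‖ ≤ c at h1
    change |r p| ^ (q + 1) * ‖χ p ^ (q + 1) • X v‖ ≤ b at h2
    change |r p| ^ q * ‖χ p ^ q • v‖ ≤ a at h3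
    have e : ‖χ p ^ (q + 1) • X v‖ ^ 2 = -⟪χ p ^ (q + 2) • X (X v), χ p ^ q • v⟫_ℝ -
        ⟪((2 * q + 2 : ℝ) • (XF n m N i).S (χ p)) • (χ p ^ (q + 1) • X v), χ p ^ q • v⟫_ℝ := by
      have e1 : X (χ p ^ (2 * q + 1 + 1) • X v) = χ p ^ q • (χ p ^ (q + 2) • X (X v)) +
          χ p ^ q • (((2 * q + 2 : ℝ) • (XF n m N i).S (χ p)) • (χ p ^ (q + 1) • X v)) := by
        rw [hX, VF.T_smul, VF.S_pow]
        ext x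
        have h2 : (2 : Sm (Pt n m)) x = 2 := map_ofNat (Sm.eval x) 2
        simp [Sm.natCast_apply, h2]
        ring
      rw [← real_inner_self_eq_norm_sq, inner_smul_sm, smul_smul, ← pow_add,
        show q + 1 + (q + 1) = 2 * q + 1 + 1 by ring, hX, VF.inner_T (XF_divFree i), ← hX, e1,
        inner_add_right, ← inner_smul_sm, ← inner_smul_sm (χ p ^ q), real_inner_comm,
        real_inner_comm _ (χ p ^ q • v)]
      ring
    have k1 : |⟪χ p ^ (q + 2) • X (X v), χ p ^ q • v⟫_ℝ| ≤
        ‖χ p ^ (q + 2) • X (X v)‖ * ‖χ p ^ q • v‖ := abs_real_inner_le_norm _ _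
    have k2 := abs_real_inner_le_norm
      (((2 * q + 2 : ℝ) • (r p • (XF n m N i).S (χ p))) • (χ p ^ (q + 1) • X v)) (χ p ^ q • v)
    have k3 : ‖((2 * q + 2 : ℝ) • (r p • (XF n m N i).S (χ p))) • (χ p ^ (q + 1) • X v)‖ ≤
      D i * ‖χ p ^ (q + 1) • X v‖ := norm_sm_smul_le (hD0 i) _ fun x _ => hD i p x
    have k4 : |r p| * |⟪((2 * q + 2 : ℝ) • (XF n m N i).S (χ p)) • (χ p ^ (q + 1) • X v),
        χ p ^ q • v⟫_ℝ| ≤ D i * ‖χ p ^ (q + 1) • X v‖ * ‖χ p ^ q • v‖ := by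
      rw [← abs_mul, ← real_inner_smul_left,
        ← smul_assoc (r p) ((2 * q + 2 : ℝ) • (XF n m N i).S (χ p)), smul_comm (r p)]
      exact k2.trans (mul_le_mul_of_nonneg_right k3 (norm_nonneg _))
    set R := |r p| with hR
    have hR0 : 0 ≤ R := abs_nonneg _
    have k5 : ‖χ p ^ (q + 1) • X v‖ ^ 2 ≤ ‖χ p ^ (q + 2) • X (X v)‖ * ‖χ p ^ q • v‖ +
        |⟪((2 * q + 2 : ℝ) • (XF n m N i).S (χ p)) • (χ p ^ (q + 1) • X v), χ p ^ q • v⟫_ℝ| := by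
      rw [e]
      exact (add_le_add ((neg_le_abs _).trans k1) (neg_le_abs _)).trans_eq' (sub_eq_add_neg _ _)
    calc (R ^ (q + 1) * ‖χ p ^ (q + 1) • X v‖) ^ 2
        = R ^ (2 * q + 2) * ‖χ p ^ (q + 1) • X v‖ ^ 2 := by ring
      _ ≤ R ^ (2 * q + 2) * _ := mul_le_mul_of_nonneg_left k5 (by positivity)
      _ = (R ^ (q + 2) * ‖χ p ^ (q + 2) • X (X v)‖) * (R ^ q * ‖χ p ^ q • v‖) +
          R ^ (2 * q + 1) * (R * |⟪((2 * q + 2 : ℝ) • (XF n m N i).S (χ p)) •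
            (χ p ^ (q + 1) • X v), χ p ^ q • v⟫_ℝ|) := by ring
      _ ≤ (R ^ (q + 2) * ‖χ p ^ (q + 2) • X (X v)‖) * (R ^ q * ‖χ p ^ q • v‖) +
          R ^ (2 * q + 1) * (D i * ‖χ p ^ (q + 1) • X v‖ * ‖χ p ^ q • v‖) := by gcongr
      _ = (R ^ (q + 2) * ‖χ p ^ (q + 2) • X (X v)‖) * (R ^ q * ‖χ p ^ q • v‖) +
          D i * ((R ^ (q + 1) * ‖χ p ^ (q + 1) • X v‖) * (R ^ q * ‖χ p ^ q • v‖)) := by ring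
      _ ≤ c * a + E * (b * a) := by
          gcongr
          exact hDE i
      _ ≤ E * (c * a) + E * (b * a) :=
          add_le_add_left (le_mul_of_one_le_left (by positivity) hE1) _
      _ = E * a * (c + b) := by ring
  have : b ^ 2 ≤ L * (L * (E * a * (c + b))) := by
    have h := sq_sum_le_card_mul_sum_sq (s := Finset.univ) (f := fun γ : Fin (q + 1) → XIdx n m N =>
      |r p| ^ (q + 1) * ‖χ p ^ (q + 1) • XT n m N (List.ofFn γ) u‖)
    refine h.trans ?_
    rw [Finset.card_univ]
    refine mul_le_mul_of_nonneg_left ?_ (by positivity)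
    refine (Finset.sum_le_card_nsmul _ _ _ fun γ _ => key _ (by simp)).trans ?_
    simp [hL]
  linarith

lemma interp_numeric {C : ℝ} (hC : 0 ≤ C) (K : ℕ) : ∀ ε > 0, ∃ D, 0 ≤ D ∧ ∀ a : ℕ → ℝ,
    (∀ k, 0 ≤ a k) → (∀ k, k + 2 ≤ K → a (k + 1) ^ 2 ≤ C * a k * (a (k + 2) + a (k + 1))) →
    ∀ j < K, a j ≤ ε * a K + D * a 0 := by
  have step : ∀ ε > 0, ∃ D, 0 < D ∧ ∀ a b c : ℝ, 0 ≤ a → 0 ≤ b → 0 ≤ c →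
      b ^ 2 ≤ C * a * (c + b) → b ≤ ε * c + D * a := by
    intro ε hε
    refine ⟨C / ε + C + 1, by positivity, fun a b c ha hb hc h => ?_⟩
    by_contra! hlt
    have e : C / ε * ε = C := by field_simp
    have hCe : 0 ≤ C / ε := by positivity
    have h1 : 0 < b := lt_of_le_of_lt (by positivity) hlt
    have h2 : (C / ε + C + 1) * a < b := by nlinarith [mul_nonneg hε.le hc]
    have h3 : ε * c < b := by nlinarith [mul_nonneg (by positivity : 0 ≤ C / ε + C + 1) ha]
    have h4 : C * a * c ≤ C / ε * a * b := by
      calc C * a * c = (C / ε * a) * (ε * c) := by rw [← e]; ring_nf; field_simp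
        _ ≤ _ := mul_le_mul_of_nonneg_left h3.le (by positivity)
    nlinarith
  have claim : ∀ k, k + 1 ≤ K → ∀ ε > 0, ∃ D, 0 ≤ D ∧ ∀ a : ℕ → ℝ, (∀ k, 0 ≤ a k) →
      (∀ k, k + 2 ≤ K → a (k + 1) ^ 2 ≤ C * a k * (a (k + 2) + a (k + 1))) →
      a k ≤ ε * a (k + 1) + D * a 0 := by
    intro k
    induction k with
    | zero =>
      exact fun _ ε hε => ⟨1, zero_le_one, fun a ha _ => by nlinarith [ha 0, ha 1, mul_nonneg hε.le (ha 1)]⟩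
    | succ k ih =>
      intro hk ε hε
      obtain ⟨D', hD', h'⟩ := step (ε / 2) (by positivity)
      obtain ⟨D, hD, h⟩ := ih (by omega) (1 / (2 * D')) (by positivity)
      refine ⟨2 * D' * D, by positivity, fun a ha hi => ?_⟩
      have h1 := h' _ _ _ (ha k) (ha (k + 1)) (ha (k + 2)) (hi k hk)
      have h2 := mul_le_mul_of_nonneg_left (h a ha hi) hD'.le
      have e : D' * (1 / (2 * D') * a (k + 1) + D * a 0) = a (k + 1) / 2 + D' * D * a 0 := by
        field_simp
      rw [e] at h2
      change _ ≤ ε * a (k + 2) + _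
      linarith
  have main : ∀ d j, j + d + 1 = K → ∀ ε > 0, ∃ D, 0 ≤ D ∧ ∀ a : ℕ → ℝ, (∀ k, 0 ≤ a k) →
      (∀ k, k + 2 ≤ K → a (k + 1) ^ 2 ≤ C * a k * (a (k + 2) + a (k + 1))) →
      a j ≤ ε * a K + D * a 0 := by
    intro d
    induction d with
    | zero =>
      intro j hj ε hε
      subst hj
      exact claim j le_rfl ε hε
    | succ d ih =>
      intro j hj ε hε
      obtain ⟨D, hD, h⟩ := claim j (by omega) 1 one_pos
      obtain ⟨D', hD', h'⟩ := ih (j + 1) (by omega) ε hε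
      refine ⟨D + D', by positivity, fun a ha hi => ?_⟩
      linarith [h a ha hi, h' a ha hi]
  intro ε hε
  have : ∀ j : Fin K, ∃ D, 0 ≤ D ∧ ∀ a : ℕ → ℝ, (∀ k, 0 ≤ a k) →
      (∀ k, k + 2 ≤ K → a (k + 1) ^ 2 ≤ C * a k * (a (k + 2) + a (k + 1))) →
      a j ≤ ε * a K + D * a 0 := fun j => main (K - j - 1) j (by omega) ε hε
  choose D hD h using this
  refine ⟨∑ j, D j, Finset.sum_nonneg fun j _ => hD j, fun a ha hi j hj => ?_⟩
  refine (h ⟨j, hj⟩ a ha hi).trans ?_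
  gcongr
  · exact ha 0
  · exact Finset.single_le_sum (fun j _ => hD j) (Finset.mem_univ _)

/-- The interpolation inequality for the local seminorms. -/
theorem cac_le (hχ : UB N r χ) (K : ℕ) {ε : ℝ} (hε : 0 < ε) : ∃ D, 0 ≤ D ∧ ∀ p u, ∀ j < K,
    cac N r χ j p u ≤ ε * cac N r χ K p u + D * ‖u‖ := by
  choose C hC0 hC using fun q => cac_interp (N := N) hχ q
  have hS : 0 ≤ ∑ q ∈ Finset.range K, C q := Finset.sum_nonneg fun q _ => hC0 q
  obtain ⟨D, hD, h⟩ := interp_numeric hS K ε hε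
  refine ⟨D, hD, fun p u j hj => ?_⟩
  rw [← cac_zero (N := N) (r := r) (χ := χ) p u]
  refine h (fun j => cac N r χ j p u) (fun j => cac_nonneg _ _ _) (fun k hk => ?_) j hj
  refine (hC k p u).trans ?_
  have h1 := cac_nonneg (N := N) (r := r) (χ := χ) k p u
  have h2 := cac_nonneg (N := N) (r := r) (χ := χ) (k + 1) p u
  have h3 := cac_nonneg (N := N) (r := r) (χ := χ) (k + 2) p u
  gcongr
  exact Finset.single_le_sum (fun q _ => hC0 q) (Finset.mem_range.2 (by omega))

/-- The Caccioppoli inequality. -/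
theorem caccioppoli (hn : 1 ≤ n) (hm : 1 ≤ m) (hN : 1 ≤ N) (hχ : UB N r χ) (K : ℕ) :
    ∃ C, 0 ≤ C ∧ ∀ p u, cac N r χ (2 * K) p u ≤
      C * (|r p| ^ (2 * K) * ‖χ p ^ (2 * K) • (H n m N ^ K) u‖ + ‖u‖) := by
  choose A hA0 hA using fun γ : Fin (2 * K) → XIdx n m N =>
    norm_XT_le hn hm hN K (List.ofFn γ) (by simp)
  choose B hB0 hB using fun γ : Fin (2 * K) → XIdx n m N =>
    Low.bound hχ (Low.comm' hχ (k := 2 * K) (A := XT n m N (List.ofFn γ))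
      (by simpa using XT_mem_Wd (List.ofFn γ)) le_rfl)
  obtain ⟨E, hE0, hE⟩ := Low.bound hχ (Low.comm' hχ (H_pow_mem_Wd (n := n) (m := m) (N := N) K) le_rfl)
  set F : ℝ := ∑ γ, (A γ * E + B γ) with hF
  set G : ℝ := ∑ γ, A γ with hG
  have hF0 : 0 ≤ F := Finset.sum_nonneg fun γ _ => by have := hA0 γ; have := hB0 γ; positivity
  have hG0 : 0 ≤ G := Finset.sum_nonneg fun γ _ => hA0 γ
  obtain ⟨D, hD0, hD⟩ := cac_le (N := N) hχ (2 * K) (ε := 1 / (2 * (F * (2 * K) + 1))) (by positivity)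
  refine ⟨2 * (G + F * (2 * K) * D), by positivity, fun p u => ?_⟩
  set S := ∑ j ∈ Finset.range (2 * K), cac N r χ j p u with hS
  set R := |r p| with hR
  have hR0 : 0 ≤ R := abs_nonneg _
  set Y := R ^ (2 * K) * ‖χ p ^ (2 * K) • (H n m N ^ K) u‖ with hY
  have hH : R ^ (2 * K) * ‖(H n m N ^ K) (χ p ^ (2 * K) • u)‖ ≤ Y + E * S := by
    have h := hE p u
    simp only [LinearMap.smul_apply, LinearMap.sub_apply, Module.End.mul_apply, Mul_apply, norm_smul,
      norm_pow, Real.norm_eq_abs] at h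
    have h' := norm_le_norm_add_norm_sub' ((H n m N ^ K) (χ p ^ (2 * K) • u))
      (χ p ^ (2 * K) • (H n m N ^ K) u)
    nlinarith [mul_le_mul_of_nonneg_left h' (pow_nonneg hR0 (2 * K))]
  have h1 : cac N r χ (2 * K) p u ≤ G * Y + F * S := by
    rw [hG, hF, Finset.sum_mul, Finset.sum_mul, ← Finset.sum_add_distrib]
    refine Finset.sum_le_sum fun γ _ => ?_
    have h := hB γ p u
    simp only [LinearMap.smul_apply, LinearMap.sub_apply, Module.End.mul_apply, Mul_apply, norm_smul,
      norm_pow, Real.norm_eq_abs] at h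
    have h' := norm_le_norm_add_norm_sub (XT n m N (List.ofFn γ) (χ p ^ (2 * K) • u))
      (χ p ^ (2 * K) • XT n m N (List.ofFn γ) u)
    have h2 := mul_le_mul_of_nonneg_left h' (pow_nonneg hR0 (2 * K))
    have h3 := mul_le_mul_of_nonneg_left (hA γ (χ p ^ (2 * K) • u)) (pow_nonneg hR0 (2 * K))
    have h4 := mul_le_mul_of_nonneg_left hH (hA0 γ)
    nlinarith
  have h2 : S ≤ (2 * K) * (1 / (2 * (F * (2 * K) + 1)) * cac N r χ (2 * K) p u + D * ‖u‖) := by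
    refine (Finset.sum_le_card_nsmul _ _ _ fun j hj => hD p u j (Finset.mem_range.1 hj)).trans ?_
    simp [mul_add]
  have h3 := mul_le_mul_of_nonneg_left h2 hF0
  have h4 : F * (2 * K) * (1 / (2 * (F * (2 * K) + 1))) ≤ 1 / 2 := by
    rw [mul_one_div, div_le_div_iff₀ (by positivity) (by positivity)]
    linarith
  have h5 := mul_le_mul_of_nonneg_right h4 (cac_nonneg (N := N) (r := r) (χ := χ) (2 * K) p u)
  have hY0 : 0 ≤ Y := by positivity
  have h6 : 0 ≤ F * (2 * K) * D * Y := by positivity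
  have h7 : 0 ≤ G * ‖u‖ := by positivity
  linarith

end Families

section Boxes
variable {n m : ℕ} {N : ℕ}

/-- The vertical size of the box of radius `r` around `z`. -/
noncomputable def ρ (N : ℕ) (z : Pt n m) (r : ℝ) : ℝ := r * (r + ‖z.1‖) ^ N

/-- The anisotropic boxes adapted to the Gru\v{s}in operator. -/
def Bx (N : ℕ) (z : Pt n m) (r : ℝ) : Set (Pt n m) := Metric.ball z.1 r ×ˢ Metric.ball z.2 (ρ N z r)

lemma mem_Bx {z w : Pt n m} {r : ℝ} : w ∈ Bx N z r ↔ ‖w.1 - z.1‖ < r ∧ ‖w.2 - z.2‖ < ρ N z r := by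
  simp [Bx, Set.mem_prod, dist_eq_norm]

lemma ρ_pos (z : Pt n m) {r : ℝ} (hr : 0 < r) : 0 < ρ N z r := by unfold ρ; positivity

lemma ρ_mono (z : Pt n m) {r s : ℝ} (hr : 0 < r) (h : r ≤ s) : ρ N z r ≤ ρ N z s := by
  have : 0 < s := hr.trans_le h
  unfold ρ; gcongr

lemma Bx_mono (z : Pt n m) {r s : ℝ} (hr : 0 < r) (h : r ≤ s) : Bx N z r ⊆ Bx N z s := fun _ hw =>
  mem_Bx.2 ⟨(mem_Bx.1 hw).1.trans_le h, (mem_Bx.1 hw).2.trans_le (ρ_mono z hr h)⟩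

lemma self_mem_Bx (z : Pt n m) {r : ℝ} (hr : 0 < r) : z ∈ Bx N z r :=
  mem_Bx.2 ⟨by simpa using hr, by simpa using ρ_pos z hr⟩

lemma isOpen_Bx (z : Pt n m) (r : ℝ) : IsOpen (Bx N z r) := Metric.isOpen_ball.prod Metric.isOpen_ball

lemma measurableSet_Bx (z : Pt n m) (r : ℝ) : MeasurableSet (Bx N z r) := (isOpen_Bx z r).measurableSet

lemma volume_Bx (z : Pt n m) {r : ℝ} (hr : 0 < r) :
    volume (Bx N z r) = ENNReal.ofReal ((2 * r) ^ n * (2 * ρ N z r) ^ m) := by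
  rw [Bx, Measure.volume_eq_prod, Measure.prod_prod, Real.volume_pi_ball _ hr,
    Real.volume_pi_ball _ (ρ_pos z hr), ENNReal.ofReal_mul (by positivity)]
  simp

lemma volume_Bx_pos (z : Pt n m) {r : ℝ} (hr : 0 < r) : 0 < volume (Bx N z r) := by
  have := ρ_pos (N := N) z hr
  rw [volume_Bx z hr]; exact ENNReal.ofReal_pos.2 (by positivity)

lemma volume_Bx_lt_top (z : Pt n m) {r : ℝ} (hr : 0 < r) : volume (Bx N z r) < ⊤ := by
  rw [volume_Bx z hr]; exact ENNReal.ofReal_lt_top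

lemma volume_Bx_scale (z : Pt n m) {r t : ℝ} (hr : 0 < r) (ht : 1 ≤ t) :
    volume (Bx N z (t * r)) ≤ ENNReal.ofReal (t ^ n * (t ^ (N + 1)) ^ m) * volume (Bx N z r) := by
  have h1 : ρ N z (t * r) ≤ t ^ (N + 1) * ρ N z r := by
    have : t * r + ‖z.1‖ ≤ t * (r + ‖z.1‖) := by nlinarith [norm_nonneg z.1]
    calc ρ N z (t * r) = t * r * (t * r + ‖z.1‖) ^ N := rfl
      _ ≤ t * r * (t * (r + ‖z.1‖)) ^ N := by gcongr
      _ = _ := by rw [ρ, mul_pow]; ring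
  have h0 := ρ_pos (N := N) z (r := t * r) (by positivity)
  have h0' := ρ_pos (N := N) z hr
  rw [volume_Bx z (by positivity), volume_Bx z hr, ← ENNReal.ofReal_mul (by positivity)]
  refine ENNReal.ofReal_le_ofReal ?_
  calc _ ≤ (2 * (t * r)) ^ n * (2 * (t ^ (N + 1) * ρ N z r)) ^ m := by gcongr
    _ = _ := by simp only [mul_pow]; ring

lemma Bx_engulf {z z' : Pt n m} {r r' : ℝ} (hr : 0 < r) (hr' : 0 < r') (h : r' ≤ 2 * r)
    (hne : (Bx N z r ∩ Bx N z' r').Nonempty) : Bx N z' r' ⊆ Bx N z (5 * r) := by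
  obtain ⟨w, hw, hw'⟩ := hne
  rw [mem_Bx] at hw hw'
  have a1 : ‖z'.1 - z.1‖ < r + r' := by
    calc ‖z'.1 - z.1‖ = ‖(w.1 - z.1) - (w.1 - z'.1)‖ := by congr 1; abel
      _ ≤ _ := norm_sub_le _ _
      _ < _ := add_lt_add hw.1 hw'.1
  have a2 : ‖z'.1‖ ≤ ‖z.1‖ + ‖z'.1 - z.1‖ := by
    simpa using norm_add_le z.1 (z'.1 - z.1)
  have h1 : ρ N z' r' ≤ 2 * r * (5 * r + ‖z.1‖) ^ N := by
    unfold ρ; gcongr ?_ * ?_ ^ N; linarith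
  have h2 : ρ N z r ≤ r * (5 * r + ‖z.1‖) ^ N := by unfold ρ; gcongr; linarith
  intro v hv
  rw [mem_Bx] at hv ⊢
  constructor
  · calc ‖v.1 - z.1‖ = ‖(v.1 - z'.1) + (z'.1 - z.1)‖ := by congr 1; abel
      _ ≤ _ := norm_add_le _ _
      _ < r' + (r + r') := add_lt_add hv.1 a1
      _ ≤ _ := by linarith
  · calc ‖v.2 - z.2‖ = ‖(v.2 - z'.2) - (w.2 - z'.2) + (w.2 - z.2)‖ := by congr 1; abel
      _ ≤ ‖v.2 - z'.2‖ + ‖w.2 - z'.2‖ + ‖w.2 - z.2‖ :=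
        (norm_add_le _ _).trans (add_le_add_left (norm_sub_le _ _) _)
      _ < ρ N z' r' + ρ N z' r' + ρ N z r := add_lt_add (add_lt_add hv.2 hw'.2) hw.2
      _ ≤ 5 * r * (5 * r + ‖z.1‖) ^ N := by linarith
      _ = _ := rfl

lemma le_volume_Bx (hn : 1 ≤ n) (z : Pt n m) {r : ℝ} (hr : 1 ≤ r) :
    ENNReal.ofReal r ≤ volume (Bx N z r) := by
  rw [volume_Bx z (by linarith)]
  refine ENNReal.ofReal_le_ofReal ?_
  have h1 : 1 ≤ ρ N z r := one_le_mul_of_one_le_of_one_le hr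
    (one_le_pow₀ (by linarith [norm_nonneg z.1]))
  have h2 : r ≤ (2 * r) ^ n := by
    calc r ≤ 2 * r := by linarith
      _ ≤ _ := le_self_pow₀ (by linarith) (by omega)
  calc r ≤ (2 * r) ^ n := h2
    _ ≤ _ := le_mul_of_one_le_right (by positivity) (one_le_pow₀ (by linarith))

/-- A stopping radius for the averages of `g` at height `L`. -/
lemma exists_stopping (hn : 1 ≤ n) {g : Pt n m → ℝ≥0∞} (hg : Continuous g) {L : ℝ≥0∞}
    (hL : 0 < L) (hL' : L < ⊤) (hi : ∫⁻ x, g x < ⊤) {z : Pt n m} (hz : L < g z) :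
    ∃ r, 0 < r ∧ r ≤ max 1 ((∫⁻ x, g x) / L).toReal ∧
      L * volume (Bx N z r) < ∫⁻ x in Bx N z r, g x ∧
      ∀ r', 2 * r ≤ r' → ∫⁻ x in Bx N z r', g x ≤ L * volume (Bx N z r') := by
  set S := {r : ℝ | 0 < r ∧ L * volume (Bx N z r) < ∫⁻ x in Bx N z r, g x} with hS
  set Q := max 1 ((∫⁻ x, g x) / L).toReal with hQ
  have hfin : (∫⁻ x, g x) / L ≠ ⊤ := (ENNReal.div_lt_top hi.ne hL.ne').ne
  have hb : ∀ r ∈ S, r ≤ Q := by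
    rintro r ⟨hr, h⟩
    by_contra! hlt
    have h1 : 1 ≤ r := (le_max_left _ _).trans hlt.le
    have h2 : L * volume (Bx N z r) ≤ ∫⁻ x, g x := h.le.trans (setLIntegral_le_lintegral _ _)
    have h3 : volume (Bx N z r) ≤ (∫⁻ x, g x) / L := by
      rw [ENNReal.le_div_iff_mul_le (Or.inl hL.ne') (Or.inl hL'.ne), mul_comm]; exact h2
    have h4 := (le_volume_Bx hn z h1).trans h3
    rw [ENNReal.ofReal_le_iff_le_toReal hfin] at h4
    exact absurd (h4.trans (le_max_right 1 _)) (not_le.2 hlt)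
  have hne : S.Nonempty := by
    obtain ⟨L', hL1, hL2⟩ := exists_between hz
    have hopen : IsOpen {w | L' < g w} := isOpen_lt continuous_const hg
    obtain ⟨ε, hε, hball⟩ := Metric.isOpen_iff.1 hopen z hL2
    obtain ⟨r, hr0, hr1, hr2⟩ : ∃ r : ℝ, 0 < r ∧ r < ε ∧ ρ N z r < ε := by
      have hc : Filter.Tendsto (fun r : ℝ => ρ N z r) (nhdsWithin 0 (Set.Ioi 0)) (nhds 0) := by
        have : Continuous fun r : ℝ => ρ N z r := by unfold ρ; fun_prop
        have h := this.tendsto 0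
        simp only [ρ, zero_mul] at h
        exact h.mono_left nhdsWithin_le_nhds
      have h1 : ∀ᶠ r : ℝ in nhdsWithin 0 (Set.Ioi 0), r < ε :=
        (Filter.tendsto_id.mono_left nhdsWithin_le_nhds).eventually (gt_mem_nhds hε)
      obtain ⟨r, ⟨h1, h2⟩, h3⟩ := ((h1.and (hc.eventually (gt_mem_nhds hε))).and
        self_mem_nhdsWithin).exists
      exact ⟨r, h3, h1, h2⟩
    refine ⟨r, hr0, ?_⟩
    have hsub : ∀ w ∈ Bx N z r, L' ≤ g w := fun w hw => by
      refine le_of_lt (hball ?_)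
      rw [Metric.mem_ball, dist_eq_norm, Prod.norm_def]
      exact max_lt ((mem_Bx.1 hw).1.trans hr1) ((mem_Bx.1 hw).2.trans hr2)
    calc L * volume (Bx N z r) < L' * volume (Bx N z r) :=
          ENNReal.mul_lt_mul_left (volume_Bx_pos z hr0).ne' (volume_Bx_lt_top z hr0).ne hL1
      _ = ∫⁻ x in Bx N z r, L' := by simp
      _ ≤ _ := setLIntegral_mono' (measurableSet_Bx z r) hsub
  have hbdd : BddAbove S := ⟨Q, hb⟩
  obtain ⟨s, hs⟩ := hne
  have hsup : 0 < sSup S := hs.1.trans_le (le_csSup hbdd hs)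
  obtain ⟨r, hr, hlt⟩ := exists_lt_of_lt_csSup ⟨s, hs⟩ (half_lt_self hsup)
  refine ⟨r, hr.1, hb r hr, hr.2, fun r' h' => ?_⟩
  by_contra! hcon
  have := le_csSup hbdd (show r' ∈ S from ⟨by linarith [hr.1], hcon⟩)
  linarith

end Boxes

section RealVar
variable {n m : ℕ} {N : ℕ}

/-- On every box `u` is, up to an error controlled by the averages of `b²`, a function of controlled
oscillation. -/
def OscHyp (N : ℕ) (A : ℝ) (u b : Pt n m → ℝ) : Prop :=
  ∀ (z : Pt n m) (r η : ℝ), 0 < r → 0 < η →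
    (∀ r', r ≤ r' → ∫⁻ x in Bx N z r', ENNReal.ofReal (b x ^ 2) ≤
      ENNReal.ofReal (η ^ 2) * volume (Bx N z r')) →
    ∃ w : Pt n m → ℝ, Continuous w ∧ ∫⁻ x in Bx N z r, ENNReal.ofReal ((u x - w x) ^ 2) ≤
      ENNReal.ofReal (A * η ^ 2) * volume (Bx N z r) ∧
      ∀ z₁ ∈ Bx N z r, ∀ z₂ ∈ Bx N z r, |w z₁ - w z₂| ^ 2 ≤ A * η ^ 2

variable {A : ℝ} {u b : Pt n m → ℝ} {δ l : ℝ}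

lemma OscHyp.meas_Bx_le (hA : 0 ≤ A) (h : OscHyp N A u b) (hu : Continuous u)
    (hδ : 0 < δ) (hAδ : A * δ ≤ 1 / 2) (hl : 0 < l) {z : Pt n m} {R : ℝ} (hR : 0 < R)
    (hav : ∀ r', R ≤ r' → ∫⁻ x in Bx N z r', ENNReal.ofReal (u x ^ 2 + b x ^ 2 / δ) ≤
      ENNReal.ofReal l * volume (Bx N z r')) :
    volume ({x | 16 * l < u x ^ 2} ∩ Bx N z R) ≤ ENNReal.ofReal (A * δ) * volume (Bx N z R) := by
  have hη : (√(δ * l)) ^ 2 = δ * l := Real.sq_sqrt (by positivity)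
  obtain ⟨w, hwc, h1, h2⟩ := h z R (√(δ * l)) hR (by positivity) (fun r' hr' => by
    rw [hη, ENNReal.ofReal_mul hδ.le, mul_assoc]
    refine le_trans ?_ (mul_le_mul_right (hav r' hr') _)
    rw [← lintegral_const_mul' _ _ ENNReal.ofReal_ne_top]
    refine lintegral_mono fun x => ?_
    rw [← ENNReal.ofReal_mul hδ.le]
    refine ENNReal.ofReal_le_ofReal ?_
    rw [mul_add, mul_div_cancel₀ _ hδ.ne']
    nlinarith [mul_nonneg hδ.le (sq_nonneg (u x))])
  rw [hη] at h1 h2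
  set V := volume (Bx N z R) with hV
  have hV0 : V ≠ 0 := (volume_Bx_pos z hR).ne'
  have hV1 : V ≠ ⊤ := (volume_Bx_lt_top z hR).ne
  have hu2 : ∫⁻ x in Bx N z R, ENNReal.ofReal (u x ^ 2) ≤ ENNReal.ofReal l * V :=
    (lintegral_mono fun x => ENNReal.ofReal_le_ofReal (by
      have : 0 ≤ b x ^ 2 / δ := by positivity
      linarith)).trans (hav R le_rfl)
  obtain ⟨z₁, hz₁, hw₁⟩ : ∃ z₁ ∈ Bx N z R, w z₁ ^ 2 ≤ 4 * l := by
    by_contra! hcon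
    have e1 : ENNReal.ofReal (4 * l) * V ≤ ∫⁻ x in Bx N z R, ENNReal.ofReal (w x ^ 2) := by
      calc _ = ∫⁻ x in Bx N z R, ENNReal.ofReal (4 * l) := by simp [hV]
        _ ≤ _ := setLIntegral_mono' (measurableSet_Bx z R) fun x hx =>
          ENNReal.ofReal_le_ofReal (hcon x hx).le
    have e2 : ∫⁻ x in Bx N z R, ENNReal.ofReal (w x ^ 2) ≤ ENNReal.ofReal (3 * l) * V := by
      calc _ ≤ ∫⁻ x in Bx N z R, (ENNReal.ofReal 2 * ENNReal.ofReal (u x ^ 2) +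
            ENNReal.ofReal 2 * ENNReal.ofReal ((u x - w x) ^ 2)) := by
            refine lintegral_mono fun x => ?_
            rw [← ENNReal.ofReal_mul (by norm_num), ← ENNReal.ofReal_mul (by norm_num),
              ← ENNReal.ofReal_add (by positivity) (by positivity)]
            exact ENNReal.ofReal_le_ofReal (by nlinarith [sq_nonneg (u x + (u x - w x))])
        _ = ENNReal.ofReal 2 * (∫⁻ x in Bx N z R, ENNReal.ofReal (u x ^ 2)) +
            ENNReal.ofReal 2 * ∫⁻ x in Bx N z R, ENNReal.ofReal ((u x - w x) ^ 2) := by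
            rw [lintegral_add_left (by fun_prop), lintegral_const_mul' _ _ ENNReal.ofReal_ne_top,
              lintegral_const_mul' _ _ ENNReal.ofReal_ne_top]
        _ ≤ ENNReal.ofReal 2 * (ENNReal.ofReal l * V) +
            ENNReal.ofReal 2 * (ENNReal.ofReal (A * (δ * l)) * V) := by gcongr
        _ = ENNReal.ofReal (2 * l + 2 * (A * (δ * l))) * V := by
            rw [ENNReal.ofReal_add (by positivity) (by positivity),
              ENNReal.ofReal_mul (q := l) (by norm_num),
              ENNReal.ofReal_mul (q := A * (δ * l)) (by norm_num)]
            ring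
        _ ≤ _ := by
            gcongr
            nlinarith
    have e3 := e1.trans e2
    rw [ENNReal.mul_le_mul_iff_left hV0 hV1, ENNReal.ofReal_le_ofReal_iff (by positivity)] at e3
    linarith
  have hw : ∀ x ∈ Bx N z R, |w x| ≤ 3 * √l := by
    intro x hx
    have hs : √l ^ 2 = l := Real.sq_sqrt hl.le
    have f1 : |w z₁| ≤ 2 * √l := abs_le_of_sq_le_sq (by nlinarith) (by positivity)
    have f2 : |w x - w z₁| ≤ √l := by
      have := h2 x hx z₁ hz₁
      rw [sq_abs] at this
      exact abs_le_of_sq_le_sq (by nlinarith) (by positivity)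
    calc |w x| = |(w x - w z₁) + w z₁| := by congr 1; ring
      _ ≤ _ := abs_add_le _ _
      _ ≤ _ := by linarith
  have hsub : {x | 16 * l < u x ^ 2} ∩ Bx N z R ⊆
      {x | ENNReal.ofReal l ≤ ENNReal.ofReal ((u x - w x) ^ 2)} ∩ Bx N z R := by
    rintro x ⟨hx, hxB⟩
    refine ⟨ENNReal.ofReal_le_ofReal ?_, hxB⟩
    have hs : √l ^ 2 = l := Real.sq_sqrt hl.le
    have hs0 : 0 < √l := by positivity
    have f1 : 4 * √l < |u x| := by
      rw [← abs_of_pos (show 0 < 4 * √l by positivity)]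
      refine sq_lt_sq.1 ?_
      have : 16 * l < u x ^ 2 := hx
      nlinarith
    have f2 : √l ≤ |u x - w x| := by
      have := abs_sub_abs_le_abs_sub (u x) (w x)
      linarith [hw x hxB]
    rw [← hs, ← sq_abs (u x - w x)]
    gcongr
  have hmk := mul_meas_ge_le_lintegral (μ := volume.restrict (Bx N z R))
    (f := fun x => ENNReal.ofReal ((u x - w x) ^ 2)) (by fun_prop) (ENNReal.ofReal l)
  rw [Measure.restrict_apply' (measurableSet_Bx z R)] at hmk
  have hl0 : ENNReal.ofReal l ≠ 0 := (ENNReal.ofReal_pos.2 hl).ne'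
  refine (measure_mono hsub).trans ?_
  rw [← ENNReal.mul_le_mul_iff_right hl0 ENNReal.ofReal_ne_top, ← mul_assoc,
    ← ENNReal.ofReal_mul hl.le]
  refine hmk.trans (h1.trans (le_of_eq ?_))
  congr 2
  ring

/-- The good-`λ` inequality. -/
lemma OscHyp.meas_le (hn : 1 ≤ n) (hA : 0 ≤ A) (h : OscHyp N A u b) (hu : Continuous u)
    (hb : Continuous b) (hi : ∫⁻ x, ENNReal.ofReal (u x ^ 2 + b x ^ 2 / δ) < ⊤)
    (hδ : 0 < δ) (hAδ : A * δ ≤ 1 / 2) (hl : 0 < l) :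
    volume {x | 16 * l < u x ^ 2} ≤
      ENNReal.ofReal (2 * (A * δ) * (5 ^ n * (5 ^ (N + 1)) ^ m) / l) *
        ∫⁻ x in {x | l / 2 < u x ^ 2 + b x ^ 2 / δ}, ENNReal.ofReal (u x ^ 2 + b x ^ 2 / δ) := by
  set G : Pt n m → ℝ := fun x => u x ^ 2 + b x ^ 2 / δ with hG
  have hGc : Continuous G := by fun_prop
  have hG0 : ∀ x, 0 ≤ G x := fun x => by positivity
  set g : Pt n m → ℝ≥0∞ := fun x => ENNReal.ofReal (G x) with hg
  have hgc : Continuous g := ENNReal.continuous_ofReal.comp hGc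
  set L := ENNReal.ofReal l with hL
  have hL0 : 0 < L := ENNReal.ofReal_pos.2 hl
  have hLt : L < ⊤ := ENNReal.ofReal_lt_top
  have hst : ∀ z : {z : Pt n m // L < g z}, _ := fun z => exists_stopping (N := N) hn hgc hL0 hLt hi z.2
  choose r hr0 hrQ hr1 hr2 using hst
  obtain ⟨U, -, hdis, hcov⟩ := Vitali.exists_disjoint_subfamily_covering_enlargement
    (fun z : {z : Pt n m // L < g z} => Bx N z.1 (r z)) Set.univ r 2 (by norm_num)
    (fun z _ => (hr0 z).le) _ (fun z _ => hrQ z) (fun z _ => ⟨z.1, self_mem_Bx _ (hr0 z)⟩)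
  have hUc : U.Countable := hdis.countable_of_isOpen (fun z _ => isOpen_Bx _ _)
    (fun z _ => ⟨z.1, self_mem_Bx _ (hr0 z)⟩)
  have hsub : {x | 16 * l < u x ^ 2} ⊆
      ⋃ z ∈ U, {x | 16 * l < u x ^ 2} ∩ Bx N z.1 (5 * r z) := by
    intro x hx
    have hx' : 16 * l < u x ^ 2 := hx
    have hgx : L < g x := by
      refine (ENNReal.ofReal_lt_ofReal_iff_of_nonneg hl.le).2 ?_
      have : 0 ≤ b x ^ 2 / δ := by positivity
      change l < u x ^ 2 + b x ^ 2 / δ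
      linarith
    obtain ⟨z, hzU, hne, hle⟩ := hcov ⟨x, hgx⟩ (Set.mem_univ _)
    rw [Set.inter_comm] at hne
    exact Set.mem_biUnion hzU ⟨hx, Bx_engulf (hr0 z) (hr0 _) hle hne (self_mem_Bx x (hr0 ⟨x, hgx⟩))⟩
  set S := {x | l / 2 < G x} with hS
  have hSm : MeasurableSet S := (isOpen_lt continuous_const hGc).measurableSet
  have hball : ∀ z, volume (Bx N z.1 (r z)) ≤ ENNReal.ofReal (2 / l) * ∫⁻ x in S ∩ Bx N z.1 (r z), g x := by
    intro z
    set B := Bx N z.1 (r z) with hB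
    set V := volume B with hV
    have hV1 : V ≠ ⊤ := (volume_Bx_lt_top z.1 (hr0 z)).ne
    have e1 : ∫⁻ x in B, g x ≤ (∫⁻ x in S ∩ B, g x) + ENNReal.ofReal (l / 2) * V := by
      rw [← lintegral_inter_add_sdiff g B hSm, Set.inter_comm]
      gcongr
      calc ∫⁻ x in B \ S, g x ≤ ∫⁻ x in B \ S, ENNReal.ofReal (l / 2) :=
            setLIntegral_mono' ((measurableSet_Bx _ _).diff hSm) fun x hx =>
              ENNReal.ofReal_le_ofReal (not_lt.1 hx.2)
        _ ≤ _ := by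
            rw [lintegral_const, Measure.restrict_apply_univ]
            gcongr
            exact measure_mono Set.sdiff_subset
    have e2 : ENNReal.ofReal (l / 2) * V + ENNReal.ofReal (l / 2) * V ≤
        (∫⁻ x in S ∩ B, g x) + ENNReal.ofReal (l / 2) * V := by
      refine le_trans (le_of_eq ?_) ((hr1 z).le.trans e1)
      rw [← add_mul, ← ENNReal.ofReal_add (by positivity) (by positivity), add_halves]
    have e3 := (ENNReal.add_le_add_iff_right (ENNReal.mul_ne_top ENNReal.ofReal_ne_top hV1)).1 e2
    calc V = ENNReal.ofReal (2 / l) * (ENNReal.ofReal (l / 2) * V) := by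
          rw [← mul_assoc, ← ENNReal.ofReal_mul (by positivity)]
          field_simp
          simp
      _ ≤ _ := by gcongr
  calc volume {x | 16 * l < u x ^ 2}
      ≤ ∑' z : U, volume ({x | 16 * l < u x ^ 2} ∩ Bx N z.1.1 (5 * r z)) :=
        (measure_mono hsub).trans (measure_biUnion_le _ hUc _)
    _ ≤ ∑' z : U, ENNReal.ofReal (2 * (A * δ) * (5 ^ n * (5 ^ (N + 1)) ^ m) / l) *
        ∫⁻ x in S ∩ Bx N z.1.1 (r z), g x := by
        refine ENNReal.tsum_le_tsum fun z => ?_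
        have h5 : 0 < 5 * r z := by linarith [hr0 z.1]
        refine (h.meas_Bx_le hA hu hδ hAδ hl h5 fun r' hr' =>
          hr2 z.1 r' (by linarith [hr0 z.1])).trans ?_
        calc _ ≤ ENNReal.ofReal (A * δ) * (ENNReal.ofReal (5 ^ n * (5 ^ (N + 1)) ^ m) *
              (ENNReal.ofReal (2 / l) * ∫⁻ x in S ∩ Bx N z.1.1 (r z), g x)) := by
              gcongr
              exact (volume_Bx_scale z.1.1 (hr0 z.1) (by norm_num)).trans (by gcongr; exact hball z.1)
          _ = _ := by
              rw [← mul_assoc, ← mul_assoc, ← ENNReal.ofReal_mul (by positivity),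
                ← ENNReal.ofReal_mul (by positivity)]
              congr 2
              ring
    _ = _ * ∑' z : U, ∫⁻ x in S ∩ Bx N z.1.1 (r z), g x := ENNReal.tsum_mul_left
    _ ≤ _ := by
        gcongr
        have := hUc.to_subtype
        rw [← lintegral_iUnion (fun z : U => hSm.inter (measurableSet_Bx _ _))
          (fun z z' hne => ((hdis z.2 z'.2 (fun e => hne (Subtype.ext e))).mono
            Set.inter_subset_right Set.inter_subset_right))]
        exact lintegral_mono_set (Set.iUnion_subset fun z => Set.inter_subset_left)

lemma add_rpow_le {a b t : ℝ} (ha : 0 ≤ a) (hb : 0 ≤ b) (ht : 0 ≤ t) :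
    (a + b) ^ t ≤ 2 ^ t * (a ^ t + b ^ t) := by
  have h1 := Real.rpow_nonneg ha t
  have h2 := Real.rpow_nonneg hb t
  rcases le_total a b with h | h
  · calc (a + b) ^ t ≤ (2 * b) ^ t := Real.rpow_le_rpow (by positivity) (by linarith) ht
      _ = 2 ^ t * b ^ t := Real.mul_rpow (by norm_num) hb
      _ ≤ _ := by gcongr; linarith
  · calc (a + b) ^ t ≤ (2 * a) ^ t := Real.rpow_le_rpow (by positivity) (by linarith) ht
      _ = 2 ^ t * a ^ t := Real.mul_rpow (by norm_num) ha
      _ ≤ _ := by gcongr; linarith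

/-- The oscillation hypothesis implies an `L_q` bound for `q = 2 t > 2`. -/
theorem OscHyp.lintegral_le (hn : 1 ≤ n) (hA : 0 ≤ A) {t : ℝ} (ht : 1 < t) :
    ∃ C : ℝ, 0 ≤ C ∧ ∀ u b : Pt n m → ℝ, OscHyp N A u b → Continuous u → Continuous b →
      HasCompactSupport b → (∃ M, ∀ x, |u x| ≤ M) → ∫⁻ x, ENNReal.ofReal (u x ^ 2) < ⊤ →
      ∫⁻ x, ENNReal.ofReal ((u x ^ 2) ^ t) ≤
        ENNReal.ofReal C * ∫⁻ x, ENNReal.ofReal ((b x ^ 2) ^ t) := by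
  set D : ℝ := 5 ^ n * (5 ^ (N + 1)) ^ m with hD
  have ht1 : 0 < t - 1 := by linarith
  set κ : ℝ := t * (2 * A * D) / (t - 1) * 2 ^ (t - 1) * 2 ^ t with hκ
  have hκ0 : 0 ≤ κ := by positivity
  set e : ℝ := (16 ^ t)⁻¹ with he
  have he0 : 0 < e := by positivity
  have he1 : e ≤ 1 := inv_le_one_of_one_le₀ (Real.one_le_rpow (by norm_num) (by linarith))
  set δ : ℝ := e / (2 * (κ + 1) * (A + 1)) with hδ
  have hδ0 : 0 < δ := by positivity
  have hAδ : A * δ ≤ 1 / 2 := by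
    rw [hδ, mul_div_assoc', div_le_div_iff₀ (by positivity) (by positivity)]
    nlinarith [mul_nonneg hκ0 hA]
  have hκδ : κ * δ ≤ e / 2 := by
    rw [hδ, mul_div_assoc', div_le_div_iff₀ (by positivity) (by positivity)]
    nlinarith [mul_nonneg hκ0 hA, mul_nonneg he0.le (mul_nonneg hκ0 hA), mul_nonneg he0.le hκ0,
      mul_nonneg he0.le hA]
  refine ⟨(δ ^ t)⁻¹, by positivity, fun u b h hu hb hbs ⟨M, hM⟩ hu2 => ?_⟩
  set G : Pt n m → ℝ := fun x => u x ^ 2 + b x ^ 2 / δ with hG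
  have hGc : Continuous G := by fun_prop
  have hG0 : ∀ x, 0 ≤ G x := fun x => by positivity
  set g : Pt n m → ℝ≥0∞ := fun x => ENNReal.ofReal (G x) with hg
  have hgm : Measurable g := by fun_prop
  have hi : ∫⁻ x, g x < ⊤ := by
    have hbi : Integrable (fun x => b x ^ 2 / δ) := by
      refine Continuous.integrable_of_hasCompactSupport (by fun_prop) ?_
      exact hbs.mono fun x hx => by
        rw [Function.mem_support] at hx ⊢
        contrapose! hx
        simp [hx]
    have : ∀ x, g x = ENNReal.ofReal (u x ^ 2) + ENNReal.ofReal (b x ^ 2 / δ) := fun x =>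
      ENNReal.ofReal_add (by positivity) (by positivity)
    simp only [this]
    rw [lintegral_add_left (by fun_prop)]
    exact ENNReal.add_lt_top.2 ⟨hu2, hbi.lintegral_lt_top⟩
  set I := ∫⁻ x, ENNReal.ofReal ((u x ^ 2) ^ t) with hI
  set J := ∫⁻ x, ENNReal.ofReal ((b x ^ 2) ^ t) with hJ
  have hIf : I ≠ ⊤ := by
    refine ne_of_lt (lt_of_le_of_lt (b := ENNReal.ofReal ((M ^ 2) ^ (t - 1)) *
      ∫⁻ x, ENNReal.ofReal (u x ^ 2)) ?_ (ENNReal.mul_lt_top ENNReal.ofReal_lt_top hu2))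
    rw [← lintegral_const_mul' _ _ ENNReal.ofReal_ne_top]
    refine lintegral_mono fun x => ?_
    rw [← ENNReal.ofReal_mul (by positivity)]
    refine ENNReal.ofReal_le_ofReal ?_
    have h1 : u x ^ 2 ≤ M ^ 2 := by
      rw [← sq_abs (u x)]
      have := hM x
      gcongr
    rcases (sq_nonneg (u x)).eq_or_lt with h0 | h0
    · rw [← h0, Real.zero_rpow (by linarith), mul_zero]
    · calc (u x ^ 2) ^ t = (u x ^ 2) ^ (t - 1) * u x ^ 2 := by
            rw [← Real.rpow_add_one h0.ne', sub_add_cancel]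
        _ ≤ _ := by gcongr
  have h1 : ENNReal.ofReal e * I = ∫⁻ x, ENNReal.ofReal ((u x ^ 2 / 16) ^ t) := by
    rw [hI, ← lintegral_const_mul' _ _ ENNReal.ofReal_ne_top]
    congr 1 with x
    rw [← ENNReal.ofReal_mul he0.le, Real.div_rpow (by positivity) (by norm_num), he]
    congr 1
    ring
  have h2 := lintegral_rpow_eq_lintegral_meas_lt_mul (μ := (volume : Measure (Pt n m)))
    (f := fun x => u x ^ 2 / 16) (Filter.Eventually.of_forall fun x => by positivity)
    (by fun_prop) (show 0 < t by linarith)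
  have h3 := lintegral_rpow_eq_lintegral_meas_lt_mul (μ := (volume : Measure (Pt n m)).withDensity g)
    (f := fun x => 2 * G x) (Filter.Eventually.of_forall fun x => by have := hG0 x; positivity)
    (by fun_prop) ht1
  have h4 : ∫⁻ s in Set.Ioi (0 : ℝ), volume {x | s < u x ^ 2 / 16} * ENNReal.ofReal (s ^ (t - 1)) ≤
      ENNReal.ofReal (2 * (A * δ) * D) * ∫⁻ s in Set.Ioi (0 : ℝ),
        (volume : Measure (Pt n m)).withDensity g {x | s < 2 * G x} * ENNReal.ofReal (s ^ (t - 1 - 1)) := by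
    rw [← lintegral_const_mul' _ _ ENNReal.ofReal_ne_top]
    refine setLIntegral_mono' measurableSet_Ioi fun s hs => ?_
    have hs : 0 < s := hs
    have e1 : {x | s < u x ^ 2 / 16} = {x | 16 * s < u x ^ 2} := by
      ext x; simp only [Set.mem_ofPred_eq]; constructor <;> intro h <;> linarith
    have e2 : {x | s < 2 * G x} = {x | s / 2 < G x} := by
      ext x; simp only [Set.mem_ofPred_eq]; constructor <;> intro h <;> linarith
    rw [e1, e2, withDensity_apply _ (isOpen_lt continuous_const hGc).measurableSet]
    calc _ ≤ _ := mul_le_mul_left (h.meas_le hn hA hu hb hi hδ0 hAδ hs) _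
      _ = ENNReal.ofReal (2 * (A * δ) * D / s) * ENNReal.ofReal (s ^ (t - 1)) *
          ∫⁻ x in {x | s / 2 < G x}, g x := by ring
      _ = ENNReal.ofReal (2 * (A * δ) * D) * ENNReal.ofReal (s ^ (t - 1 - 1)) *
          ∫⁻ x in {x | s / 2 < G x}, g x := by
          have e3 : s ^ (t - 1) = s ^ (t - 1 - 1) * s := by
            rw [← Real.rpow_add_one hs.ne', sub_add_cancel]
          rw [← ENNReal.ofReal_mul (by positivity), ← ENNReal.ofReal_mul (by positivity), e3]
          congr 2
          field_simp
      _ = _ := by ring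
  have h5 : ∫⁻ x, ENNReal.ofReal ((2 * G x) ^ (t - 1)) ∂(volume : Measure (Pt n m)).withDensity g ≤
      ENNReal.ofReal (2 ^ (t - 1) * 2 ^ t) * (I + ENNReal.ofReal (δ ^ t)⁻¹ * J) := by
    rw [lintegral_withDensity_eq_lintegral_mul _ hgm (by fun_prop), hI, hJ,
      ← lintegral_const_mul' _ _ ENNReal.ofReal_ne_top, ← lintegral_add_left (by fun_prop),
      ← lintegral_const_mul' _ _ ENNReal.ofReal_ne_top]
    refine lintegral_mono fun x => ?_
    rw [Pi.mul_apply, hg, ← ENNReal.ofReal_mul (hG0 x), ← ENNReal.ofReal_mul (by positivity),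
      ← ENNReal.ofReal_add (by positivity) (by positivity), ← ENNReal.ofReal_mul (by positivity)]
    refine ENNReal.ofReal_le_ofReal ?_
    have f1 : G x * (2 * G x) ^ (t - 1) = 2 ^ (t - 1) * G x ^ t := by
      rw [Real.mul_rpow (by norm_num) (hG0 x)]
      rcases (hG0 x).eq_or_lt with h0 | h0
      · rw [← h0, Real.zero_rpow (by linarith : t ≠ 0)]; ring
      · rw [Real.rpow_sub_one h0.ne']; field_simp
    rw [f1, mul_assoc]
    refine mul_le_mul_of_nonneg_left ?_ (by positivity)
    refine (add_rpow_le (sq_nonneg _) (by positivity) (by linarith)).trans (le_of_eq ?_)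
    rw [Real.div_rpow (by positivity) hδ0.le]
    ring
  have h6 : ENNReal.ofReal e * I ≤ ENNReal.ofReal (e / 2) * (I + ENNReal.ofReal (δ ^ t)⁻¹ * J) := by
    rw [h3] at h5
    rw [h1, h2]
    refine (mul_le_mul_right h4 _).trans ?_
    have e1 : ENNReal.ofReal t * (ENNReal.ofReal (2 * (A * δ) * D) * ∫⁻ s in Set.Ioi (0 : ℝ),
        (volume : Measure (Pt n m)).withDensity g {x | s < 2 * G x} * ENNReal.ofReal (s ^ (t - 1 - 1))) =
        ENNReal.ofReal (t * (2 * (A * δ) * D) / (t - 1)) * (ENNReal.ofReal (t - 1) * ∫⁻ s in Set.Ioi (0 : ℝ),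
        (volume : Measure (Pt n m)).withDensity g {x | s < 2 * G x} * ENNReal.ofReal (s ^ (t - 1 - 1))) := by
      generalize (∫⁻ s in Set.Ioi (0 : ℝ), (volume : Measure (Pt n m)).withDensity g
        {x | s < 2 * G x} * ENNReal.ofReal (s ^ (t - 1 - 1))) = Z
      have hD0 : 0 ≤ D := by rw [hD]; positivity
      clear_value D
      rw [← mul_assoc (ENNReal.ofReal t), ← mul_assoc (ENNReal.ofReal (_ / _)),
        ← ENNReal.ofReal_mul (by linarith), ← ENNReal.ofReal_mul (by positivity)]
      congr 2
      field_simp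
    rw [e1]
    refine (mul_le_mul_right h5 _).trans ?_
    rw [← mul_assoc, ← ENNReal.ofReal_mul (by positivity)]
    gcongr
    refine le_trans (le_of_eq ?_) hκδ
    rw [hκ]
    ring
  have h7 : ENNReal.ofReal e * I = ENNReal.ofReal (e / 2) * I + ENNReal.ofReal (e / 2) * I := by
    rw [← add_mul, ← ENNReal.ofReal_add (by positivity) (by positivity), add_halves]
  rw [h7, mul_add] at h6
  have h8 := (ENNReal.add_le_add_iff_left (ENNReal.mul_ne_top ENNReal.ofReal_ne_top hIf)).1 h6
  rwa [ENNReal.mul_le_mul_iff_right (ENNReal.ofReal_pos.2 (by positivity)).ne'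
    ENNReal.ofReal_ne_top] at h8

end RealVar

section Locality
variable {V : Type*} [NormedAddCommGroup V] [NormedSpace ℝ V] {ι : Type*}

lemma fderiv_eq_zero_of_eqOn {f : V → ℝ} {U : Set V} (hU : IsOpen U) (h : ∀ x ∈ U, f x = 0) {x : V}
    (hx : x ∈ U) : fderiv ℝ f x = 0 := by
  have : f =ᶠ[nhds x] fun _ => (0 : ℝ) := by
    filter_upwards [hU.mem_nhds hx] with y hy using h y hy
  rw [this.fderiv_eq, fderiv_const_apply]

lemma wS_eq_zero (X : ι → VF V) (β : List ι) {a : Sm V} {U : Set V} (hU : IsOpen U)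
    (h : ∀ x ∈ U, a x = 0) : ∀ x ∈ U, wS X β a x = 0 := by
  induction β with
  | nil => simpa using h
  | cons i β ih =>
    intro x hx
    rw [wS_cons, Module.End.mul_apply, VF.S_apply, Sm.mul_apply, Ds_apply,
      fderiv_eq_zero_of_eqOn hU ih hx]
    simp

lemma wT_eq_zero (X : ι → VF V) (β : List ι) {a : TF V} {U : Set V} (hU : IsOpen U)
    (h : ∀ x ∈ U, a x = 0) : ∀ x ∈ U, wT X β a x = 0 := fun x hx => by
  have := wS_eq_zero X β (a := a.toSm) hU h x hx
  rwa [wS_toSm] at this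

/-- Pullback of a smooth function along an affine map. -/
noncomputable def pullAff {W : Type*} [NormedAddCommGroup W] [NormedSpace ℝ W] (c : W) (L : V →L[ℝ] W) :
    Sm W →ₗ[ℝ] Sm V where
  toFun F := Sm.mk (fun x => F (c + L x)) (F.contDiff.comp (by fun_prop))
  map_add' _ _ := rfl
  map_smul' _ _ := rfl

lemma pullAff_apply {W : Type*} [NormedAddCommGroup W] [NormedSpace ℝ W] (c : W) (L : V →L[ℝ] W)
    (F : Sm W) (x : V) : pullAff c L F x = F (c + L x) := rfl

lemma Ds_pullAff {W : Type*} [NormedAddCommGroup W] [NormedSpace ℝ W] (c : W) (L : V →L[ℝ] W)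
    (F : Sm W) (v : V) : Ds v (pullAff c L F) = pullAff c L (Ds (L v) F) := by
  ext x
  have h : HasFDerivAt (fun x => F (c + L x)) ((fderiv ℝ F (c + L x)).comp L) x :=
    (F.differentiable _).hasFDerivAt.comp x (L.hasFDerivAt.const_add c)
  rw [Ds_apply, pullAff_apply, Ds_apply]
  exact congrArg (· v) h.fderiv

lemma Ds_smul_dir (c : ℝ) (v : V) (F : Sm V) : Ds (c • v) F = c • Ds v F := by
  ext x; simp [Ds_apply]

end Locality

section Cutoffs
variable {n m : ℕ} {N : ℕ}

/-- Space of rescaled points together with the parameters of the rescaled vector fields. -/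
abbrev EPt (n m : ℕ) := (Fin n → ℝ) × ℝ × Pt n m

/-- The rescaled vector fields. -/
noncomputable def YF (n m N : ℕ) : XIdx n m N → VF (EPt n m)
  | Sum.inl j => ⟨1, (0, 0, dx n m j)⟩
  | Sum.inr (ν, k) => ⟨cν N ν.1 • Sm.mk (fun e => ∏ i, (e.1 i + e.2.1 * e.2.2.1 i) ^ ν.1 i)
      (by fun_prop), (0, 0, dy n m k)⟩

/-- The linear part of the rescaling map. -/
noncomputable def rescL (z : Pt n m) (r : ℝ) (N : ℕ) : Pt n m →L[ℝ] EPt n m :=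
  (0 : Pt n m →L[ℝ] (Fin n → ℝ)).prod ((0 : Pt n m →L[ℝ] ℝ).prod
    ((r⁻¹ • ContinuousLinearMap.fst ℝ _ _).prod ((ρ N z r)⁻¹ • ContinuousLinearMap.snd ℝ _ _)))

/-- The constant part of the rescaling map. -/
noncomputable def rescC (z : Pt n m) (r : ℝ) (N : ℕ) : EPt n m :=
  ((r + ‖z.1‖)⁻¹ • z.1, r / (r + ‖z.1‖), (-(r⁻¹ • z.1), -((ρ N z r)⁻¹ • z.2)))

lemma resc_letter (z : Pt n m) {r : ℝ} (hr : 0 < r) (i : XIdx n m N) (F : Sm (EPt n m)) :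
    r • (XF n m N i).S (pullAff (rescC z r N) (rescL z r N) F) =
      pullAff (rescC z r N) (rescL z r N) ((YF n m N i).S F) := by
  have hT : 0 < r + ‖z.1‖ := by positivity
  have hρ := ρ_pos (N := N) z hr
  obtain ⟨j, rfl⟩ | ⟨ν, k, rfl⟩ := XIdx.cases i
  · have e : rescL z r N (dx n m j) = r⁻¹ • ((0, 0, dx n m j) : EPt n m) := by
      simp [rescL, dx]
    rw [XF_iX, VF.S_apply, VF.S_apply, Ds_pullAff, e, Ds_smul_dir, map_smul]
    simp only [one_mul, YF, iX]
    rw [smul_smul, mul_inv_cancel₀ hr.ne', one_smul]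
  · have e : rescL z r N (dy n m k) = (ρ N z r)⁻¹ • ((0, 0, dy n m k) : EPt n m) := by
      simp [rescL, dy]
    rw [XF_iY, VF.S_apply, VF.S_apply, Ds_pullAff, e, Ds_smul_dir, map_smul]
    ext x
    simp only [YF, iY, Sm.smul_apply, Sm.mul_apply, pullAff_apply, Sm.coe_mk]
    have e2 : ∏ i, ((rescC z r N + rescL z r N x).1 i + (rescC z r N + rescL z r N x).2.1 *
        (rescC z r N + rescL z r N x).2.2.1 i) ^ ν.1 i = xpow m ν.1 x / (r + ‖z.1‖) ^ N := by
      have : ∀ i, (rescC z r N + rescL z r N x).1 i + (rescC z r N + rescL z r N x).2.1 *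
        (rescC z r N + rescL z r N x).2.2.1 i = x.1 i / (r + ‖z.1‖) := fun i => by
        simp [rescC, rescL]
        field_simp
        ring
      simp only [this, div_pow, Finset.prod_div_distrib, Finset.prod_pow_eq_pow_sum, ν.2]
      simp [xpow, xs]
    rw [e2]
    unfold ρ
    field_simp

lemma resc_word (z : Pt n m) {r : ℝ} (hr : 0 < r) (β : List (XIdx n m N)) (F : Sm (EPt n m)) :
    r ^ β.length • wS (XF n m N) β (pullAff (rescC z r N) (rescL z r N) F) =
      pullAff (rescC z r N) (rescL z r N) (wS (YF n m N) β F) := by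
  induction β with
  | nil => simp
  | cons i β ih =>
    rw [wS_cons, wS_cons, Module.End.mul_apply, Module.End.mul_apply, ← resc_letter z hr, ← ih,
      map_smul, smul_smul, List.length_cons, pow_succ']

/-- The reference cutoff. -/
noncomputable def bump0 (n m : ℕ) : ContDiffBump (0 : Pt n m) := ⟨1 / 2, 1, by norm_num, by norm_num⟩

/-- The reference cutoff, on the rescaled space. -/
noncomputable def bumpE (n m : ℕ) : Sm (EPt n m) :=
  Sm.mk (fun e => bump0 n m e.2.2) ((bump0 n m).contDiff.comp (by fun_prop))

/-- Cutoff function adapted to the box `Bx N z r`. -/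
noncomputable def cut (N : ℕ) (z : Pt n m) (r : ℝ) : Sm (Pt n m) :=
  pullAff (rescC z r N) (rescL z r N) (bumpE n m)

lemma cut_eq (z : Pt n m) (r : ℝ) (w : Pt n m) : cut N z r w =
    bump0 n m (r⁻¹ • (w.1 - z.1), (ρ N z r)⁻¹ • (w.2 - z.2)) := by
  change bump0 n m _ = _
  congr 1
  simp only [rescC, rescL]
  ext i <;> simp <;> ring

lemma cut_mem_Icc (z : Pt n m) (r : ℝ) (w : Pt n m) : 0 ≤ cut N z r w ∧ cut N z r w ≤ 1 := by
  rw [cut_eq]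
  exact ⟨(bump0 n m).nonneg, (bump0 n m).le_one⟩

lemma cut_ne_zero {z : Pt n m} {r : ℝ} (hr : 0 < r) {w : Pt n m} :
    cut N z r w ≠ 0 ↔ w ∈ Bx N z r := by
  have hρ := ρ_pos (N := N) z hr
  rw [cut_eq, ← Function.mem_support, (bump0 n m).support_eq, mem_ball_zero_iff, mem_Bx, Prod.norm_def,
    max_lt_iff, norm_smul, norm_smul, norm_inv, norm_inv, Real.norm_of_nonneg hr.le,
    Real.norm_of_nonneg hρ.le]
  simp only [bump0]
  rw [inv_mul_lt_iff₀ hr, inv_mul_lt_iff₀ hρ, mul_one, mul_one]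

lemma cut_eq_zero {z : Pt n m} {r : ℝ} (hr : 0 < r) {w : Pt n m} (h : w ∉ Bx N z r) : cut N z r w = 0 := by
  by_contra h'
  exact h ((cut_ne_zero hr).1 h')

lemma ρ_half (z : Pt n m) {r t : ℝ} (hr : 0 < r) (ht : 0 ≤ t) (ht1 : t ≤ 1) :
    ρ N z (t * r) ≤ t * ρ N z r := by
  unfold ρ
  have : (t * r + ‖z.1‖) ^ N ≤ (r + ‖z.1‖) ^ N := by
    gcongr
    nlinarith
  calc _ ≤ t * r * (r + ‖z.1‖) ^ N := by gcongr
    _ = _ := by ring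

lemma cut_eq_one {z : Pt n m} {r : ℝ} (hr : 0 < r) {w : Pt n m} (hw : w ∈ Bx N z (r / 2)) :
    cut N z r w = 1 := by
  have hρ := ρ_pos (N := N) z hr
  rw [mem_Bx] at hw
  rw [cut_eq]
  apply (bump0 n m).one_of_mem_closedBall
  rw [mem_closedBall_zero_iff, Prod.norm_def,
    max_le_iff, norm_smul, norm_smul, norm_inv, norm_inv, Real.norm_of_nonneg hr.le,
    Real.norm_of_nonneg hρ.le]
  simp only [bump0]
  rw [inv_mul_le_iff₀ hr, inv_mul_le_iff₀ hρ]
  have := ρ_half (N := N) z hr (t := 1 / 2) (by norm_num) (by norm_num)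
  rw [show 1 / 2 * r = r / 2 by ring] at this
  constructor <;> linarith [hw.1, hw.2]

lemma UB_cut {P : Type*} (z : P → Pt n m) (r : P → ℝ) (hr : ∀ p, 0 < r p) :
    UB N r fun p => cut N (z p) (r p) := by
  intro β
  have hK : IsCompact (Metric.closedBall (0 : EPt n m) 1) := isCompact_closedBall _ _
  obtain ⟨C, hC⟩ := hK.exists_bound_of_continuousOn
    (f := wS (YF n m N) β (bumpE n m)) (Sm.continuous _).continuousOn
  refine ⟨max C 0, fun p x => ?_⟩
  have hT : 0 < r p + ‖(z p).1‖ := by have := hr p; positivity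
  have e := congrArg (fun a : Sm (Pt n m) => a x) (resc_word (z p) (hr p) β (bumpE n m))
  simp only [Sm.smul_apply, pullAff_apply] at e
  change |r p ^ β.length * wS (XF n m N) β (pullAff _ _ _) x| ≤ _
  rw [e]
  set w := rescC (z p) (r p) N + rescL (z p) (r p) N x with hw
  by_cases h : ‖w.2.2‖ ≤ 1
  · refine le_max_of_le_left (hC w ?_)
    rw [mem_closedBall_zero_iff, Prod.norm_def, Prod.norm_def, max_le_iff, max_le_iff]
    refine ⟨?_, ?_, h⟩
    · simp only [hw, rescC, rescL, Prod.fst_add, ContinuousLinearMap.prod_apply,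
        zero_apply, add_zero]
      rw [norm_smul, norm_inv, Real.norm_of_nonneg hT.le, inv_mul_le_iff₀ hT]
      linarith [hr p]
    · simp only [hw, rescC, rescL, Prod.fst_add, Prod.snd_add, ContinuousLinearMap.prod_apply,
        zero_apply, add_zero]
      rw [norm_div, Real.norm_of_nonneg hT.le, Real.norm_of_nonneg (hr p).le, div_le_one hT]
      linarith [norm_nonneg (z p).1]
  · refine le_max_of_le_right (le_of_eq ?_)
    rw [abs_eq_zero]
    refine wS_eq_zero _ β (U := {e : EPt n m | 1 < ‖e.2.2‖}) (isOpen_lt continuous_const (by fun_prop))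
      (fun e he => ?_) w (not_le.1 h)
    change bump0 n m e.2.2 = 0
    have : e.2.2 ∉ Function.support (bump0 n m) := by
      rw [(bump0 n m).support_eq, mem_ball_zero_iff]
      simp only [bump0, not_lt]
      exact le_of_lt he
    simpa using this

lemma UB.scale {P : Type*} {r r' : P → ℝ} {a : P → Sm (Pt n m)} (h : UB N r a)
    (hr : ∀ p, |r' p| ≤ |r p|) : UB N r' a := by
  intro β
  obtain ⟨C, hC⟩ := h β
  refine ⟨C, fun p x => le_trans ?_ (hC p x)⟩
  rw [abs_mul, abs_mul, abs_pow, abs_pow]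
  exact mul_le_mul_of_nonneg_right (pow_le_pow_left₀ (abs_nonneg _) (hr p) _) (abs_nonneg _)

end Cutoffs

section Marginal

lemma enorm_le_lintegral_update {d : ℕ} (f : TF (Fin d → ℝ)) (i : Fin d) (x : Fin d → ℝ) :
    ‖f x‖ₑ ≤ ∫⁻ t, ‖rD i f (Function.update x i t)‖ₑ := by
  have h := HasCompactSupport.enorm_le_lintegral_Ici_deriv
    (f := fun t => f (Function.update x i t))
    ((f.contDiff.of_le (by simp)).comp (contDiff_update 1 x i))
    (f.hasCompactSupport.comp_isClosedEmbedding (isClosedEmbedding_update x i)) (x i)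
  rw [Function.update_eq_self] at h
  refine h.trans ((setLIntegral_le_lintegral _ _).trans (le_of_eq ?_))
  congr 1
  ext t
  have h2 : HasDerivAt (fun t => f (Function.update x i t))
      (fderiv ℝ f (Function.update x i t) (Pi.single i 1)) t :=
    (f.differentiable _).hasFDerivAt.comp_hasDerivAt t (hasDerivAt_update x i t)
  rw [h2.deriv]
  rfl

lemma enorm_le_lmarginal {d : ℕ} (l : List (Fin d)) (hl : l.Nodup) (f : TF (Fin d → ℝ)) (x : Fin d → ℝ) :
    ‖f x‖ₑ ≤ (∫⋯∫⁻_l.toFinset, fun y => ‖(l.map fun i => rD i).prod f y‖ₑ ∂fun _ => volume) x := by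
  induction l with
  | nil => simp
  | cons i l ih =>
    obtain ⟨hi, hl⟩ := List.nodup_cons.1 hl
    refine (ih hl).trans ?_
    rw [List.toFinset_cons, lmarginal_insert' _ (by exact (TF.continuous _).enorm.measurable) (by simpa using hi)]
    refine lmarginal_mono (fun y => ?_) x
    simp only [List.map_cons, List.prod_cons, Module.End.mul_apply]
    exact enorm_le_lintegral_update _ i y

lemma enorm_le_lintegral_prod {d : ℕ} (f : TF (Fin d → ℝ)) (x : Fin d → ℝ) :
    ‖f x‖ₑ ≤ ∫⁻ y, ‖((List.finRange d).map fun i => rD i).prod f y‖ₑ := by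
  have h := enorm_le_lmarginal (List.finRange d) (List.nodup_finRange d) f x
  rwa [List.toFinset_finRange, lmarginal_univ] at h

end Marginal

section Sobolev
variable {n m N : ℕ}

/-- The slice `x ↦ F(x,y)`. -/
noncomputable def sliceX (y : Fin m → ℝ) : TF (Pt n m) →ₗ[ℝ] TF (Fin n → ℝ) where
  toFun F := TF.mk (fun x => F (x, y)) (F.contDiff.comp (contDiff_prodMk_left y))
    (HasCompactSupport.intro (F.hasCompactSupport.isCompact.image continuous_fst) fun x hx => by
      by_contra h
      exact hx ⟨(x, y), subset_tsupport _ h, rfl⟩)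
  map_add' _ _ := rfl
  map_smul' _ _ := rfl

lemma Dv_sliceX (y : Fin m → ℝ) (F : TF (Pt n m)) (v : Fin n → ℝ) :
    Dv v (sliceX y F) = sliceX y (Dv (v, 0) F) := by
  ext x
  have h : HasFDerivAt (fun x => F (x, y)) ((fderiv ℝ F (x, y)).comp
      (ContinuousLinearMap.inl ℝ (Fin n → ℝ) (Fin m → ℝ))) x :=
    (F.differentiable (x, y)).hasFDerivAt.comp x (hasFDerivAt_prodMk_left x y)
  have h' : fderiv ℝ (sliceX y F) x = _ := h.fderiv
  rw [Dv_apply, h']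
  change _ = fderiv ℝ F (x, y) (v, 0)
  simp

/-- The derivative along a list of `x` directions. -/
noncomputable def DX (n m : ℕ) (l : List (Fin n)) : Module.End ℝ (TF (Pt n m)) :=
  (l.map fun j => Dv (dx n m j)).prod

/-- The derivative along a list of `y` directions. -/
noncomputable def DY (n m : ℕ) (l : List (Fin m)) : Module.End ℝ (TF (Pt n m)) :=
  (l.map fun k => Dv (dy n m k)).prod

@[simp] lemma DX_cons (j : Fin n) (l : List (Fin n)) : DX n m (j :: l) = Dv (dx n m j) * DX n m l := by
  simp [DX]
@[simp] lemma DY_cons (k : Fin m) (l : List (Fin m)) : DY n m (k :: l) = Dv (dy n m k) * DY n m l := by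
  simp [DY]

lemma slice_DY (l : List (Fin m)) (x : Fin n → ℝ) (f : TF (Pt n m)) :
    (l.map fun i => rD i).prod (slice x f) = slice x (DY n m l f) := by
  induction l with
  | nil => simp [DY]
  | cons k l ih => simp [ih, Dv_slice, dy]

lemma sliceX_DX (l : List (Fin n)) (y : Fin m → ℝ) (f : TF (Pt n m)) :
    (l.map fun i => rD i).prod (sliceX y f) = sliceX y (DX n m l f) := by
  induction l with
  | nil => simp [DX]
  | cons k l ih => simp [ih, Dv_sliceX, dx]

/-- The mixed derivative `∂_{x_1} ⋯ ∂_{x_n} ∂_{y_1} ⋯ ∂_{y_m}`. -/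
noncomputable def Dall (n m : ℕ) : Module.End ℝ (TF (Pt n m)) :=
  DX n m (List.finRange n) * DY n m (List.finRange m)

lemma enorm_le_lintegral_Dall (f : TF (Pt n m)) (z : Pt n m) :
    ‖f z‖ₑ ≤ ∫⁻ w, ‖Dall n m f w‖ₑ := by
  obtain ⟨x, y⟩ := z
  rw [Measure.volume_eq_prod, lintegral_prod_symm _ (TF.continuous _).enorm.aemeasurable]
  have h := enorm_le_lintegral_prod (slice x f) y
  rw [slice_DY, slice_apply] at h
  refine h.trans (lintegral_mono fun y' => ?_)
  have h := enorm_le_lintegral_prod (sliceX y' (DY n m (List.finRange m) f)) x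
  rw [sliceX_DX] at h
  exact h

/-- Scaled sums of the norms of `X`-derivatives. -/
noncomputable def sn (N : ℕ) (k : ℕ) (R : ℝ) (u : TF (Pt n m)) : ℝ :=
  ∑ j ∈ Finset.range (k + 1), ∑ γ : Fin j → XIdx n m N, R ^ j * ‖XT n m N (List.ofFn γ) u‖

lemma sn_nonneg (k : ℕ) {R : ℝ} (hR : 0 ≤ R) (u : TF (Pt n m)) : 0 ≤ sn N k R u :=
  Finset.sum_nonneg fun _ _ => Finset.sum_nonneg fun _ _ => by positivity

lemma le_sn {k : ℕ} {R : ℝ} (hR : 0 ≤ R) (β : List (XIdx n m N)) (hβ : β.length ≤ k) (u : TF (Pt n m)) :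
    R ^ β.length * ‖XT n m N β u‖ ≤ sn N k R u := by
  refine le_trans ?_ (Finset.single_le_sum (f := fun j => ∑ γ : Fin j → XIdx n m N,
    R ^ j * ‖XT n m N (List.ofFn γ) u‖) (fun _ _ => Finset.sum_nonneg fun _ _ => by positivity)
    (Finset.mem_range.2 (Nat.lt_succ_of_le hβ)))
  have := Finset.single_le_sum (f := fun γ : Fin β.length → XIdx n m N =>
    R ^ β.length * ‖XT n m N (List.ofFn γ) u‖)
    (fun _ _ => by positivity) (Finset.mem_univ β.get)
  simp only [List.ofFn_get] at this
  exact this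

variable (n m N) in
/-- Number of words of length at most `k`. -/
noncomputable def nW (k : ℕ) : ℝ := ∑ j ∈ Finset.range (k + 1), (Nat.card (Fin j → XIdx n m N) : ℝ)

lemma nW_nonneg (k : ℕ) : 0 ≤ nW n m N k := Finset.sum_nonneg fun _ _ => by positivity

lemma sn_le {k : ℕ} {R B : ℝ} {u : TF (Pt n m)}
    (h : ∀ β : List (XIdx n m N), β.length ≤ k → R ^ β.length * ‖XT n m N β u‖ ≤ B) :
    sn N k R u ≤ nW n m N k * B := by
  unfold sn nW
  rw [Finset.sum_mul]
  refine Finset.sum_le_sum fun j hj => ?_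
  refine (Finset.sum_le_card_nsmul _ _ B fun γ _ => ?_).trans (le_of_eq ?_)
  · have := h (List.ofFn γ) (by simpa using Nat.lt_succ_iff.1 (Finset.mem_range.1 hj))
    simpa using this
  · simp

lemma sn_mono {k l : ℕ} (h : k ≤ l) {R : ℝ} (hR : 0 ≤ R) (u : TF (Pt n m)) : sn N k R u ≤ sn N l R u :=
  Finset.sum_le_sum_of_subset_of_nonneg (by intro x; simp only [Finset.mem_range]; omega)
    fun _ _ _ => Finset.sum_nonneg fun _ _ => by positivity

lemma sn_Wd_aux {j : ℕ} {A : Module.End ℝ (TF (Pt n m))} (hA : A ∈ Wd n m N j) (k : ℕ) :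
    ∃ C, 0 ≤ C ∧ ∀ β : List (XIdx n m N), β.length ≤ k → ∀ R, 0 ≤ R → ∀ u,
      R ^ j * (R ^ β.length * ‖XT n m N β (A u)‖) ≤ C * sn N (k + j) R u := by
  induction hA using Submodule.span_induction with
  | mem A h =>
    obtain ⟨γ, hγ, rfl⟩ := h
    refine ⟨1, zero_le_one, fun β hβ R hR u => ?_⟩
    have := le_sn hR (β ++ γ) (k := k + j) (by rw [List.length_append, hγ]; omega) u
    rw [XT_append, List.length_append, hγ, pow_add, Module.End.mul_apply] at this
    linarith [this]
  | zero => exact ⟨0, le_rfl, fun β _ R hR u => by simp⟩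
  | add A B _ _ hA hB =>
    obtain ⟨C, hC, hA⟩ := hA
    obtain ⟨D, hD, hB⟩ := hB
    refine ⟨C + D, by positivity, fun β hβ R hR u => ?_⟩
    have h1 := hA β hβ R hR u
    have h2 := hB β hβ R hR u
    have h3 : R ^ j * (R ^ β.length * ‖XT n m N β ((A + B) u)‖) ≤
        R ^ j * (R ^ β.length * (‖XT n m N β (A u)‖ + ‖XT n m N β (B u)‖)) := by
      rw [LinearMap.add_apply, map_add]
      gcongr
      exact norm_add_le _ _
    linarith
  | smul a A _ hA =>
    obtain ⟨C, hC, hA⟩ := hA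
    refine ⟨|a| * C, by positivity, fun β hβ R hR u => ?_⟩
    have h1 := mul_le_mul_of_nonneg_left (hA β hβ R hR u) (abs_nonneg a)
    rw [LinearMap.smul_apply, map_smul, norm_smul, Real.norm_eq_abs]
    linarith

lemma sn_Wd {j : ℕ} {A : Module.End ℝ (TF (Pt n m))} (hA : A ∈ Wd n m N j) (k : ℕ) :
    ∃ C, 0 ≤ C ∧ ∀ R, 0 ≤ R → ∀ u, R ^ j * sn N k R (A u) ≤ C * sn N (k + j) R u := by
  obtain ⟨C, hC, h⟩ := sn_Wd_aux hA k
  refine ⟨nW n m N k * C, mul_nonneg (nW_nonneg k) hC, fun R hR u => ?_⟩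
  rcases hR.eq_or_lt with rfl | hR'
  · rcases Nat.eq_zero_or_pos j with rfl | hj
    · have := sn_le (k := k) (R := 0) (B := C * sn N (k + 0) 0 u) (u := A u)
        fun β hβ => by simpa using h β hβ 0 le_rfl u
      linarith
    · rw [zero_pow hj.ne', zero_mul]
      exact mul_nonneg (mul_nonneg (nW_nonneg k) hC) (sn_nonneg _ le_rfl _)
  · have hp : 0 < R ^ j := by positivity
    have := sn_le (k := k) (R := R) (B := (R ^ j)⁻¹ * (C * sn N (k + j) R u)) (u := A u)
        fun β hβ => by
          rw [← div_eq_inv_mul, le_div_iff₀ hp]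
          linarith [h β hβ R hR u]
    calc _ ≤ R ^ j * (nW n m N k * ((R ^ j)⁻¹ * (C * sn N (k + j) R u))) := by gcongr
      _ = _ := by field_simp

end Sobolev

section Embedding
variable {n m N : ℕ}

/-- The function vanishes off the closed box around `z` of radius `R`. -/
def Off (N : ℕ) (z : Pt n m) (R : ℝ) (u : TF (Pt n m)) : Prop :=
  ∀ w : Pt n m, R < ‖w.1 - z.1‖ ∨ ρ N z R < ‖w.2 - z.2‖ → u w = 0

lemma Off.open_ (z : Pt n m) (R : ℝ) :
    IsOpen {w : Pt n m | R < ‖w.1 - z.1‖ ∨ ρ N z R < ‖w.2 - z.2‖} :=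
  IsOpen.union (s₁ := {w : Pt n m | R < ‖w.1 - z.1‖}) (s₂ := {w : Pt n m | ρ N z R < ‖w.2 - z.2‖})
    (isOpen_lt continuous_const (by fun_prop)) (isOpen_lt continuous_const (by fun_prop))

lemma Off.XT {z : Pt n m} {R : ℝ} {u : TF (Pt n m)} (h : Off N z R u) (β : List (XIdx n m N)) :
    Off N z R (XT n m N β u) :=
  wT_eq_zero _ _ (Off.open_ z R) h

lemma Off.Dv {z : Pt n m} {R : ℝ} {u : TF (Pt n m)} (h : Off N z R u) (v : Pt n m) :
    Off N z R (Dv v u) := fun w hw => by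
  rw [Dv_apply, fderiv_eq_zero_of_eqOn (Off.open_ z R) h hw]; rfl

lemma Off.DX {z : Pt n m} {R : ℝ} {u : TF (Pt n m)} (h : Off N z R u) (l : List (Fin n)) :
    Off N z R (DX n m l u) := by
  induction l with
  | nil => exact h
  | cons j l ih => rw [DX_cons]; exact ih.Dv _

lemma Off.DY {z : Pt n m} {R : ℝ} {u : TF (Pt n m)} (h : Off N z R u) (l : List (Fin m)) :
    Off N z R (DY n m l u) := by
  induction l with
  | nil => exact h
  | cons j l ih => rw [DY_cons]; exact ih.Dv _

lemma T_Dv_dy (i : XIdx n m N) (k : Fin m) (u : TF (Pt n m)) :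
    (XF n m N i).T (Dv (dy n m k) u) = Dv (dy n m k) ((XF n m N i).T u) := by
  obtain ⟨j, rfl⟩ | ⟨ν, l, rfl⟩ := XIdx.cases i
  · rw [T_iX, T_iX, Dv_comm]
  · rw [XF_iY, VF.T_apply, VF.T_apply, Dv_smul, Dv_comm, map_smul, Ds_dy_xpow]
    simp

lemma XT_Dv_dy (β : List (XIdx n m N)) (k : Fin m) (u : TF (Pt n m)) :
    XT n m N β (Dv (dy n m k) u) = Dv (dy n m k) (XT n m N β u) := by
  induction β with
  | nil => simp [XT]
  | cons i β ih =>
    simp only [XT, wT_cons, Module.End.mul_apply] at ih ⊢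
    rw [ih, T_Dv_dy]

/-- The operators `x_i^(N-j) ∂_{y_k}`. -/
noncomputable def Zop (N : ℕ) (i : Fin n) (k : Fin m) (j : ℕ) : Module.End ℝ (TF (Pt n m)) :=
  Mul (xs n m i ^ (N - j)) * Dv (dy n m k)

lemma T_mem_Wd (i : XIdx n m N) : (XF n m N i).T ∈ Wd n m N 1 := by
  have := XT_mem_Wd [i]
  simpa [XT] using this

lemma cν_single (i : Fin n) : cν N (Pi.single i N) = 1 := by
  have : ∏ j, ((Pi.single i N : Fin n → ℕ) j).factorial = N.factorial := by
    rw [Finset.prod_eq_single i]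
    · simp
    · intro j _ hj; simp [Pi.single_eq_of_ne hj]
    · simp
  rw [cν, ← Nat.cast_prod, this, div_self (by positivity), Real.sqrt_one]

lemma Zop_mem (i : Fin n) (k : Fin m) (j : ℕ) (hj : j ≤ N) : Zop N i k j ∈ Wd n m N (j + 1) := by
  induction j with
  | zero =>
    have e : ∑ l, (Pi.single i N : Fin n → ℕ) l = N := by simp
    have h := T_mem_Wd (iY (n := n) (m := m) (N := N) ⟨Pi.single i N, e⟩ k)
    have e2 : (XF n m N (iY ⟨Pi.single i N, e⟩ k)).T = Zop N i k 0 := by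
      have : xpow m (Pi.single i N : Fin n → ℕ) = xs n m i ^ N := by
        rw [xpow, Finset.prod_eq_single i]
        · simp
        · intro j _ hj; simp [Pi.single_eq_of_ne hj]
        · simp
      rw [XF_iY, VF.T, Zop, cν_single, one_smul, this, Nat.sub_zero]
    rwa [e2] at h
  | succ j ih =>
    have ih := ih (by omega)
    have h1 := T_mem_Wd (iX (n := n) (m := m) (N := N) i)
    have h2 : (XF n m N (iX i)).T * Zop N i k j - Zop N i k j * (XF n m N (iX i)).T =
        ((N - j : ℕ) : ℝ) • Zop N i k (j + 1) := by
      ext u : 1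
      obtain ⟨l, hl⟩ : ∃ l, N - j = l + 1 := ⟨N - (j + 1), by omega⟩
      have hl' : N - (j + 1) = l := by omega
      simp only [LinearMap.sub_apply, Module.End.mul_apply, T_iX, Zop, LinearMap.smul_apply, hl, hl',
        Mul_apply]
      rw [Dv_smul, Dv_comm (dy n m k), Ds_Spow, Ds_xs]
      ext w
      simp [dx]
    have h3 : Zop N i k (j + 1) = ((N - j : ℕ) : ℝ)⁻¹ •
        ((XF n m N (iX i)).T * Zop N i k j - Zop N i k j * (XF n m N (iX i)).T) := by
      rw [h2, smul_smul, inv_mul_cancel₀, one_smul]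
      exact_mod_cast (by omega : N - j ≠ 0)
    rw [h3]
    refine Submodule.smul_mem _ _ (Submodule.sub_mem _ ?_ ?_)
    · have := Wd_mul h1 ih
      rwa [add_comm 1] at this
    · exact Wd_mul ih h1

lemma norm_dy_le (hn : 1 ≤ n) (k : Fin m) : ∃ C, 0 ≤ C ∧ ∀ (z : Pt n m) (R : ℝ), 0 < R → ∀ u,
    Off N z R u → ρ N z R * ‖Dv (dy n m k) u‖ ≤ C * sn N (N + 1) R u := by
  have h := fun (q : Fin n × Bool) => sn_Wd (Zop_mem (N := N) q.1 k (if q.2 then 0 else N)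
    (by split_ifs <;> omega)) 0
  choose C hC h using h
  refine ⟨3 ^ N * ∑ q, C q, by have := Finset.sum_nonneg fun q (_ : q ∈ Finset.univ) => hC q; positivity,
    fun z R hR u hu => ?_⟩
  have hi : ∃ i : Fin n, ‖z.1‖ = |z.1 i| := by
    have : Nonempty (Fin n) := ⟨⟨0, hn⟩⟩
    obtain ⟨i, hi⟩ := Finite.exists_max fun i => |z.1 i|
    exact ⟨i, le_antisymm ((pi_norm_le_iff_of_nonneg (abs_nonneg _)).2 hi) (norm_le_pi_norm z.1 i)⟩
  obtain ⟨i, hi⟩ := hi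
  have key : ∀ b : Bool, R * (‖Zop N i k (if b then 0 else N) u‖ * (R ^ (if b then 0 else N))) ≤
      (∑ q, C q) * sn N (N + 1) R u := fun b => by
    have h1 := h (i, b) R hR.le u
    have h2 : ‖Zop N i k (if b then 0 else N) u‖ ≤ sn N 0 R (Zop N i k (if b then 0 else N) u) := by
      have := le_sn (k := 0) hR.le ([] : List (XIdx n m N)) (by simp) (Zop N i k (if b then 0 else N) u)
      simpa [Grusin.XT] using this
    have h3 : C (i, b) ≤ ∑ q, C q := Finset.single_le_sum (fun q _ => hC q) (Finset.mem_univ _)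
    have h4 : sn N (0 + ((if b then 0 else N) + 1)) R u ≤ sn N (N + 1) R u :=
      sn_mono (by split_ifs <;> omega) hR.le u
    calc _ = R ^ ((if b then 0 else N) + 1) * ‖Zop N i k (if b then 0 else N) u‖ := by
          rw [pow_succ]; ring
      _ ≤ R ^ ((if b then 0 else N) + 1) * sn N 0 R (Zop N i k (if b then 0 else N) u) := by gcongr
      _ ≤ _ := h1
      _ ≤ _ := mul_le_mul h3 h4 (sn_nonneg _ hR.le _) ((hC _).trans h3)
  rcases le_or_gt ‖z.1‖ (2 * R) with hz | hz
  · have h1 := key false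
    simp only [Bool.false_eq_true, if_false] at h1
    have e : Zop N i k N u = Dv (dy n m k) u := by simp [Zop]
    rw [e] at h1
    have h2 : ρ N z R ≤ 3 ^ N * (R * R ^ N) := by
      unfold ρ
      have : (R + ‖z.1‖) ^ N ≤ (3 * R) ^ N := by gcongr; linarith
      calc _ ≤ R * (3 * R) ^ N := by gcongr
        _ = _ := by rw [mul_pow]; ring
    calc _ ≤ 3 ^ N * (R * R ^ N) * ‖Dv (dy n m k) u‖ := by gcongr
      _ = 3 ^ N * (R * (‖Dv (dy n m k) u‖ * R ^ N)) := by ring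
      _ ≤ 3 ^ N * ((∑ q, C q) * sn N (N + 1) R u) := by gcongr
      _ = _ := by ring
  · have h1 := key true
    simp only [if_true, pow_zero, mul_one] at h1
    have h2 : (R + ‖z.1‖) ^ N * ‖Dv (dy n m k) u‖ ≤ 3 ^ N * ‖Zop N i k 0 u‖ := by
      have e1 : ‖((R + ‖z.1‖) ^ N) • Dv (dy n m k) u‖ ≤ ‖((3 : ℝ) ^ N) • Zop N i k 0 u‖ := by
        apply norm_mono
        intro w
        simp only [TF.smul_apply, Zop, Module.End.mul_apply, Mul_apply, TF.sm_smul_apply, Nat.sub_zero,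
          Sm.pow_apply]
        by_cases hw : R < ‖w.1 - z.1‖ ∨ ρ N z R < ‖w.2 - z.2‖
        · rw [hu.Dv (dy n m k) w hw]; simp
        · have h5 : |w.1 i - z.1 i| ≤ R := (norm_le_pi_norm (w.1 - z.1) i).trans (not_lt.1 (not_or.1 hw).1)
          have h6 : R + ‖z.1‖ ≤ 3 * |w.1 i| := by
            have := abs_sub_abs_le_abs_sub (z.1 i) (w.1 i)
            rw [abs_sub_comm] at this
            linarith
          rw [← mul_assoc, abs_mul, abs_mul, abs_mul]
          change _ ≤ |(3 : ℝ) ^ N| * |(w.1 i) ^ N| * _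
          rw [abs_pow, abs_pow, abs_pow, ← mul_pow, abs_of_nonneg (by positivity : 0 ≤ R + ‖z.1‖),
            abs_of_nonneg (by norm_num : (0:ℝ) ≤ 3)]
          gcongr
      rw [norm_smul, norm_smul, Real.norm_of_nonneg (by positivity), Real.norm_of_nonneg (by positivity)] at e1
      exact e1
    unfold ρ
    calc _ = R * ((R + ‖z.1‖) ^ N * ‖Dv (dy n m k) u‖) := by ring
      _ ≤ R * (3 ^ N * ‖Zop N i k 0 u‖) := by gcongr
      _ = 3 ^ N * (R * ‖Zop N i k 0 u‖) := by ring
      _ ≤ 3 ^ N * ((∑ q, C q) * sn N (N + 1) R u) := by gcongr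
      _ = _ := by ring

lemma norm_sn_XT {R : ℝ} (hR : 0 ≤ R) (β : List (XIdx n m N)) (k : ℕ) (u : TF (Pt n m)) :
    R ^ β.length * sn N k R (XT n m N β u) ≤ nW n m N k * sn N (k + β.length) R u := by
  rw [sn, Finset.mul_sum, nW, Finset.sum_mul]
  refine Finset.sum_le_sum fun j hj => ?_
  rw [Finset.mul_sum]
  refine (Finset.sum_le_card_nsmul _ _ (sn N (k + β.length) R u) fun γ _ => ?_).trans (le_of_eq (by simp))
  have := le_sn (k := k + β.length) hR (List.ofFn γ ++ β)
    (by simp; exact Nat.lt_succ_iff.1 (Finset.mem_range.1 hj)) u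
  rw [XT_append, List.length_append, List.length_ofFn, pow_add, Module.End.mul_apply] at this
  linarith

lemma sn_dy_le (hn : 1 ≤ n) (k : Fin m) (J : ℕ) : ∃ C, 0 ≤ C ∧ ∀ (z : Pt n m) (R : ℝ), 0 < R → ∀ u,
    Off N z R u → ρ N z R * sn N J R (Dv (dy n m k) u) ≤ C * sn N (J + (N + 1)) R u := by
  obtain ⟨C, hC, h⟩ := norm_dy_le (N := N) hn k
  refine ⟨nW n m N J * (C * nW n m N (N + 1)),
    mul_nonneg (nW_nonneg _) (mul_nonneg hC (nW_nonneg _)), fun z R hR u hu => ?_⟩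
  have hρ := ρ_pos (N := N) z hR
  have := sn_le (k := J) (R := R) (u := Dv (dy n m k) u)
    (B := (ρ N z R)⁻¹ * (C * (nW n m N (N + 1) * sn N (J + (N + 1)) R u))) fun β hβ => by
      rw [XT_Dv_dy, ← div_eq_inv_mul, le_div_iff₀ hρ]
      have h1 := mul_le_mul_of_nonneg_left (h z R hR _ (hu.XT β)) (pow_nonneg hR.le β.length)
      have h2 := norm_sn_XT hR.le β (N + 1) u
      have h3 : sn N (N + 1 + β.length) R u ≤ sn N (J + (N + 1)) R u := sn_mono (by omega) hR.le u
      calc _ = R ^ β.length * (ρ N z R * ‖Dv (dy n m k) (XT n m N β u)‖) := by ring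
        _ ≤ _ := h1
        _ = C * (R ^ β.length * sn N (N + 1) R (XT n m N β u)) := by ring
        _ ≤ C * (nW n m N (N + 1) * sn N (J + (N + 1)) R u) := by
          have := mul_le_mul_of_nonneg_left h3 (nW_nonneg (n := n) (m := m) (N := N) (N + 1))
          exact mul_le_mul_of_nonneg_left (h2.trans this) hC
  calc _ ≤ ρ N z R * (nW n m N J * ((ρ N z R)⁻¹ * (C * (nW n m N (N + 1) * sn N (J + (N + 1)) R u)))) := by
        gcongr
    _ = _ := by field_simp

lemma sn_DY_le (hn : 1 ≤ n) (l : List (Fin m)) (J : ℕ) : ∃ C, 0 ≤ C ∧ ∀ (z : Pt n m) (R : ℝ), 0 < R → ∀ u,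
    Off N z R u → ρ N z R ^ l.length * sn N J R (DY n m l u) ≤ C * sn N (J + l.length * (N + 1)) R u := by
  induction l generalizing J with
  | nil => exact ⟨1, zero_le_one, fun z R hR u _ => by simp [DY]⟩
  | cons k l ih =>
    obtain ⟨C, hC, h⟩ := sn_dy_le (N := N) hn k J
    obtain ⟨D, hD, h'⟩ := ih (J + (N + 1))
    refine ⟨C * D, by positivity, fun z R hR u hu => ?_⟩
    have hρ := ρ_pos (N := N) z hR
    rw [DY_cons, Module.End.mul_apply, List.length_cons, pow_succ]
    calc _ = ρ N z R ^ l.length * (ρ N z R * sn N J R (Dv (dy n m k) (DY n m l u))) := by ring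
      _ ≤ ρ N z R ^ l.length * (C * sn N (J + (N + 1)) R (DY n m l u)) := by
        exact mul_le_mul_of_nonneg_left (h z R hR _ (hu.DY l)) (by positivity)
      _ = C * (ρ N z R ^ l.length * sn N (J + (N + 1)) R (DY n m l u)) := by ring
      _ ≤ C * (D * sn N (J + (N + 1) + l.length * (N + 1)) R u) :=
        mul_le_mul_of_nonneg_left (h' z R hR u hu) hC
      _ = _ := by rw [show J + (N + 1) + l.length * (N + 1) = J + (l.length + 1) * (N + 1) by ring]; ring

lemma DX_eq (l : List (Fin n)) : DX n m l = XT n m N (l.map iX) := by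
  induction l with
  | nil => rfl
  | cons j l ih =>
    rw [DX_cons, ih]
    simp only [List.map_cons, XT, wT_cons]
    congr 1
    ext u : 1
    exact (T_iX j u).symm

lemma norm_Dall_le (hn : 1 ≤ n) : ∃ C, 0 ≤ C ∧ ∀ (z : Pt n m) (R : ℝ), 0 < R → ∀ u,
    Off N z R u → R ^ n * ρ N z R ^ m * ‖Dall n m u‖ ≤ C * sn N (n + m * (N + 1)) R u := by
  obtain ⟨C, hC, h⟩ := sn_DY_le (N := N) hn (List.finRange m) n
  refine ⟨C, hC, fun z R hR u hu => ?_⟩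
  have hρ := ρ_pos (N := N) z hR
  have h1 := h z R hR u hu
  rw [List.length_finRange] at h1
  refine le_trans ?_ h1
  have := le_sn (k := n) hR.le ((List.finRange n).map (iX (m := m) (N := N))) (by simp)
    (DY n m (List.finRange m) u)
  rw [← DX_eq, List.length_map, List.length_finRange] at this
  calc _ = ρ N z R ^ m * (R ^ n * ‖DX n m (List.finRange n) (DY n m (List.finRange m) u)‖) := by
        rw [Dall, Module.End.mul_apply]; ring
    _ ≤ _ := by gcongr

end Embedding

section Embedding
variable {n m N : ℕ}

/-- The volume of the box around `z` of radius `R`. -/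
noncomputable def vol (N : ℕ) (z : Pt n m) (R : ℝ) : ℝ := (2 * R) ^ n * (2 * ρ N z R) ^ m

lemma vol_pos (z : Pt n m) {R : ℝ} (hR : 0 < R) : 0 < vol N z R := by
  have := ρ_pos (N := N) z hR
  unfold vol
  positivity

lemma ofReal_norm_sq (f : TF (Pt n m)) : ENNReal.ofReal (‖f‖ ^ 2) = ∫⁻ w, ‖f w‖ₑ ^ 2 := by
  rw [norm_sq_eq, ofReal_integral_eq_lintegral_ofReal]
  · refine lintegral_congr fun w => ?_
    rw [Real.enorm_eq_ofReal_abs, ← ENNReal.ofReal_pow (abs_nonneg _), sq_abs]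
  · simpa only [sq] using TF.integrable_mul f f
  · exact Filter.Eventually.of_forall fun w => sq_nonneg _

lemma Off.lintegral_le {z : Pt n m} {R : ℝ} (hR : 0 < R) {u : TF (Pt n m)} (hu : Off N z R u) :
    ∫⁻ w, ‖u w‖ₑ ≤ ENNReal.ofReal (√(vol N z R) * ‖u‖) := by
  have hρ := ρ_pos (N := N) z hR
  set S : Set (Pt n m) := Metric.closedBall z.1 R ×ˢ Metric.closedBall z.2 (ρ N z R) with hS
  have hSm : MeasurableSet S := Metric.isClosed_closedBall.measurableSet.prod Metric.isClosed_closedBall.measurableSet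
  have hvol : volume S = ENNReal.ofReal (vol N z R) := by
    rw [hS, Measure.volume_eq_prod, Measure.prod_prod, Real.volume_pi_closedBall _ hR.le,
      Real.volume_pi_closedBall _ hρ.le, ← ENNReal.ofReal_mul (by positivity)]
    simp [vol]
  have h1 : ∫⁻ w, ‖u w‖ₑ = ∫⁻ w in S, ‖u w‖ₑ := by
    rw [← lintegral_indicator hSm]
    refine lintegral_congr fun w => ?_
    by_cases hw : w ∈ S
    · rw [Set.indicator_of_mem hw]
    · rw [Set.indicator_of_notMem hw, hu w, enorm_zero]
      by_contra! h
      exact hw ⟨by simpa [dist_eq_norm] using h.1, by simpa [dist_eq_norm] using h.2⟩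
  have h2 := ENNReal.lintegral_mul_le_Lp_mul_Lq (volume.restrict S) (Real.HolderConjugate.two_two)
    (f := fun w => ‖u w‖ₑ) (g := fun _ => 1) (TF.continuous _).enorm.aemeasurable aemeasurable_const
  have h3 : ∫⁻ w in S, ‖u w‖ₑ ^ (2 : ℝ) ≤ ENNReal.ofReal (‖u‖ ^ 2) := by
    rw [ofReal_norm_sq]
    refine (lintegral_mono' Measure.restrict_le_self le_rfl).trans (le_of_eq (lintegral_congr fun w => ?_))
    norm_cast
  rw [h1]
  simp only [Pi.mul_apply, mul_one, ENNReal.one_rpow, lintegral_const, one_mul,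
    Measure.restrict_apply_univ] at h2
  refine h2.trans ?_
  rw [hvol, mul_comm, ENNReal.ofReal_mul (by positivity), Real.sqrt_eq_rpow,
    ENNReal.ofReal_rpow_of_nonneg (vol_pos z hR).le (by norm_num)]
  gcongr
  refine (ENNReal.rpow_le_rpow h3 (by norm_num)).trans (le_of_eq ?_)
  rw [ENNReal.ofReal_rpow_of_nonneg (by positivity) (by norm_num), ← Real.sqrt_eq_rpow,
    Real.sqrt_sq (norm_nonneg _)]

/-- The scale-invariant Sobolev embedding. -/
lemma sup_le (hn : 1 ≤ n) : ∃ C, 0 ≤ C ∧ ∀ (z : Pt n m) (R : ℝ), 0 < R → ∀ u, Off N z R u → ∀ w,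
    √(vol N z R) * |u w| ≤ C * sn N (n + m * (N + 1)) R u := by
  obtain ⟨C, hC, h⟩ := norm_Dall_le (N := N) (m := m) hn
  refine ⟨2 ^ n * 2 ^ m * C, by positivity, fun z R hR u hu w => ?_⟩
  have h1 := (enorm_le_lintegral_Dall u w).trans (Off.lintegral_le hR (u := Dall n m u)
    ((hu.DY _).DX _))
  rw [Real.enorm_eq_ofReal_abs, ENNReal.ofReal_le_ofReal_iff (by positivity)] at h1
  have h2 := h z R hR u hu
  calc _ ≤ √(vol N z R) * (√(vol N z R) * ‖Dall n m u‖) := by gcongr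
    _ = 2 ^ n * 2 ^ m * (R ^ n * ρ N z R ^ m * ‖Dall n m u‖) := by
      rw [← mul_assoc, Real.mul_self_sqrt (vol_pos z hR).le, vol, mul_pow, mul_pow]; ring
    _ ≤ _ := by rw [mul_assoc _ C]; gcongr

lemma fderiv_eq_sum (u : TF (Pt n m)) (w h : Pt n m) :
    fderiv ℝ u w h = ∑ j, h.1 j * Dv (dx n m j) u w + ∑ k, h.2 k * Dv (dy n m k) u w := by
  have e : h = ∑ j, h.1 j • dx n m j + ∑ k, h.2 k • dy n m k := by
    have h1 : ∑ j, h.1 j • dx n m j = (h.1, 0) := by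
      refine Prod.ext ?_ ?_
      · ext i; simp [Prod.fst_sum, dx, Finset.sum_apply, Pi.single_apply]
      · simp [Prod.snd_sum, dx]
    have h2 : ∑ k, h.2 k • dy n m k = (0, h.2) := by
      refine Prod.ext ?_ ?_
      · simp [Prod.fst_sum, dy]
      · ext i; simp [Prod.snd_sum, dy, Finset.sum_apply, Pi.single_apply]
    rw [h1, h2]; simp
  conv_lhs => rw [e]
  simp only [map_add, map_sum, map_smul, smul_eq_mul, Dv_apply]

lemma osc_le (hn : 1 ≤ n) : ∃ C, 0 ≤ C ∧ ∀ (z : Pt n m) (R r : ℝ), 0 < r → r ≤ R → ∀ u, Off N z R u →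
    ∀ w ∈ Bx N z r, ∀ w' ∈ Bx N z r,
      √(vol N z R) * |u w - u w'| ≤ C * (r / R) * sn N (n + m * (N + 1) + (N + 1)) R u := by
  set J := n + m * (N + 1)
  obtain ⟨C, hC, h⟩ := sup_le (N := N) (m := m) hn
  have hy : ∀ k : Fin m, ∃ C, 0 ≤ C ∧ ∀ (z : Pt n m) (R : ℝ), 0 < R → ∀ u,
    Off N z R u → ρ N z R * sn N J R (Dv (dy n m k) u) ≤ C * sn N (J + (N + 1)) R u :=
    fun k => sn_dy_le hn k J
  choose D hD hy using hy
  have hW := nW_nonneg (n := n) (m := m) (N := N) J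
  refine ⟨∑ _j : Fin n, 2 * C * nW n m N J + ∑ k, 2 * C * D k, add_nonneg
    (Finset.sum_nonneg fun _ _ => by positivity)
    (Finset.sum_nonneg fun k _ => mul_nonneg (by positivity) (hD k)), fun z R r hr hrR u hu w hw w' hw' => ?_⟩
  have hR := hr.trans_le hrR
  have hρ := ρ_pos (N := N) z hR
  set S := sn N (J + (N + 1)) R u with hS
  have hV := Real.sqrt_pos.2 (vol_pos (N := N) z hR)
  set V := √(vol N z R)
  have hρr : ρ N z r ≤ r / R * ρ N z R := by
    have := ρ_half (N := N) z hR (t := r / R) (by positivity) ((div_le_one hR).2 hrR)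
    rwa [div_mul_cancel₀ _ hR.ne'] at this
  have hb1 : ∀ j, |(w.1 - w'.1) j| ≤ 2 * r := fun j => by
    have h1 := norm_le_pi_norm (w.1 - z.1) j
    have h2 := norm_le_pi_norm (w'.1 - z.1) j
    have h3 := (mem_Bx.1 hw).1
    have h4 := (mem_Bx.1 hw').1
    simp only [Pi.sub_apply, Real.norm_eq_abs] at h1 h2 ⊢
    have : w.1 j - w'.1 j = (w.1 j - z.1 j) - (w'.1 j - z.1 j) := by ring
    rw [this]
    exact (abs_sub _ _).trans (by linarith)
  have hb2 : ∀ k, |(w.2 - w'.2) k| ≤ 2 * (r / R * ρ N z R) := fun k => by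
    have h1 := norm_le_pi_norm (w.2 - z.2) k
    have h2 := norm_le_pi_norm (w'.2 - z.2) k
    have h3 := (mem_Bx.1 hw).2
    have h4 := (mem_Bx.1 hw').2
    simp only [Pi.sub_apply, Real.norm_eq_abs] at h1 h2 ⊢
    have : w.2 k - w'.2 k = (w.2 k - z.2 k) - (w'.2 k - z.2 k) := by ring
    rw [this]
    exact (abs_sub _ _).trans (by linarith)
  have hX : ∀ j v, V * |Dv (dx n m j) u v| ≤ C * (R⁻¹ * (nW n m N J * S)) := fun j v => by
    have e : Dv (dx n m j) u = XT n m N [iX j] u := by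
      rw [XT, wT_cons, wT_nil, mul_one]; exact (T_iX j u).symm
    rw [e]
    refine (h z R hR _ (hu.XT _) v).trans ?_
    gcongr
    rw [← div_eq_inv_mul, le_div_iff₀' hR]
    have h1 := norm_sn_XT hR.le [iX (n := n) (m := m) (N := N) j] J u
    simp only [List.length_singleton, pow_one] at h1
    exact h1.trans (mul_le_mul_of_nonneg_left (sn_mono (by omega) hR.le u) hW)
  have hY : ∀ k v, V * |Dv (dy n m k) u v| ≤ C * ((ρ N z R)⁻¹ * (D k * S)) := fun k v => by
    refine (h z R hR _ (hu.Dv _) v).trans ?_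
    gcongr
    rw [← div_eq_inv_mul, le_div_iff₀' hρ]
    exact hy k z R hR u hu
  have hd : ∀ v, |fderiv ℝ u v (w - w')| ≤
      V⁻¹ * ((∑ _j : Fin n, 2 * C * nW n m N J + ∑ k, 2 * C * D k) * (r / R) * S) := fun v => by
    rw [← div_eq_inv_mul, le_div_iff₀' hV, fderiv_eq_sum]
    calc V * |∑ j, (w - w').1 j * Dv (dx n m j) u v + ∑ k, (w - w').2 k * Dv (dy n m k) u v|
        ≤ V * (∑ j, |(w.1 - w'.1) j| * |Dv (dx n m j) u v| + ∑ k, |(w.2 - w'.2) k| * |Dv (dy n m k) u v|) := by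
          gcongr
          refine (abs_add_le _ _).trans (add_le_add ?_ ?_)
          · exact (Finset.abs_sum_le_sum_abs _ _).trans (le_of_eq (by simp only [abs_mul]; rfl))
          · exact (Finset.abs_sum_le_sum_abs _ _).trans (le_of_eq (by simp only [abs_mul]; rfl))
      _ ≤ V * (∑ j, 2 * r * |Dv (dx n m j) u v| + ∑ k, 2 * (r / R * ρ N z R) * |Dv (dy n m k) u v|) := by
          gcongr with j _ k _
          · exact hb1 j
          · exact hb2 k
      _ = ∑ j, 2 * r * (V * |Dv (dx n m j) u v|) + ∑ k, 2 * (r / R * ρ N z R) * (V * |Dv (dy n m k) u v|) := by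
          rw [mul_add, Finset.mul_sum, Finset.mul_sum]
          congr 1 <;> exact Finset.sum_congr rfl fun _ _ => by ring
      _ ≤ ∑ j : Fin n, 2 * r * (C * (R⁻¹ * (nW n m N J * S))) +
          ∑ k, 2 * (r / R * ρ N z R) * (C * ((ρ N z R)⁻¹ * (D k * S))) := by
          refine add_le_add (Finset.sum_le_sum fun j _ => ?_) (Finset.sum_le_sum fun k _ => ?_)
          · exact mul_le_mul_of_nonneg_left (hX j v) (by positivity)
          · exact mul_le_mul_of_nonneg_left (hY k v) (by positivity)
      _ = _ := by
          rw [mul_assoc (_ + _), add_mul, Finset.sum_mul, Finset.sum_mul]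
          congr 1 <;> refine Finset.sum_congr rfl fun _ _ => ?_
          · rw [div_eq_mul_inv]; ring
          · field_simp
  have hmv := Convex.norm_image_sub_le_of_norm_hasDerivWithin_le (f := fun t : ℝ => u (w' + t • (w - w')))
    (f' := fun t => fderiv ℝ u (w' + t • (w - w')) (w - w')) (s := Set.univ) (x := 0) (y := 1)
    (fun t _ => by
      have h1 : HasFDerivAt u (fderiv ℝ u (w' + t • (w - w'))) (w' + t • (w - w')) :=
        (u.differentiable _).hasFDerivAt
      have h2 : HasDerivAt (fun t : ℝ => w' + t • (w - w')) (w - w') t := by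
        simpa using ((hasDerivAt_id t).smul_const (w - w')).const_add w'
      exact (h1.comp_hasDerivAt t h2).hasDerivWithinAt)
    (fun t _ => by rw [Real.norm_eq_abs]; exact hd _) convex_univ (Set.mem_univ _) (Set.mem_univ _)
  simp only [one_smul, add_sub_cancel, zero_smul, add_zero, Real.norm_eq_abs, sub_zero, abs_one, mul_one] at hmv
  calc V * |u w - u w'| ≤ V * _ := mul_le_mul_of_nonneg_left hmv hV.le
    _ = _ := by rw [mul_inv_cancel_left₀ hV.ne']

end Embedding

section Local
variable {n m N : ℕ} {P : Type*} {r : P → ℝ} {χ : P → Sm (Pt n m)}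

lemma sn_cut_le (hχ : UB N r χ) (hr : ∀ p, 0 < r p) {J K M : ℕ} (hJ : J < K) (hM : J ≤ M) :
    ∃ C, 0 ≤ C ∧ ∀ p u, sn N J (r p) (χ p ^ M • u) ≤ C * (cac N r χ K p u + ‖u‖) := by
  choose C hC0 hC using fun j => (hχ.pow (M - j)).bound
  have hlow : ∀ β : List (XIdx n m N), ∃ B, 0 ≤ B ∧ (β.length ≤ J → ∀ p u,
      ‖(r p ^ β.length • (XT n m N β * Mul (χ p ^ M) - Mul (χ p ^ M) * XT n m N β)) u‖ ≤
        B * ∑ j ∈ Finset.range β.length, cac N r χ j p u) := fun β => by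
    by_cases h : β.length ≤ J
    · obtain ⟨B, h0, hB⟩ := Low.bound hχ (Low.comm hχ β (h.trans hM))
      exact ⟨B, h0, fun _ => hB⟩
    · exact ⟨0, le_rfl, fun h' => absurd h' h⟩
  choose B hB0 hB using hlow
  obtain ⟨D, hD0, hD⟩ := cac_le hχ K (ε := 1) one_pos
  have hfin : {β : List (XIdx n m N) | β.length ≤ J}.Finite := List.finite_length_le _ _
  set F : ℝ := ∑ β ∈ hfin.toFinset, (C β.length + B β * β.length) with hF
  have hF1 : ∀ β : List (XIdx n m N), β.length ≤ J → C β.length + B β * β.length ≤ F := fun β hβ =>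
    Finset.single_le_sum (f := fun β : List (XIdx n m N) => C β.length + B β * β.length)
      (fun γ _ => add_nonneg (hC0 _) (mul_nonneg (hB0 γ) (Nat.cast_nonneg _))) (by simpa using hβ)
  have hF0 : 0 ≤ F := Finset.sum_nonneg fun γ _ => add_nonneg (hC0 _) (mul_nonneg (hB0 γ) (Nat.cast_nonneg _))
  refine ⟨nW n m N J * (F * (1 + D)), mul_nonneg (nW_nonneg _) (by positivity), fun p u => ?_⟩
  rw [mul_assoc]
  refine sn_le fun β hβ => ?_
  set Y := cac N r χ K p u + D * ‖u‖
  have hY : ∀ j < K, cac N r χ j p u ≤ Y := fun j hj => by simpa using hD p u j hj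
  have hY0 : 0 ≤ Y := (cac_nonneg _ _ _).trans (hY J hJ)
  have hrp := (hr p).le
  have h1 : r p ^ β.length * ‖χ p ^ M • XT n m N β u‖ ≤ C β.length * Y := by
    have e : χ p ^ M • XT n m N β u = χ p ^ (M - β.length) • χ p ^ β.length • XT n m N β u := by
      rw [smul_smul, ← pow_add, Nat.sub_add_cancel (hβ.trans hM)]
    rw [e]
    have h2 := norm_sm_smul_le (hC0 β.length) (χ p ^ β.length • XT n m N β u)
      fun x _ => hC β.length p x
    have h3 := (le_cac (r := r) (χ := χ) β p u).trans (hY β.length (hβ.trans_lt hJ))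
    rw [abs_of_pos (hr p)] at h3
    calc _ ≤ r p ^ β.length * (C β.length * ‖χ p ^ β.length • XT n m N β u‖) := by gcongr
      _ = C β.length * (r p ^ β.length * ‖χ p ^ β.length • XT n m N β u‖) := by ring
      _ ≤ _ := by have := hC0 β.length; gcongr
  have h2 := hB β hβ p u
  have h3 : ∑ j ∈ Finset.range β.length, cac N r χ j p u ≤ β.length * Y := by
    refine (Finset.sum_le_card_nsmul _ _ Y fun j hj => hY j ?_).trans (le_of_eq (by simp))
    have := Finset.mem_range.1 hj
    omega
  simp only [LinearMap.smul_apply, LinearMap.sub_apply, Module.End.mul_apply, Mul_apply, norm_smul,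
    norm_pow, Real.norm_eq_abs, abs_of_pos (hr p)] at h2
  have h4 := mul_le_mul_of_nonneg_left (norm_le_norm_add_norm_sub
    (XT n m N β (χ p ^ M • u)) (χ p ^ M • XT n m N β u)) (pow_nonneg hrp β.length)
  have h4' := mul_le_mul_of_nonneg_left (norm_le_norm_add_norm_sub'
    (XT n m N β (χ p ^ M • u)) (χ p ^ M • XT n m N β u)) (pow_nonneg hrp β.length)
  have h5 := mul_le_mul_of_nonneg_left h3 (hB0 β)
  calc _ ≤ r p ^ β.length * ‖χ p ^ M • XT n m N β u‖ + r p ^ β.length *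
        ‖XT n m N β (χ p ^ M • u) - χ p ^ M • XT n m N β u‖ := by rw [← mul_add]; exact h4'
    _ ≤ C β.length * Y + B β * (β.length * Y) := by linarith
    _ = (C β.length + B β * β.length) * Y := by ring
    _ ≤ F * Y := by gcongr; exact hF1 β hβ
    _ ≤ F * ((1 + D) * (cac N r χ K p u + ‖u‖)) := by
      refine mul_le_mul_of_nonneg_left ?_ hF0
      have := mul_nonneg hD0 (cac_nonneg (N := N) (r := r) (χ := χ) K p u)
      have := norm_nonneg u
      simp only [Y]
      linarith
    _ = _ := by ring

lemma sn_cut_le_H (hn : 1 ≤ n) (hm : 1 ≤ m) (hN : 1 ≤ N) (hχ : UB N r χ) (hr : ∀ p, 0 < r p)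
    {J K M : ℕ} (hJ : J < 2 * K) (hM : J ≤ M) :
    ∃ C, 0 ≤ C ∧ ∀ p u, sn N J (r p) (χ p ^ M • u) ≤
      C * (r p ^ (2 * K) * ‖χ p ^ (2 * K) • (H n m N ^ K) u‖ + ‖u‖) := by
  obtain ⟨C, hC, h⟩ := sn_cut_le hχ hr hJ hM
  obtain ⟨D, hD, h'⟩ := caccioppoli hn hm hN hχ K
  refine ⟨C * (D + 1), by positivity, fun p u => (h p u).trans ?_⟩
  have h1 := h' p u
  rw [abs_of_pos (hr p)] at h1
  rw [mul_assoc]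
  refine mul_le_mul_of_nonneg_left ?_ hC
  have : 0 ≤ r p ^ (2 * K) * ‖χ p ^ (2 * K) • (H n m N ^ K) u‖ :=
    mul_nonneg (pow_nonneg (hr p).le _) (norm_nonneg _)
  linarith

end Local

section Duality
variable {E F : Type*} [NormedAddCommGroup E] [InnerProductSpace ℝ E] [AddCommGroup F] [Module ℝ F]

lemma riesz_approx (l : E →L[ℝ] ℝ) {ε : ℝ} (hε : 0 < ε) :
    ∃ h : E, ∀ f, |⟪h, f⟫_ℝ - l f| ≤ ε * ‖f‖ := by
  let L : UniformSpace.Completion E →L[ℝ] ℝ := l.extend (UniformSpace.Completion.toComplL)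
  have hL : ∀ f : E, L (f : UniformSpace.Completion E) = l f := fun f =>
    ContinuousLinearMap.extend_eq (e := UniformSpace.Completion.toComplL) l
      (UniformSpace.Completion.denseRange_coe)
      (UniformSpace.Completion.isUniformInducing_coe E) f
  obtain ⟨h, hh⟩ := (UniformSpace.Completion.denseRange_coe (α := E)).exists_dist_lt
    ((InnerProductSpace.toDual ℝ _).symm L) hε
  refine ⟨h, fun f => ?_⟩
  rw [← hL, ← UniformSpace.Completion.inner_coe, ← InnerProductSpace.toDual_symm_apply,
    ← inner_sub_left]
  refine (abs_real_inner_le_norm _ _).trans ?_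
  rw [UniformSpace.Completion.norm_coe, ← dist_eq_norm, dist_comm]
  gcongr

lemma exists_approx_of_dual (S : Submodule ℝ E) (h : ∀ l : E →L[ℝ] ℝ, (∀ x ∈ S, l x = 0) → l = 0)
    (b : E) {ε : ℝ} (hε : 0 < ε) : ∃ x ∈ S, ‖x - b‖ ≤ ε := by
  have hb : b ∈ closure (S : Set E) := by
    by_contra hb
    obtain ⟨f, u, hf, hu⟩ := geometric_hahn_banach_closed_point (S.convex.closure) isClosed_closure hb
    have h0 : f = 0 := h f fun x hx => by
      by_contra hne
      have h1 := hf (((u + 1) / f x) • x) (subset_closure (S.smul_mem _ hx))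
      rw [map_smul, smul_eq_mul, div_mul_cancel₀ _ hne] at h1
      linarith
    have h2 := hf 0 (subset_closure S.zero_mem)
    rw [h0] at h2 hu
    simp only [zero_apply] at h2 hu
    linarith
  obtain ⟨x, hx, hd⟩ := Metric.mem_closure_iff.1 hb ε hε
  exact ⟨x, hx, by rw [← dist_eq_norm, dist_comm]; exact hd.le⟩

lemma exists_dual (K : F →ₗ[ℝ] E) (L : F →ₗ[ℝ] ℝ) {C : ℝ} (hC : 0 ≤ C)
    (h : ∀ φ, |L φ| ≤ C * ‖K φ‖) : ∃ l : E →L[ℝ] ℝ, (∀ f, |l f| ≤ C * ‖f‖) ∧ ∀ φ, l (K φ) = L φ := by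
  have hker : LinearMap.ker K ≤ LinearMap.ker L := fun φ hφ => by
    have := h φ
    rw [LinearMap.mem_ker.1 hφ, norm_zero, mul_zero] at this
    exact abs_nonpos_iff.1 this
  let g : LinearMap.range K →ₗ[ℝ] ℝ :=
    ((LinearMap.ker K).liftQ L hker).comp K.quotKerEquivRange.symm.toLinearMap
  have hg : ∀ φ, g ⟨K φ, φ, rfl⟩ = L φ := fun φ => by
    have : K.quotKerEquivRange.symm ⟨K φ, φ, rfl⟩ = (LinearMap.ker K).mkQ φ := by
      rw [LinearEquiv.symm_apply_eq]; rfl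
    simp only [g, LinearMap.comp_apply, LinearEquiv.coe_coe, this]
    exact Submodule.liftQ_apply _ _ _
  let g' : LinearMap.range K →L[ℝ] ℝ := g.mkContinuous C fun x => by
    obtain ⟨_, φ, rfl⟩ := x
    rw [hg]; exact h φ
  obtain ⟨l, hl, hn⟩ := exists_extension_norm_eq (LinearMap.range K) g'
  refine ⟨l, fun f => (l.le_opNorm f).trans ?_, fun φ => ?_⟩
  · rw [hn]
    gcongr
    exact LinearMap.mkContinuous_norm_le _ hC _
  · exact (hl ⟨K φ, φ, rfl⟩).trans (hg φ)

end Duality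

section Mollifier
set_option linter.unusedSectionVars false
variable {V W : Type*} [NormedAddCommGroup V] [NormedSpace ℝ V]
  [FiniteDimensional ℝ V] [MeasureSpace V] [BorelSpace V] [(volume : Measure V).IsAddHaarMeasure]
  [NormedAddCommGroup W] [NormedSpace ℝ W]
  [FiniteDimensional ℝ W] [MeasureSpace W] [BorelSpace W] [(volume : Measure W).IsAddHaarMeasure]

/-- Translation of a test function. -/
noncomputable def TF.trans (t : V) (f : TF V) : TF V :=
  TF.mk (fun z => f (z - t)) (f.contDiff.comp (contDiff_id.sub contDiff_const))
    (f.hasCompactSupport.comp_homeomorph (Homeomorph.subRight t))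

lemma TF.trans_apply (t : V) (f : TF V) (z : V) : f.trans t z = f (z - t) := rfl

lemma Dv_trans (v t : V) (f : TF V) : Dv v (f.trans t) = (Dv v f).trans t := by
  ext z
  rw [Dv_apply, TF.trans_apply, Dv_apply]
  exact congrArg (· v) (fderiv_comp_sub (𝕜 := ℝ) (f := f) (x := z) t)

lemma inner_trans (t : V) (f g : TF V) : ⟪f.trans t, g⟫_ℝ = ⟪f, g.trans (-t)⟫_ℝ := by
  simp only [inner_eq, TF.trans_apply]
  rw [← integral_add_right_eq_self _ t]
  simp

lemma norm_trans (t : V) (f : TF V) : ‖f.trans t‖ = ‖f‖ := by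
  have : ‖f.trans t‖ ^ 2 = ‖f‖ ^ 2 := by
    simp only [norm_sq_eq, TF.trans_apply]
    exact integral_sub_right_eq_self (fun z => f z ^ 2) t
  exact (pow_left_inj₀ (norm_nonneg _) (norm_nonneg _) two_ne_zero).1 this

lemma continuous_inner_trans (i : W →L[ℝ] V) (f g : TF V) :
    Continuous fun t => ⟪f.trans (i t), g⟫_ℝ := by
  simp only [inner_eq, TF.trans_apply]
  rw [← continuousOn_univ]
  refine continuousOn_integral_of_compact_support (k := tsupport g) g.hasCompactSupport ?_ fun t z _ hz => ?_
  · have := f.continuous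
    have := g.continuous
    exact Continuous.continuousOn (by fun_prop)
  · rw [image_eq_zero_of_notMem_tsupport hz, mul_zero]

lemma moll_contDiff (i : W →L[ℝ] V) (ρ : TF W) (f : TF V) :
    ContDiff ℝ ∞ fun z => ∫ t, ρ t * f (z - i t) := by
  have h := contDiffOn_convolution_right_with_param (n := ⊤) (μ := (volume : Measure W))
    (f := fun _ => (1 : ℝ)) (ContinuousLinearMap.mul ℝ ℝ)
    (g := fun (z : V) t => ρ (-t) * f (z + i t)) (s := Set.univ) (k := -tsupport ρ) isOpen_univ
    ρ.hasCompactSupport.isCompact.neg (fun z t _ ht => by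
      rw [image_eq_zero_of_notMem_tsupport (f := ρ) (by simpa using ht), zero_mul])
    (locallyIntegrable_const 1) (by
      have h1 := ρ.contDiff
      have h2 := f.contDiff
      refine ContDiff.contDiffOn ?_
      have h3 : ContDiff ℝ ∞ fun q : V × W => ρ (-q.2) := h1.comp contDiff_snd.neg
      have h4 : ContDiff ℝ ∞ fun q : V × W => f (q.1 + i q.2) :=
        h2.comp (contDiff_fst.add (i.contDiff.comp contDiff_snd))
      exact h3.mul h4)
  rw [Set.univ_prod_univ, contDiffOn_univ] at h
  have h' := h.comp (contDiff_prodMk_left (0 : W))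
  have e : (fun z => ∫ t, ρ t * f (z - i t)) = (fun q : V × W => convolution (fun _ : W => (1 : ℝ))
      (fun t => ρ (-t) * f (q.1 + i t)) (ContinuousLinearMap.mul ℝ ℝ) volume q.2) ∘
      fun z => (z, 0) := by
    funext z
    simp [convolution_def, sub_eq_add_neg]
  rw [e]
  exact h'

/-- Convolution with the push-forward of `ρ` along `i`. -/
noncomputable def moll (i : W →L[ℝ] V) (ρ : TF W) : TF V →ₗ[ℝ] TF V where
  toFun f := TF.mk (fun z => ∫ t, ρ t * f (z - i t)) (moll_contDiff i ρ f)
    (HasCompactSupport.intro (f.hasCompactSupport.isCompact.add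
      (ρ.hasCompactSupport.isCompact.image i.continuous)) fun z hz => by
      refine integral_eq_zero_of_ae (Filter.Eventually.of_forall fun t => ?_)
      by_contra h
      exact hz ⟨z - i t, subset_tsupport _ (right_ne_zero_of_mul h), i t,
        ⟨t, subset_tsupport _ (left_ne_zero_of_mul h), rfl⟩, by simp⟩)
  map_add' f g := by
    ext z
    simp only [TF.coe_mk, TF.add_apply, mul_add]
    have h : ∀ f : TF V, Integrable (fun t => ρ t * f (z - i t)) (volume : Measure W) := fun f =>
      ρ.integrable_mul_cont (f.continuous.comp (by fun_prop))
    exact integral_add (h f) (h g)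
  map_smul' c f := by
    ext z
    simp only [TF.coe_mk, TF.smul_apply, RingHom.id_apply, ← integral_const_mul]
    exact integral_congr_ae (Filter.Eventually.of_forall fun t => by simp; ring)

lemma moll_apply (i : W →L[ℝ] V) (ρ : TF W) (f : TF V) (z : V) :
    moll i ρ f z = ∫ t, ρ t * f (z - i t) := rfl

lemma inner_moll (i : W →L[ℝ] V) (ρ : TF W) (f g : TF V) :
    ⟪moll i ρ f, g⟫_ℝ = ∫ t, ρ t * ⟪f.trans (i t), g⟫_ℝ := by
  simp only [inner_eq, moll_apply, TF.trans_apply, ← integral_const_mul, ← integral_mul_const]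
  rw [integral_integral_swap_of_hasCompactSupport]
  · simp only [mul_assoc]
  · have := f.continuous
    have := g.continuous
    have := ρ.continuous
    show Continuous fun q : V × W => ρ q.2 * f (q.1 - i q.2) * g q.1
    fun_prop
  · refine HasCompactSupport.intro (g.hasCompactSupport.isCompact.prod ρ.hasCompactSupport.isCompact)
      fun q hq => ?_
    simp only [Function.uncurry]
    by_contra h
    exact hq ⟨subset_tsupport _ (right_ne_zero_of_mul h),
      subset_tsupport _ (left_ne_zero_of_mul (left_ne_zero_of_mul h))⟩

lemma inner_moll_symm (i : W →L[ℝ] V) {ρ : TF W} (hρ : ∀ t, ρ (-t) = ρ t) (f g : TF V) :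
    ⟪moll i ρ f, g⟫_ℝ = ⟪f, moll i ρ g⟫_ℝ := by
  rw [inner_moll, real_inner_comm, inner_moll, ← integral_neg_eq_self]
  refine integral_congr_ae (Filter.Eventually.of_forall fun t => ?_)
  simp only [hρ, map_neg]
  rw [inner_trans, neg_neg, real_inner_comm]

lemma norm_moll_le (i : W →L[ℝ] V) (ρ : TF W) (f : TF V) :
    ‖moll i ρ f‖ ≤ (∫ t, |ρ t|) * ‖f‖ := by
  have h : ‖moll i ρ f‖ * ‖moll i ρ f‖ ≤ (∫ t, |ρ t|) * ‖f‖ * ‖moll i ρ f‖ := by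
    rw [← real_inner_self_eq_norm_mul_norm, inner_moll, mul_assoc, ← integral_mul_const]
    refine integral_mono (ρ.integrable_mul_cont (continuous_inner_trans i f _))
      ((TF.integrable ρ).abs.mul_const _) fun t => ?_
    refine (le_abs_self _).trans ?_
    rw [abs_mul]
    refine mul_le_mul_of_nonneg_left ((abs_real_inner_le_norm _ _).trans ?_) (abs_nonneg _)
    rw [norm_trans]
  rcases (norm_nonneg (moll i ρ f)).eq_or_lt with h0 | h0
  · rw [← h0]
    exact mul_nonneg (integral_nonneg fun _ => abs_nonneg _) (norm_nonneg _)
  · exact le_of_mul_le_mul_right h h0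

lemma Dv_moll (i : W →L[ℝ] V) (ρ : TF W) (v : V) (f : TF V) :
    Dv v (moll i ρ f) = moll i ρ (Dv v f) := by
  refine ext_inner_right ℝ fun g => ?_
  rw [inner_Dv, inner_moll, inner_moll, ← integral_neg]
  refine integral_congr_ae (Filter.Eventually.of_forall fun t => ?_)
  simp only [← Dv_trans, inner_Dv, mul_neg]

lemma moll_Dv (i : W →L[ℝ] V) (ρ : TF W) (w : W) (f : TF V) :
    moll i ρ (Dv (i w) f) = moll i (Dv w ρ) f := by
  ext z
  let κ : Sm W := Sm.mk (fun t => f (z - i t)) (f.contDiff.comp (contDiff_const.sub i.contDiff))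
  have h := TF.integral_Dv_mul w ρ κ
  have hκ : ∀ t, Ds w κ t = -Dv (i w) f (z - i t) := fun t => by
    rw [Ds_apply, Dv_apply]
    have h1 : HasFDerivAt (fun t => z - i t) (-(i : W →L[ℝ] V)) t := i.hasFDerivAt.const_sub z
    have h2 := (f.differentiable (z - i t)).hasFDerivAt.comp t h1
    have h3 : fderiv ℝ κ t = _ := h2.fderiv
    rw [h3]
    simp
  simp only [moll_apply]
  rw [← neg_neg (∫ t, ρ t * Dv (i w) f (z - i t)), ← integral_neg]
  have h4 : ∫ t, κ t * Dv w ρ t = ∫ t, Dv w ρ t * f (z - i t) :=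
    integral_congr_ae (Filter.Eventually.of_forall fun t => mul_comm _ _)
  rw [← h4, h]
  congr 1
  exact integral_congr_ae (Filter.Eventually.of_forall fun t => by simp only [hκ]; ring)

lemma moll_smul (i : W →L[ℝ] V) (ρ : TF W) {c : Sm V} (hc : ∀ z t, c (z - i t) = c z) (f : TF V) :
    moll i ρ (c • f) = c • moll i ρ f := by
  ext z
  simp only [moll_apply, TF.sm_smul_apply, hc, ← integral_const_mul]
  exact integral_congr_ae (Filter.Eventually.of_forall fun t => by ring)

lemma exists_moll_approx (i : W →L[ℝ] V) (f : TF V) {ε : ℝ} (hε : 0 < ε) :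
    ∃ ρ : TF W, (∀ t, ρ (-t) = ρ t) ∧ ‖moll i ρ f - f‖ ≤ ε := by
  have hc : Continuous fun t : W => ‖f.trans (i t) - f‖ ^ 2 := by
    have : ∀ t : W, ‖f.trans (i t) - f‖ ^ 2 = ‖f‖ ^ 2 - 2 * ⟪f.trans (i t), f⟫_ℝ + ‖f‖ ^ 2 := fun t => by
      rw [norm_sub_sq_real, norm_trans]
    simp only [this]
    have := continuous_inner_trans i f f
    fun_prop
  have h0 : f.trans (i 0) = f := by ext z; simp [TF.trans_apply]
  obtain ⟨δ, hδ, hd⟩ := Metric.continuousAt_iff.1 (hc.continuousAt (x := 0)) (ε ^ 2) (by positivity)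
  have hd' : ∀ t : W, ‖t‖ < δ → ‖f.trans (i t) - f‖ ≤ ε := fun t ht => by
    have := hd (x := t) (by simpa using ht)
    rw [h0] at this
    simp only [sub_self, norm_zero, ne_eq, OfNat.ofNat_ne_zero, not_false_eq_true, zero_pow,
      dist_zero_right, norm_pow, norm_norm] at this
    exact le_of_lt (lt_of_pow_lt_pow_left₀ 2 hε.le this)
  let b : ContDiffBump (0 : W) := ⟨δ / 4, δ / 2, by positivity, by linarith⟩
  let ρ : TF W := TF.mk (b.normed volume) b.contDiff_normed b.hasCompactSupport_normed
  have hint : ∫ t, ρ t = 1 := b.integral_normed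
  refine ⟨ρ, b.normed_neg, ?_⟩
  set g := moll i ρ f - f with hg
  have h : ‖g‖ * ‖g‖ ≤ ε * ‖g‖ := by
    have e : ⟪g, g⟫_ℝ = ∫ t, ρ t * ⟪f.trans (i t) - f, g⟫_ℝ := by
      simp only [inner_sub_left _ _ g, mul_sub]
      rw [integral_sub (ρ.integrable_mul_cont (continuous_inner_trans i f _))
        ((TF.integrable ρ).mul_const _), ← inner_moll, integral_mul_const, hint, one_mul, ← inner_sub_left]
    have e2 : ε * ‖g‖ = ∫ t, ρ t * (ε * ‖g‖) := by rw [integral_mul_const, hint, one_mul]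
    rw [← real_inner_self_eq_norm_mul_norm, e, e2]
    refine integral_mono ?_ ((TF.integrable ρ).mul_const _) fun t => ?_
    · refine ρ.integrable_mul_cont ?_
      simp only [inner_sub_left]
      exact (continuous_inner_trans i f _).sub continuous_const
    · by_cases ht : ‖t‖ < δ
      · refine mul_le_mul_of_nonneg_left ((real_inner_le_norm _ _).trans ?_) (b.nonneg_normed t)
        gcongr
        exact hd' t ht
      · have : ρ t = 0 := by
          by_contra h
          have := b.support_normed_eq (μ := (volume : Measure W)) ▸ (show t ∈ Function.support (b.normed volume) from h)
          have h' : ‖t‖ < δ / 2 := by simpa using this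
          linarith
        simp [this]
  rcases (norm_nonneg g).eq_or_lt with h0 | h0
  · rw [← h0]; exact hε.le
  · exact le_of_mul_le_mul_right h h0

end Mollifier

section Laplacian
set_option linter.unusedSectionVars false
variable {V : Type*} [NormedAddCommGroup V] [NormedSpace ℝ V]
  [FiniteDimensional ℝ V] [MeasureSpace V] [BorelSpace V] [(volume : Measure V).IsAddHaarMeasure]
  {ι : Type*} [Fintype ι]

/-- The constant-coefficient derivative along a word of directions. -/
noncomputable def DW (e : ι → V) (l : List ι) : Module.End ℝ (TF V) := (l.map fun i => Dv (e i)).prod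

@[simp] lemma DW_nil (e : ι → V) : DW e [] = 1 := rfl
@[simp] lemma DW_cons (e : ι → V) (i : ι) (l : List ι) : DW e (i :: l) = Dv (e i) * DW e l := by
  simp [DW]
lemma DW_append (e : ι → V) (l l' : List ι) : DW e (l ++ l') = DW e l * DW e l' := by
  simp [DW]

/-- The operator `1 - Σ ∂_{e_i}²`. -/
noncomputable def lap (e : ι → V) : Module.End ℝ (TF V) := 1 - ∑ i, Dv (e i) ^ 2

lemma commute_Dv (v w : V) : Commute (Dv v : Module.End ℝ (TF V)) (Dv w) :=
  LinearMap.ext fun f => Dv_comm v w f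

lemma commute_Dv_DW (v : V) (e : ι → V) (l : List ι) : Commute (Dv v : Module.End ℝ (TF V)) (DW e l) :=
  Commute.list_prod_right _ _ fun x hx => by
    obtain ⟨i, -, rfl⟩ := List.mem_map.1 hx
    exact commute_Dv _ _

lemma commute_DW_lap (v : V) (e : ι → V) : Commute (Dv v : Module.End ℝ (TF V)) (lap e) :=
  (Commute.one_right _).sub_right (Commute.sum_right _ _ _ fun i _ => (commute_Dv v (e i)).pow_right 2)

lemma DW_lap (e : ι → V) (l : List ι) (k : ℕ) (f : TF V) :
    DW e l ((lap e ^ k) f) = (lap e ^ k) (DW e l f) := by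
  have h : Commute (DW e l) (lap e ^ k) := Commute.pow_right (Commute.list_prod_left _ _ fun x hx => by
    obtain ⟨i, -, rfl⟩ := List.mem_map.1 hx
    exact commute_DW_lap _ _) k
  exact LinearMap.congr_fun h f

lemma inner_lap_self (e : ι → V) (f : TF V) : ⟪lap e f, f⟫_ℝ = ‖f‖ ^ 2 + ∑ i, ‖Dv (e i) f‖ ^ 2 := by
  simp only [lap, LinearMap.sub_apply, Module.End.one_apply, LinearMap.sum_apply, pow_two,
    Module.End.mul_apply, inner_sub_left, sum_inner, inner_Dv, Finset.sum_neg_distrib,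
    real_inner_self_eq_norm_mul_norm, sub_neg_eq_add]

lemma inner_lap (e : ι → V) (f g : TF V) : ⟪lap e f, g⟫_ℝ = ⟪f, lap e g⟫_ℝ := by
  simp only [lap, LinearMap.sub_apply, Module.End.one_apply, LinearMap.sum_apply, pow_two,
    Module.End.mul_apply, inner_sub_left, inner_sub_right, sum_inner, inner_sum, inner_Dv, neg_neg]

lemma inner_lap_pow (e : ι → V) (k : ℕ) (f g : TF V) : ⟪(lap e ^ k) f, g⟫_ℝ = ⟪f, (lap e ^ k) g⟫_ℝ := by
  induction k generalizing f g with
  | zero => rfl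
  | succ k ih =>
    rw [pow_succ, Module.End.mul_apply, ih, inner_lap, ← Module.End.mul_apply, ← pow_succ', pow_succ]

lemma norm_le_lap (e : ι → V) (f : TF V) : ‖f‖ ≤ ‖lap e f‖ := by
  by_contra! h
  have h1 := real_inner_le_norm (lap e f) f
  have h2 : 0 ≤ ∑ i, ‖Dv (e i) f‖ ^ 2 := by positivity
  rw [inner_lap_self] at h1
  nlinarith [norm_nonneg (lap e f), norm_nonneg f]

lemma norm_Dv_le_lap (e : ι → V) (i : ι) (f : TF V) : ‖Dv (e i) f‖ ≤ ‖lap e f‖ := by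
  have h1 := real_inner_le_norm (lap e f) f
  have h2 := Finset.single_le_sum (f := fun i => ‖Dv (e i) f‖ ^ 2) (fun _ _ => by positivity)
    (Finset.mem_univ i)
  rw [inner_lap_self] at h1
  have h3 := norm_le_lap e f
  refine le_of_sq_le_sq ?_ (norm_nonneg _)
  nlinarith [norm_nonneg (lap e f), norm_nonneg f]

lemma norm_lap_sq (e : ι → V) (f : TF V) :
    ‖lap e f‖ ^ 2 = ⟪lap e f, f⟫_ℝ + ∑ i, ⟪lap e (Dv (e i) f), Dv (e i) f⟫_ℝ := by
  have h : ∀ i, lap e (Dv (e i) f) = Dv (e i) (lap e f) := fun i =>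
    (LinearMap.congr_fun (commute_DW_lap (e i) e) f).symm
  simp only [h, inner_Dv, Finset.sum_neg_distrib, ← inner_sum, ← sub_eq_add_neg, ← inner_sub_right]
  rw [← real_inner_self_eq_norm_sq]
  congr 1
  simp [lap, pow_two]

lemma norm_Dv_Dv_le_lap (e : ι → V) (i j : ι) (f : TF V) : ‖Dv (e j) (Dv (e i) f)‖ ≤ ‖lap e f‖ := by
  refine le_of_sq_le_sq ?_ (norm_nonneg _)
  have h0 : ∀ g : TF V, 0 ≤ ⟪lap e g, g⟫_ℝ := fun g => by rw [inner_lap_self]; positivity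
  have h1 := Finset.single_le_sum (f := fun i => ⟪lap e (Dv (e i) f), Dv (e i) f⟫_ℝ) (fun _ _ => h0 _)
    (Finset.mem_univ i)
  have h2 := Finset.single_le_sum (f := fun j => ‖Dv (e j) (Dv (e i) f)‖ ^ 2) (fun _ _ => by positivity)
    (Finset.mem_univ j)
  have h3 := inner_lap_self e (Dv (e i) f)
  rw [norm_lap_sq]
  nlinarith [h0 f, norm_nonneg (Dv (e i) f)]

lemma norm_DW_le_lap (e : ι → V) (k : ℕ) (l : List ι) (hl : l.length ≤ 2 * k) (f : TF V) :
    ‖DW e l f‖ ≤ ‖(lap e ^ k) f‖ := by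
  induction k generalizing l f with
  | zero =>
    obtain rfl : l = [] := List.length_eq_zero_iff.1 (by omega)
    simp
  | succ k ih =>
    rw [pow_succ, Module.End.mul_apply]
    match l, hl with
    | [], _ => exact (norm_le_lap e f).trans (ih [] (by simp) _)
    | [i], _ =>
      simpa using (norm_Dv_le_lap e i f).trans (ih [] (by simp) (lap e f))
    | i :: j :: l, hl =>
      have h := DW_lap e l 1 f
      rw [pow_one] at h
      rw [DW_cons, DW_cons, Module.End.mul_apply, Module.End.mul_apply]
      refine (norm_Dv_Dv_le_lap e j i _).trans ?_
      rw [← h]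
      exact ih l (by simp at hl; omega) _

lemma norm_le_lap_pow (e : ι → V) (k : ℕ) (f : TF V) : ‖f‖ ≤ ‖(lap e ^ k) f‖ :=
  norm_DW_le_lap e k [] (by simp) f

lemma norm_lap_pow_mono (e : ι → V) {j k : ℕ} (h : j ≤ k) (f : TF V) :
    ‖(lap e ^ j) f‖ ≤ ‖(lap e ^ k) f‖ := by
  obtain ⟨l, rfl⟩ := Nat.exists_eq_add_of_le' h
  rw [pow_add, Module.End.mul_apply]
  exact norm_le_lap_pow e l _

/-- The functional `f ↦ ℓ (B f)` of a bounded operator `B`. -/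
noncomputable def pull (ℓ : TF V →L[ℝ] ℝ) (B : TF V →ₗ[ℝ] TF V) (C : ℝ) (h : ∀ f, ‖ℓ (B f)‖ ≤ C * ‖f‖) :
    TF V →L[ℝ] ℝ :=
  LinearMap.mkContinuous (ℓ.toLinearMap ∘ₗ B) C h

lemma pull_apply (ℓ : TF V →L[ℝ] ℝ) (B : TF V →ₗ[ℝ] TF V) (C : ℝ) (h : ∀ f, ‖ℓ (B f)‖ ≤ C * ‖f‖)
    (f : TF V) : pull ℓ B C h f = ℓ (B f) := rfl

lemma lap_moll (e : ι → V) (ρ : TF V) (f : TF V) :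
    lap e (moll (.id ℝ V) ρ f) = moll (.id ℝ V) (lap e ρ) f := by
  have h : ∀ i, Dv (e i) (Dv (e i) (moll (.id ℝ V) ρ f)) =
      moll (.id ℝ V) (Dv (e i) (Dv (e i) ρ)) f := fun i => by
    rw [Dv_moll, Dv_moll, ← moll_Dv, ← moll_Dv]
    rfl
  have hlin : ∀ ρ₁ ρ₂ : TF V, moll (.id ℝ V) (ρ₁ - ρ₂) f = moll (.id ℝ V) ρ₁ f - moll (.id ℝ V) ρ₂ f := by
    intro ρ₁ ρ₂
    ext z
    simp only [moll_apply, TF.sub_apply, sub_mul]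
    have h : ∀ ρ : TF V, Integrable (fun t => ρ t * f (z - t)) (volume : Measure V) := fun ρ =>
      ρ.integrable_mul_cont (f.continuous.comp (by fun_prop))
    exact integral_sub (h _) (h _)
  have hsum : ∀ s : Finset ι, ∑ i ∈ s, moll (.id ℝ V) (Dv (e i) (Dv (e i) ρ)) f =
      moll (.id ℝ V) (∑ i ∈ s, Dv (e i) (Dv (e i) ρ)) f := by
    classical
    intro s
    induction s using Finset.induction_on with
    | empty => ext z; simp [moll_apply]
    | insert i s hi ih =>
      rw [Finset.sum_insert hi, Finset.sum_insert hi, ih, ← sub_neg_eq_add, ← sub_neg_eq_add, hlin,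
        sub_right_inj, ← zero_sub, ← zero_sub, hlin, sub_left_inj]
      ext z; simp [moll_apply]
  simp only [lap, LinearMap.sub_apply, Module.End.one_apply, LinearMap.sum_apply, pow_two,
    Module.End.mul_apply, h, hsum, hlin]

lemma lap_pow_moll (e : ι → V) (ρ : TF V) (k : ℕ) (f : TF V) :
    (lap e ^ k) (moll (.id ℝ V) ρ f) = moll (.id ℝ V) ((lap e ^ k) ρ) f := by
  induction k generalizing ρ with
  | zero => rfl
  | succ k ih => rw [pow_succ, Module.End.mul_apply, lap_moll, ih, ← Module.End.mul_apply, ← pow_succ]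

lemma lap_pow_moll' (e : ι → V) (ρ : TF V) (k : ℕ) (f : TF V) :
    (lap e ^ k) (moll (.id ℝ V) ρ f) = moll (.id ℝ V) ρ ((lap e ^ k) f) := by
  have h1 : ∀ f, lap e (moll (.id ℝ V) ρ f) = moll (.id ℝ V) ρ (lap e f) := fun f => by
    simp only [lap, LinearMap.sub_apply, Module.End.one_apply, LinearMap.sum_apply, pow_two,
      Module.End.mul_apply, map_sub, map_sum, Dv_moll]
  induction k generalizing f with
  | zero => rfl
  | succ k ih => rw [pow_succ, Module.End.mul_apply, Module.End.mul_apply, h1, ih]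

lemma eq_zero_of_forall_moll {W : Type*} [NormedAddCommGroup W] [NormedSpace ℝ W]
    [FiniteDimensional ℝ W] [MeasureSpace W] [BorelSpace W] [(volume : Measure W).IsAddHaarMeasure]
    (i : W →L[ℝ] V) (ℓ : TF V →L[ℝ] ℝ)
    (h : ∀ ρ : TF W, (∀ t, ρ (-t) = ρ t) → ∀ f, ℓ (moll i ρ f) = 0) : ℓ = 0 := by
  ext f
  refine abs_eq_zero.1 (le_antisymm (le_of_forall_pos_le_add fun ε hε => ?_) (abs_nonneg _))
  obtain ⟨ρ, hρ, hf⟩ := exists_moll_approx i f (div_pos hε (by positivity : 0 < ‖ℓ‖ + 1))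
  have h1 := ℓ.le_opNorm (moll i ρ f - f)
  rw [map_sub, h ρ hρ, zero_sub, norm_neg, Real.norm_eq_abs] at h1
  have h2 : ‖ℓ‖ * ‖moll i ρ f - f‖ ≤ (‖ℓ‖ + 1) * (ε / (‖ℓ‖ + 1)) := by
    refine mul_le_mul (by linarith) hf (norm_nonneg _) (by positivity)
  rw [mul_div_cancel₀ _ (by positivity)] at h2
  linarith

/-- The range of every power of `1 - Δ` on test functions is dense. -/
theorem lap_pow_dense (e : ι → V) (k : ℕ) (b : TF V) {ε : ℝ} (hε : 0 < ε) :
    ∃ θ, ‖(lap e ^ k) θ - b‖ ≤ ε := by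
  obtain ⟨x, ⟨θ, rfl⟩, h⟩ := exists_approx_of_dual (LinearMap.range (lap e ^ k)) (fun ℓ hℓ => by
    refine eq_zero_of_forall_moll (.id ℝ V) ℓ fun ρ hρ f => ?_
    set C := (∫ t, |((lap e ^ k) ρ) t|) with hC
    have hC0 : 0 ≤ C := integral_nonneg fun _ => abs_nonneg _
    refine abs_eq_zero.1 (le_antisymm (le_of_forall_pos_le_add fun δ hδ => ?_) (abs_nonneg _))
    set D := (∫ t, |ρ t|) + C with hD
    have hD0 : 0 ≤ D := add_nonneg (integral_nonneg fun _ => abs_nonneg _) hC0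
    obtain ⟨h, hh⟩ := riesz_approx ℓ (div_pos hδ (by positivity : 0 < (D * ‖f‖ + 1)))
    set η := δ / (D * ‖f‖ + 1)
    have hη : 0 < η := by positivity
    have h1 : ∀ g, ⟪(lap e ^ k) (moll (.id ℝ V) ρ h), g⟫_ℝ ≤ η * C * ‖g‖ := fun g => by
      have h2 := hh ((lap e ^ k) (moll (.id ℝ V) ρ g))
      rw [hℓ _ ⟨_, rfl⟩, sub_zero] at h2
      rw [inner_lap_pow, inner_moll_symm _ hρ, ← lap_pow_moll', mul_assoc]
      refine (le_abs_self _).trans (h2.trans (mul_le_mul_of_nonneg_left ?_ hη.le))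
      rw [lap_pow_moll]
      exact norm_moll_le _ _ _
    have h3 : ‖moll (.id ℝ V) ρ h‖ ≤ η * C := by
      refine (norm_le_lap_pow e k _).trans ?_
      have h2 := h1 ((lap e ^ k) (moll (.id ℝ V) ρ h))
      rw [real_inner_self_eq_norm_mul_norm] at h2
      by_contra! h4
      nlinarith [norm_nonneg ((lap e ^ k) (moll (.id ℝ V) ρ h)), mul_nonneg hη.le hC0]
    have h4 := hh (moll (.id ℝ V) ρ f)
    have h5 := abs_real_inner_le_norm (moll (.id ℝ V) ρ h) f
    rw [inner_moll_symm _ hρ] at h5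
    have h6 := mul_le_mul_of_nonneg_left (norm_moll_le (.id ℝ V) ρ f) hη.le
    have h7 := mul_le_mul_of_nonneg_right h3 (norm_nonneg f)
    have h8 : η * (D * ‖f‖ + 1) = δ := div_mul_cancel₀ _ (by positivity)
    rw [zero_add]
    calc |ℓ (moll (.id ℝ V) ρ f)| = |⟪h, moll (.id ℝ V) ρ f⟫_ℝ -
          (⟪h, moll (.id ℝ V) ρ f⟫_ℝ - ℓ (moll (.id ℝ V) ρ f))| := by rw [sub_sub_cancel]
      _ ≤ |⟪h, moll (.id ℝ V) ρ f⟫_ℝ| + |⟪h, moll (.id ℝ V) ρ f⟫_ℝ - ℓ (moll (.id ℝ V) ρ f)| :=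
        abs_sub _ _
      _ ≤ δ := by rw [hD] at h8; nlinarith) b hε
  exact ⟨θ, h⟩

end Laplacian

section Regularity
set_option linter.unusedSectionVars false
variable {n m : ℕ} {N : ℕ}

/-- The elliptic operator `1 - Δ_x - Δ_y`. -/
noncomputable def ell (n m : ℕ) : Module.End ℝ (TF (Pt n m)) := lap (Sum.elim (dx n m) (dy n m))

lemma ell_eq : ell n m = 1 - (∑ j, Dv (dx n m j) ^ 2 + ∑ k, Dv (dy n m k) ^ 2) := by
  simp [ell, lap, Fintype.sum_sum_type]

lemma DX_eq_DW (γ : List (Fin n)) : DX n m γ = DW (Sum.elim (dx n m) (dy n m)) (γ.map Sum.inl) := by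
  simp [DX, DW, Function.comp_def]

lemma DY_eq_DW (b : List (Fin m)) : DY n m b = DW (Sum.elim (dx n m) (dy n m)) (b.map Sum.inr) := by
  simp [DY, DW, Function.comp_def]

lemma DX_append (γ δ : List (Fin n)) : DX n m (γ ++ δ) = DX n m γ * DX n m δ := DW_append _ _ _
lemma DY_append (γ δ : List (Fin m)) : DY n m (γ ++ δ) = DY n m γ * DY n m δ := DW_append _ _ _
@[simp] lemma DX_nil : DX n m [] = 1 := rfl
@[simp] lemma DY_nil : DY n m [] = 1 := rfl

lemma H_eq : H n m N = -∑ j, Dv (dx n m j) ^ 2 -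
    ∑ k, Mul (liftS (m := m) (pot n N)) * Dv (dy n m k) ^ 2 := by
  have e : (∑ i, xs n m i ^ 2) ^ N = liftS (pot n N) := by
    simp [pot, map_sum, liftS_rx]
  ext1 f
  rw [H_apply, e]
  simp [pow_two]

lemma Ds_liftS (v : Pt n m) (a : Sm (Fin n → ℝ)) :
    Ds v (liftS (m := m) a) = liftS (Ds v.1 a) := by
  ext z
  have h : HasFDerivAt (fun z : Pt n m => a z.1) ((fderiv ℝ a z.1).comp (ContinuousLinearMap.fst ℝ _ _)) z :=
    HasFDerivAt.comp z (a.contDiff.differentiable (by simp) z.1).hasFDerivAt hasFDerivAt_fst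
  rw [Ds_apply, liftS_apply, Ds_apply]
  exact congrArg (· v) h.fderiv

/-- Differential operators of order at most `J` in `x` and of any order in `y`, with compactly supported
coefficients depending on `x` only. -/
noncomputable def Opx (n m J : ℕ) : Submodule ℝ (Module.End ℝ (TF (Pt n m))) :=
  Submodule.span ℝ {T | ∃ (c : TF (Fin n → ℝ)) (γ : List (Fin n)) (b : List (Fin m)), γ.length ≤ J ∧
    T = Mul (liftS c.toSm) * (DX n m γ * DY n m b)}

lemma Opx_gen {J : ℕ} (c : TF (Fin n → ℝ)) (γ : List (Fin n)) (b : List (Fin m)) (h : γ.length ≤ J) :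
    Mul (liftS c.toSm) * (DX n m γ * DY n m b) ∈ Opx n m J :=
  Submodule.subset_span ⟨c, γ, b, h, rfl⟩

lemma Opx_mono {J J' : ℕ} (h : J ≤ J') : Opx n m J ≤ Opx n m J' :=
  Submodule.span_mono fun _ ⟨c, γ, b, hγ, e⟩ => ⟨c, γ, b, hγ.trans h, e⟩

/-- Induction principle for linear maps between these spaces. -/
lemma Opx_map {J : ℕ} (F : Module.End ℝ (TF (Pt n m)) →ₗ[ℝ] Module.End ℝ (TF (Pt n m)))
    (S : Submodule ℝ (Module.End ℝ (TF (Pt n m))))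
    (h : ∀ (c : TF (Fin n → ℝ)) (γ : List (Fin n)) (b : List (Fin m)), γ.length ≤ J →
      F (Mul (liftS c.toSm) * (DX n m γ * DY n m b)) ∈ S) {T : Module.End ℝ (TF (Pt n m))}
    (hT : T ∈ Opx n m J) : F T ∈ S := by
  have : Opx n m J ≤ S.comap F := by
    refine Submodule.span_le.2 ?_
    rintro _ ⟨c, γ, b, hγ, rfl⟩
    exact h c γ b hγ
  exact this hT

lemma commute_dx_DD (v : Pt n m) (γ : List (Fin n)) (b : List (Fin m)) :
    Commute (Dv v) (DX n m γ * DY n m b) :=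
  Commute.mul_right (commute_Dv_DW v _ γ) (commute_Dv_DW v _ b)

lemma Opx_comm_dx {J : ℕ} (j : Fin n) {T : Module.End ℝ (TF (Pt n m))} (hT : T ∈ Opx n m J) :
    Dv (dx n m j) * T - T * Dv (dx n m j) ∈ Opx n m J := by
  refine Opx_map (LinearMap.mulLeft ℝ (Dv (dx n m j)) - LinearMap.mulRight ℝ (Dv (dx n m j))) _
    (fun c γ b hγ => ?_) hT
  convert Opx_gen (Dv (Pi.single j 1) c) γ b hγ using 1
  ext1 f
  have h := LinearMap.congr_fun (commute_dx_DD (dx n m j) γ b) f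
  simp only [Module.End.mul_apply] at h
  have h2 : Ds (dx n m j) (liftS (m := m) c.toSm) = liftS (Dv (Pi.single j 1) c).toSm :=
    Ds_liftS _ _
  simp only [LinearMap.sub_apply, LinearMap.mulLeft_apply, LinearMap.mulRight_apply,
    Module.End.mul_apply, Mul_apply, Dv_smul, h, h2]
  abel

lemma Opx_mul_dx {J : ℕ} (j : Fin n) {T : Module.End ℝ (TF (Pt n m))} (hT : T ∈ Opx n m J) :
    T * Dv (dx n m j) ∈ Opx n m (J + 1) := by
  refine Opx_map (LinearMap.mulRight ℝ (Dv (dx n m j))) _ (fun c γ b hγ => ?_) hT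
  have h := Opx_gen c (γ ++ [j]) b (J := J + 1) (by simpa using hγ)
  have h2 : DX n m [j] * DY n m b = DY n m b * DX n m [j] := by
    simpa using show Dv (dx n m j) * DY n m b = DY n m b * Dv (dx n m j) from
      (commute_Dv_DW (dx n m j) (dy n m) b).eq
  rw [DX_append, mul_assoc (DX n m γ), h2] at h
  simpa [mul_assoc] using h

lemma Opx_mul_dy {J : ℕ} (k : Fin m) {T : Module.End ℝ (TF (Pt n m))} (hT : T ∈ Opx n m J) :
    T * Dv (dy n m k) ∈ Opx n m J := by
  refine Opx_map (LinearMap.mulRight ℝ (Dv (dy n m k))) _ (fun c γ b hγ => ?_) hT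
  have h := Opx_gen c γ (b ++ [k]) hγ
  rw [DY_append] at h
  simpa [mul_assoc] using h

lemma Opx_dx_mul {J : ℕ} (j : Fin n) {T : Module.End ℝ (TF (Pt n m))} (hT : T ∈ Opx n m J) :
    Dv (dx n m j) * T ∈ Opx n m (J + 1) := by
  have := add_mem (Opx_mono J.le_succ (Opx_comm_dx j hT)) (Opx_mul_dx j hT)
  simpa using this

lemma Opx_dy_mul {J : ℕ} (k : Fin m) {T : Module.End ℝ (TF (Pt n m))} (hT : T ∈ Opx n m J) :
    Dv (dy n m k) * T ∈ Opx n m J := by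
  refine Opx_map (LinearMap.mulLeft ℝ (Dv (dy n m k))) _ (fun c γ b hγ => ?_) hT
  convert Opx_mul_dy k (Opx_gen c γ b hγ) using 1
  ext1 f
  have h := LinearMap.congr_fun (commute_dx_DD (dy n m k) γ b) f
  simp only [Module.End.mul_apply] at h
  have h2 : Ds (dy n m k) (liftS (m := m) c.toSm) = 0 := by
    rw [Ds_liftS]
    ext z
    simp [Ds_apply, dy]
  simp only [LinearMap.mulLeft_apply, Module.End.mul_apply, Mul_apply, Dv_smul, h, h2]
  simp

lemma Opx_Mul_mul {J : ℕ} (a : Sm (Fin n → ℝ)) {T : Module.End ℝ (TF (Pt n m))} (hT : T ∈ Opx n m J) :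
    Mul (liftS a) * T ∈ Opx n m J := by
  refine Opx_map (LinearMap.mulLeft ℝ (Mul (liftS a))) _ (fun c γ b hγ => ?_) hT
  convert Opx_gen (a • c) γ b hγ using 1
  have h2 : liftS (m := m) (a • c).toSm = liftS a * liftS c.toSm := by
    ext z; simp
  simp [h2, mul_assoc]

lemma Opx_H_mul {J : ℕ} {T : Module.End ℝ (TF (Pt n m))} (hT : T ∈ Opx n m J) :
    H n m N * T ∈ Opx n m (J + 2) := by
  rw [H_eq, sub_mul, neg_mul, Finset.sum_mul, Finset.sum_mul]
  refine sub_mem (neg_mem (sum_mem fun j _ => ?_)) (sum_mem fun k _ => ?_)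
  · rw [pow_two, mul_assoc]
    exact Opx_dx_mul j (Opx_dx_mul j hT)
  · rw [pow_two, mul_assoc, mul_assoc]
    exact Opx_mono (by omega) (Opx_Mul_mul _ (Opx_dy_mul k (Opx_dy_mul k hT)))

lemma Opx_mul_ell {J : ℕ} {T : Module.End ℝ (TF (Pt n m))} (hT : T ∈ Opx n m J) :
    T * ell n m ∈ Opx n m (J + 2) := by
  rw [ell_eq, mul_sub, mul_one, mul_add, Finset.mul_sum, Finset.mul_sum]
  refine sub_mem (Opx_mono (by omega) hT) (add_mem (sum_mem fun j _ => ?_) (sum_mem fun k _ => ?_))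
  · rw [pow_two, ← mul_assoc]
    exact Opx_mul_dx j (Opx_mul_dx j hT)
  · rw [pow_two, ← mul_assoc]
    exact Opx_mono (by omega) (Opx_mul_dy k (Opx_mul_dy k hT))

lemma Opx_comm_ell {J : ℕ} {T : Module.End ℝ (TF (Pt n m))} (hT : T ∈ Opx n m J) :
    T * ell n m - H n m N * T ∈ Opx n m (J + 1) := by
  have e : T * ell n m - H n m N * T = T + ∑ j, (Dv (dx n m j) ^ 2 * T - T * Dv (dx n m j) ^ 2) -
      ∑ k, T * Dv (dy n m k) ^ 2 +
      ∑ k, Mul (liftS (m := m) (pot n N)) * (Dv (dy n m k) ^ 2 * T) := by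
    rw [ell_eq, H_eq]
    simp only [sub_mul, mul_sub, neg_mul, Finset.sum_mul, Finset.mul_sum, mul_add, mul_one,
      Finset.sum_sub_distrib, mul_assoc]
    abel
  rw [e]
  refine add_mem (sub_mem (add_mem (Opx_mono (by omega) hT) (sum_mem fun j _ => ?_))
    (sum_mem fun k _ => ?_)) (sum_mem fun k _ => ?_)
  · have h := Opx_comm_dx j hT
    have := add_mem (Opx_dx_mul j h) (Opx_mul_dx j h)
    convert this using 1
    noncomm_ring
  · rw [pow_two, ← mul_assoc]
    exact Opx_mono (by omega) (Opx_mul_dy k (Opx_mul_dy k hT))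
  · rw [pow_two, mul_assoc]
    exact Opx_mono (by omega) (Opx_Mul_mul _ (Opx_dy_mul k (Opx_dy_mul k hT)))

lemma Opx_H_pow_mul {J : ℕ} {T : Module.End ℝ (TF (Pt n m))} (hT : T ∈ Opx n m J) (k : ℕ) :
    H n m N ^ k * T ∈ Opx n m (J + 2 * k) := by
  induction k with
  | zero => simpa using hT
  | succ k ih =>
    rw [pow_succ', mul_assoc]
    exact Opx_H_mul ih

lemma Opx_mul_ell_pow {J : ℕ} {T : Module.End ℝ (TF (Pt n m))} (hT : T ∈ Opx n m J) (k : ℕ) :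
    T * ell n m ^ k ∈ Opx n m (J + 2 * k) := by
  induction k with
  | zero => simpa using hT
  | succ k ih =>
    rw [pow_succ, ← mul_assoc]
    exact Opx_mul_ell ih

lemma Opx_comm_ell_pow {J : ℕ} {T : Module.End ℝ (TF (Pt n m))} (hT : T ∈ Opx n m J) (k : ℕ) :
    T * ell n m ^ (k + 1) - H n m N ^ (k + 1) * T ∈ Opx n m (J + 2 * k + 1) := by
  induction k with
  | zero => simpa using Opx_comm_ell hT
  | succ k ih =>
    have e : T * ell n m ^ (k + 2) - H n m N ^ (k + 2) * T =
        (T * ell n m ^ (k + 1) - H n m N ^ (k + 1) * T) * ell n m +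
        H n m N ^ (k + 1) * (T * ell n m - H n m N * T) := by
      rw [pow_succ (ell n m) (k + 1), pow_succ (H n m N) (k + 1)]
      noncomm_ring
    rw [e]
    exact add_mem (Opx_mono (by omega) (Opx_mul_ell ih))
      (Opx_mono (by omega) (Opx_H_pow_mul (Opx_comm_ell hT) (k + 1)))

end Regularity

section Regularity
set_option linter.unusedSectionVars false
variable {n m : ℕ} {N : ℕ}

/-- The operators `T` for which `ℓ ∘ T` is controlled by the `k`-th power of `1 - Δ`. -/
noncomputable def Bd (ℓ : TF (Pt n m) →L[ℝ] ℝ) (k : ℕ) : Submodule ℝ (Module.End ℝ (TF (Pt n m))) where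
  carrier := {T | ∃ C, 0 ≤ C ∧ ∀ f, |ℓ (T f)| ≤ C * ‖(ell n m ^ k) f‖}
  zero_mem' := ⟨0, le_rfl, fun f => by simp⟩
  add_mem' := by
    rintro S T ⟨C, hC, h⟩ ⟨D, hD, h'⟩
    refine ⟨C + D, add_nonneg hC hD, fun f => ?_⟩
    rw [LinearMap.add_apply, map_add, add_mul]
    exact (abs_add_le _ _).trans (add_le_add (h f) (h' f))
  smul_mem' := by
    rintro c T ⟨C, hC, h⟩
    refine ⟨|c| * C, by positivity, fun f => ?_⟩
    rw [LinearMap.smul_apply, map_smul, smul_eq_mul, abs_mul, mul_assoc]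
    exact mul_le_mul_of_nonneg_left (h f) (abs_nonneg _)

lemma Bd_mono (ℓ : TF (Pt n m) →L[ℝ] ℝ) {j k : ℕ} (h : j ≤ k) : Bd ℓ j ≤ Bd ℓ k := by
  rintro T ⟨C, hC, hT⟩
  exact ⟨C, hC, fun f => (hT f).trans (mul_le_mul_of_nonneg_left (norm_lap_pow_mono _ h f) hC)⟩

lemma exists_norm_liftS_smul_le (c : TF (Fin n → ℝ)) :
    ∃ C, 0 ≤ C ∧ ∀ f : TF (Pt n m), ‖liftS (m := m) c.toSm • f‖ ≤ C * ‖f‖ := by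
  obtain ⟨C, hC⟩ := c.continuous.bounded_above_of_compact_support c.hasCompactSupport
  refine ⟨|C|, abs_nonneg _, fun f => norm_sm_smul_le (abs_nonneg _) f fun z _ => ?_⟩
  exact (hC z.1).trans (le_abs_self C)

lemma norm_DD_le (γ : List (Fin n)) (b : List (Fin m)) (f : TF (Pt n m)) :
    ‖(DX n m γ * DY n m b) f‖ ≤ ‖(ell n m ^ (γ.length + b.length)) f‖ := by
  rw [DX_eq_DW, DY_eq_DW, ← DW_append]
  exact norm_DW_le_lap _ _ _ (by simp; omega) f

lemma exists_mem_Bd (ℓ : TF (Pt n m) →L[ℝ] ℝ) {J : ℕ} {T : Module.End ℝ (TF (Pt n m))}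
    (hT : T ∈ Opx n m J) : ∃ k, T ∈ Bd ℓ k := by
  refine Submodule.span_induction (p := fun T _ => ∃ k, T ∈ Bd ℓ k) ?_ ⟨0, zero_mem _⟩ ?_ ?_ hT
  · rintro _ ⟨c, γ, b, -, rfl⟩
    obtain ⟨C, hC, h⟩ := exists_norm_liftS_smul_le (m := m) c
    refine ⟨γ.length + b.length, ‖ℓ‖ * C, by positivity, fun f => ?_⟩
    refine (ℓ.le_opNorm _).trans ?_
    rw [mul_assoc]
    exact mul_le_mul_of_nonneg_left ((h _).trans (mul_le_mul_of_nonneg_left (norm_DD_le γ b f) hC))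
      (norm_nonneg _)
  · rintro S T - - ⟨j, hj⟩ ⟨k, hk⟩
    exact ⟨max j k, add_mem (Bd_mono ℓ (le_max_left _ _) hj) (Bd_mono ℓ (le_max_right _ _) hk)⟩
  · rintro c T - ⟨k, hk⟩
    exact ⟨k, Submodule.smul_mem _ c hk⟩

lemma Opx_le_Bd {ℓ : TF (Pt n m) →L[ℝ] ℝ} {J : ℕ} (h : Opx n m J ≤ Bd ℓ 0) (K : ℕ) :
    Opx n m (J + 2 * K) ≤ Bd ℓ K := by
  refine Submodule.span_le.2 ?_
  rintro _ ⟨c, γ, b, hγ, rfl⟩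
  obtain ⟨C, hC, hT⟩ := h (Opx_gen c (γ.take J) b (by simp))
  refine ⟨C, hC, fun f => ?_⟩
  have e : DX n m γ * DY n m b = DX n m (γ.take J) * DY n m b * DX n m (γ.drop J) := by
    have : DX n m (γ.drop J) * DY n m b = DY n m b * DX n m (γ.drop J) :=
      (Commute.list_prod_left _ _ fun x hx => by
        obtain ⟨i, -, rfl⟩ := List.mem_map.1 hx
        exact commute_Dv_DW _ _ b).eq
    rw [mul_assoc, ← this, ← mul_assoc, ← DX_append, List.take_append_drop]
  rw [e, ← mul_assoc]
  refine (hT (DX n m (γ.drop J) f)).trans (mul_le_mul_of_nonneg_left ?_ hC)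
  rw [pow_zero, Module.End.one_apply, DX_eq_DW]
  exact norm_DW_le_lap _ K _ (by simp; omega) f

lemma exists_strong_approx (K M : ℕ) (f : TF (Pt n m)) {ε : ℝ} (hε : 0 < ε) :
    ∃ θ, ‖(ell n m ^ M) ((ell n m ^ K) θ - f)‖ ≤ ε := by
  obtain ⟨θ, h⟩ := lap_pow_dense (Sum.elim (dx n m) (dy n m)) (M + K) ((ell n m ^ M) f) hε
  refine ⟨θ, ?_⟩
  rwa [map_sub, ← Module.End.mul_apply, ← pow_add]

lemma abs_le_of_approx {ℓ : TF (Pt n m) →L[ℝ] ℝ} {T : Module.End ℝ (TF (Pt n m))} {M K : ℕ} {C : ℝ}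
    (hM : T ∈ Bd ℓ M) (hC : 0 ≤ C) (h : ∀ f, |ℓ ((T * ell n m ^ K) f)| ≤ C * ‖(ell n m ^ K) f‖)
    (f : TF (Pt n m)) : |ℓ (T f)| ≤ C * ‖f‖ := by
  obtain ⟨D, hD, hM⟩ := hM
  refine le_of_forall_pos_le_add fun ε hε => ?_
  obtain ⟨θ, hθ⟩ := exists_strong_approx K M f (div_pos hε (by positivity : 0 < C + D + 1))
  set η := ε / (C + D + 1)
  have hη : η * (C + D + 1) = ε := div_mul_cancel₀ _ (by positivity)
  have hη0 : 0 < η := by positivity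
  have h1 := hM ((ell n m ^ K) θ - f)
  have h2 := h θ
  have h3 := (norm_le_lap_pow (Sum.elim (dx n m) (dy n m)) M ((ell n m ^ K) θ - f)).trans hθ
  have h4 : ‖(ell n m ^ K) θ‖ ≤ ‖f‖ + η := by
    have := norm_add_le ((ell n m ^ K) θ - f) f
    rw [sub_add_cancel] at this
    linarith
  have h5 := mul_le_mul_of_nonneg_left hθ hD
  have h6 := mul_le_mul_of_nonneg_left h4 hC
  rw [Module.End.mul_apply] at h2
  rw [map_sub, map_sub, abs_sub_comm] at h1
  have h7 := abs_sub_abs_le_abs_sub (ℓ (T f)) (ℓ (T ((ell n m ^ K) θ)))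
  nlinarith

lemma mem_Bd_zero_of {ℓ : TF (Pt n m) →L[ℝ] ℝ} {T : Module.End ℝ (TF (Pt n m))} {M K : ℕ}
    (hM : T ∈ Bd ℓ M) (h : T * ell n m ^ K ∈ Bd ℓ K) : T ∈ Bd ℓ 0 := by
  obtain ⟨C, hC, h⟩ := h
  exact ⟨C, hC, abs_le_of_approx hM hC h⟩

/-- The powers of `H` of order less than `K`. -/
noncomputable def Hlow (n m N K : ℕ) : Submodule ℝ (Module.End ℝ (TF (Pt n m))) :=
  Submodule.span ℝ ((fun j => H n m N ^ j) '' {j | j < K})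

lemma Hlow_mul_mem {K J : ℕ} {L T : Module.End ℝ (TF (Pt n m))} (hL : L ∈ Hlow n m N (K + 1))
    (hT : T ∈ Opx n m J) : L * T ∈ Opx n m (J + 2 * K) := by
  have : Hlow n m N (K + 1) ≤ (Opx n m (J + 2 * K)).comap (LinearMap.mulRight ℝ T) := by
    refine Submodule.span_le.2 ?_
    rintro _ ⟨j, hj, rfl⟩
    exact Opx_mono (by simp at hj; omega) (Opx_H_pow_mul hT j)
  exact this hL

/-- Elliptic regularity in the `x` variables for functionals annihilating the range of `Q`. -/
theorem Opx_le_Bd_zero {K : ℕ} {Q : Module.End ℝ (TF (Pt n m))} (hQ : Q - H n m N ^ (K + 1) ∈ Hlow n m N (K + 1))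
    {ℓ : TF (Pt n m) →L[ℝ] ℝ} (hℓ : ∀ f, ℓ (Q f) = 0)
    (hy : ∀ b : List (Fin m), ∃ C, 0 ≤ C ∧ ∀ f, |ℓ (DY n m b f)| ≤ C * ‖f‖) (J : ℕ) :
    Opx n m J ≤ Bd ℓ 0 := by
  induction J with
  | zero =>
    refine Submodule.span_le.2 ?_
    rintro _ ⟨c, γ, b, hγ, rfl⟩
    obtain rfl : γ = [] := List.length_eq_zero_iff.1 (by omega)
    obtain ⟨C, hC, h⟩ := hy b
    obtain ⟨D, hD, h'⟩ := exists_norm_liftS_smul_le (m := m) c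
    refine ⟨C * D, by positivity, fun f => ?_⟩
    have e : (Mul (liftS (m := m) c.toSm) * (DX n m [] * DY n m b)) f = DY n m b (liftS (m := m) c.toSm • f) := by
      have : Commute (Mul (liftS (m := m) c.toSm)) (DY n m b) := Commute.list_prod_right _ _ fun x hx => by
        obtain ⟨k, -, rfl⟩ := List.mem_map.1 hx
        refine LinearMap.ext fun f => ?_
        simp only [Module.End.mul_apply, Mul_apply, Dv_smul, Ds_liftS]
        have : Ds (dy n m k).1 c.toSm = 0 := by ext z; simp [Ds_apply, dy]
        simp [this]
      rw [DX_nil, one_mul, this.eq]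
      rfl
    rw [e, pow_zero, Module.End.one_apply, mul_assoc]
    exact (h _).trans (mul_le_mul_of_nonneg_left (h' f) hC)
  | succ J ih =>
    intro T hT
    obtain ⟨M, hM⟩ := exists_mem_Bd ℓ hT
    refine mem_Bd_zero_of hM (K := K + 1) ?_
    have hR : T * ell n m ^ (K + 1) - H n m N ^ (K + 1) * T - (Q - H n m N ^ (K + 1)) * T ∈
        Opx n m (J + 2 * (K + 1)) :=
      sub_mem (Opx_mono (by omega) (Opx_comm_ell_pow hT K)) (Opx_mono (by omega) (Hlow_mul_mem hQ hT))
    obtain ⟨C, hC, h⟩ := Opx_le_Bd ih (K + 1) hR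
    refine ⟨C, hC, fun f => ?_⟩
    have e := h f
    simp only [LinearMap.sub_apply, Module.End.mul_apply, map_sub, hℓ] at e
    rw [Module.End.mul_apply]
    simpa using e

end Regularity

section LocalApprox
set_option linter.unusedSectionVars false
variable {n m : ℕ} {N : ℕ}

lemma inner_H (f g : TF (Pt n m)) : ⟪H n m N f, g⟫_ℝ = ⟪f, H n m N g⟫_ℝ := by
  have h : ∀ i, ∀ f g : TF (Pt n m), ⟪(XF n m N i).T f, g⟫_ℝ = -⟪f, (XF n m N i).T g⟫_ℝ :=
    fun i => VF.inner_T (XF_divFree i)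
  simp only [H, LinearMap.neg_apply, LinearMap.sum_apply, inner_neg_left, inner_neg_right, sum_inner,
    inner_sum, pow_two, Module.End.mul_apply, h, neg_neg]

lemma inner_H_pow (k : ℕ) (f g : TF (Pt n m)) : ⟪(H n m N ^ k) f, g⟫_ℝ = ⟪f, (H n m N ^ k) g⟫_ℝ := by
  induction k generalizing f g with
  | zero => rfl
  | succ k ih =>
    rw [pow_succ, Module.End.mul_apply, ih, inner_H, ← Module.End.mul_apply, ← pow_succ', pow_succ]

lemma Hlow_symm {K : ℕ} {L : Module.End ℝ (TF (Pt n m))} (hL : L ∈ Hlow n m N K) (f g : TF (Pt n m)) :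
    ⟪L f, g⟫_ℝ = ⟪f, L g⟫_ℝ := by
  refine Submodule.span_induction (p := fun L _ => ⟪L f, g⟫_ℝ = ⟪f, L g⟫_ℝ) ?_ (by simp) ?_ ?_ hL
  · rintro _ ⟨j, -, rfl⟩
    exact inner_H_pow j f g
  · intro A B _ _ hA hB
    simp only [LinearMap.add_apply, inner_add_left, inner_add_right, hA, hB]
  · intro c A _ hA
    simp only [LinearMap.smul_apply, inner_smul_left, inner_smul_right, hA, RCLike.conj_to_real]

lemma Wd_eq_zero {k : ℕ} {A : Module.End ℝ (TF (Pt n m))} (hA : A ∈ Wd n m N k) {U : Set (Pt n m)}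
    (hU : IsOpen U) {f : TF (Pt n m)} (h : ∀ x ∈ U, f x = 0) {x : Pt n m} (hx : x ∈ U) : A f x = 0 := by
  refine Submodule.span_induction (p := fun A _ => A f x = 0) ?_ rfl ?_ ?_ hA
  · rintro _ ⟨β, -, rfl⟩
    exact wT_eq_zero _ β hU h x hx
  · intro A B _ _ hA hB
    rw [LinearMap.add_apply, TF.add_apply, hA, hB, add_zero]
  · intro c A _ hA
    rw [LinearMap.smul_apply, TF.smul_apply, hA, mul_zero]

lemma Hlow_le {K : ℕ} {S : Submodule ℝ (Module.End ℝ (TF (Pt n m)))} (h : ∀ j < K, H n m N ^ j ∈ S) :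
    Hlow n m N K ≤ S := by
  refine Submodule.span_le.2 ?_
  rintro _ ⟨j, hj, rfl⟩
  exact h j hj

lemma Hlow_eq_zero {K : ℕ} {A : Module.End ℝ (TF (Pt n m))} (hA : A ∈ Hlow n m N K) {U : Set (Pt n m)}
    (hU : IsOpen U) {f : TF (Pt n m)} (h : ∀ x ∈ U, f x = 0) {x : Pt n m} (hx : x ∈ U) : A f x = 0 := by
  have := Hlow_le (n := n) (m := m) (N := N) (K := K)
    (S := LinearMap.ker ((TF.eval x).comp (LinearMap.applyₗ (R := ℝ) f))) fun j _ =>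
      Wd_eq_zero (H_pow_mem_Wd j) hU h hx
  exact this hA

/-- Differential operators of order at most `k`, written with the derivatives on the left and with
compactly supported coefficients. -/
noncomputable def Opc (n m k : ℕ) : Submodule ℝ (Module.End ℝ (TF (Pt n m))) :=
  Submodule.span ℝ {T | ∃ (δ : List (Fin n ⊕ Fin m)) (χ : TF (Pt n m)), δ.length ≤ k ∧
    T = DW (Sum.elim (dx n m) (dy n m)) δ * Mul χ.toSm}

lemma Opc_gen {k : ℕ} (δ : List (Fin n ⊕ Fin m)) (χ : TF (Pt n m)) (h : δ.length ≤ k) :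
    DW (Sum.elim (dx n m) (dy n m)) δ * Mul χ.toSm ∈ Opc n m k := Submodule.subset_span ⟨δ, χ, h, rfl⟩

lemma Opc_mono {k l : ℕ} (h : k ≤ l) : Opc n m k ≤ Opc n m l :=
  Submodule.span_mono fun _ ⟨δ, χ, hδ, e⟩ => ⟨δ, χ, hδ.trans h, e⟩

lemma Opc_map {k : ℕ} (B : Module.End ℝ (TF (Pt n m))) (S : Submodule ℝ (Module.End ℝ (TF (Pt n m))))
    (h : ∀ (δ : List (Fin n ⊕ Fin m)) (χ : TF (Pt n m)), δ.length ≤ k →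
      B * (DW (Sum.elim (dx n m) (dy n m)) δ * Mul χ.toSm) ∈ S) {T : Module.End ℝ (TF (Pt n m))}
    (hT : T ∈ Opc n m k) : B * T ∈ S := by
  have : Opc n m k ≤ S.comap (LinearMap.mulLeft ℝ B) := by
    refine Submodule.span_le.2 ?_
    rintro _ ⟨δ, χ, hδ, rfl⟩
    exact h δ χ hδ
  exact this hT

lemma Opc_Dv_mul {k : ℕ} (i : Fin n ⊕ Fin m) {T : Module.End ℝ (TF (Pt n m))} (hT : T ∈ Opc n m k) :
    Dv (Sum.elim (dx n m) (dy n m) i) * T ∈ Opc n m (k + 1) := by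
  refine Opc_map _ _ (fun δ χ hδ => ?_) hT
  rw [← mul_assoc, ← DW_cons]
  exact Opc_gen _ _ (by simpa using hδ)

lemma Opc_Mul_mul {k : ℕ} (a : Sm (Pt n m)) {T : Module.End ℝ (TF (Pt n m))} (hT : T ∈ Opc n m k) :
    Mul a * T ∈ Opc n m k := by
  refine Opc_map _ _ (fun δ χ hδ => ?_) hT
  clear hT
  induction δ generalizing a k with
  | nil =>
    have := Opc_gen (k := k) [] (a • χ) (by simp)
    rw [DW_nil, one_mul] at this ⊢
    have e : (a • χ).toSm = a * χ.toSm := by ext z; simp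
    rwa [e, map_mul] at this
  | cons i δ ih =>
    obtain ⟨k, rfl⟩ : ∃ k', k = k' + 1 := ⟨k - 1, by simp at hδ; omega⟩
    have hδ' : δ.length ≤ k := by simpa using hδ
    have h1 := Opc_Dv_mul i (ih a hδ')
    have h2 := ih (Ds (Sum.elim (dx n m) (dy n m) i) a) hδ'
    convert sub_mem h1 (Opc_mono k.le_succ h2) using 1
    ext1 f
    simp only [DW_cons, Module.End.mul_apply, Mul_apply, LinearMap.sub_apply, Dv_smul]
    abel

lemma Opc_H_mul {k : ℕ} {T : Module.End ℝ (TF (Pt n m))} (hT : T ∈ Opc n m k) :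
    H n m N * T ∈ Opc n m (k + 2) := by
  rw [H_eq, sub_mul, neg_mul, Finset.sum_mul, Finset.sum_mul]
  refine sub_mem (neg_mem (sum_mem fun j _ => ?_)) (sum_mem fun l _ => ?_)
  · rw [pow_two, mul_assoc]
    exact Opc_Dv_mul (Sum.inl j) (Opc_Dv_mul (Sum.inl j) hT)
  · rw [pow_two, mul_assoc, mul_assoc]
    exact Opc_Mul_mul _ (Opc_Dv_mul (Sum.inr l) (Opc_Dv_mul (Sum.inr l) hT))

lemma Opc_H_pow (χ : TF (Pt n m)) (k : ℕ) : H n m N ^ k * Mul χ.toSm ∈ Opc n m (2 * k) := by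
  induction k with
  | zero => simpa using Opc_gen [] χ (by simp)
  | succ k ih =>
    rw [pow_succ', mul_assoc]
    exact Opc_H_mul ih

lemma Opc_Hlow {K : ℕ} {L : Module.End ℝ (TF (Pt n m))} (hL : L ∈ Hlow n m N (K + 1)) (χ : TF (Pt n m)) :
    L * Mul χ.toSm ∈ Opc n m (2 * K) := by
  have := Hlow_le (n := n) (m := m) (N := N) (K := K + 1)
    (S := (Opc n m (2 * K)).comap (LinearMap.mulRight ℝ (Mul χ.toSm))) fun j hj =>
      Opc_mono (by omega) (Opc_H_pow χ j)
  exact this hL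

lemma Opc_bound {k : ℕ} {T : Module.End ℝ (TF (Pt n m))} (hT : T ∈ Opc n m k) :
    ∃ C, 0 ≤ C ∧ ∀ (e : TF (Pt n m) →L[ℝ] ℝ) (ε : ℝ), 0 ≤ ε →
      (∀ δ : List (Fin n ⊕ Fin m), δ.length ≤ k → ∀ f, |e (DW (Sum.elim (dx n m) (dy n m)) δ f)| ≤ ε * ‖f‖) →
      ∀ f, |e (T f)| ≤ ε * (C * ‖f‖) := by
  refine Submodule.span_induction (p := fun T _ => ∃ C, 0 ≤ C ∧ ∀ (e : TF (Pt n m) →L[ℝ] ℝ) (ε : ℝ), 0 ≤ ε →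
      (∀ δ : List (Fin n ⊕ Fin m), δ.length ≤ k → ∀ f, |e (DW (Sum.elim (dx n m) (dy n m)) δ f)| ≤ ε * ‖f‖) →
      ∀ f, |e (T f)| ≤ ε * (C * ‖f‖)) ?_ ⟨0, le_rfl, by simp⟩ ?_ ?_ hT
  · rintro _ ⟨δ, χ, hδ, rfl⟩
    obtain ⟨C, hC⟩ := χ.continuous.bounded_above_of_compact_support χ.hasCompactSupport
    refine ⟨|C|, abs_nonneg _, fun e ε hε h f => (h δ hδ _).trans (mul_le_mul_of_nonneg_left ?_ hε)⟩
    exact norm_sm_smul_le (abs_nonneg _) f fun z _ => (hC z).trans (le_abs_self C)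
  · rintro A B _ _ ⟨C, hC, hA⟩ ⟨D, hD, hB⟩
    refine ⟨C + D, add_nonneg hC hD, fun e ε hε h f => ?_⟩
    rw [LinearMap.add_apply, map_add, add_mul, mul_add]
    exact (abs_add_le _ _).trans (add_le_add (hA e ε hε h f) (hB e ε hε h f))
  · rintro c A _ ⟨C, hC, hA⟩
    refine ⟨|c| * C, by positivity, fun e ε hε h f => ?_⟩
    rw [LinearMap.smul_apply, map_smul, smul_eq_mul, abs_mul, mul_assoc, mul_left_comm]
    exact mul_le_mul_of_nonneg_left (hA e ε hε h f) (abs_nonneg _)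

lemma exists_cutoff_x (R : ℝ) (hR : 0 < R) : ∃ c : TF (Fin n → ℝ), (∀ x, |c x| ≤ 1) ∧
    ∀ x, ‖x‖ ≤ R → c x = 1 := by
  let b : ContDiffBump (0 : Fin n → ℝ) := ⟨R, R + 1, hR, by linarith⟩
  refine ⟨TF.mk b b.contDiff b.hasCompactSupport, fun x => ?_, fun x hx => ?_⟩
  · exact abs_le.2 ⟨by linarith [b.nonneg' x, show TF.mk b b.contDiff b.hasCompactSupport x = b x from rfl],
      b.le_one⟩
  · exact b.one_of_mem_closedBall (by simpa using hx)

/-- A functional which annihilates the range of `Q` and is regular in `y` is locally approximated by test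
functions on which `Q` is locally small. -/
theorem exists_local_approx {K : ℕ} {Q : Module.End ℝ (TF (Pt n m))}
    (hQ : Q - H n m N ^ (K + 1) ∈ Hlow n m N (K + 1))
    {ℓ : TF (Pt n m) →L[ℝ] ℝ} (hℓ : ∀ f, ℓ (Q f) = 0)
    (hy : ∀ b : List (Fin m), ∃ C, 0 ≤ C ∧ ∀ f, |ℓ (DY n m b f)| ≤ C * ‖f‖) {R : ℝ} (hR : 0 < R)
    (χ : TF (Pt n m)) (hχ : ∀ z : Pt n m, R < ‖z.1‖ → χ z = 0) {ε : ℝ} (hε : 0 < ε) :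
    ∃ h : TF (Pt n m), ‖h‖ ≤ ‖ℓ‖ + ε ∧ ‖χ.toSm • Q h‖ ≤ ε ∧
      ∀ f : TF (Pt n m), (∀ z : Pt n m, R < ‖z.1‖ → f z = 0) → |⟪h, f⟫_ℝ - ℓ f| ≤ ε * ‖f‖ := by
  have hQd : Q = H n m N ^ (K + 1) + (Q - H n m N ^ (K + 1)) := by abel
  obtain ⟨c, hc1, hcR⟩ := exists_cutoff_x (n := n) R hR
  have hcm : ∀ f : TF (Pt n m), ‖liftS (m := m) c.toSm • f‖ ≤ 1 * ‖f‖ := fun f =>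
    norm_sm_smul_le zero_le_one f fun z _ => hc1 z.1
  have hceq : ∀ f : TF (Pt n m), (∀ z : Pt n m, R < ‖z.1‖ → f z = 0) → liftS (m := m) c.toSm • f = f := by
    intro f hf
    ext z
    rcases le_or_gt ‖z.1‖ R with h | h
    · simp [hcR z.1 h]
    · simp [hf z h]
  have hQs : ∀ f g, ⟪Q f, g⟫_ℝ = ⟪f, Q g⟫_ℝ := fun f g => by
    rw [hQd, LinearMap.add_apply, LinearMap.add_apply, inner_add_left, inner_add_right, Hlow_symm hQ,
      inner_H_pow]
  have hGQ : Q * Mul χ.toSm ∈ Opc n m (2 * (K + 1)) := by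
    rw [hQd, add_mul]
    exact add_mem (Opc_H_pow χ _) (Opc_mono (by omega) (Opc_Hlow hQ χ))
  obtain ⟨C, hC, hCe⟩ := Opc_bound hGQ
  set η := ε / (C + 1) with hη
  have hη0 : 0 < η := by positivity
  have hηε : η * (C + 1) = ε := div_mul_cancel₀ _ (by positivity)
  have hηle : η ≤ ε := by nlinarith
  have hT : Mul (liftS c.toSm) * ell n m ^ (K + 1) ∈ Bd ℓ 0 := by
    have h0 := Opx_gen (m := m) (J := 0) c [] [] (by simp)
    rw [DX_nil, DY_nil, mul_one, mul_one] at h0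
    exact Opx_le_Bd_zero hQ hℓ hy _ (Opx_mul_ell_pow h0 (K + 1))
  obtain ⟨D, hD, hTD⟩ := hT
  obtain ⟨g, hg⟩ := riesz_approx (pull ℓ _ D hTD) (half_pos hη0)
  obtain ⟨h, hh⟩ := lap_pow_dense (Sum.elim (dx n m) (dy n m)) (K + 1) g (half_pos hη0)
  have hcℓ : ∀ f, ‖ℓ (Mul (liftS (m := m) c.toSm) f)‖ ≤ ‖ℓ‖ * ‖f‖ := fun f => by
    refine (ℓ.le_opNorm _).trans (mul_le_mul_of_nonneg_left ?_ (norm_nonneg _))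
    simpa using hcm f
  let e : TF (Pt n m) →L[ℝ] ℝ := innerSL ℝ h - pull ℓ (Mul (liftS c.toSm)) _ hcℓ
  have he : ∀ f, e f = ⟪h, f⟫_ℝ - ℓ (liftS (m := m) c.toSm • f) := fun f => rfl
  have heK : ∀ f, |e ((ell n m ^ (K + 1)) f)| ≤ η * ‖f‖ := fun f => by
    have h1 := hg f
    have h2 : |⟪(ell n m ^ (K + 1)) h - g, f⟫_ℝ| ≤ η / 2 * ‖f‖ :=
      (abs_real_inner_le_norm _ _).trans (mul_le_mul_of_nonneg_right hh (norm_nonneg _))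
    have h3 : e ((ell n m ^ (K + 1)) f) = ⟪(ell n m ^ (K + 1)) h - g, f⟫_ℝ + (⟪g, f⟫_ℝ -
        pull ℓ _ D hTD f) := by
      have h4 : ⟪(ell n m ^ (K + 1)) h, f⟫_ℝ = ⟪h, (ell n m ^ (K + 1)) f⟫_ℝ := inner_lap_pow _ _ _ _
      rw [he, inner_sub_left, h4]
      simp [pull_apply, ell]
    rw [h3]
    refine (abs_add_le _ _).trans ?_
    linarith
  have heW : ∀ δ : List (Fin n ⊕ Fin m), δ.length ≤ 2 * (K + 1) →
      ∀ f, |e (DW (Sum.elim (dx n m) (dy n m)) δ f)| ≤ η * ‖f‖ := fun δ hδ f => by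
    refine abs_le_of_approx (M := K + 1) (K := K + 1) ⟨‖e‖, e.opNorm_nonneg, fun f => ?_⟩ hη0.le
      (fun f => ?_) f
    · exact (e.le_opNorm _).trans (mul_le_mul_of_nonneg_left (norm_DW_le_lap _ _ _ hδ f) e.opNorm_nonneg)
    · rw [Module.End.mul_apply, ell, DW_lap]
      exact (heK _).trans (mul_le_mul_of_nonneg_left (norm_DW_le_lap _ _ _ hδ f) hη0.le)
  have he0 : ∀ f, |e f| ≤ η * ‖f‖ := heW [] (by simp)
  refine ⟨h, ?_, ?_, fun f hf => ?_⟩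
  · have h1 := he0 h
    rw [he, real_inner_self_eq_norm_mul_norm] at h1
    have h2 := (hcℓ h).trans' (le_abs_self _)
    rw [Mul_apply] at h2
    by_contra! h3
    nlinarith [abs_le.1 h1, norm_nonneg ℓ]
  · have h1 : ∀ f, |⟪χ.toSm • Q h, f⟫_ℝ| ≤ ε * ‖f‖ := fun f => by
      have h2 : liftS (m := m) c.toSm • Q (χ.toSm • f) = Q (χ.toSm • f) := by
        refine hceq _ fun z hz => ?_
        have hU : IsOpen {z : Pt n m | R < ‖z.1‖} := isOpen_lt continuous_const (by fun_prop)
        have h0 : ∀ z ∈ {z : Pt n m | R < ‖z.1‖}, (χ.toSm • f) z = 0 := fun z hz => by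
          simp [hχ z hz]
        rw [hQd, LinearMap.add_apply, TF.add_apply, Hlow_eq_zero hQ hU h0 hz,
          Wd_eq_zero (H_pow_mem_Wd (K + 1)) hU h0 hz, add_zero]
      have h3 := hCe e η hη0.le heW f
      rw [Module.End.mul_apply, he, Mul_apply, h2, hℓ, sub_zero] at h3
      rw [inner_smul_sm, hQs]
      refine h3.trans ?_
      nlinarith [norm_nonneg f]
    have h2 := h1 (χ.toSm • Q h)
    rw [real_inner_self_eq_norm_mul_norm] at h2
    have h3 := le_abs_self (‖χ.toSm • Q h‖ * ‖χ.toSm • Q h‖)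
    by_contra! h4
    nlinarith
  · have h1 := he0 f
    rw [he, hceq f hf] at h1
    exact h1.trans (mul_le_mul_of_nonneg_right hηle (norm_nonneg _))

end LocalApprox

section DenseRange
set_option linter.unusedSectionVars false
variable {n m : ℕ} {N : ℕ}

lemma Wd_le_cac {P : Type*} {r : P → ℝ} {χ : P → Sm (Pt n m)} {k : ℕ} {A : Module.End ℝ (TF (Pt n m))}
    (hA : A ∈ Wd n m N k) :
    ∃ C, 0 ≤ C ∧ ∀ p u, |r p| ^ k * ‖χ p ^ k • A u‖ ≤ C * cac N r χ k p u := by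
  induction hA using Submodule.span_induction with
  | mem A h =>
    obtain ⟨β, rfl, rfl⟩ := h
    exact ⟨1, zero_le_one, fun p u => by rw [one_mul]; exact le_cac β p u⟩
  | zero => exact ⟨0, le_rfl, fun p u => by simp⟩
  | add A B _ _ hA hB =>
    obtain ⟨C, hC, hA⟩ := hA
    obtain ⟨D, hD, hB⟩ := hB
    refine ⟨C + D, by positivity, fun p u => ?_⟩
    rw [add_mul, LinearMap.add_apply, smul_add]
    refine le_trans ?_ (add_le_add (hA p u) (hB p u))
    rw [← mul_add]
    exact mul_le_mul_of_nonneg_left (norm_add_le _ _) (by positivity)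
  | smul c A _ hA =>
    obtain ⟨C, hC, hA⟩ := hA
    refine ⟨|c| * C, by positivity, fun p u => ?_⟩
    rw [LinearMap.smul_apply, smul_comm, norm_smul, mul_assoc, mul_left_comm]
    exact mul_le_mul_of_nonneg_left (hA p u) (abs_nonneg _)

lemma inner_H_pow_nonneg (k : ℕ) (f : TF (Pt n m)) : 0 ≤ ⟪(H n m N ^ k) f, f⟫_ℝ := by
  rcases Nat.even_or_odd' k with ⟨j, rfl | rfl⟩
  · rw [two_mul, pow_add, Module.End.mul_apply, inner_H_pow]
    exact real_inner_self_nonneg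
  · rw [show 2 * j + 1 = j + (1 + j) by ring, pow_add, Module.End.mul_apply, inner_H_pow, pow_add, pow_one,
      Module.End.mul_apply]
    set g := (H n m N ^ j) f
    have h : ∀ i, ⟪(XF n m N i).T g, (XF n m N i).T g⟫_ℝ = -⟪((XF n m N i).T ^ 2) g, g⟫_ℝ := fun i => by
      rw [VF.inner_T (XF_divFree i), real_inner_comm]; rfl
    rw [H, LinearMap.neg_apply, LinearMap.sum_apply, inner_neg_left, sum_inner, ← Finset.sum_neg_distrib]
    refine Finset.sum_nonneg fun i _ => ?_
    rw [← h]
    exact real_inner_self_nonneg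

lemma norm_le_one_add_H_pow (K : ℕ) (f : TF (Pt n m)) :
    ‖f‖ ≤ ‖f + (H n m N ^ K) f‖ ∧ ‖(H n m N ^ K) f‖ ≤ ‖f + (H n m N ^ K) f‖ := by
  have h := inner_H_pow_nonneg (N := N) K f
  have e := norm_add_sq_real f ((H n m N ^ K) f)
  rw [real_inner_comm] at e
  constructor <;> refine le_of_sq_le_sq ?_ (norm_nonneg _) <;> rw [e]
  · nlinarith [sq_nonneg ‖(H n m N ^ K) f‖]
  · nlinarith [sq_nonneg ‖f‖]

lemma H_add_apply (s K : ℕ) (φ : TF (Pt n m)) : (H n m N ^ s + H n m N ^ (s + K)) φ =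
    (H n m N ^ s) φ + (H n m N ^ K) ((H n m N ^ s) φ) := by
  rw [LinearMap.add_apply, add_comm s, pow_add, Module.End.mul_apply]

lemma norm_H_mul_le (s K : ℕ) (φ : TF (Pt n m)) :
    ‖(H n m N ^ s) φ‖ ≤ ‖(H n m N ^ s + H n m N ^ (s + K)) φ‖ := by
  rw [H_add_apply]
  exact (norm_le_one_add_H_pow _ _).1

/-- A bounded sequence of test functions with `H ^ s` tending to zero tends weakly to zero. -/
lemma exists_weak_small (hn : 1 ≤ n) (hm : 1 ≤ m) (hN : 1 ≤ N) (s : ℕ) (f : TF (Pt n m)) {C ε : ℝ}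
    (hC : 0 < C) (hε : 0 < ε) : ∃ δ > 0, ∀ φ : TF (Pt n m), ‖φ‖ ≤ C → ‖(H n m N ^ s) φ‖ ≤ δ → |⟪φ, f⟫_ℝ| ≤ ε := by
  rcases Nat.eq_zero_or_pos s with rfl | hs
  · refine ⟨ε / (‖f‖ + 1), by positivity, fun φ _ h => (abs_real_inner_le_norm _ _).trans ?_⟩
    rw [pow_zero, Module.End.one_apply, le_div_iff₀ (by positivity)] at h
    nlinarith [norm_nonneg φ]
  have hub : UB N (fun t : ℝ => t) (fun _ => (1 : Sm (Pt n m))) := UB.one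
  obtain ⟨C₁, hC₁, h₁⟩ := caccioppoli hn hm hN hub s
  obtain ⟨D, hD, h₂⟩ := cac_le hub (2 * s) one_pos
  let j : Fin n := ⟨0, hn⟩
  let x := xs n m j
  let a : Sm (Pt n m) := Sm.mk (fun z => Real.arctan (z.1 j)) (Real.contDiff_arctan.comp (by fun_prop))
  let c : Sm (Pt n m) := Sm.mk (fun z => 1 / (1 + z.1 j ^ 2))
    (contDiff_const.div (by fun_prop) fun z => by positivity)
  have hx : ∀ z, x z = z.1 j := fun z => rfl
  have hcd : c * (1 + x ^ 2) = 1 := by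
    ext z
    have : (1 + z.1 j ^ 2) ≠ 0 := by positivity
    simp [c, hx, this]
  have hac : Ds (dx n m j) a = c := by
    ext z
    let L : Pt n m →L[ℝ] ℝ := (ContinuousLinearMap.proj j).comp (ContinuousLinearMap.fst ℝ _ _)
    have h : HasFDerivAt (fun z : Pt n m => z.1 j) L z := L.hasFDerivAt
    have h' := h.arctan.fderiv
    rw [Ds_apply]
    change fderiv ℝ (fun z : Pt n m => Real.arctan (z.1 j)) z _ = _
    rw [h']
    simp [c, dx, L]
  set F := ‖(1 + x ^ 2) • f‖ with hF
  have hb : ∀ φ : TF (Pt n m), ⟪φ, f⟫_ℝ ^ 2 ≤ 4 * F ^ 2 * (‖φ‖ * ‖Dv (dx n m j) φ‖) := fun φ => by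
    have e1 : ⟪φ, f⟫_ℝ = ⟪c • φ, (1 + x ^ 2) • f⟫_ℝ := by
      rw [inner_smul_sm, smul_smul, hcd, one_smul]
    have e2 : ‖c • φ‖ ^ 2 + ‖(x * c) • φ‖ ^ 2 = ⟪c • φ, φ⟫_ℝ := by
      rw [← real_inner_self_eq_norm_sq, ← real_inner_self_eq_norm_sq, inner_smul_sm, inner_smul_sm, inner_smul_sm,
        ← inner_add_right, smul_smul, smul_smul, ← add_smul]
      rw [show c * c + x * c * (x * c) = c * (c * (1 + x ^ 2)) by ring, hcd, mul_one]
    have e3 : ⟪c • φ, φ⟫_ℝ = -2 * ⟪a • φ, Dv (dx n m j) φ⟫_ℝ := by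
      have h := inner_Dv (dx n m j) (a • φ) φ
      rw [Dv_smul, hac, inner_add_left, inner_smul_sm a, real_inner_comm] at h
      linarith
    have e4 : ‖a • φ‖ ≤ 2 * ‖φ‖ := norm_sm_smul_le zero_le_two φ fun z _ => abs_le.2
      ⟨by linarith [Real.neg_pi_div_two_lt_arctan (z.1 j), Real.pi_le_four, show a z = Real.arctan (z.1 j) from rfl],
        by linarith [Real.arctan_lt_pi_div_two (z.1 j), Real.pi_le_four, show a z = Real.arctan (z.1 j) from rfl]⟩
    have e5 := (neg_le_abs _).trans (abs_real_inner_le_norm (a • φ) (Dv (dx n m j) φ))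
    have e6 : ‖c • φ‖ ^ 2 ≤ 4 * (‖φ‖ * ‖Dv (dx n m j) φ‖) := by
      nlinarith [sq_nonneg ‖(x * c) • φ‖, mul_le_mul_of_nonneg_right e4 (norm_nonneg (Dv (dx n m j) φ))]
    rw [e1, ← sq_abs]
    refine (pow_le_pow_left₀ (abs_nonneg _) (abs_real_inner_le_norm _ _) 2).trans ?_
    rw [mul_pow, ← hF]
    nlinarith [sq_nonneg F]
  have ht : ∀ t > 0, ∀ φ : TF (Pt n m), t * ‖Dv (dx n m j) φ‖ ≤ C₁ * t ^ (2 * s) * ‖(H n m N ^ s) φ‖ +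
      (C₁ + D) * ‖φ‖ := fun t ht φ => by
    have h3 := le_cac (r := fun t : ℝ => t) (χ := fun _ => (1 : Sm (Pt n m))) [iX (N := N) (m := m) j] t φ
    have e : XT n m N [iX j] φ = Dv (dx n m j) φ := by
      rw [XT, wT_cons, wT_nil, mul_one, T_iX]
    rw [e, List.length_singleton, pow_one, one_pow, one_smul, abs_of_pos ht] at h3
    have h4 := h₁ t φ
    rw [one_pow, one_smul, abs_of_pos ht] at h4
    have h5 := h₂ t φ 1 (by omega)
    nlinarith
  set η := ε ^ 2 / (4 * F ^ 2 * C + 1) with hη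
  have hη0 : 0 < η := by positivity
  set t := ((C₁ + D) * C + 1) / η with ht'
  have ht0 : 0 < t := by positivity
  refine ⟨1 / (C₁ * t ^ (2 * s) + 1), by positivity, fun φ hφ hs => abs_le_of_sq_le_sq ?_ hε.le⟩
  have h6 : t * ‖Dv (dx n m j) φ‖ ≤ t * η := by
    rw [ht', div_mul_cancel₀ _ hη0.ne']
    refine (ht t ht0 φ).trans ?_
    rw [le_div_iff₀ (by positivity)] at hs
    nlinarith [norm_nonneg ((H n m N ^ s) φ)]
  have h7 := le_of_mul_le_mul_left h6 ht0
  have h8 : (4 * F ^ 2 * C + 1) * η = ε ^ 2 := mul_div_cancel₀ _ (by positivity)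
  calc _ ≤ 4 * F ^ 2 * (C * η) := (hb φ).trans (by gcongr)
    _ ≤ _ := by nlinarith

/-- Commutators of powers of `H` with large cutoffs are small. -/
lemma exists_comm_cut (hn : 1 ≤ n) (hm : 1 ≤ m) (hN : 1 ≤ N) (s : ℕ) {K : ℕ} (hK : 1 ≤ K) :
    ∃ C, 0 ≤ C ∧ ∀ (R : ℝ), 1 ≤ R → ∀ u : TF (Pt n m),
    ‖(H n m N ^ s + H n m N ^ (s + K)) (cut N (0 : Pt n m) R ^ (2 * (s + K)) • u)‖ ≤
      C * (‖cut N (0 : Pt n m) R ^ (2 * (s + K)) • (H n m N ^ s + H n m N ^ (s + K)) u‖ + R⁻¹ * ‖u‖) := by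
  let P := {R : ℝ // 1 ≤ R}
  let χ : P → Sm (Pt n m) := fun R => cut N 0 R.1
  have hχ : UB N (fun R : P => R.1) χ := UB_cut _ _ fun R => by linarith [R.2]
  have hχ1 : UB N (fun _ : P => (1 : ℝ)) χ := hχ.scale fun R => by
    rw [abs_one, abs_of_pos (by linarith [R.2])]; exact R.2
  let S : P → TF (Pt n m) → ℝ := fun R u => ∑ j ∈ Finset.range (2 * (s + K)), cac N (fun _ => (1 : ℝ)) χ j R u
  have hS0 : ∀ R u, 0 ≤ S R u := fun R u => Finset.sum_nonneg fun _ _ => cac_nonneg _ _ _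
  have hcomm : ∀ k, k ≤ s + K → ∃ C, 0 ≤ C ∧ ∀ (R : P) u, ‖(H n m N ^ k) (χ R ^ (2 * (s + K)) • u) -
      χ R ^ (2 * (s + K)) • (H n m N ^ k) u‖ ≤ C * (R.1⁻¹ * S R u) := by
    intro k hk
    obtain ⟨C, hC, h⟩ := Low.bound hχ (Low.comm' hχ (H_pow_mem_Wd k) (M := 2 * (s + K)) (by omega))
    refine ⟨C, hC, fun R u => ?_⟩
    have hR : 0 < R.1 := by linarith [R.2]
    have h1 := h R u
    rw [LinearMap.smul_apply, norm_smul, norm_pow, Real.norm_eq_abs, abs_of_pos hR] at h1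
    refine le_of_mul_le_mul_left (h1.trans ?_) (pow_pos hR (2 * k))
    rw [mul_left_comm]
    refine mul_le_mul_of_nonneg_left ?_ hC
    rw [Finset.mul_sum, Finset.mul_sum]
    refine le_trans (Finset.sum_le_sum fun j hj => ?_) (Finset.sum_le_sum_of_subset_of_nonneg
      (Finset.range_mono (by omega : 2 * k ≤ 2 * (s + K))) fun _ _ _ => mul_nonneg (by positivity)
        (mul_nonneg (by positivity) (cac_nonneg _ _ _)))
    have e : cac N (fun R : P => R.1) χ j R u = R.1 ^ j * cac N (fun _ => (1 : ℝ)) χ j R u := by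
      simp only [cac, abs_one, one_pow, one_mul, Finset.mul_sum, abs_of_pos hR]
    rw [e, ← mul_assoc]
    refine mul_le_mul_of_nonneg_right ?_ (cac_nonneg _ _ _)
    rw [← div_eq_mul_inv, le_div_iff₀ hR, ← pow_succ]
    exact pow_le_pow_right₀ R.2 (by simpa using hj)
  obtain ⟨C₁, hC₁, h₁⟩ := hcomm s (by omega)
  obtain ⟨C₂, hC₂, h₂⟩ := hcomm (s + K) le_rfl
  obtain ⟨C₀, hC₀, h₀⟩ := caccioppoli hn hm hN hχ1 (s + K)
  obtain ⟨A, hA, hA'⟩ := Wd_le_cac (r := fun _ : P => (1 : ℝ)) (χ := χ) (H_pow_mem_Wd (n := n) (m := m) (N := N) s)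
  obtain ⟨D, hD, hD'⟩ := cac_le hχ1 (2 * (s + K)) (ε := 1 / (2 * (C₀ * A + 1))) (by positivity)
  obtain ⟨D₁, hD₁, hD₁'⟩ := cac_le hχ1 (2 * (s + K)) one_pos
  have hSle : ∃ C, 0 ≤ C ∧ ∀ R u, S R u ≤
      C * (‖χ R ^ (2 * (s + K)) • (H n m N ^ s + H n m N ^ (s + K)) u‖ + ‖u‖) := by
    refine ⟨2 * (s + K) * (2 * C₀ * (1 + A * D) + D₁), by positivity, fun R u => ?_⟩
    set q := ‖χ R ^ (2 * (s + K)) • (H n m N ^ s + H n m N ^ (s + K)) u‖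
    set X := cac N (fun _ => (1 : ℝ)) χ (2 * (s + K)) R u
    have hq : 0 ≤ q := norm_nonneg _
    have hu := norm_nonneg u
    have h3 : ‖χ R ^ (2 * (s + K)) • (H n m N ^ s) u‖ ≤ A * (1 / (2 * (C₀ * A + 1)) * X + D * ‖u‖) := by
      have h4 := hA' R u
      rw [abs_one, one_pow, one_mul] at h4
      refine le_trans ?_ (h4.trans (mul_le_mul_of_nonneg_left (hD' R u (2 * s) (by omega)) hA))
      rw [show 2 * (s + K) = 2 * K + 2 * s by ring, pow_add, ← smul_smul]
      refine (norm_sm_smul_le zero_le_one _ fun z _ => ?_).trans_eq (one_mul _)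
      have := cut_mem_Icc (N := N) 0 R.1 z
      rw [Sm.pow_apply, abs_of_nonneg (pow_nonneg this.1 _)]
      exact pow_le_one₀ this.1 this.2
    have h5 : X ≤ C₀ * (q + A * (1 / (2 * (C₀ * A + 1)) * X + D * ‖u‖) + ‖u‖) := by
      refine (h₀ R u).trans ?_
      rw [abs_one, one_pow, one_mul]
      have : ‖χ R ^ (2 * (s + K)) • (H n m N ^ (s + K)) u‖ ≤ q + ‖χ R ^ (2 * (s + K)) • (H n m N ^ s) u‖ := by
        rw [show (H n m N ^ (s + K)) u = (H n m N ^ s + H n m N ^ (s + K)) u - (H n m N ^ s) u by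
          rw [LinearMap.add_apply]; abel, smul_sub]
        exact norm_sub_le _ _
      gcongr
      linarith
    have h6 : C₀ * A * (1 / (2 * (C₀ * A + 1))) ≤ 1 / 2 := by
      rw [mul_one_div, div_le_div_iff₀ (by positivity) (by positivity)]
      linarith
    have hX : 0 ≤ X := cac_nonneg _ _ _
    have h7 : X ≤ 2 * C₀ * (1 + A * D) * (q + ‖u‖) := by
      have := mul_nonneg (mul_nonneg hA hD) hq
      have := mul_nonneg hC₀ this
      nlinarith [mul_le_mul_of_nonneg_right h6 hX]
    calc S R u ≤ ∑ j ∈ Finset.range (2 * (s + K)), (1 * X + D₁ * ‖u‖) :=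
          Finset.sum_le_sum fun j hj => hD₁' R u j (by simpa using hj)
      _ = 2 * (s + K) * (X + D₁ * ‖u‖) := by
          rw [Finset.sum_const, Finset.card_range, nsmul_eq_mul, one_mul]; push_cast; ring
      _ ≤ 2 * (s + K) * (2 * C₀ * (1 + A * D) * (q + ‖u‖) + D₁ * (q + ‖u‖)) := by
          gcongr; linarith
      _ = _ := by ring
  obtain ⟨B, hB, hB'⟩ := hSle
  refine ⟨1 + (C₁ + C₂) * B, by positivity, fun R hR u => ?_⟩
  have h1 := h₁ ⟨R, hR⟩ u
  have h2 := h₂ ⟨R, hR⟩ u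
  have h3 := hB' ⟨R, hR⟩ u
  change ‖_ - cut N (0 : Pt n m) R ^ (2 * (s + K)) • _‖ ≤ C₁ * (R⁻¹ * _) at h1
  change ‖_ - cut N (0 : Pt n m) R ^ (2 * (s + K)) • _‖ ≤ C₂ * (R⁻¹ * _) at h2
  change _ ≤ B * (‖cut N (0 : Pt n m) R ^ (2 * (s + K)) • _‖ + _) at h3
  set q := ‖cut N (0 : Pt n m) R ^ (2 * (s + K)) • (H n m N ^ s + H n m N ^ (s + K)) u‖
  have hR1 : R⁻¹ ≤ 1 := inv_le_one_of_one_le₀ hR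
  have hR0 : 0 ≤ R⁻¹ := by positivity
  have hq : 0 ≤ q := norm_nonneg _
  have h4 : R⁻¹ * S ⟨R, hR⟩ u ≤ B * (q + R⁻¹ * ‖u‖) := by
    refine (mul_le_mul_of_nonneg_left h3 hR0).trans ?_
    rw [mul_left_comm, mul_add]
    gcongr
    exact mul_le_of_le_one_left hq hR1
  have h5 : ‖(H n m N ^ s + H n m N ^ (s + K)) (cut N (0 : Pt n m) R ^ (2 * (s + K)) • u)‖ ≤
      q + (C₁ * (R⁻¹ * S ⟨R, hR⟩ u) + C₂ * (R⁻¹ * S ⟨R, hR⟩ u)) := by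
    refine le_trans ?_ (add_le_add_right ((norm_add_le _ _).trans (add_le_add h1 h2)) q)
    refine le_trans (le_of_eq ?_) (norm_add_le _ _)
    congr 1
    simp only [LinearMap.add_apply, smul_add]
    abel
  have h6 := mul_nonneg hR0 (norm_nonneg u)
  have h7 := mul_le_mul_of_nonneg_left h4 (add_nonneg hC₁ hC₂)
  nlinarith

end DenseRange

section DenseRange2
set_option linter.unusedSectionVars false
variable {n m : ℕ} {N : ℕ}

/-- The box cutoff as a test function. -/
noncomputable def cutT (N : ℕ) (z : Pt n m) {r : ℝ} (hr : 0 < r) : TF (Pt n m) :=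
  TF.mk (cut N z r) (cut N z r).contDiff <| HasCompactSupport.of_support_subset_isCompact
    ((isCompact_closedBall z.1 r).prod (isCompact_closedBall z.2 (ρ N z r))) fun w hw => by
      have := mem_Bx.1 ((cut_ne_zero hr).1 hw)
      simp only [Set.mem_prod, Metric.mem_closedBall, dist_eq_norm]
      exact ⟨this.1.le, this.2.le⟩

lemma cutT_toSm (z : Pt n m) {r : ℝ} (hr : 0 < r) : (cutT N z hr).toSm = cut N z r := rfl

lemma norm_cut_pow_smul_le (z : Pt n m) (r : ℝ) (k : ℕ) (f : TF (Pt n m)) : ‖cut N z r ^ k • f‖ ≤ ‖f‖ := by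
  refine (norm_sm_smul_le zero_le_one f fun w _ => ?_).trans_eq (one_mul _)
  have := cut_mem_Icc (N := N) z r w
  rw [Sm.pow_apply, abs_of_nonneg (pow_nonneg this.1 _)]
  exact pow_le_one₀ this.1 this.2

lemma norm_cut_pow_smul_mono (z : Pt n m) (r : ℝ) {j k : ℕ} (h : j ≤ k) (f : TF (Pt n m)) :
    ‖cut N z r ^ k • f‖ ≤ ‖cut N z r ^ j • f‖ := by
  rw [← Nat.sub_add_cancel h, pow_add, ← smul_smul]
  exact norm_cut_pow_smul_le z r _ _

lemma exists_subset_Bx (z₀ : Pt n m) (f : TF (Pt n m)) :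
    ∃ R₀ ≥ (1 : ℝ), ∀ R ≥ R₀, ∀ z ∉ Bx N z₀ R, f z = 0 := by
  obtain ⟨C, hC⟩ := f.hasCompactSupport.isCompact.isBounded.exists_norm_le
  refine ⟨max 1 (C + ‖z₀‖ + 1), le_max_left _ _, fun R hR z hz => ?_⟩
  have hR1 := (le_max_left _ _).trans hR
  have hR2 := (le_max_right _ _).trans hR
  by_contra h
  refine hz (mem_Bx.2 ?_)
  have h1 := hC z (subset_tsupport _ h)
  have h2 := norm_sub_le z z₀
  rw [Prod.norm_def (z - z₀)] at h2
  have h3 := (le_max_left _ _).trans h2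
  have h4 := (le_max_right _ _).trans h2
  refine ⟨lt_of_le_of_lt h3 (by linarith), lt_of_le_of_lt h4 ?_⟩
  have : R * 1 ≤ R * (R + ‖z₀.1‖) ^ N := by
    gcongr; exact one_le_pow₀ (by linarith [norm_nonneg z₀.1])
  rw [ρ]
  linarith

lemma H_moll (ρ : TF (Fin m → ℝ)) (f : TF (Pt n m)) :
    H n m N (moll (ContinuousLinearMap.inr ℝ (Fin n → ℝ) (Fin m → ℝ)) ρ f) =
      moll (ContinuousLinearMap.inr ℝ (Fin n → ℝ) (Fin m → ℝ)) ρ (H n m N f) := by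
  simp only [H_eq, LinearMap.sub_apply, LinearMap.neg_apply, LinearMap.sum_apply, Module.End.mul_apply,
    pow_two, Mul_apply, map_sub, map_neg, map_sum, Dv_moll]
  congr 1
  refine Finset.sum_congr rfl fun k _ => (moll_smul _ _ (fun z t => ?_) _).symm
  simp

lemma moll_DY (b : List (Fin m)) : ∀ ρ : TF (Fin m → ℝ), ∃ ρ' : TF (Fin m → ℝ), ∀ f : TF (Pt n m),
    moll (ContinuousLinearMap.inr ℝ (Fin n → ℝ) (Fin m → ℝ)) ρ (DY n m b f) =
      moll (ContinuousLinearMap.inr ℝ (Fin n → ℝ) (Fin m → ℝ)) ρ' f := by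
  induction b with
  | nil => exact fun ρ => ⟨ρ, fun f => rfl⟩
  | cons k b ih =>
    intro ρ
    obtain ⟨ρ', h⟩ := ih (Dv (Pi.single k 1) ρ)
    refine ⟨ρ', fun f => ?_⟩
    rw [← h, ← moll_Dv, DY_cons]
    rfl

/-- The range of `H ^ s (1 + H ^ K)` on test functions is dense. -/
theorem dense_range (hn : 1 ≤ n) (hm : 1 ≤ m) (hN : 1 ≤ N) (s : ℕ) {K : ℕ} (hK : 1 ≤ K) (b : TF (Pt n m))
    {ε : ℝ} (hε : 0 < ε) : ∃ φ, ‖(H n m N ^ s + H n m N ^ (s + K)) φ - b‖ ≤ ε := by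
  set Q := H n m N ^ s + H n m N ^ (s + K) with hQ
  obtain ⟨_, ⟨φ, rfl⟩, h⟩ := exists_approx_of_dual (LinearMap.range Q) (fun ℓ hℓ => by
    refine eq_zero_of_forall_moll (ContinuousLinearMap.inr ℝ (Fin n → ℝ) (Fin m → ℝ)) ℓ fun ρ _ => ?_
    have hb : ∀ (ρ : TF (Fin m → ℝ)) (f : TF (Pt n m)),
        ‖ℓ (moll (ContinuousLinearMap.inr ℝ (Fin n → ℝ) (Fin m → ℝ)) ρ f)‖ ≤ (‖ℓ‖ * ∫ t, |ρ t|) * ‖f‖ := by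
      intro ρ f
      rw [mul_assoc]
      exact (ℓ.le_opNorm _).trans (mul_le_mul_of_nonneg_left (norm_moll_le _ _ _) ℓ.opNorm_nonneg)
    set ℓ' := pull ℓ _ _ (hb ρ) with hℓ'
    have hpow : ∀ k f, (H n m N ^ k) (moll (ContinuousLinearMap.inr ℝ (Fin n → ℝ) (Fin m → ℝ)) ρ f) =
        moll (ContinuousLinearMap.inr ℝ (Fin n → ℝ) (Fin m → ℝ)) ρ ((H n m N ^ k) f) := fun k f => by
      induction k generalizing f with
      | zero => rfl
      | succ k ih => rw [pow_succ, Module.End.mul_apply, Module.End.mul_apply, H_moll, ih]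
    have h0 : ∀ f, ℓ' (Q f) = 0 := fun f => by
      rw [hℓ', pull_apply, hQ, LinearMap.add_apply, map_add, ← hpow, ← hpow, ← LinearMap.add_apply]
      exact hℓ _ ⟨_, rfl⟩
    have hy : ∀ b : List (Fin m), ∃ C, 0 ≤ C ∧ ∀ f, |ℓ' (DY n m b f)| ≤ C * ‖f‖ := fun b => by
      obtain ⟨ρ', h⟩ := moll_DY (n := n) b ρ
      refine ⟨‖ℓ‖ * ∫ t, |ρ' t|, mul_nonneg ℓ.opNorm_nonneg (integral_nonneg fun t => abs_nonneg _), fun f => ?_⟩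
      rw [hℓ', pull_apply, h]
      exact hb ρ' f
    have hL : s + K - 1 + 1 = s + K := by omega
    have hlow : Q - H n m N ^ (s + K - 1 + 1) ∈ Hlow n m N (s + K - 1 + 1) := by
      rw [hL, hQ, add_sub_cancel_right]
      exact Submodule.subset_span ⟨s, show s < s + K by omega, rfl⟩
    obtain ⟨C, hC, hcomm⟩ := exists_comm_cut hn hm hN s hK
    intro f
    rw [← pull_apply ℓ _ _ (hb ρ) f, ← hℓ']
    have hL0 : 0 ≤ ‖ℓ'‖ := ℓ'.opNorm_nonneg
    refine abs_eq_zero.1 (le_antisymm (le_of_forall_pos_le_add fun ε hε => ?_) (abs_nonneg _))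
    obtain ⟨δ, hδ, hsmall⟩ := exists_weak_small hn hm hN s f (C := ‖ℓ'‖ + 1) (by positivity) (half_pos hε)
    obtain ⟨R₀, hR₀, hf⟩ := exists_subset_Bx (N := N) 0 f
    set R := 2 * R₀ + 2 * C * (‖ℓ'‖ + 1) / δ with hR
    have hR2 : 2 * R₀ ≤ R := by rw [hR]; exact le_add_of_nonneg_right (by positivity)
    have hR1 : 1 ≤ R := by linarith
    have hR0 : 0 < R := by linarith
    have hfR : ∀ z : Pt n m, R < ‖z.1‖ → f z = 0 := fun z hz => hf R (by linarith) z fun h => by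
      have := (mem_Bx.1 h).1
      rw [Prod.fst_zero, sub_zero] at this
      linarith
    set ε₁ := min (min 1 (δ / (2 * (C + 1)))) (ε / (2 * (‖f‖ + 1))) with hε₁
    have hε₁0 : 0 < ε₁ := by positivity
    obtain ⟨h, hh1, hh2, hh3⟩ := exists_local_approx hlow h0 hy hR0 (cutT N (0 : Pt n m) hR0) (fun z hz =>
      cut_eq_zero hR0 fun h => by
        have := (mem_Bx.1 h).1
        rw [Prod.fst_zero, sub_zero] at this
        linarith) hε₁0
    rw [cutT_toSm] at hh2
    have hh4 : ‖h‖ ≤ ‖ℓ'‖ + 1 := hh1.trans (by gcongr; exact (min_le_left _ _).trans (min_le_left _ _))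
    have h1 : ‖cut N (0 : Pt n m) R ^ (2 * (s + K)) • Q h‖ ≤ ε₁ := by
      refine (norm_cut_pow_smul_mono _ _ (by omega : 1 ≤ 2 * (s + K)) _).trans ?_
      rwa [pow_one]
    have h2 := hsmall (cut N (0 : Pt n m) R ^ (2 * (s + K)) • h) ((norm_cut_pow_smul_le _ _ _ _).trans hh4) (by
      refine (norm_H_mul_le s K _).trans ((hcomm R hR1 h).trans ?_)
      have h3 : C * ε₁ ≤ δ / 2 := by
        have : ε₁ ≤ δ / (2 * (C + 1)) := (min_le_left _ _).trans (min_le_right _ _)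
        rw [le_div_iff₀ (by positivity)] at this
        nlinarith
      have h4 : C * (R⁻¹ * ‖h‖) ≤ δ / 2 := by
        rw [mul_left_comm, inv_mul_le_iff₀ hR0]
        have : 2 * C * (‖ℓ'‖ + 1) / δ ≤ R := by rw [hR]; linarith
        rw [div_le_iff₀ hδ] at this
        nlinarith [mul_le_mul_of_nonneg_left hh4 hC]
      rw [mul_add]
      nlinarith [mul_le_mul_of_nonneg_left h1 hC])
    have h3 : cut N (0 : Pt n m) R ^ (2 * (s + K)) • f = f := by
      ext z
      rw [TF.sm_smul_apply, Sm.pow_apply]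
      by_cases hz : z ∈ Bx N (0 : Pt n m) (R / 2)
      · rw [cut_eq_one hR0 hz, one_pow, one_mul]
      · rw [hf (R / 2) (by linarith) z hz, mul_zero]
    rw [inner_smul_sm, h3] at h2
    have h4 := hh3 f hfR
    have h5 : ε₁ * ‖f‖ ≤ ε / 2 := by
      have : ε₁ ≤ ε / (2 * (‖f‖ + 1)) := min_le_right _ _
      rw [le_div_iff₀ (by positivity)] at this
      nlinarith
    have h6 := abs_sub_abs_le_abs_sub (ℓ' f) ⟪h, f⟫_ℝ
    rw [abs_sub_comm] at h6
    linarith) b hε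
  exact ⟨φ, h⟩

end DenseRange2

section Solve
set_option linter.unusedSectionVars false
variable {n m : ℕ} {N : ℕ}

lemma norm_le_of_dense {E : Type*} [SeminormedAddCommGroup E] [InnerProductSpace ℝ E] {S : Set E}
    (hS : ∀ b : E, ∀ ε > 0, ∃ y ∈ S, ‖y - b‖ ≤ ε) {x : E} {c : ℝ} (hc : 0 ≤ c)
    (h : ∀ y ∈ S, |⟪x, y⟫_ℝ| ≤ c * ‖y‖) : ‖x‖ ≤ c := by
  have hx : 0 ≤ ‖x‖ := norm_nonneg x
  have h1 : ‖x‖ * ‖x‖ ≤ c * ‖x‖ := by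
    refine le_of_forall_pos_le_add fun ε hε => ?_
    obtain ⟨y, hy, hyx⟩ := hS x (ε / (c + ‖x‖ + 1)) (by positivity)
    rw [le_div_iff₀ (by positivity)] at hyx
    have h2 := (le_abs_self _).trans (h y hy)
    have h3 : ⟪x, y⟫_ℝ = ‖x‖ * ‖x‖ + ⟪x, y - x⟫_ℝ := by
      rw [inner_sub_right, real_inner_self_eq_norm_mul_norm]; ring
    have h4 := (neg_le_abs _).trans (abs_real_inner_le_norm x (y - x))
    have h5 := mul_le_mul_of_nonneg_left (norm_le_norm_add_norm_sub' y x) hc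
    nlinarith [norm_nonneg (y - x)]
  rcases hx.eq_or_lt with h0 | h0
  · rwa [← h0]
  · exact le_of_mul_le_mul_right h1 h0

/-- Weak solutions of `H ^ K v = Ω' h` are approximated by test functions. -/
theorem exists_solution (hn : 1 ≤ n) (hm : 1 ≤ m) (hN : 1 ≤ N) {K : ℕ} (hK : 1 ≤ K)
    {Ω Ω' : Module.End ℝ (TF (Pt n m))} (hΩ : ∀ f g, ⟪Ω f, g⟫_ℝ = ⟪f, Ω' g⟫_ℝ) {C : ℝ} (hC : 0 ≤ C)
    (hb : ∀ φ, ‖Ω φ‖ ≤ C * ‖(H n m N ^ K) φ‖) (h : TF (Pt n m)) {ε : ℝ} (hε : 0 < ε) :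
    ∃ v : TF (Pt n m), ‖v‖ ≤ C * ‖h‖ + ε ∧ ‖(H n m N ^ K) v - Ω' h‖ ≤ ε ∧
      ∀ φ, |⟪v, (H n m N ^ K) φ⟫_ℝ - ⟪h, Ω φ⟫_ℝ| ≤ ε * ‖(H n m N ^ K) φ‖ := by
  obtain ⟨l, hl1, hl2⟩ := exists_dual (H n m N ^ K) ((innerₗ _ h).comp Ω) (C := ‖h‖ * C) (by positivity) fun φ => by
    rw [LinearMap.comp_apply, innerₗ_apply_apply, mul_assoc]
    exact (abs_real_inner_le_norm _ _).trans (mul_le_mul_of_nonneg_left (hb φ) (norm_nonneg _))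
  obtain ⟨g, hg⟩ := riesz_approx l (ε := ε / 4) (by positivity)
  have hg' : ‖g‖ ≤ C * ‖h‖ + ε / 4 := by
    have h1 := hg g
    have h2 := hl1 g
    rw [real_inner_self_eq_norm_mul_norm] at h1
    rcases (norm_nonneg g).eq_or_lt with h0 | h0
    · rw [← h0]; positivity
    · refine le_of_mul_le_mul_right ?_ h0
      have := (abs_le.1 h1).2
      have := (abs_le.1 h2).2
      nlinarith
  obtain ⟨v, hv⟩ := dense_range hn hm hN 0 hK (g + Ω' h) (ε := ε / 4) (by positivity)
  rw [H_add_apply, pow_zero, Module.End.one_apply] at hv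
  have hd : ‖v - g‖ ≤ ε / 2 := by
    refine norm_le_of_dense (S := Set.range ⇑(H n m N ^ 0 + H n m N ^ (0 + K))) (fun b ε hε => ?_) ?_ ?_
    · obtain ⟨φ, hφ⟩ := dense_range hn hm hN 0 hK b hε
      exact ⟨_, ⟨φ, rfl⟩, hφ⟩
    · positivity
    · rintro _ ⟨φ, rfl⟩
      rw [H_add_apply, pow_zero, Module.End.one_apply]
      obtain ⟨h1, h2⟩ := norm_le_one_add_H_pow (N := N) K φ
      have h3 := (abs_real_inner_le_norm _ φ).trans (mul_le_mul_of_nonneg_right hv (norm_nonneg φ))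
      have h4 := hg ((H n m N ^ K) φ)
      rw [hl2, LinearMap.comp_apply, innerₗ_apply_apply, real_inner_comm (Ω φ), hΩ, real_inner_comm (Ω' h)] at h4
      have e : ⟪v - g, φ + (H n m N ^ K) φ⟫_ℝ = ⟪v + (H n m N ^ K) v - (g + Ω' h), φ⟫_ℝ -
          (⟪g, (H n m N ^ K) φ⟫_ℝ - ⟪Ω' h, φ⟫_ℝ) := by
        simp only [inner_sub_left, inner_add_left, inner_add_right, inner_H_pow]
        ring
      rw [e]
      refine (abs_sub _ _).trans ?_
      nlinarith
  refine ⟨v, ?_, ?_, fun φ => ?_⟩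
  · have := norm_add_le (v - g) g
    rw [sub_add_cancel] at this
    linarith
  · have := norm_sub_le (v + (H n m N ^ K) v - (g + Ω' h)) (v - g)
    rw [show v + (H n m N ^ K) v - (g + Ω' h) - (v - g) = (H n m N ^ K) v - Ω' h by abel] at this
    linarith
  · have h4 := hg ((H n m N ^ K) φ)
    rw [hl2, LinearMap.comp_apply, innerₗ_apply_apply] at h4
    have h5 := (abs_real_inner_le_norm (v - g) _).trans (mul_le_mul_of_nonneg_right hd (norm_nonneg ((H n m N ^ K) φ)))
    rw [inner_sub_left] at h5
    have h6 := abs_add_le (⟪v, (H n m N ^ K) φ⟫_ℝ - ⟪g, (H n m N ^ K) φ⟫_ℝ) (⟪g, (H n m N ^ K) φ⟫_ℝ - ⟪h, Ω φ⟫_ℝ)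
    rw [sub_add_sub_cancel] at h6
    nlinarith [norm_nonneg ((H n m N ^ K) φ)]

end Solve

section Off
variable {n m N : ℕ}

lemma UB_one_sub_cut {P : Type*} (z : P → Pt n m) (r : P → ℝ) (hr : ∀ p, 0 < r p) :
    UB N r fun p => 1 - cut N (z p) (4 * r p) := by
  have h := (UB_cut (N := N) z (fun p => 4 * r p) fun p => by have := hr p; positivity).const_smul (-1)
  refine UB.scale (r := fun p => 4 * r p) ?_ fun p => ?_
  · convert UB.one.add h using 2 with p
    rw [neg_one_smul, sub_eq_add_neg]
  · rw [abs_of_pos (hr p), abs_of_pos (by have := hr p; positivity)]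
    linarith [hr p]

lemma norm_one_sub_cut_pow_smul_le (z : Pt n m) (r : ℝ) (k : ℕ) (f : TF (Pt n m)) :
    ‖(1 - cut N z r) ^ k • f‖ ≤ ‖f‖ := by
  refine (norm_sm_smul_le zero_le_one f fun w _ => ?_).trans_eq (one_mul _)
  have := cut_mem_Icc (N := N) z r w
  have e : ((1 - cut N z r) ^ k : Sm (Pt n m)) w = (1 - cut N z r w) ^ k := by
    simp [Sm.pow_apply, Sm.sub_apply]
  rw [e, abs_of_nonneg (pow_nonneg (by linarith) _)]
  exact pow_le_one₀ (by linarith) (by linarith)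

lemma inner_XT (τ : List (XIdx n m N)) (f g : TF (Pt n m)) :
    ⟪XT n m N τ f, g⟫_ℝ = ⟪f, ((-1 : ℝ) ^ τ.length • XT n m N τ.reverse) g⟫_ℝ := by
  rw [inner_wT XF_divFree, LinearMap.smul_apply, inner_smul_right]

lemma XT_adjoint_mem_Wd (τ : List (XIdx n m N)) :
    (-1 : ℝ) ^ τ.length • XT n m N τ.reverse ∈ Wd n m N τ.length := by
  refine Submodule.smul_mem _ _ ?_
  simpa using XT_mem_Wd τ.reverse

/-- Away from the source, a weak solution of `H ^ K v = Ω' h` is controlled in terms of its norm. -/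
lemma exists_off_le (hn : 1 ≤ n) (hm : 1 ≤ m) (hN : 1 ≤ N) {s : ℕ} (hs : 1 ≤ s) (K : ℕ) :
    ∃ C, 0 ≤ C ∧ ∀ (z : Pt n m) (R : ℝ), 0 < R → ∀ v, R ^ (2 * K) * ‖(1 - cut N z (4 * R)) ^ (2 * K) •
      (H n m N ^ K) v‖ ≤ C * (R ^ (2 * (K + s)) * ‖(1 - cut N z (4 * R)) ^ (2 * (K + s)) •
        (H n m N ^ (K + s)) v‖ + ‖v‖) := by
  have hχ := UB_one_sub_cut (N := N) (P := {q : Pt n m × ℝ // 0 < q.2}) (fun p => p.1.1) (fun p => p.1.2)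
    fun p => p.2
  obtain ⟨A, hA, h1⟩ := Wd_le_cac (r := fun p : {q : Pt n m × ℝ // 0 < q.2} => p.1.2)
    (χ := fun p => 1 - cut N p.1.1 (4 * p.1.2)) (H_pow_mem_Wd (n := n) (m := m) (N := N) K)
  obtain ⟨D, hD, h2⟩ := cac_le hχ (2 * (K + s)) one_pos
  obtain ⟨B, hB, h3⟩ := caccioppoli hn hm hN hχ (K + s)
  refine ⟨A * (B + D), by positivity, fun z R hR v => ?_⟩
  have g1 := h1 ⟨(z, R), hR⟩ v
  have g2 := h2 ⟨(z, R), hR⟩ v (2 * K) (by omega)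
  have g3 := h3 ⟨(z, R), hR⟩ v
  simp only [abs_of_pos hR] at g1 g3
  refine g1.trans ?_
  rw [mul_assoc]
  refine mul_le_mul_of_nonneg_left ?_ hA
  have : 0 ≤ D * (R ^ (2 * (K + s)) * ‖(1 - cut N z (4 * R)) ^ (2 * (K + s)) • (H n m N ^ (K + s)) v‖) := by
    positivity
  linarith

theorem word_cut_le (hn : 1 ≤ n) (hm : 1 ≤ m) (hN : 1 ≤ N) {s : ℕ} (hs : 1 ≤ s) {K : ℕ} (hK : 1 ≤ K)
    (τ : List (XIdx n m N)) (hτ : τ.length = 2 * (K + s)) :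
    ∃ C, 0 ≤ C ∧ ∀ (z : Pt n m) (R : ℝ), 0 < R → ∀ b : TF (Pt n m), (∀ x ∈ Bx N z (4 * R), b x = 0) → ∀ φ,
      R ^ (2 * K) * ‖cut N z R ^ (2 * K) • XT n m N τ φ‖ ≤
        C * (‖b‖ + R ^ (2 * K) * ‖(H n m N ^ (K + s)) φ - (H n m N ^ K) b‖) := by
  obtain ⟨A, hA, hτ'⟩ := norm_XT_le hn hm hN (K + s) τ hτ
  obtain ⟨B, hB, hoff⟩ := exists_off_le hn hm hN hs K
  refine ⟨A + B * A, by positivity, fun z R hR b hb φ => ?_⟩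
  set a := ‖cut N z R ^ (2 * K) • XT n m N τ φ‖ with ha
  set E := ‖(H n m N ^ (K + s)) φ - (H n m N ^ K) b‖ with hE
  set F := ‖(H n m N ^ (K + s)) φ‖
  set h := cut N z R ^ (4 * K) • XT n m N τ φ with hh
  have hha : ‖h‖ ≤ a := norm_cut_pow_smul_mono z R (by omega) _
  have haa : ⟪h, XT n m N τ φ⟫_ℝ = a ^ 2 := by
    rw [hh, show 4 * K = 2 * K + 2 * K by ring, pow_add, ← smul_smul, inner_smul_sm, real_inner_self_eq_norm_sq]
  set Ω' := (-1 : ℝ) ^ τ.length • XT n m N τ.reverse with hΩ'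
  have hΩ0 : ∀ x, (1 - cut N z (4 * R)) x ≠ 0 → (Ω' h) x = 0 := by
    intro x hx
    have hΩ := XT_adjoint_mem_Wd (n := n) (m := m) τ
    refine Wd_eq_zero hΩ (Off.open_ (N := N) z R) (fun w hw => ?_) ?_
    · rw [hh, TF.sm_smul_apply]
      by_cases h0 : cut N z R w = 0
      · rw [Sm.pow_apply, h0, zero_pow (by omega), zero_mul]
      · have := mem_Bx.1 ((cut_ne_zero hR).1 h0)
        rcases hw with hw | hw <;> linarith
    · by_contra hx'
      simp only [Set.mem_ofPred_eq, not_or, not_lt] at hx'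
      refine hx ?_
      rw [Sm.sub_apply, cut_eq_one (by positivity) (mem_Bx.2 ⟨?_, ?_⟩)]
      · simp
      · linarith
      · have := ρ_half (N := N) z (r := 4 * R / 2) (t := 1 / 2) (by positivity) (by norm_num) (by norm_num)
        rw [show 1 / 2 * (4 * R / 2) = R by ring] at this
        have h2 := ρ_pos (N := N) z (r := 4 * R / 2) (by positivity)
        linarith
  have hθb : (1 - cut N z (4 * R)) ^ (2 * K) • b = b := by
    ext x
    rw [TF.sm_smul_apply]
    by_cases hx : x ∈ Bx N z (4 * R)
    · rw [hb x hx, mul_zero]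
    · have : ((1 - cut N z (4 * R)) ^ (2 * K) : Sm (Pt n m)) x = (1 - cut N z (4 * R) x) ^ (2 * K) := by
        simp [Sm.pow_apply, Sm.sub_apply]
      rw [this, cut_eq_zero (by positivity) hx]
      simp
  have key : ∀ ε > 0, R ^ (2 * K) * a ^ 2 ≤ R ^ (2 * K) * (A * a + ε) * E +
      B * (R ^ (2 * (K + s)) * ε + (A * a + ε)) * ‖b‖ + R ^ (2 * K) * ε * F := by
    intro ε hε
    obtain ⟨v, hv1, hv2, hv3⟩ := exists_solution hn hm hN (K := K + s) (by omega) (Ω := XT n m N τ) (Ω' := Ω')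
      (inner_XT τ) hA hτ' h hε
    have hv : ‖v‖ ≤ A * a + ε := hv1.trans (by gcongr)
    have c1 := hv3 φ
    rw [haa, ← sub_add_cancel ((H n m N ^ (K + s)) φ) ((H n m N ^ K) b), inner_add_right, sub_add_cancel,
      ← inner_H_pow, ← hθb, ← inner_smul_sm, hθb] at c1
    have c2 := abs_real_inner_le_norm v ((H n m N ^ (K + s)) φ - (H n m N ^ K) b)
    have c3 := abs_real_inner_le_norm ((1 - cut N z (4 * R)) ^ (2 * K) • (H n m N ^ K) v) b
    have c4 := hoff z R hR v
    have c5 : ‖(1 - cut N z (4 * R)) ^ (2 * (K + s)) • (H n m N ^ (K + s)) v‖ ≤ ε := by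
      refine le_trans (le_of_eq ?_) ((norm_one_sub_cut_pow_smul_le (N := N) z (4 * R) (2 * (K + s))
        ((H n m N ^ (K + s)) v - Ω' h)).trans hv2)
      congr 1
      ext x
      rw [TF.sm_smul_apply, TF.sm_smul_apply, TF.sub_apply]
      by_cases hx : (1 - cut N z (4 * R)) x = 0
      · rw [Sm.pow_apply, hx, zero_pow (by omega)]; simp
      · rw [hΩ0 x hx, sub_zero]
    have c6 : R ^ (2 * K) * |⟪(1 - cut N z (4 * R)) ^ (2 * K) • (H n m N ^ K) v, b⟫_ℝ| ≤
        B * (R ^ (2 * (K + s)) * ε + (A * a + ε)) * ‖b‖ := by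
      refine (mul_le_mul_of_nonneg_left c3 (by positivity)).trans ?_
      rw [← mul_assoc]
      refine mul_le_mul_of_nonneg_right (c4.trans (mul_le_mul_of_nonneg_left ?_ hB)) (norm_nonneg b)
      exact add_le_add (mul_le_mul_of_nonneg_left c5 (by positivity)) hv
    have c7 : a ^ 2 ≤ (A * a + ε) * E + |⟪(1 - cut N z (4 * R)) ^ (2 * K) • (H n m N ^ K) v, b⟫_ℝ| + ε * F := by
      have := (abs_le.1 c1).1
      have := le_abs_self ⟪(1 - cut N z (4 * R)) ^ (2 * K) • (H n m N ^ K) v, b⟫_ℝ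
      have := (abs_le.1 c2).2
      have := mul_le_mul_of_nonneg_right hv (norm_nonneg ((H n m N ^ (K + s)) φ - (H n m N ^ K) b))
      linarith
    have c8 := mul_le_mul_of_nonneg_left c7 (show 0 ≤ R ^ (2 * K) by positivity)
    linarith
  have lim : R ^ (2 * K) * a ^ 2 ≤ R ^ (2 * K) * (A * a) * E + B * (A * a) * ‖b‖ := by
    refine le_of_forall_pos_le_add fun δ hδ => ?_
    set Q := R ^ (2 * K) * E + B * (R ^ (2 * (K + s)) + 1) * ‖b‖ + R ^ (2 * K) * F + 1 with hQ
    have hQ0 : 0 < Q := by positivity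
    refine (key (δ / Q) (by positivity)).trans ?_
    have : δ / Q * Q = δ := by field_simp
    have h1 : 0 < δ / Q := by positivity
    rw [hQ] at this
    linarith
  have ha0 : 0 ≤ a := norm_nonneg _
  rcases ha0.eq_or_lt' with h0 | h0
  · rw [h0, mul_zero]; positivity
  · refine le_of_mul_le_mul_right (a := a) ?_ h0
    have : 0 ≤ a * (B * A * (R ^ (2 * K) * E) + A * ‖b‖) := by positivity
    linarith

end Off

section Approx
variable {n m N : ℕ}

/-- An approximate solution relation `T b ε w` (`w` solves up to `ε` the problem with datum `b`) which is
compatible with differences, bounded in `L²`, and locally smooth away from the datum. -/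
structure IsApp (N : ℕ) (T : TF (Pt n m) → ℝ → TF (Pt n m) → Prop) : Prop where
  sub : ∀ {b ε w b' ε' w'}, T b ε w → T b' ε' w' → T (b - b') (ε + ε') (w - w')
  bound : ∃ C, 0 ≤ C ∧ ∀ {b ε w}, T b ε w → ‖w‖ ≤ C * (‖b‖ + ε)
  loc : ∃ C, 0 ≤ C ∧ ∀ (z : Pt n m) (R : ℝ), 0 < R → ∀ b : TF (Pt n m), (∀ x ∈ Bx N z (4 * R), b x = 0) →
    ∀ ε > 0, ∃ w, T b ε w ∧ ∀ r, 0 < r → r ≤ R / 2 → ∀ z₁ ∈ Bx N z r, ∀ z₂ ∈ Bx N z r,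
      √(vol N z R) * |w z₁ - w z₂| ≤ C * (r / R) * (‖b‖ + ε)

lemma vol_scale (z : Pt n m) {r t : ℝ} (hr : 0 < r) (ht : 1 ≤ t) :
    vol N z (t * r) ≤ t ^ n * (t ^ (N + 1)) ^ m * vol N z r := by
  have h := volume_Bx_scale (N := N) z hr ht
  rw [volume_Bx z (by positivity), volume_Bx z hr, ← ENNReal.ofReal_mul (by positivity)] at h
  exact (ENNReal.ofReal_le_ofReal_iff (mul_nonneg (by positivity) (vol_pos z hr).le)).1 h

lemma vol_mono (z : Pt n m) {r t : ℝ} (hr : 0 < r) (ht : r ≤ t) : vol N z r ≤ vol N z t := by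
  have := ρ_mono (N := N) z hr ht
  have := ρ_pos (N := N) z hr
  have : 0 < t := hr.trans_le ht
  unfold vol
  gcongr

lemma ofReal_norm_sq' (f : TF (Pt n m)) : ENNReal.ofReal (‖f‖ ^ 2) = ∫⁻ w, ENNReal.ofReal (f w ^ 2) := by
  rw [ofReal_norm_sq]
  refine lintegral_congr fun w => ?_
  rw [Real.enorm_eq_ofReal_abs, ← ENNReal.ofReal_pow (abs_nonneg _), sq_abs]

lemma norm_le_of_box {f b : TF (Pt n m)} {z : Pt n m} {r η : ℝ} (hr : 0 < r) (hη : 0 ≤ η)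
    (h : ∀ w, |f w| ≤ |b w|) (h0 : ∀ w ∉ Bx N z r, f w = 0)
    (hb : ∫⁻ x in Bx N z r, ENNReal.ofReal (b x ^ 2) ≤ ENNReal.ofReal (η ^ 2) * volume (Bx N z r)) :
    ‖f‖ ≤ η * √(vol N z r) := by
  have hv := vol_pos (N := N) z hr
  refine abs_le_of_sq_le_sq' ?_ (by positivity) |>.2
  rw [mul_pow, Real.sq_sqrt hv.le]
  refine (ENNReal.ofReal_le_ofReal_iff (by positivity)).1 ?_
  rw [ofReal_norm_sq', ENNReal.ofReal_mul (by positivity), vol, ← volume_Bx z hr]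
  refine le_trans ?_ hb
  rw [← lintegral_indicator (measurableSet_Bx z r)]
  refine lintegral_mono fun w => ?_
  by_cases hw : w ∈ Bx N z r
  · rw [Set.indicator_of_mem hw]
    exact ENNReal.ofReal_le_ofReal (sq_le_sq.2 (h w))
  · rw [Set.indicator_of_notMem hw, h0 w hw]; simp

theorem IsApp.oscHyp {T : TF (Pt n m) → ℝ → TF (Pt n m) → Prop} (hT : IsApp N T) :
    ∃ A, 0 ≤ A ∧ ∀ (b : TF (Pt n m)) (u : Pt n m → ℝ), Continuous u → (∀ ε > 0, ∃ v, T b ε v ∧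
      ∫⁻ x, ENNReal.ofReal ((u x - v x) ^ 2) ≤ ENNReal.ofReal (ε ^ 2)) → OscHyp N A u b := by
  obtain ⟨C, hC, hbd⟩ := hT.bound
  obtain ⟨D, hD, hloc⟩ := hT.loc
  set S := √((16 : ℝ) ^ n * (16 ^ (N + 1)) ^ m) with hS
  refine ⟨2 + 2 * (C * (S + 1)) ^ 2 + (D * (S + 1)) ^ 2, by positivity, fun b u hu happ z r η hr hη hb => ?_⟩
  have hv := vol_pos (N := N) z hr
  set R : ℕ → ℝ := fun j => 2 ^ j * r with hR
  have hRr : ∀ j, r ≤ R j := fun j => le_mul_of_one_le_left hr.le (one_le_pow₀ (by norm_num))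
  have hR0 : ∀ j, 0 < R j := fun j => hr.trans_le (hRr j)
  have hsq : ∀ t, 0 < t → √(vol N z (16 * t)) ≤ S * √(vol N z t) := fun t ht => by
    rw [hS, ← Real.sqrt_mul (by positivity)]
    exact Real.sqrt_le_sqrt (vol_scale z ht (by norm_num))
  set θ : ℕ → Sm (Pt n m) := fun j => cut N z (16 * R j) with hθ
  obtain ⟨R₀, hR₀, hbR⟩ := exists_subset_Bx (N := N) z b
  obtain ⟨J, hJ⟩ := pow_unbounded_of_one_lt (R₀ / r) (one_lt_two)
  rw [div_lt_iff₀ hr] at hJ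
  have hθJ : θ J • b = b := by
    ext x
    rw [TF.sm_smul_apply]
    by_cases hx : x ∈ Bx N z (16 * R J / 2)
    · rw [hθ]; simp only []; rw [cut_eq_one (by have := hR0 J; positivity) hx, one_mul]
    · rw [hbR _ (by have := hR0 J; simp only [hR] at this ⊢; linarith) x hx, mul_zero]
  set f : ℕ → TF (Pt n m) := fun j => (θ (j + 1) - θ j) • b with hf
  have hsum : ∑ j ∈ Finset.range J, f j = b - θ 0 • b := by
    rw [hf, ← Finset.sum_smul, Finset.sum_range_sub, sub_smul, hθJ]
  have hcut : ∀ j x, 0 ≤ θ j x ∧ θ j x ≤ 1 := fun j x => cut_mem_Icc _ _ _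
  have hθ0 : ∀ j, ∀ x ∉ Bx N z (16 * R j), θ j x = 0 := fun j x hx =>
    cut_eq_zero (by have := hR0 j; positivity) hx
  have hf1 : ∀ j, ‖f j‖ ≤ S * η * √(vol N z (2 * R j)) := fun j => by
    have h2 : 16 * R (j + 1) = 16 * (2 * R j) := by simp only [hR]; ring
    refine (norm_le_of_box (b := b) (z := z) (r := 16 * R (j + 1)) (η := η) (by have := hR0 (j+1); positivity)
      hη.le (fun w => ?_) (fun w hw => ?_) (hb _ (by have := hRr (j+1); linarith))).trans ?_
    · rw [TF.sm_smul_apply, Sm.sub_apply, abs_mul]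
      refine mul_le_of_le_one_left (abs_nonneg _) (abs_le.2 ?_)
      constructor <;> linarith [(hcut j w).1, (hcut j w).2, (hcut (j+1) w).1, (hcut (j+1) w).2]
    · rw [TF.sm_smul_apply, Sm.sub_apply, hθ0 _ w hw, hθ0 j w fun h => hw (Bx_mono z (by have := hR0 j; positivity)
        (by rw [h2]; linarith [hR0 j]) h), sub_zero, zero_mul]
    · rw [h2]
      have := hsq (2 * R j) (by have := hR0 j; positivity)
      nlinarith
  have hf0 : ∀ j, ∀ x ∈ Bx N z (4 * (2 * R j)), f j x = 0 := fun j x hx => by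
    have h0 := hR0 j
    have h1 : θ j x = 1 := cut_eq_one (by positivity) (by convert hx using 1; ring_nf)
    have h2 : θ (j + 1) x = 1 := cut_eq_one (by have := hR0 (j + 1); positivity)
      (Bx_mono z (by positivity) (by simp only [hR] at h0 ⊢; rw [pow_succ]; linarith) hx)
    rw [TF.sm_smul_apply, Sm.sub_apply, h1, h2, sub_self, zero_mul]
  set ε : ℝ := η * √(vol N z r) / (J + 1) with hε
  have hε0 : 0 < ε := by positivity
  choose w hw hosc using fun j => hloc z (2 * R j) (by have := hR0 j; positivity) (f j) (hf0 j) ε hε0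
  obtain ⟨v, hv1, hv2⟩ := happ ε hε0
  have hrec : ∀ k, T (b - ∑ j ∈ Finset.range k, f j) (ε + k * ε) (v - ∑ j ∈ Finset.range k, w j) := by
    intro k
    induction k with
    | zero => simpa using hv1
    | succ k ih =>
      have := hT.sub ih (hw k)
      rw [Finset.sum_range_succ, Finset.sum_range_succ, ← sub_sub, ← sub_sub]
      convert this using 1
      push_cast; ring
  have hJε : ε + J * ε = η * √(vol N z r) := by rw [hε]; field_simp; ring
  have hmain : ‖v - ∑ j ∈ Finset.range J, w j‖ ≤ C * (S + 1) * (η * √(vol N z r)) := by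
    have := hbd (hrec J)
    rw [hsum, sub_sub_cancel, hJε] at this
    have h0 : ‖θ 0 • b‖ ≤ S * η * √(vol N z r) := by
      have h2 : R 0 = r := by simp [hR]
      refine (norm_le_of_box (b := b) (z := z) (r := 16 * R 0) (η := η) (by have := hR0 0; positivity)
        hη.le (fun w => ?_) (fun w hw => ?_) (hb _ (by have := hRr 0; linarith))).trans ?_
      · rw [TF.sm_smul_apply, abs_mul]
        exact mul_le_of_le_one_left (abs_nonneg _) (abs_le.2 ⟨by linarith [(hcut 0 w).1], (hcut 0 w).2⟩)
      · rw [TF.sm_smul_apply, hθ0 _ w hw, zero_mul]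
      · rw [h2]
        have := hsq r hr
        nlinarith
    refine this.trans ?_
    rw [mul_assoc]
    exact mul_le_mul_of_nonneg_left (by linarith) hC
  have hεη : ∀ t, r ≤ t → ε ≤ η * √(vol N z t) := fun t ht => by
    refine (div_le_self (by positivity) (by linarith [(Nat.cast_nonneg J : (0 : ℝ) ≤ J)])).trans ?_
    exact mul_le_mul_of_nonneg_left (Real.sqrt_le_sqrt (vol_mono z hr ht)) hη.le
  refine ⟨⇑(∑ j ∈ Finset.range J, w j), TF.continuous _, ?_, fun z₁ h₁ z₂ h₂ => ?_⟩
  · have e1 : ε ^ 2 ≤ η ^ 2 * vol N z r := by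
      refine (pow_le_pow_left₀ hε0.le (hεη r le_rfl) 2).trans_eq ?_
      rw [mul_pow, Real.sq_sqrt hv.le]
    have e2 : ‖v - ∑ j ∈ Finset.range J, w j‖ ^ 2 ≤ (C * (S + 1)) ^ 2 * (η ^ 2 * vol N z r) := by
      refine (pow_le_pow_left₀ (norm_nonneg _) hmain 2).trans_eq ?_
      rw [mul_pow, mul_pow η, Real.sq_sqrt hv.le]
    refine (lintegral_mono' Measure.restrict_le_self le_rfl).trans ?_
    have e3 : ∫⁻ x, ENNReal.ofReal ((u x - (∑ j ∈ Finset.range J, w j) x) ^ 2) ≤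
        ∫⁻ x, (2 * ENNReal.ofReal ((u x - v x) ^ 2) +
          2 * ENNReal.ofReal ((v - ∑ j ∈ Finset.range J, w j) x ^ 2)) := by
      refine lintegral_mono fun x => ?_
      rw [show (2 : ℝ≥0∞) = ENNReal.ofReal 2 by simp, ← ENNReal.ofReal_mul (by norm_num),
        ← ENNReal.ofReal_mul (by norm_num), ← ENNReal.ofReal_add (by positivity) (by positivity), TF.sub_apply]
      refine ENNReal.ofReal_le_ofReal ?_
      nlinarith [sq_nonneg (u x - v x - (v x - (∑ j ∈ Finset.range J, w j) x))]
    refine e3.trans ?_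
    rw [lintegral_add_left (by have := v.continuous; fun_prop), lintegral_const_mul' _ _ (by simp),
      lintegral_const_mul' _ _ (by simp), ← ofReal_norm_sq', volume_Bx z hr,
      show (2 : ℝ≥0∞) = ENNReal.ofReal 2 by simp, ← ENNReal.ofReal_mul (by positivity),
      ← ENNReal.ofReal_mul (by positivity)]
    refine (add_le_add_left (mul_le_mul_right hv2 _) _).trans ?_
    rw [← ENNReal.ofReal_mul (by norm_num), ← ENNReal.ofReal_add (by positivity) (by positivity)]
    refine ENNReal.ofReal_le_ofReal ?_
    change _ ≤ _ * vol N z r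
    have : 0 ≤ (D * (S + 1)) ^ 2 * (η ^ 2 * vol N z r) := by positivity
    linarith
  · have e1 : ∀ j, |w j z₁ - w j z₂| ≤ D * (S + 1) * η * (1 / 2) ^ (j + 1) := fun j => by
      have hV := Real.sqrt_pos.2 (vol_pos (N := N) z (R := 2 * R j) (by have := hR0 j; positivity))
      refine le_of_mul_le_mul_left ((hosc j r hr (by linarith [hRr j]) z₁ h₁ z₂ h₂).trans ?_) hV
      have e2 : r / (2 * R j) = (1 / 2) ^ (j + 1) := by
        simp only [hR]
        rw [one_div, inv_pow, pow_succ]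
        field_simp
      rw [e2]
      have e3 : ‖f j‖ + ε ≤ (S + 1) * (η * √(vol N z (2 * R j))) := by
        linarith [hf1 j, hεη (2 * R j) (by linarith [hRr j, hR0 j])]
      refine (mul_le_mul_of_nonneg_left e3 (by positivity)).trans_eq (by ring)
    have e4 : |(∑ j ∈ Finset.range J, w j) z₁ - (∑ j ∈ Finset.range J, w j) z₂| ≤ D * (S + 1) * η := by
      rw [TF.sum_apply, TF.sum_apply, ← Finset.sum_sub_distrib]
      refine (Finset.abs_sum_le_sum_abs _ _).trans ((Finset.sum_le_sum fun j _ => e1 j).trans ?_)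
      rw [← Finset.mul_sum]
      refine mul_le_of_le_one_right (by positivity) ?_
      have : ∀ k, ∑ j ∈ Finset.range k, (1 / 2 : ℝ) ^ (j + 1) = 1 - (1 / 2) ^ k := fun k => by
        induction k with
        | zero => simp
        | succ k ih => rw [Finset.sum_range_succ, ih]; ring
      rw [this]
      have : (0 : ℝ) ≤ (1 / 2) ^ J := by positivity
      linarith
    refine (pow_le_pow_left₀ (abs_nonneg _) e4 2).trans ?_
    rw [mul_pow]
    refine mul_le_mul_of_nonneg_right ?_ (by positivity)
    have : 0 ≤ 2 + 2 * (C * (S + 1)) ^ 2 := by positivity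
    linarith

end Approx

section Instances
variable {n m N : ℕ}

lemma osc_cut_le (hn : 1 ≤ n) {M : ℕ} (hM : 1 ≤ M) : ∃ C, 0 ≤ C ∧ ∀ (z : Pt n m) (R r : ℝ), 0 < r → r ≤ R / 2 →
    ∀ u : TF (Pt n m), ∀ w ∈ Bx N z r, ∀ w' ∈ Bx N z r, √(vol N z R) * |u w - u w'| ≤
      C * (r / R) * sn N (n + m * (N + 1) + (N + 1)) R (cut N z R ^ M • u) := by
  obtain ⟨C, hC, h⟩ := osc_le (n := n) (m := m) (N := N) hn
  refine ⟨C, hC, fun z R r hr hrR u w hw w' hw' => ?_⟩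
  have hR : 0 < R := by linarith
  have hoff : Off N z R (cut N z R ^ M • u) := fun x hx => by
    rw [TF.sm_smul_apply, Sm.pow_apply, cut_eq_zero hR fun h => ?_, zero_pow (by omega), zero_mul]
    rcases hx with hx | hx
    exacts [hx.not_gt (mem_Bx.1 h).1, hx.not_gt (mem_Bx.1 h).2]
  have := h z R r hr (by linarith) _ hoff w hw w' hw'
  rwa [TF.sm_smul_apply, TF.sm_smul_apply, Sm.pow_apply, Sm.pow_apply, cut_eq_one hR (Bx_mono z hr hrR hw),
    cut_eq_one hR (Bx_mono z hr hrR hw'), one_pow, one_mul, one_mul] at this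

lemma isApp_derivative (hn : 1 ≤ n) (hm : 1 ≤ m) (hN : 1 ≤ N) {s : ℕ} (hs : 1 ≤ s)
    (α : List (XIdx n m N)) (hα : α.length = 2 * s) :
    IsApp N fun b ε w => ∃ φ, ‖(H n m N ^ s) φ - b‖ ≤ ε ∧ w = XT n m N α φ where
  sub := by
    rintro b ε _ b' ε' _ ⟨φ, hφ, rfl⟩ ⟨φ', hφ', rfl⟩
    refine ⟨φ - φ', ?_, (map_sub _ _ _).symm⟩
    rw [map_sub, sub_sub_sub_comm]
    exact (norm_sub_le _ _).trans (add_le_add hφ hφ')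
  bound := by
    obtain ⟨C, hC, h⟩ := norm_XT_le hn hm hN s α hα
    refine ⟨C, hC, ?_⟩
    rintro b ε _ ⟨φ, hφ, rfl⟩
    refine (h φ).trans (mul_le_mul_of_nonneg_left ?_ hC)
    linarith [norm_le_norm_add_norm_sub' ((H n m N ^ s) φ) b]
  loc := by
    set K := n + m * (N + 1) + (N + 1) with hK
    have hK1 : 1 ≤ K := by omega
    obtain ⟨A, hA, hosc⟩ := osc_cut_le (n := n) (m := m) (N := N) hn hK1
    obtain ⟨B, hB, hsn⟩ := sn_cut_le (N := N) (UB_cut (P := {q : Pt n m × ℝ // 0 < q.2}) (fun p => p.1.1)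
      (fun p => p.1.2) fun p => p.2) (fun p => p.2) (J := K) (K := 2 * K) (M := K) (by omega) le_rfl
    obtain ⟨D, hD, hXT⟩ := norm_XT_le hn hm hN s α hα
    choose E hE hw using fun γ : Fin (2 * K) → XIdx n m N =>
      word_cut_le hn hm hN hs hK1 (List.ofFn γ ++ α) (by simp [hα]; ring)
    have hE0 : 0 ≤ ∑ γ, E γ := Finset.sum_nonneg fun γ _ => hE γ
    refine ⟨A * (B * (∑ γ, E γ + D)), by positivity, fun z R hR b hb ε hε => ?_⟩
    set δ := ε / (1 + R ^ (2 * K)) with hδ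
    have hδ0 : 0 < δ := by positivity
    have hδ1 : δ + R ^ (2 * K) * δ = ε := by rw [hδ]; field_simp
    obtain ⟨φ, hφ⟩ := dense_range hn hm hN s hK1 (b + (H n m N ^ K) b) hδ0
    rw [H_add_apply, add_sub_add_comm, ← map_sub] at hφ
    obtain ⟨h1, h2⟩ := norm_le_one_add_H_pow (N := N) K ((H n m N ^ s) φ - b)
    have hRδ : 0 ≤ R ^ (2 * K) * δ := by positivity
    have h3 := h1.trans hφ
    have h4 := h2.trans hφ
    rw [map_sub, ← Module.End.mul_apply, ← pow_add] at h4
    have hcac : cac N (fun p : {q : Pt n m × ℝ // 0 < q.2} => p.1.2) (fun p => cut N p.1.1 p.1.2) (2 * K)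
        ⟨(z, R), hR⟩ (XT n m N α φ) ≤ (∑ γ, E γ) * (‖b‖ + ε) := by
      rw [cac, Finset.sum_mul]
      refine Finset.sum_le_sum fun γ _ => ?_
      have := hw γ z R hR b hb φ
      rw [XT_append, Module.End.mul_apply] at this
      simp only [abs_of_pos hR]
      refine this.trans (mul_le_mul_of_nonneg_left ?_ (hE γ))
      have := mul_le_mul_of_nonneg_left h4 (show 0 ≤ R ^ (2 * K) by positivity)
      linarith
    refine ⟨XT n m N α φ, ⟨φ, by linarith, rfl⟩, fun r hr hrR z₁ h₁ z₂ h₂ => ?_⟩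
    refine (hosc z R r hr hrR _ z₁ h₁ z₂ h₂).trans ?_
    have h5 := hsn ⟨(z, R), hR⟩ (XT n m N α φ)
    have h6 : ‖XT n m N α φ‖ ≤ D * (‖b‖ + ε) := by
      refine (hXT φ).trans (mul_le_mul_of_nonneg_left ?_ hD)
      linarith [norm_le_norm_add_norm_sub' ((H n m N ^ s) φ) b]
    have h7 : sn N K R (cut N z R ^ K • XT n m N α φ) ≤ B * (∑ γ, E γ + D) * (‖b‖ + ε) := by
      refine h5.trans ?_
      rw [mul_assoc]
      refine mul_le_mul_of_nonneg_left ?_ hB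
      linarith
    refine (mul_le_mul_of_nonneg_left h7 (by positivity)).trans_eq (by ring)

lemma dense_range_pow (hn : 1 ≤ n) (hm : 1 ≤ m) (hN : 1 ≤ N) (s : ℕ) (b : TF (Pt n m)) {ε : ℝ} (hε : 0 < ε) :
    ∃ φ, ‖(H n m N ^ s) φ - b‖ ≤ ε := by
  obtain ⟨φ, hφ⟩ := dense_range hn hm hN s le_rfl b hε
  refine ⟨φ + (H n m N ^ 1) φ, ?_⟩
  rwa [map_add, ← Module.End.mul_apply, ← pow_add]

/-- The transposed approximate solution relation. -/
def DualApp (s K : ℕ) (α : List (XIdx n m N)) (b : TF (Pt n m)) (ε : ℝ) (v : TF (Pt n m)) : Prop :=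
  (∀ φ, |⟪v, (H n m N ^ (K + s)) φ⟫_ℝ - ⟪b, XT n m N α ((H n m N ^ K) φ)⟫_ℝ| ≤ ε * ‖(H n m N ^ (K + s)) φ‖) ∧
    ‖(H n m N ^ (K + s)) v - (H n m N ^ K) (((-1 : ℝ) ^ α.length • XT n m N α.reverse) b)‖ ≤ ε

lemma exists_dualApp (hn : 1 ≤ n) (hm : 1 ≤ m) (hN : 1 ≤ N) {s : ℕ} (hs : 1 ≤ s) (K : ℕ)
    (α : List (XIdx n m N)) (hα : α.length = 2 * s) (b : TF (Pt n m)) {ε : ℝ} (hε : 0 < ε) :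
    ∃ v, DualApp s K α b ε v := by
  obtain ⟨C, hC, hX⟩ := norm_XT_le hn hm hN s α hα
  obtain ⟨v, -, h1, h2⟩ := exists_solution hn hm hN (K := K + s) (by omega)
    (Ω := XT n m N α * H n m N ^ K) (Ω' := H n m N ^ K * ((-1 : ℝ) ^ α.length • XT n m N α.reverse))
    (fun f g => by rw [Module.End.mul_apply, inner_XT, inner_H_pow, Module.End.mul_apply]) hC
    (fun φ => by
      rw [add_comm K s, pow_add]
      exact hX _) b hε
  exact ⟨v, h2, h1⟩

lemma isApp_dual (hn : 1 ≤ n) (hm : 1 ≤ m) (hN : 1 ≤ N) {s K : ℕ} (hs : 1 ≤ s)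
    (hK : n + m * (N + 1) + (N + 1) ≤ K) (α : List (XIdx n m N)) (hα : α.length = 2 * s) :
    IsApp N (DualApp s K α) := by
  have hbd : ∃ C, 0 ≤ C ∧ ∀ {b ε w}, DualApp s K α b ε w → ‖w‖ ≤ C * (‖b‖ + ε) := by
    obtain ⟨C, hC, hX⟩ := norm_XT_le hn hm hN s α hα
    refine ⟨C + 1, by positivity, fun {b ε w} h => ?_⟩
    have hε : 0 ≤ ε := (norm_nonneg _).trans h.2
    have hb := norm_nonneg b
    refine (norm_le_of_dense (S := Set.range ⇑(H n m N ^ (K + s))) (c := C * ‖b‖ + ε) (fun b ε hε => ?_)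
      (by positivity) ?_).trans ?_
    · obtain ⟨φ, hφ⟩ := dense_range_pow hn hm hN (K + s) b hε
      exact ⟨_, ⟨φ, rfl⟩, hφ⟩
    · rintro _ ⟨φ, rfl⟩
      have h1 := h.1 φ
      have h2 := abs_real_inner_le_norm b (XT n m N α ((H n m N ^ K) φ))
      have h3 := hX ((H n m N ^ K) φ)
      rw [← Module.End.mul_apply (H n m N ^ s), ← pow_add, add_comm s] at h3
      have h4 := abs_sub_abs_le_abs_sub ⟪w, (H n m N ^ (K + s)) φ⟫_ℝ ⟪b, XT n m N α ((H n m N ^ K) φ)⟫_ℝ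
      have h5 := mul_le_mul_of_nonneg_left h3 hb
      linarith
    · nlinarith [mul_nonneg hC hε]
  refine ⟨fun {b ε w b' ε' w'} h h' => ⟨fun φ => ?_, ?_⟩, hbd, ?_⟩
  · rw [inner_sub_left, inner_sub_left, sub_sub_sub_comm, add_mul]
    exact (abs_sub _ _).trans (add_le_add (h.1 φ) (h'.1 φ))
  · rw [map_sub, map_sub, map_sub, sub_sub_sub_comm]
    exact (norm_sub_le _ _).trans (add_le_add h.2 h'.2)
  · set J := n + m * (N + 1) + (N + 1) with hJ
    obtain ⟨A, hA, hosc⟩ := osc_cut_le (n := n) (m := m) (N := N) hn (M := J) (by omega)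
    obtain ⟨B, hB, hsn⟩ := sn_cut_le_H hn hm hN (UB_cut (P := {q : Pt n m × ℝ // 0 < q.2}) (fun p => p.1.1)
      (fun p => p.1.2) fun p => p.2) (fun p => p.2) (J := J) (K := K + s) (M := J) (by omega) le_rfl
    obtain ⟨D, hD, hbd⟩ := hbd
    refine ⟨A * (B * (1 + D)), by positivity, fun z R hR b hb ε hε => ?_⟩
    set δ := ε / (1 + R ^ (2 * (K + s))) with hδ
    have hδ0 : 0 < δ := by positivity
    have hδ1 : δ + R ^ (2 * (K + s)) * δ = ε := by rw [hδ]; field_simp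
    have hRδ : 0 ≤ R ^ (2 * (K + s)) * δ := by positivity
    obtain ⟨v, hv⟩ := exists_dualApp hn hm hN hs K α hα b hδ0
    have hv' : DualApp s K α b ε v := ⟨fun φ => (hv.1 φ).trans (by gcongr; linarith), hv.2.trans (by linarith)⟩
    refine ⟨v, hv', fun r hr hrR z₁ h₁ z₂ h₂ => ?_⟩
    refine (hosc z R r hr hrR _ z₁ h₁ z₂ h₂).trans ?_
    have h5 := hsn ⟨(z, R), hR⟩ v
    have h6 : ‖cut N z R ^ (2 * (K + s)) • (H n m N ^ (K + s)) v‖ ≤ δ := by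
      refine le_trans (le_of_eq ?_) ((norm_cut_pow_smul_le (N := N) z R (2 * (K + s)) _).trans hv.2)
      congr 1
      ext x
      rw [TF.sm_smul_apply, TF.sm_smul_apply, TF.sub_apply]
      by_cases hx : cut N z R x = 0
      · rw [Sm.pow_apply, hx, zero_pow (by omega), zero_mul, zero_mul]
      · have hxR := (cut_ne_zero hR).1 hx
        have hxR' := Bx_mono z hR (by linarith : R ≤ 4 * R) hxR
        rw [Wd_eq_zero (H_pow_mem_Wd K) (isOpen_Bx z (4 * R)) (fun y hy =>
          Wd_eq_zero (XT_adjoint_mem_Wd α) (isOpen_Bx z (4 * R)) hb hy) hxR', sub_zero]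
    have h7 : sn N J R (cut N z R ^ J • v) ≤ B * (1 + D) * (‖b‖ + ε) := by
      refine h5.trans ?_
      rw [mul_assoc]
      refine mul_le_mul_of_nonneg_left ?_ hB
      have := hbd hv'
      have := mul_le_mul_of_nonneg_left h6 (show 0 ≤ R ^ (2 * (K + s)) by positivity)
      have := norm_nonneg b
      simp only at *
      linarith
    refine (mul_le_mul_of_nonneg_left h7 (by positivity)).trans_eq (by ring)

end Instances

section Limit
variable {n m N : ℕ}

lemma exists_sup_le (hn : 1 ≤ n) (hm : 1 ≤ m) (hN : 1 ≤ N) {K : ℕ} (hK : n + m * (N + 1) < 2 * K) :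
    ∃ C, 0 ≤ C ∧ ∀ (u : TF (Pt n m)) z, |u z| ≤ C * (‖(H n m N ^ K) u‖ + ‖u‖) := by
  obtain ⟨A, hA, hsup⟩ := sup_le (n := n) (m := m) (N := N) hn
  obtain ⟨B, hB, hsn⟩ := sn_cut_le_H hn hm hN (UB_cut (P := Pt n m) (fun p => p) (fun _ => 1) fun _ => one_pos)
    (fun _ => one_pos) (J := n + m * (N + 1)) (K := K) (M := n + m * (N + 1)) hK le_rfl
  refine ⟨A * B, by positivity, fun u z => ?_⟩
  have hoff : Off N z 1 (cut N z 1 ^ (n + m * (N + 1)) • u) := fun x hx => by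
    rw [TF.sm_smul_apply, Sm.pow_apply, cut_eq_zero one_pos fun h => ?_, zero_pow (by omega), zero_mul]
    rcases hx with hx | hx
    exacts [hx.not_gt (mem_Bx.1 h).1, hx.not_gt (mem_Bx.1 h).2]
  have h1 := hsup z 1 one_pos _ hoff z
  rw [TF.sm_smul_apply, Sm.pow_apply, cut_eq_one one_pos (self_mem_Bx z (by norm_num)), one_pow, one_mul] at h1
  have h2 : 1 ≤ √(vol N z 1) := by
    refine Real.one_le_sqrt.2 ?_
    have h3 : 1 ≤ (1 + ‖z.1‖) ^ N := one_le_pow₀ (by linarith [norm_nonneg z.1])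
    exact one_le_mul_of_one_le_of_one_le (one_le_pow₀ (by norm_num)) (one_le_pow₀ (by rw [ρ]; linarith))
  have h3 := hsn z u
  rw [one_pow, one_mul] at h3
  have h4 := norm_cut_pow_smul_le (N := N) z 1 (2 * K) ((H n m N ^ K) u)
  have h5 : |u z| ≤ √(vol N z 1) * |u z| := le_mul_of_one_le_left (abs_nonneg _) h2
  refine h5.trans (h1.trans ?_)
  rw [mul_assoc]
  refine mul_le_mul_of_nonneg_left (h3.trans (mul_le_mul_of_nonneg_left ?_ hB)) hA
  linarith

lemma DualApp.mono {s K : ℕ} {α : List (XIdx n m N)} {b v : TF (Pt n m)} {ε δ : ℝ} (h : DualApp s K α b ε v)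
    (hε : ε ≤ δ) : DualApp s K α b δ v :=
  ⟨fun φ => (h.1 φ).trans (mul_le_mul_of_nonneg_right hε (norm_nonneg _)), h.2.trans hε⟩

lemma DualApp.inner_le (hn : 1 ≤ n) (hm : 1 ≤ m) (hN : 1 ≤ N) {s K : ℕ} {α : List (XIdx n m N)}
    (hα : α.length = 2 * s) {b v : TF (Pt n m)} {ε : ℝ} (h : DualApp s K α b ε v) (ψ : TF (Pt n m)) :
    |⟪v, (H n m N ^ s) ψ⟫_ℝ - ⟪b, XT n m N α ψ⟫_ℝ| ≤ ε * ‖(H n m N ^ s) ψ‖ := by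
  obtain ⟨C, hC, hX⟩ := norm_XT_le hn hm hN s α hα
  have hε : 0 ≤ ε := (norm_nonneg _).trans h.2
  refine le_of_forall_pos_le_add fun η hη => ?_
  set Q := ‖b‖ * C + ε + ‖v‖ + 1 with hQ
  have hQ0 : 0 < Q := by positivity
  set δ := η / Q with hδ
  have hδ0 : 0 < δ := by positivity
  have hδQ : δ * Q = η := by rw [hδ]; field_simp
  obtain ⟨φ, hφ⟩ := dense_range_pow hn hm hN (K + s) ((H n m N ^ s) ψ) hδ0
  have e : (H n m N ^ (K + s)) φ = (H n m N ^ s) ((H n m N ^ K) φ) := by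
    rw [add_comm, pow_add, Module.End.mul_apply]
  have h1 := h.1 φ
  have h2 := abs_real_inner_le_norm v ((H n m N ^ (K + s)) φ - (H n m N ^ s) ψ)
  have h3 := abs_real_inner_le_norm b (XT n m N α ((H n m N ^ K) φ - ψ))
  have h4 := hX ((H n m N ^ K) φ - ψ)
  rw [map_sub (H n m N ^ s), ← e] at h4
  have h5 := mul_le_mul_of_nonneg_left hφ (norm_nonneg v)
  have h6 := mul_le_mul_of_nonneg_left (h4.trans (mul_le_mul_of_nonneg_left hφ hC)) (norm_nonneg b)
  have h7 : ‖(H n m N ^ (K + s)) φ‖ ≤ ‖(H n m N ^ s) ψ‖ + δ := by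
    linarith [norm_le_norm_add_norm_sub' ((H n m N ^ (K + s)) φ) ((H n m N ^ s) ψ)]
  have h8 := mul_le_mul_of_nonneg_left h7 hε
  rw [inner_sub_right] at h2
  rw [map_sub, inner_sub_right] at h3
  rw [map_sub] at h6
  have := abs_le.1 h1
  have := abs_le.1 h2
  have := abs_le.1 h3
  rw [abs_le]
  constructor <;> linarith

theorem exists_dual_solution (hn : 1 ≤ n) (hm : 1 ≤ m) (hN : 1 ≤ N) {s : ℕ} (hs : 1 ≤ s)
    (α : List (XIdx n m N)) (hα : α.length = 2 * s) :
    ∃ A, 0 ≤ A ∧ ∀ b : TF (Pt n m), ∃ u : Pt n m → ℝ, Continuous u ∧ (∃ M, ∀ x, |u x| ≤ M) ∧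
      ∫⁻ x, ENNReal.ofReal (u x ^ 2) < ⊤ ∧ OscHyp N A u b ∧
      ∀ ψ, ⟪b, XT n m N α ψ⟫_ℝ = ∫ x, u x * (H n m N ^ s) ψ x := by
  set K := n + m * (N + 1) + (N + 1) with hK
  have hT := isApp_dual hn hm hN hs hK.ge α hα
  obtain ⟨A, hA, hosc⟩ := hT.oscHyp
  obtain ⟨B, hB, hbd⟩ := hT.bound
  obtain ⟨C, hC, hsup⟩ := exists_sup_le hn hm hN (K := K + s) (by omega)
  refine ⟨A, hA, fun b => ?_⟩
  set e : ℕ → ℝ := fun l => 1 / ((l : ℝ) + 1) with he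
  have he0 : ∀ l, 0 < e l := fun l => by positivity
  choose v hv using fun l => exists_dualApp hn hm hN hs K α hα b (he0 l)
  have hem : ∀ l k, l ≤ k → e k ≤ e l := fun l k h => by simp only [he]; gcongr
  have hlim : Filter.Tendsto e Filter.atTop (nhds 0) := tendsto_one_div_add_atTop_nhds_zero_nat
  have hd : ∀ l k, l ≤ k → DualApp s K α (0 : TF (Pt n m)) (2 * e l) (v k - v l) := fun l k h => by
    have := hT.sub (hv k) (hv l)
    rw [sub_self] at this
    exact this.mono (by linarith [hem l k h])
  have hnorm : ∀ l k, l ≤ k → ‖v k - v l‖ ≤ 2 * B * e l := fun l k h => by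
    have := hbd (hd l k h)
    rw [norm_zero] at this
    linarith
  have hunif : ∀ l k, l ≤ k → ∀ x, |v k x - v l x| ≤ C * (2 + 2 * B) * e l := fun l k h x => by
    have h1 := hsup (v k - v l) x
    have h2 := (hd l k h).2
    rw [map_zero, map_zero, sub_zero] at h2
    refine h1.trans ?_
    rw [mul_assoc]
    exact mul_le_mul_of_nonneg_left (by linarith [hnorm l k h]) hC
  have hlim' : Filter.Tendsto (fun l => C * (2 + 2 * B) * e l) Filter.atTop (nhds 0) := by
    simpa using hlim.const_mul (C * (2 + 2 * B))
  have hcau : ∀ x, CauchySeq fun k => v k x := fun x =>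
    cauchySeq_of_le_tendsto_0' _ (fun l k h => by
      rw [dist_comm, Real.dist_eq]; exact hunif l k h x) hlim'
  choose u hu using fun x => cauchySeq_tendsto_of_complete (hcau x)
  have huv : ∀ l x, |u x - v l x| ≤ C * (2 + 2 * B) * e l := fun l x =>
    le_of_tendsto ((hu x).sub_const _).abs (Filter.eventually_atTop.2 ⟨l, fun k h => hunif l k h x⟩)
  have hcont : Continuous u := by
    refine TendstoUniformly.continuous (F := fun l => ⇑(v l)) (p := Filter.atTop) ?_
      (Filter.Frequently.of_forall fun l => (v l).continuous)
    rw [Metric.tendstoUniformly_iff]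
    intro ε hε
    filter_upwards [hlim'.eventually (gt_mem_nhds hε)] with l hl x
    exact (huv l x).trans_lt hl
  have hL2 : ∀ l, ∫⁻ x, ENNReal.ofReal ((u x - v l x) ^ 2) ≤ ENNReal.ofReal ((2 * B * e l) ^ 2) := fun l => by
    have h1 := lintegral_liminf_le (μ := (volume : Measure (Pt n m)))
      (u := Filter.atTop) (f := fun (k : ℕ) x => ENNReal.ofReal ((v k - v l) x ^ 2)) fun k => by
        have := (v k - v l).continuous
        fun_prop
    have h2 : ∀ x, Filter.liminf (fun k => ENNReal.ofReal ((v k - v l) x ^ 2)) Filter.atTop =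
        ENNReal.ofReal ((u x - v l x) ^ 2) := fun x =>
      Filter.Tendsto.liminf_eq (ENNReal.tendsto_ofReal (((hu x).sub_const _).pow 2))
    simp only [h2, ← ofReal_norm_sq'] at h1
    refine h1.trans (Filter.liminf_le_of_frequently_le' (Filter.Eventually.frequently ?_))
    refine Filter.eventually_atTop.2 ⟨l, fun k h => ENNReal.ofReal_le_ofReal ?_⟩
    exact pow_le_pow_left₀ (norm_nonneg _) (hnorm l k h) 2
  refine ⟨u, hcont, ?_, ?_, hosc b u hcont fun ε hε => ?_, fun ψ => ?_⟩
  · obtain ⟨M, hM⟩ := (v 0).continuous.bounded_above_of_compact_support (v 0).hasCompactSupport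
    refine ⟨M + C * (2 + 2 * B) * e 0, fun x => ?_⟩
    have := abs_sub_abs_le_abs_sub (u x) (v 0 x)
    have := hM x
    rw [Real.norm_eq_abs] at this
    linarith [huv 0 x]
  · have h1 : ∫⁻ x, ENNReal.ofReal (u x ^ 2) ≤ ∫⁻ x, (2 * ENNReal.ofReal ((u x - v 0 x) ^ 2) +
        2 * ENNReal.ofReal (v 0 x ^ 2)) := by
      refine lintegral_mono fun x => ?_
      rw [show (2 : ℝ≥0∞) = ENNReal.ofReal 2 by simp, ← ENNReal.ofReal_mul (by norm_num),
        ← ENNReal.ofReal_mul (by norm_num), ← ENNReal.ofReal_add (by positivity) (by positivity)]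
      refine ENNReal.ofReal_le_ofReal ?_
      nlinarith [sq_nonneg (u x - v 0 x - v 0 x)]
    refine h1.trans_lt ?_
    rw [lintegral_add_left (by have := (v 0).continuous; fun_prop), lintegral_const_mul' _ _ (by simp),
      lintegral_const_mul' _ _ (by simp), ← ofReal_norm_sq']
    exact ENNReal.add_lt_top.2 ⟨ENNReal.mul_lt_top (by simp) ((hL2 0).trans_lt ENNReal.ofReal_lt_top),
      ENNReal.mul_lt_top (by simp) ENNReal.ofReal_lt_top⟩
  · obtain ⟨l, hl⟩ := ((hlim.const_mul (2 * B + 1)).eventually (gt_mem_nhds (by simpa using hε))).exists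
    have := he0 l
    refine ⟨v l, (hv l).mono (by nlinarith), (hL2 l).trans (ENNReal.ofReal_le_ofReal ?_)⟩
    exact pow_le_pow_left₀ (by positivity) (by linarith) 2
  · set f := (H n m N ^ s) ψ
    have hint : ∀ w : Pt n m → ℝ, Continuous w → Integrable fun x => w x * f x := fun w hw =>
      (hw.mul f.continuous).integrable_of_hasCompactSupport f.hasCompactSupport.mul_left
    refine tendsto_nhds_unique (f := fun l => ⟪v l, f⟫_ℝ) (l := Filter.atTop) ?_ ?_
    · refine tendsto_iff_dist_tendsto_zero.2 (squeeze_zero (fun _ => dist_nonneg)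
        (fun l => (hv l).inner_le hn hm hN hα ψ) ?_)
      simpa using hlim.mul_const ‖f‖
    · refine tendsto_iff_dist_tendsto_zero.2 (squeeze_zero (g := fun l => C * (2 + 2 * B) * e l * ∫ x, |f x|)
        (fun _ => dist_nonneg) (fun l => ?_) (by simpa using hlim'.mul_const (∫ x, |f x|)))
      rw [dist_comm, Real.dist_eq, inner_eq, ← integral_sub (hint u hcont) (hint _ (v l).continuous),
        ← integral_const_mul]
      refine (abs_integral_le_integral_abs).trans (integral_mono ((hint u hcont).sub (hint _ (v l).continuous)).abs
        (f.integrable.abs.const_mul _) fun x => ?_)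
      simp only []
      rw [← sub_mul, abs_mul]
      exact mul_le_mul_of_nonneg_right (huv l x) (abs_nonneg _)

end Limit

section LpBounds
variable {n m N : ℕ}

lemma ofReal_sq_rpow (a : ℝ) {t : ℝ} (ht : 0 ≤ t) : ENNReal.ofReal ((a ^ 2) ^ t) = ‖a‖ₑ ^ (2 * t) := by
  rw [Real.enorm_eq_ofReal_abs, ENNReal.ofReal_rpow_of_nonneg (abs_nonneg _) (by positivity),
    Real.rpow_mul (abs_nonneg _), Real.rpow_two, sq_abs]

/-- Absorption of a finite quantity into the left-hand side of a Hölder-type bound. -/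
lemma le_of_le_rpow_mul {p q : ℝ} (hpq : p.HolderConjugate q) {I c F : ℝ≥0∞} (hI : I ≠ ⊤)
    (h : I ≤ (c * I) ^ (1 / q) * F ^ (1 / p)) : I ≤ c ^ (p / q) * F := by
  rcases eq_or_ne I 0 with h0 | h0
  · simp [h0]
  have hp := hpq.pos
  have hq := hpq.symm.pos
  have h1 := ENNReal.rpow_le_rpow h hp.le
  rw [ENNReal.mul_rpow_of_nonneg _ _ hp.le, ← ENNReal.rpow_mul, ← ENNReal.rpow_mul,
    one_div_mul_cancel hp.ne', ENNReal.rpow_one, one_div_mul_eq_div,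
    ENNReal.mul_rpow_of_nonneg _ _ (by positivity)] at h1
  have h2 : I ^ p = I ^ (p / q) * I := by
    conv_rhs => rw [← ENNReal.rpow_one I, ← ENNReal.rpow_mul]
    rw [← ENNReal.rpow_add _ _ h0 hI]
    congr 1
    have := hpq.inv_add_inv_eq_one
    field_simp at this ⊢
    linarith
  rw [h2, mul_comm (c ^ _), mul_assoc] at h1
  refine (ENNReal.mul_le_mul_iff_right ?_ ?_).1 h1
  · simp [h0, hI]
  · exact ENNReal.rpow_ne_top_of_nonneg (by positivity) hI

/-- The test function `w (w² + ε²) ^ (p / 2 - 1)`. -/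
noncomputable def dualPow (w : TF (Pt n m)) (p ε : ℝ) (hε : 0 < ε) : TF (Pt n m) :=
  TF.mk (fun x => w x * (w x ^ 2 + ε ^ 2) ^ (p / 2 - 1))
    (w.contDiff.mul (((w.contDiff.pow 2).add contDiff_const).rpow_const_of_ne fun x => by positivity))
    w.hasCompactSupport.mul_right

lemma dualPow_rpow_le {p ε a : ℝ} (hp : 1 < p) (hp2 : p < 2) (hε : 0 < ε) :
    ((a * (a ^ 2 + ε ^ 2) ^ (p / 2 - 1)) ^ 2) ^ (p.conjExponent / 2) ≤
      a * (a ^ 2 + ε ^ 2) ^ (p / 2 - 1) * a := by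
  set t := p.conjExponent / 2 with ht
  have hp1 : 0 < p - 1 := by linarith
  have htp : t * (p - 1) = p / 2 := by rw [ht, Real.conjExponent]; field_simp
  have ht1 : 0 < t - 1 := by nlinarith
  set r := a ^ 2 + ε ^ 2 with hr
  have hr0 : 0 < r := by positivity
  rcases eq_or_ne a 0 with h0 | h0
  · have : t ≠ 0 := by linarith
    simp [h0, Real.zero_rpow this]
  have ha : 0 < a ^ 2 := by positivity
  have h1 : ((a * r ^ (p / 2 - 1)) ^ 2) ^ t = a ^ 2 * ((a ^ 2) ^ (t - 1) * r ^ ((p - 2) * t)) := by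
    rw [mul_pow, Real.mul_rpow ha.le (by positivity), ← Real.rpow_natCast, ← Real.rpow_natCast,
      ← Real.rpow_mul hr0.le, ← Real.rpow_mul hr0.le, ← mul_assoc]
    congr 1
    · rw [Real.rpow_natCast, Real.rpow_sub_one ha.ne']
      field_simp
    · congr 1; push_cast; ring
  have h2 : a * r ^ (p / 2 - 1) * a = a ^ 2 * (r ^ (t - 1) * r ^ ((p - 2) * t)) := by
    rw [← Real.rpow_add hr0, show t - 1 + (p - 2) * t = p / 2 - 1 by linarith]
    ring
  rw [h1, h2]
  gcongr
  rw [hr]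
  nlinarith [sq_nonneg ε]

lemma lintegral_rpow_two_le (hn : 1 ≤ n) (hm : 1 ≤ m) (hN : 1 ≤ N) {s : ℕ} (α : List (XIdx n m N))
    (hα : α.length = 2 * s) : ∃ C : ℝ, 0 ≤ C ∧ ∀ φ, ∫⁻ x, ENNReal.ofReal (XT n m N α φ x ^ 2) ≤
      ENNReal.ofReal C * ∫⁻ x, ENNReal.ofReal ((H n m N ^ s) φ x ^ 2) := by
  obtain ⟨C, hC, h⟩ := norm_XT_le hn hm hN s α hα
  refine ⟨C ^ 2, by positivity, fun φ => ?_⟩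
  rw [← ofReal_norm_sq', ← ofReal_norm_sq', ← ENNReal.ofReal_mul (by positivity), ← mul_pow]
  exact ENNReal.ofReal_le_ofReal (pow_le_pow_left₀ (norm_nonneg _) (h φ) 2)

lemma TF.exists_abs_le (f : TF (Pt n m)) : ∃ M, ∀ x, |f x| ≤ M :=
  f.continuous.bounded_above_of_compact_support f.hasCompactSupport

lemma lintegral_rpow_le_of_two_lt (hn : 1 ≤ n) (hm : 1 ≤ m) (hN : 1 ≤ N) {s : ℕ} (hs : 1 ≤ s)
    (α : List (XIdx n m N)) (hα : α.length = 2 * s) {t : ℝ} (ht : 1 < t) :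
    ∃ C : ℝ, 0 ≤ C ∧ ∀ φ, ∫⁻ x, ENNReal.ofReal ((XT n m N α φ x ^ 2) ^ t) ≤
      ENNReal.ofReal C * ∫⁻ x, ENNReal.ofReal (((H n m N ^ s) φ x ^ 2) ^ t) := by
  obtain ⟨A, hA, h⟩ := (isApp_derivative hn hm hN hs α hα).oscHyp
  obtain ⟨C, hC, h'⟩ := OscHyp.lintegral_le (m := m) (N := N) hn hA ht
  refine ⟨C, hC, fun φ => h' _ _ (h _ _ (XT n m N α φ).continuous fun ε hε =>
    ⟨_, ⟨φ, by simpa using hε.le, rfl⟩, by simp⟩) (XT n m N α φ).continuous (TF.continuous _)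
    (TF.hasCompactSupport _) (TF.exists_abs_le _) ?_⟩
  rw [← ofReal_norm_sq']
  exact ENNReal.ofReal_lt_top

lemma lintegral_dualPow_le (hn : 1 ≤ n) (hm : 1 ≤ m) (hN : 1 ≤ N) {s : ℕ} (hs : 1 ≤ s)
    (α : List (XIdx n m N)) (hα : α.length = 2 * s) {p : ℝ} (hp : 1 < p) (hp2 : p < 2) :
    ∃ C : ℝ, 0 ≤ C ∧ ∀ φ ε, ∀ hε : 0 < ε,
      ∫⁻ x, ENNReal.ofReal (dualPow (XT n m N α φ) p ε hε x * XT n m N α φ x) ≤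
      ENNReal.ofReal C * ∫⁻ x, ENNReal.ofReal (((H n m N ^ s) φ x ^ 2) ^ (p / 2)) := by
  have hp0 : 0 < p := by linarith
  have hpq := Real.HolderConjugate.conjExponent hp
  set q := p.conjExponent with hq
  have hq2 : 1 < q / 2 := by
    have : 0 < p - 1 := by linarith
    rw [hq, Real.conjExponent, div_div, one_lt_div (by positivity)]
    linarith
  obtain ⟨A, hA, h⟩ := exists_dual_solution hn hm hN hs α hα
  obtain ⟨C, hC, h'⟩ := OscHyp.lintegral_le (m := m) (N := N) hn hA hq2
  refine ⟨C ^ (p / q), by have := hpq.symm.pos; positivity, fun φ ε hε => ?_⟩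
  set w := XT n m N α φ
  set f := (H n m N ^ s) φ
  set g := dualPow w p ε hε with hg
  have hpt : ∀ x, (g x ^ 2) ^ (q / 2) ≤ g x * w x := fun x => dualPow_rpow_le hp hp2 hε
  obtain ⟨u, hu, hM, hu2, hosc, hdual⟩ := h g
  have hint : ENNReal.ofReal ⟪g, w⟫_ℝ = ∫⁻ x, ENNReal.ofReal (g x * w x) := by
    rw [inner_eq, ofReal_integral_eq_lintegral_ofReal]
    · exact (g.continuous.mul w.continuous).integrable_of_hasCompactSupport g.hasCompactSupport.mul_right
    · exact Filter.Eventually.of_forall fun x => le_trans (by positivity) (hpt x)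
  rw [← hint, ← ENNReal.ofReal_rpow_of_nonneg hC (by have := hpq.symm.pos; positivity)]
  refine le_of_le_rpow_mul hpq ENNReal.ofReal_ne_top ?_
  have h1 : ENNReal.ofReal ⟪g, w⟫_ℝ ≤ ∫⁻ x, ‖u x‖ₑ * ‖f x‖ₑ := by
    rw [hdual φ]
    refine (Real.ofReal_le_enorm _).trans ((enorm_integral_le_lintegral_enorm _).trans_eq ?_)
    simp [f]
  have hol := ENNReal.lintegral_mul_le_Lp_mul_Lq (volume : Measure (Pt n m)) hpq.symm
    (f := fun x => ‖u x‖ₑ) (g := fun x => ‖f x‖ₑ) hu.enorm.aemeasurable f.continuous.enorm.aemeasurable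
  refine h1.trans (hol.trans (mul_le_mul' (ENNReal.rpow_le_rpow ?_ hpq.symm.one_div_nonneg)
    (ENNReal.rpow_le_rpow (le_of_eq ?_) hpq.one_div_nonneg)))
  · have h2 := h' u g hosc hu g.continuous g.hasCompactSupport hM hu2
    simp only [ofReal_sq_rpow (u _) (by linarith : 0 ≤ q / 2), mul_div_cancel₀ q two_ne_zero] at h2
    refine h2.trans (mul_le_mul_right ?_ _)
    rw [hint]
    exact lintegral_mono fun x => ENNReal.ofReal_le_ofReal (hpt x)
  · simp only [ofReal_sq_rpow (f _) (by linarith : 0 ≤ p / 2), mul_div_cancel₀ p two_ne_zero]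

lemma lintegral_rpow_le_of_lt_two (hn : 1 ≤ n) (hm : 1 ≤ m) (hN : 1 ≤ N) {s : ℕ} (hs : 1 ≤ s)
    (α : List (XIdx n m N)) (hα : α.length = 2 * s) {p : ℝ} (hp : 1 < p) (hp2 : p < 2) :
    ∃ C : ℝ, 0 ≤ C ∧ ∀ φ, ∫⁻ x, ENNReal.ofReal ((XT n m N α φ x ^ 2) ^ (p / 2)) ≤
      ENNReal.ofReal C * ∫⁻ x, ENNReal.ofReal (((H n m N ^ s) φ x ^ 2) ^ (p / 2)) := by
  obtain ⟨C, hC, h⟩ := lintegral_dualPow_le hn hm hN hs α hα hp hp2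
  refine ⟨C, hC, fun φ => ?_⟩
  set w := XT n m N α φ
  have he : ∀ k : ℕ, 0 < 1 / ((k : ℝ) + 1) := fun k => by positivity
  have h1 := lintegral_liminf_le (μ := (volume : Measure (Pt n m))) (u := Filter.atTop)
    (f := fun (k : ℕ) x => ENNReal.ofReal (dualPow w p _ (he k) x * w x)) fun k => by
      have := (dualPow w p _ (he k)).continuous
      have := w.continuous
      fun_prop
  have h2 : ∀ x, Filter.liminf (fun k : ℕ => ENNReal.ofReal (dualPow w p _ (he k) x * w x)) Filter.atTop =
      ENNReal.ofReal ((w x ^ 2) ^ (p / 2)) := fun x => by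
    refine Filter.Tendsto.liminf_eq (ENNReal.tendsto_ofReal ?_)
    simp only [dualPow, TF.coe_mk]
    rcases eq_or_ne (w x) 0 with h0 | h0
    · simp [h0, Real.zero_rpow (by linarith : p / 2 ≠ 0)]
    have h3 : (w x ^ 2) ^ (p / 2) = w x * (w x ^ 2 + 0 ^ 2) ^ (p / 2 - 1) * w x := by
      rw [zero_pow two_ne_zero, add_zero, Real.rpow_sub_one (by positivity)]
      field_simp
    rw [h3]
    refine ((Filter.Tendsto.rpow_const ?_ (Or.inl (by positivity))).const_mul _).mul_const _
    exact (tendsto_one_div_add_atTop_nhds_zero_nat.pow 2).const_add _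
  simp only [h2] at h1
  exact h1.trans (Filter.liminf_le_of_frequently_le' (Filter.Frequently.of_forall fun k => h φ _ (he k)))

/-- Bound for derivatives along a word of length `2 s` by the `s`-th power of the operator. -/
theorem exists_eLpNorm_XT_le (hn : 1 ≤ n) (hm : 1 ≤ m) (hN : 1 ≤ N) {s : ℕ} (hs : 1 ≤ s)
    (α : List (XIdx n m N)) (hα : α.length = 2 * s) {p : ℝ} (hp : 1 < p) :
    ∃ C : ℝ, 0 ≤ C ∧ ∀ φ, eLpNorm (XT n m N α φ) (ENNReal.ofReal p) volume ≤
      ENNReal.ofReal C * eLpNorm ((H n m N ^ s) φ) (ENNReal.ofReal p) volume := by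
  have hp0 : 0 < p := by linarith
  obtain ⟨C, hC, h⟩ : ∃ C : ℝ, 0 ≤ C ∧ ∀ φ, ∫⁻ x, ENNReal.ofReal ((XT n m N α φ x ^ 2) ^ (p / 2)) ≤
      ENNReal.ofReal C * ∫⁻ x, ENNReal.ofReal (((H n m N ^ s) φ x ^ 2) ^ (p / 2)) := by
    rcases lt_trichotomy p 2 with h | rfl | h
    · exact lintegral_rpow_le_of_lt_two hn hm hN hs α hα hp h
    · simpa using lintegral_rpow_two_le hn hm hN α hα
    · exact lintegral_rpow_le_of_two_lt hn hm hN hs α hα (by linarith)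
  refine ⟨C ^ (1 / p), by positivity, fun φ => ?_⟩
  have h1 := ENNReal.rpow_le_rpow (h φ) (by positivity : 0 ≤ 1 / p)
  simp only [ofReal_sq_rpow _ (by positivity : 0 ≤ p / 2), mul_div_cancel₀ p two_ne_zero] at h1
  rw [ENNReal.mul_rpow_of_nonneg _ _ (by positivity), ENNReal.ofReal_rpow_of_nonneg hC (by positivity)] at h1
  simpa only [eLpNorm_eq_lintegral_rpow_enorm_toReal (ENNReal.ofReal_pos.2 hp0).ne' ENNReal.ofReal_ne_top,
    ENNReal.toReal_ofReal hp0.le] using h1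

/-- Bound for operators spanned by words of length `k` by the words themselves. -/
lemma exists_eLpNorm_le_iSup {k : ℕ} {p : ℝ} (hp : 1 < p) {A : TF (Pt n m) →ₗ[ℝ] TF (Pt n m)}
    (hA : A ∈ Wd n m N k) : ∃ C : ℝ, 0 ≤ C ∧ ∀ φ, eLpNorm (A φ) (ENNReal.ofReal p) volume ≤
      ENNReal.ofReal C * ⨆ α : Fin k → XIdx n m N,
        eLpNorm (XT n m N (List.ofFn α) φ) (ENNReal.ofReal p) volume := by
  induction hA using Submodule.span_induction with
  | mem A h =>
    obtain ⟨β, hβ, rfl⟩ := h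
    refine ⟨1, zero_le_one, fun φ => ?_⟩
    subst hβ
    rw [ENNReal.ofReal_one, one_mul]
    exact le_iSup_of_le β.get (by rw [List.ofFn_get])
  | zero => exact ⟨0, le_rfl, fun φ => by simp [show ⇑(0 : TF (Pt n m)) = 0 from rfl]⟩
  | add A B _ _ hA hB =>
    obtain ⟨C, hC, hA⟩ := hA
    obtain ⟨D, hD, hB⟩ := hB
    refine ⟨C + D, by positivity, fun φ => ?_⟩
    rw [ENNReal.ofReal_add hC hD, add_mul]
    exact (eLpNorm_add_le (A φ).continuous.aestronglyMeasurable (B φ).continuous.aestronglyMeasurable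
      (by simpa using hp.le)).trans (add_le_add (hA φ) (hB φ))
  | smul c A _ hA =>
    obtain ⟨C, hC, hA⟩ := hA
    refine ⟨|c| * C, by positivity, fun φ => ?_⟩
    rw [ENNReal.ofReal_mul (abs_nonneg _), mul_assoc, ← Real.enorm_eq_ofReal_abs]
    exact (eLpNorm_const_smul_le (c := c) (f := ⇑(A φ))).trans (mul_le_mul_right (hA φ) _)

end LpBounds

end Grusin

/-- (Two-sided equivalence of even powers of the Gru\v{s}in operator
with `X`-derivatives.)  For `n, m, N ≥ 1`, `p ∈ (1,∞)` and `s ≥ 1`, there are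
`c, c' > 0` such that for all `φ ∈ C_c^∞(ℝ^(n+m))`:
`c · max_{|α| = 2s} ‖X^α φ‖_p ≤ ‖H_N^s φ‖_p ≤ c' · max_{|α| = 2s} ‖X^α φ‖_p`. -/
theorem grusin_power_equivalent_to_X_derivatives
    (n m N : ℕ) (hn : 1 ≤ n) (hm : 1 ≤ m) (hN : 1 ≤ N)
    (p : ℝ) (hp : 1 < p) (s : ℕ) (hs : 1 ≤ s) :
    ∃ c > (0 : ℝ), ∃ c' > (0 : ℝ), ∀ φ : Pt n m → ℝ,
      ContDiff ℝ (⊤ : ℕ∞) φ → HasCompactSupport φ →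
        (ENNReal.ofReal c *
            ⨆ α : Fin (2 * s) → XIdx n m N, eLpNorm (Xw α φ) (ENNReal.ofReal p) volume) ≤
            eLpNorm ((grusin n m N)^[s] φ) (ENNReal.ofReal p) volume ∧
          eLpNorm ((grusin n m N)^[s] φ) (ENNReal.ofReal p) volume ≤
            ENNReal.ofReal c' *
              ⨆ α : Fin (2 * s) → XIdx n m N, eLpNorm (Xw α φ) (ENNReal.ofReal p) volume := by
  choose C hC hle using fun α : Fin (2 * s) → XIdx n m N =>
    Grusin.exists_eLpNorm_XT_le hn hm hN hs (List.ofFn α) (by simp) hp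
  obtain ⟨D, hD, hge⟩ := Grusin.exists_eLpNorm_le_iSup hp (Grusin.H_pow_mem_Wd (n := n) (m := m) (N := N) s)
  have hK : 0 < 1 + ∑ α, C α := by
    have := Finset.sum_nonneg fun α (_ : α ∈ Finset.univ) => hC α
    positivity
  refine ⟨(1 + ∑ α, C α)⁻¹, inv_pos.2 hK, D + 1, by positivity, fun φ hφ hφc => ?_⟩
  have hX : ∀ α : Fin (2 * s) → XIdx n m N,
      ⇑(Grusin.XT n m N (List.ofFn α) (Grusin.TF.mk φ hφ hφc)) = Xw α φ := fun α =>
    Grusin.coe_Xw α _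
  have hH : ⇑((Grusin.H n m N ^ s) (Grusin.TF.mk φ hφ hφc)) = (grusin n m N)^[s] φ :=
    Grusin.coe_H_pow s _
  constructor
  · rw [ENNReal.mul_iSup]
    refine iSup_le fun α => ?_
    have h := hle α (Grusin.TF.mk φ hφ hφc)
    rw [hX, hH] at h
    refine (mul_le_mul_right h _).trans ?_
    rw [← mul_assoc, ← ENNReal.ofReal_mul (inv_nonneg.2 hK.le)]
    refine mul_le_of_le_one_left' (ENNReal.ofReal_le_one.2 ?_)
    rw [inv_mul_le_one₀ hK]
    exact (Finset.single_le_sum (fun α _ => hC α) (Finset.mem_univ α)).trans (by linarith)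
  · have h := hge (Grusin.TF.mk φ hφ hφc)
    simp only [hX, hH] at h
    exact h.trans (mul_le_mul_left (ENNReal.ofReal_le_ofReal (by linarith)) _)
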